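/- For all integers k ≥ 1 and ℓ ≥ 7 there exists a k-planar simple graph G with exactly n = 23ℓ(k−1)k² + 11ℓ + 2 vertices such that cr(G) ≤ 2k² and cr_{k-planar}(G) ≥ 11ℓk⁴ (hence the k-planar crossing ratio is Ω(n/k)). -/

import Mathlib

open Set

noncomputable section

/-- A drawing of a simple graph in the plane: vertices are mapped to distinct
points, each edge `uv` is drawn as a simple arc joining the images of `u` and
`v` and avoiding the images of the other vertices, any two arcs meet in
finitely many points, and no three arcs pass through a common non-vertex
point. -/
structure Drawing {V : Type} (G : SimpleGraph V) where
  vpos : V → ℝ × ℝ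
  vpos_inj : Function.Injective vpos
  arc : V → V → ℝ → ℝ × ℝ
  arc_symm : ∀ u v t, arc u v t = arc v u (1 - t)
  arc_cont : ∀ u v, G.Adj u v → ContinuousOn (arc u v) (Set.Icc 0 1)
  arc_injOn : ∀ u v, G.Adj u v → Set.InjOn (arc u v) (Set.Icc 0 1)
  arc_start : ∀ u v, G.Adj u v → arc u v 0 = vpos u
  arc_end : ∀ u v, G.Adj u v → arc u v 1 = vpos v
  arc_avoids : ∀ u v, G.Adj u v → ∀ t ∈ Set.Ioo (0:ℝ) 1, arc u v t ∉ Set.range vpos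
  inter_finite : ∀ u v w z, G.Adj u v → G.Adj w z → s(u, v) ≠ s(w, z) →
    ((arc u v '' Set.Icc 0 1) ∩ (arc w z '' Set.Icc 0 1)).Finite
  no_triple_point : ∀ p : ℝ × ℝ, p ∉ Set.range vpos →
    ∀ u₁ v₁ u₂ v₂ u₃ v₃, G.Adj u₁ v₁ → G.Adj u₂ v₂ → G.Adj u₃ v₃ →
      s(u₁, v₁) ≠ s(u₂, v₂) → s(u₁, v₁) ≠ s(u₃, v₃) → s(u₂, v₂) ≠ s(u₃, v₃) →
      ¬ (p ∈ arc u₁ v₁ '' Set.Icc 0 1 ∧ p ∈ arc u₂ v₂ '' Set.Icc 0 1 ∧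
          p ∈ arc u₃ v₃ '' Set.Icc 0 1)

namespace Drawing

variable {V : Type} {G : SimpleGraph V}

lemma img_symm_aux (Γ : Drawing G) (u v : V) :
    Γ.arc u v '' Set.Icc 0 1 = Γ.arc v u '' Set.Icc 0 1 := by
  have key : ∀ a b : V, Γ.arc a b '' Set.Icc 0 1 ⊆ Γ.arc b a '' Set.Icc 0 1 := by
    rintro a b p ⟨t, ht, rfl⟩
    refine ⟨1 - t, ⟨by linarith [ht.2], by linarith [ht.1]⟩, ?_⟩
    rw [Γ.arc_symm b a (1 - t)]
    congr 1
    ring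
  exact Set.Subset.antisymm (key u v) (key v u)

/-- The image (trace) of an edge in the drawing. -/
def img (Γ : Drawing G) (e : Sym2 V) : Set (ℝ × ℝ) :=
  Sym2.lift ⟨fun u v => Γ.arc u v '' Set.Icc 0 1, fun u v => Γ.img_symm_aux u v⟩ e

/-- `p` is a crossing point of the two distinct edges `e` and `f` : it lies on
both arcs and is not the image of a vertex (so it is not a shared endpoint). -/
def Crossing (Γ : Drawing G) (e f : Sym2 V) (p : ℝ × ℝ) : Prop :=
  e ∈ G.edgeSet ∧ f ∈ G.edgeSet ∧ e ≠ f ∧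
    p ∈ Γ.img e ∧ p ∈ Γ.img f ∧ p ∉ Set.range Γ.vpos

/-- The edges `e` and `f` cross in the drawing. -/
def Crosses (Γ : Drawing G) (e f : Sym2 V) : Prop := ∃ p, Γ.Crossing e f p

/-- The set of crossing points of a drawing. -/
def crossingSet (Γ : Drawing G) : Set (ℝ × ℝ) := {p | ∃ e f, Γ.Crossing e f p}

/-- The number of crossings of a drawing. -/
def crossings (Γ : Drawing G) : ℕ := Γ.crossingSet.ncard

/-- The set of crossing points lying on a given edge. -/
def edgeCrossings (Γ : Drawing G) (e : Sym2 V) : Set (ℝ × ℝ) :=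
  {p | ∃ f, Γ.Crossing e f p}

/-- A drawing is `k`-planar if every edge is involved in at most `k` crossings. -/
def IsKPlanar (Γ : Drawing G) (k : ℕ) : Prop :=
  ∀ e ∈ G.edgeSet, (Γ.edgeCrossings e).ncard ≤ k

/-- A drawing is `k`-gap-planar if each crossing can be assigned to one of its
two involved edges such that every edge is assigned at most `k` crossings. -/
def IsKGapPlanar (Γ : Drawing G) (k : ℕ) : Prop :=
  ∃ assign : ℝ × ℝ → Sym2 V,
    (∀ p ∈ Γ.crossingSet, ∃ f, Γ.Crossing (assign p) f p) ∧
    ∀ e : Sym2 V, {p | p ∈ Γ.crossingSet ∧ assign p = e}.ncard ≤ k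

/-- A drawing is skewness-`k` if there is a set of at most `k` edges such that
every crossing involves an edge from the set. -/
def IsSkewness (Γ : Drawing G) (k : ℕ) : Prop :=
  ∃ S : Finset (Sym2 V), S.card ≤ k ∧
    ∀ p ∈ Γ.crossingSet, ∃ e ∈ S, ∃ f, Γ.Crossing e f p

/-- A drawing is `k`-apex if there is a set of at most `k` vertices such that
every crossing involves an edge incident to one of these vertices. -/
def IsKApex (Γ : Drawing G) (k : ℕ) : Prop :=
  ∃ S : Finset V, S.card ≤ k ∧
    ∀ p ∈ Γ.crossingSet, ∃ e f, Γ.Crossing e f p ∧ ∃ a ∈ S, a ∈ e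

/-- A drawing is `(k,l)`-grid-free if there is no set of `k` edges each of
which crosses each edge of some set of `l` edges. -/
def IsGridFree (Γ : Drawing G) (k l : ℕ) : Prop :=
  ¬ ∃ A B : Finset (Sym2 V), A.card = k ∧ B.card = l ∧
      ∀ e ∈ A, ∀ f ∈ B, Γ.Crosses e f

/-- A drawing is `k`-fan-crossing-free if no edge crosses `k` edges that all
share a common endpoint. -/
def IsKFanCrossingFree (Γ : Drawing G) (k : ℕ) : Prop :=
  ¬ ∃ (e : Sym2 V) (a : V) (F : Finset (Sym2 V)), F.card = k ∧
      ∀ f ∈ F, a ∈ f ∧ Γ.Crosses e f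

/-- A drawing is planarly connected if for any two crossing edges, two of
their endpoints are joined by a crossing-free edge. -/
def IsPlanarlyConnected (Γ : Drawing G) : Prop :=
  ∀ e f : Sym2 V, Γ.Crosses e f →
    ∃ a b : V, a ∈ e ∧ b ∈ f ∧ G.Adj a b ∧ Γ.edgeCrossings s(a, b) = ∅

/-- A drawing is straight-line if every edge is drawn as the line segment
between the images of its endpoints. -/
def IsStraight (Γ : Drawing G) : Prop :=
  ∀ u v : V, G.Adj u v → ∀ t ∈ Set.Icc (0:ℝ) 1,
    Γ.arc u v t = (1 - t) • Γ.vpos u + t • Γ.vpos v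

/-- A straight-line RAC drawing: straight-line and any two crossing edges are
perpendicular. -/
def IsRAC (Γ : Drawing G) : Prop :=
  Γ.IsStraight ∧
    ∀ u v w z : V, G.Adj u v → G.Adj w z → Γ.Crosses s(u, v) s(w, z) →
      (Γ.vpos v - Γ.vpos u).1 * (Γ.vpos z - Γ.vpos w).1 +
        (Γ.vpos v - Γ.vpos u).2 * (Γ.vpos z - Γ.vpos w).2 = 0

end Drawing

/-- The crossing number of `G`: the minimum number of crossings over all
drawings of `G`. -/
def crNum {V : Type} (G : SimpleGraph V) : ℕ :=
  sInf {n | ∃ Γ : Drawing G, Γ.crossings = n}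

/-- The crossing number of `G` restricted to drawings satisfying `P`. -/
def crNumRestricted {V : Type} (G : SimpleGraph V) (P : Drawing G → Prop) : ℕ :=
  sInf {n | ∃ Γ : Drawing G, P Γ ∧ Γ.crossings = n}

/-- The rectilinear crossing number of `G`. -/
def rectCrNum {V : Type} (G : SimpleGraph V) : ℕ :=
  crNumRestricted G (fun Γ => Γ.IsStraight)

/-- An ℓ₂-bundle between `x` and `y`: `P` is the set of the internal vertices
of ℓ internally disjoint paths of length two from `x` to `y`, all of whose
internal vertices have degree exactly two in `G` (here ℓ = `P.card`). -/
def IsL2Bundle {V : Type} (G : SimpleGraph V) (x y : V) (P : Finset V) : Prop :=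
  x ≠ y ∧ x ∉ P ∧ y ∉ P ∧
    ∀ p ∈ P, G.Adj x p ∧ G.Adj p y ∧ (G.neighborSet p).ncard = 2

/-- Two drawings of `G` are weakly isomorphic: there is an incidence-preserving
one-to-one correspondence of vertices and edges that preserves crossings. -/
def WeaklyIso {V : Type} {G : SimpleGraph V} (Γ Γ' : Drawing G) : Prop :=
  ∃ φ : G ≃g G, ∀ e f : Sym2 V,
    Γ.Crosses e f ↔ Γ'.Crosses (Sym2.map (fun a => φ a) e) (Sym2.map (fun a => φ a) f)

/-- A nowhere vanishing continuous function on the unit square has a continuous logarithm. -/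
lemma exists_log_square (F : ℝ × ℝ → ℂ)
    (hF : ContinuousOn F (Icc (0:ℝ) 1 ×ˢ Icc (0:ℝ) 1))
    (h0 : ∀ x ∈ Icc (0:ℝ) 1 ×ˢ Icc (0:ℝ) 1, F x ≠ 0) :
    ∃ L : ℝ × ℝ → ℂ, Continuous L ∧
      ∀ x ∈ Icc (0:ℝ) 1 ×ˢ Icc (0:ℝ) 1, Complex.exp (L x) = F x := by
  let r : ℝ × ℝ → ℝ × ℝ := fun x =>
    ((projIcc (0:ℝ) 1 zero_le_one x.1 : ℝ), (projIcc (0:ℝ) 1 zero_le_one x.2 : ℝ))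
  have hr : Continuous r := by
    have hc : Continuous (projIcc (0:ℝ) 1 zero_le_one) := continuous_projIcc
    exact (continuous_subtype_val.comp (hc.comp continuous_fst)).prodMk
      (continuous_subtype_val.comp (hc.comp continuous_snd))
  have hm : ∀ x, r x ∈ Icc (0:ℝ) 1 ×ˢ Icc (0:ℝ) 1 := fun x => ⟨Subtype.coe_prop _, Subtype.coe_prop _⟩
  have hc : Continuous (F ∘ r) := hF.comp_continuous hr hm
  obtain ⟨L, ⟨-, hL⟩, -⟩ := Complex.isCoveringMapOn_exp.existsUnique_continuousMap_lifts
    (⟨F ∘ r, hc⟩ : C(ℝ × ℝ, ℂ)) (a₀ := (0, 0)) (Complex.exp_log (h0 _ (hm (0, 0))))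
    (fun x => h0 _ (hm x))
  refine ⟨L, L.continuous, fun x hx => ?_⟩
  have h1 : Complex.exp (L x) = F (r x) := congrFun hL x
  rw [h1]
  congr 1
  have := projIcc_of_mem zero_le_one hx.1
  have := projIcc_of_mem zero_le_one hx.2
  ext <;> simp_all [r]

lemma exp_eq_one_const {h : ℝ → ℂ} (hc : ContinuousOn h (Icc 0 1))
    (he : ∀ t ∈ Icc (0:ℝ) 1, Complex.exp (h t) = 1) : h 0 = h 1 := by
  have hT : IsDiscrete (range ((↑) : ℤ → ℝ)) :=
    ⟨Int.isClosedEmbedding_coe_real.isEmbedding.toHomeomorph.symm.isEmbedding.discreteTopology⟩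
  have hpi : (2 * Real.pi : ℂ) * Complex.I ≠ 0 := by
    simp [Real.pi_ne_zero]
  have hm : MapsTo (fun t => (h t / (2 * Real.pi * Complex.I)).re) (Icc (0:ℝ) 1)
      (range ((↑) : ℤ → ℝ)) := by
    intro t ht
    obtain ⟨n, hn⟩ := Complex.exp_eq_one_iff.1 (he t ht)
    refine ⟨n, ?_⟩
    simp only [hn]
    rw [mul_div_assoc, div_self hpi]
    simp
  have key := isPreconnected_Icc.constant_of_mapsTo (S := Icc (0:ℝ) 1) hT
    (f := fun t => (h t / (2 * Real.pi * Complex.I)).re)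
    (Complex.continuous_re.comp_continuousOn (hc.div_const _)) hm
    (x := 0) (y := 1) (by simp) (by simp)
  obtain ⟨n, hn⟩ := Complex.exp_eq_one_iff.1 (he 0 (by simp))
  obtain ⟨m, hm⟩ := Complex.exp_eq_one_iff.1 (he 1 (by simp))
  simp only [hn, hm] at key
  rw [mul_div_assoc, div_self hpi, mul_div_assoc, div_self hpi] at key
  simp at key
  rw [hn, hm, key]

lemma log_variation_unique {f g : ℝ → ℂ} (hf : ContinuousOn f (Icc 0 1))
    (hg : ContinuousOn g (Icc 0 1))
    (he : ∀ t ∈ Icc (0:ℝ) 1, Complex.exp (f t) = Complex.exp (g t)) : f 1 - f 0 = g 1 - g 0 := by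
  have := exp_eq_one_const (h := fun t => f t - g t) (hf.sub hg) (fun t ht => by
    rw [Complex.exp_sub, he t ht, div_self (Complex.exp_ne_zero _)])
  linear_combination -this

namespace Drawing

variable {V : Type} {G : SimpleGraph V}

lemma parity_exists (Γ : Drawing G) : ∃ (s : V → V → ZMod 2) (n : V → V → V → ZMod 2),
    (∀ u v, u ≠ v → s u v + s v u = 1) ∧
    ∀ u v w z, G.Adj u v → G.Adj w z → u ≠ w → u ≠ z → v ≠ w → v ≠ z →
      s u w + s u z + s v w + s v z + n u v w + n u v z + n w z u + n w z v = 1 →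
      ∃ t ∈ Icc (0:ℝ) 1, ∃ t' ∈ Icc (0:ℝ) 1, Γ.arc u v t = Γ.arc w z t' := by
  classical
  let c : ℝ × ℝ → ℂ := fun x => Complex.equivRealProdCLM.symm x
  have hcc : Continuous c := Complex.equivRealProdCLM.symm.continuous
  have hci : Function.Injective c := Complex.equivRealProdCLM.symm.injective
  let lg : V → V → ℂ := fun u v => Complex.log (c (Γ.vpos u) - c (Γ.vpos v))
  have hlg : ∀ u v, u ≠ v → Complex.exp (lg u v) = c (Γ.vpos u) - c (Γ.vpos v) := fun u v h =>
    Complex.exp_log (sub_ne_zero.2 fun h' => h (Γ.vpos_inj (hci h')))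
  have hm : ∀ u v, u ≠ v → ∃ m : ℤ, lg v u = lg u v + Real.pi * Complex.I * (2 * m + 1) := by
    intro u v h
    have : Complex.exp (lg v u) = Complex.exp (lg u v + Real.pi * Complex.I) := by
      rw [Complex.exp_add, hlg u v h, hlg v u h.symm, Complex.exp_pi_mul_I]; ring
    obtain ⟨m, hm⟩ := Complex.exp_eq_exp_iff_exists_int.1 this
    exact ⟨m, by rw [hm]; ring⟩
  choose! m hm using hm
  have hn : ∀ u v p, G.Adj u v → u ≠ p → v ≠ p → ∃ (n : ℤ) (f : ℝ → ℂ),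
      ContinuousOn f (Icc 0 1) ∧
      (∀ t ∈ Icc (0:ℝ) 1, Complex.exp (f t) = c (Γ.arc u v t) - c (Γ.vpos p)) ∧
      f 1 - f 0 = lg v p - lg u p + 2 * Real.pi * Complex.I * n := by
    intro u v p huv hu hv
    have hne : ∀ t ∈ Icc (0:ℝ) 1, c (Γ.arc u v t) - c (Γ.vpos p) ≠ 0 := by
      intro t ht h
      have h := hci (sub_eq_zero.1 h)
      rcases eq_or_lt_of_le ht.1 with h0 | h0
      · rw [← h0, Γ.arc_start u v huv] at h; exact hu (Γ.vpos_inj h)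
      rcases eq_or_lt_of_le ht.2 with h1 | h1
      · rw [h1, Γ.arc_end u v huv] at h; exact hv (Γ.vpos_inj h)
      exact Γ.arc_avoids u v huv t ⟨h0, h1⟩ ⟨p, h.symm⟩
    obtain ⟨L, hL, hLe⟩ := exists_log_square
      (fun x => c (Γ.arc u v x.1) - c (Γ.vpos p))
      ((hcc.comp_continuousOn ((Γ.arc_cont u v huv).comp continuousOn_fst
        (fun x hx => hx.1))).sub continuousOn_const) (fun x hx => hne _ hx.1)
    have hE : ∀ t ∈ Icc (0:ℝ) 1, Complex.exp (L (t, 0)) = c (Γ.arc u v t) - c (Γ.vpos p) :=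
      fun t ht => hLe (t, 0) ⟨ht, by simp⟩
    have h0 := hE 0 (by simp)
    have h1 := hE 1 (by simp)
    rw [Γ.arc_start u v huv, ← hlg u p hu] at h0
    rw [Γ.arc_end u v huv, ← hlg v p hv] at h1
    obtain ⟨a, ha⟩ := Complex.exp_eq_exp_iff_exists_int.1 h0
    obtain ⟨b, hb⟩ := Complex.exp_eq_exp_iff_exists_int.1 h1
    refine ⟨b - a, fun t => L (t, 0), by fun_prop, hE, ?_⟩
    simp only [ha, hb]; push_cast; ring
  choose! n hn using hn
  refine ⟨fun u v => (m u v : ZMod 2), fun u v p => (n u v p : ZMod 2), ?_, ?_⟩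
  · intro u v h
    have h1 := hm u v h
    have h2 := hm v u h.symm
    have hpi : (Real.pi : ℂ) * Complex.I ≠ 0 := by simp [Real.pi_ne_zero]
    have h3 : Real.pi * Complex.I * (2 * ((m u v : ℂ) + m v u + 1)) = 0 := by
      linear_combination -h1 - h2
    rcases mul_eq_zero.1 h3 with h4 | h4
    · exact absurd h4 hpi
    have h5 : m u v + m v u + 1 = 0 := by
      have : ((m u v + m v u + 1 : ℤ) : ℂ) = 0 := by push_cast; linear_combination h4 / 2
      exact_mod_cast this
    have h6 : (m u v : ZMod 2) + (m v u : ZMod 2) = ((-1 : ℤ) : ZMod 2) := by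
      rw [← Int.cast_add]; congr 1; omega
    rw [h6]; decide
  · intro u v w z huv hwz huw huz hvw hvz hy
    by_contra hcon
    push Not at hcon
    obtain ⟨L, hL, hLe⟩ := exists_log_square
      (fun x => c (Γ.arc u v x.1) - c (Γ.arc w z x.2))
      ((hcc.comp_continuousOn ((Γ.arc_cont u v huv).comp continuousOn_fst
        (fun x hx => hx.1))).sub
        (hcc.comp_continuousOn ((Γ.arc_cont w z hwz).comp continuousOn_snd
        (fun x hx => hx.2)))) (fun x hx h => hcon _ hx.1 _ hx.2 (hci (sub_eq_zero.1 h)))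
    have side1 : ∀ q t₀, t₀ ∈ Icc (0:ℝ) 1 → u ≠ q → v ≠ q → Γ.arc w z t₀ = Γ.vpos q →
        L (1, t₀) - L (0, t₀) = lg v q - lg u q + 2 * Real.pi * Complex.I * n u v q := by
      intro q t₀ ht₀ hu hv hq
      obtain ⟨f, hf, hfe, hfv⟩ := hn u v q huv hu hv
      rw [← hfv]
      refine (log_variation_unique (f := fun t => L (t, t₀)) (by fun_prop) hf fun t ht => ?_)
      rw [hfe t ht, ← hq]
      exact hLe (t, t₀) ⟨ht, ht₀⟩
    have side2 : ∀ q t₀, t₀ ∈ Icc (0:ℝ) 1 → w ≠ q → z ≠ q → Γ.arc u v t₀ = Γ.vpos q →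
        L (t₀, 1) - L (t₀, 0) = lg z q - lg w q + 2 * Real.pi * Complex.I * n w z q := by
      intro q t₀ ht₀ hu hv hq
      obtain ⟨f, hf, hfe, hfv⟩ := hn w z q hwz hu hv
      rw [← hfv]
      refine (log_variation_unique (f := fun t => L (t₀, t) - Real.pi * Complex.I)
        (by fun_prop) hf fun t ht => ?_).symm.trans (by ring) |>.symm
      rw [hfe t ht, ← hq, Complex.exp_sub, Complex.exp_pi_mul_I, hLe (t₀, t) ⟨ht₀, ht⟩]
      ring
    have e1 := side1 w 0 (by simp) huw hvw (Γ.arc_start w z hwz)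
    have e2 := side1 z 1 (by simp) huz hvz (Γ.arc_end w z hwz)
    have e3 := side2 u 0 (by simp) huw.symm huz.symm (Γ.arc_start u v huv)
    have e4 := side2 v 1 (by simp) hvw.symm hvz.symm (Γ.arc_end u v huv)
    have m1 := hm u w huw
    have m2 := hm u z huz
    have m3 := hm v w hvw
    have m4 := hm v z hvz
    have hpi : (Real.pi : ℂ) * Complex.I ≠ 0 := by simp [Real.pi_ne_zero]
    have h3 : Real.pi * Complex.I * (2 * ((m u w : ℂ) + m v z - m v w - m u z
        + n u v w - n u v z + n w z v - n w z u)) = 0 := by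
      linear_combination -e1 + e2 + e3 - e4 - m1 + m2 + m3 - m4
    rcases mul_eq_zero.1 h3 with h4 | h4
    · exact absurd h4 hpi
    have h5 : m u w + m v z - m v w - m u z + n u v w - n u v z + n w z v - n w z u = 0 := by
      have : ((m u w + m v z - m v w - m u z + n u v w - n u v z + n w z v - n w z u : ℤ) : ℂ)
        = 0 := by push_cast; linear_combination h4 / 2
      exact_mod_cast this
    have h6 := congrArg (Int.cast : ℤ → ZMod 2) h5
    push_cast at h6
    have h2 : (2 : ZMod 2) = 0 := by decide
    have : (0 : ZMod 2) = 1 := by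
      linear_combination hy - h6 - ((m v w : ZMod 2) + m u z + n u v z + n w z u) * h2
    exact absurd this (by decide)

end Drawing

/-- A system of paths: the path `i` has length `len i` and joins the base vertices `src i` and
`tgt i`; its inner vertices are private to it. -/
structure PathSystem (B I : Type) where
  src : I → B
  tgt : I → B
  len : I → ℕ
  len_pos : ∀ i, 0 < len i
  src_ne : ∀ i, src i ≠ tgt i
  simple : ∀ i j, len i = 1 → len j = 1 → s(src i, tgt i) = s(src j, tgt j) → i = j

namespace PathSystem

variable {B I : Type} (S : PathSystem B I)

/-- Base vertices together with the inner vertices of all paths. -/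
abbrev Vert : Type := B ⊕ (Σ i : I, Fin (S.len i - 1))

/-- The `m`-th vertex of the path `i`. -/
def node (i : I) (m : ℕ) : S.Vert :=
  if m = 0 then Sum.inl (S.src i)
  else if h : m - 1 < S.len i - 1 then Sum.inr ⟨i, m - 1, h⟩ else Sum.inl (S.tgt i)

@[simp] lemma node_zero (i : I) : S.node i 0 = Sum.inl (S.src i) := by simp [node]

@[simp] lemma node_len (i : I) : S.node i (S.len i) = Sum.inl (S.tgt i) := by
  have := S.len_pos i
  simp [node, this.ne']

lemma node_inner {i : I} {m : ℕ} (h0 : 0 < m) (h1 : m < S.len i) :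
    S.node i m = Sum.inr ⟨i, m - 1, by omega⟩ := by
  rw [node, if_neg h0.ne', dif_pos]

lemma node_cases {i : I} {m : ℕ} (hm : m ≤ S.len i) :
    (m = 0 ∧ S.node i m = Sum.inl (S.src i)) ∨ (m = S.len i ∧ S.node i m = Sum.inl (S.tgt i)) ∨
      ∃ (h0 : 0 < m) (h1 : m < S.len i), S.node i m = Sum.inr ⟨i, m - 1, by omega⟩ := by
  rcases Nat.eq_zero_or_pos m with h | h
  · left; subst h; simp
  rcases hm.eq_or_lt with h1 | h1
  · right; left; subst h1; simp
  · right; right; exact ⟨h, h1, S.node_inner h h1⟩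

lemma node_inner_inj {i j : I} {m m' : ℕ} (h0 : 0 < m) (h1 : m < S.len i) (hm' : m' ≤ S.len j)
    (h : S.node i m = S.node j m') : i = j ∧ m = m' := by
  rw [S.node_inner h0 h1] at h
  rcases S.node_cases hm' with ⟨-, h2⟩ | ⟨-, h2⟩ | ⟨h3, h4, h2⟩
  · rw [h2] at h; cases h
  · rw [h2] at h; cases h
  · rw [h2] at h
    have h := Sum.inr.inj h
    rw [Sigma.mk.injEq] at h
    obtain ⟨rfl, h⟩ := h
    have := Fin.mk.inj (eq_of_heq h)
    exact ⟨rfl, by omega⟩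

lemma node_inj {i : I} {m m' : ℕ} (hm : m ≤ S.len i) (hm' : m' ≤ S.len i)
    (h : S.node i m = S.node i m') : m = m' := by
  rcases S.node_cases hm with ⟨h1, h2⟩ | ⟨h1, h2⟩ | ⟨h3, h4, h2⟩
  · rcases S.node_cases hm' with ⟨h1', h2'⟩ | ⟨h1', h2'⟩ | ⟨h3', h4', h2'⟩
    · omega
    · rw [h2, h2'] at h; exact absurd (Sum.inl.inj h) (S.src_ne i)
    · exact (S.node_inner_inj h3' h4' hm h.symm).2.symm
  · rcases S.node_cases hm' with ⟨h1', h2'⟩ | ⟨h1', h2'⟩ | ⟨h3', h4', h2'⟩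
    · rw [h2, h2'] at h; exact absurd (Sum.inl.inj h).symm (S.src_ne i)
    · omega
    · exact (S.node_inner_inj h3' h4' hm h.symm).2.symm
  · exact (S.node_inner_inj h3 h4 hm' h).2

/-- The graph formed by the paths. -/
def graph : SimpleGraph S.Vert where
  Adj a b := ∃ i m, m < S.len i ∧
    ((a = S.node i m ∧ b = S.node i (m + 1)) ∨ (b = S.node i m ∧ a = S.node i (m + 1)))
  symm := ⟨by
    rintro a b ⟨i, m, hm, h⟩
    exact ⟨i, m, hm, h.symm⟩⟩
  loopless := ⟨by
    rintro a ⟨i, m, hm, ⟨h1, h2⟩ | ⟨h1, h2⟩⟩ <;>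
    · have := S.node_inj (i := i) (m := m) (m' := m + 1) (by omega) (by omega) (by rw [← h1, ← h2])
      omega⟩

lemma adj_node {i : I} {m : ℕ} (hm : m < S.len i) :
    S.graph.Adj (S.node i m) (S.node i (m + 1)) := ⟨i, m, hm, Or.inl ⟨rfl, rfl⟩⟩

/-- The `m`-th edge of the path `i`. -/
def edge (i : I) (m : ℕ) : Sym2 S.Vert := s(S.node i m, S.node i (m + 1))

lemma edge_inj {i j : I} {m m' : ℕ} (hm : m < S.len i) (hm' : m' < S.len j)
    (h : S.edge i m = S.edge j m') : i = j ∧ m = m' := by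
  have hij : i = j := by
    rw [edge, edge, Sym2.eq_iff] at h
    by_cases hi : 0 < m
    · rcases h with ⟨h1, -⟩ | ⟨h1, -⟩
      · exact (S.node_inner_inj hi hm (by omega) h1).1
      · exact (S.node_inner_inj hi hm (by omega) h1).1
    by_cases hi' : m + 1 < S.len i
    · rcases h with ⟨-, h1⟩ | ⟨-, h1⟩
      · exact (S.node_inner_inj (by omega) hi' (by omega) h1).1
      · exact (S.node_inner_inj (by omega) hi' (by omega) h1).1
    by_cases hj : 0 < m'
    · rcases h with ⟨h1, -⟩ | ⟨-, h1⟩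
      · exact (S.node_inner_inj hj hm' (by omega) h1.symm).1.symm
      · exact (S.node_inner_inj hj hm' (by omega) h1.symm).1.symm
    by_cases hj' : m' + 1 < S.len j
    · rcases h with ⟨-, h1⟩ | ⟨h1, -⟩
      · exact (S.node_inner_inj (by omega) hj' (by omega) h1.symm).1.symm
      · exact (S.node_inner_inj (by omega) hj' (by omega) h1.symm).1.symm
    have hm0 : m = 0 := by omega
    have hm0' : m' = 0 := by omega
    have e1 : S.len i = 1 := by omega
    have e2 : S.len j = 1 := by omega
    apply S.simple i j e1 e2
    subst hm0; subst hm0'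
    have a1 := S.node_len i
    have a2 := S.node_len j
    rw [e1] at a1; rw [e2] at a2
    simp only [zero_add, node_zero, a1, a2, Sum.inl.injEq] at h
    rw [Sym2.eq_iff]; exact h
  subst hij
  refine ⟨rfl, ?_⟩
  rw [edge, edge, Sym2.eq_iff] at h
  rcases h with ⟨h1, -⟩ | ⟨h1, h2⟩
  · exact S.node_inj (by omega) (by omega) h1
  · have := S.node_inj (by omega) (by omega) h1
    have := S.node_inj (by omega) (by omega) h2
    omega

lemma mem_edgeSet {e : Sym2 S.Vert} :
    e ∈ S.graph.edgeSet ↔ ∃ i m, m < S.len i ∧ e = S.edge i m := by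
  induction e with | h a b =>
  rw [SimpleGraph.mem_edgeSet]
  constructor
  · rintro ⟨i, m, hm, ⟨h1, h2⟩ | ⟨h1, h2⟩⟩
    · exact ⟨i, m, hm, by rw [edge, h1, h2]⟩
    · exact ⟨i, m, hm, by rw [edge, h1, h2, Sym2.eq_swap]⟩
  · rintro ⟨i, m, hm, h⟩
    rw [edge, Sym2.eq_iff] at h
    exact ⟨i, m, hm, by tauto⟩

/-- Paths with disjoint sets of ends. -/
def Indep (i j : I) : Prop :=
  S.src i ≠ S.src j ∧ S.src i ≠ S.tgt j ∧ S.tgt i ≠ S.src j ∧ S.tgt i ≠ S.tgt j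

lemma Indep.ne {i j : I} (h : S.Indep i j) : i ≠ j := by
  rintro rfl; exact h.1 rfl

lemma Indep.symm {i j : I} (h : S.Indep i j) : S.Indep j i :=
  ⟨h.1.symm, h.2.2.1.symm, h.2.1.symm, h.2.2.2.symm⟩

lemma Indep.node_ne {i j : I} (h : S.Indep i j) {m m' : ℕ} (hm : m ≤ S.len i)
    (hm' : m' ≤ S.len j) : S.node i m ≠ S.node j m' := by
  intro he
  obtain ⟨a1, a2, a3, a4⟩ := h
  rcases S.node_cases hm with ⟨h1, h2⟩ | ⟨h1, h2⟩ | ⟨h3, h4, h2⟩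
  · rcases S.node_cases hm' with ⟨h1', h2'⟩ | ⟨h1', h2'⟩ | ⟨h3', h4', h2'⟩
    · rw [h2, h2'] at he; exact a1 (Sum.inl.inj he)
    · rw [h2, h2'] at he; exact a2 (Sum.inl.inj he)
    · rw [h2, h2'] at he; cases he
  · rcases S.node_cases hm' with ⟨h1', h2'⟩ | ⟨h1', h2'⟩ | ⟨h3', h4', h2'⟩
    · rw [h2, h2'] at he; exact a3 (Sum.inl.inj he)
    · rw [h2, h2'] at he; exact a4 (Sum.inl.inj he)
    · rw [h2, h2'] at he; cases he
  · have := (S.node_inner_inj h3 h4 hm' he).1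
    subst this
    exact a1 rfl

/-- Some edge of the path `i` crosses some edge of the path `j` at the point `p`. -/
def CrossAt (Γ : Drawing S.graph) (i j : I) (m : ℕ) (p : ℝ × ℝ) : Prop :=
  m < S.len i ∧ ∃ m' < S.len j, Γ.Crossing (S.edge i m) (S.edge j m') p

end PathSystem

/-- The mod 2 count associated with two paths with ends `x, x'` and `y, y'`. -/
def chainParity {B : Type} (s : B → B → ZMod 2) (x x' : B) (N : B → ZMod 2) (y y' : B)
    (M : B → ZMod 2) : ZMod 2 :=
  s x y + s x y' + s x' y + s x' y' + N y + N y' + M x + M x'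

lemma zmod2_telescope (f : ℕ → ZMod 2) (n : ℕ) :
    ∑ m ∈ Finset.range n, (f m + f (m + 1)) = f 0 + f n := by
  induction n with
  | zero => simp [CharTwo.add_self_eq_zero]
  | succ n ih =>
    rw [Finset.sum_range_succ, ih]
    linear_combination (CharTwo.add_self_eq_zero (f n))

namespace PathSystem

variable {B I : Type} (S : PathSystem B I)

lemma path_parity_exists (Γ : Drawing S.graph) :
    ∃ (s : B → B → ZMod 2) (N : I → B → ZMod 2), (∀ x y, x ≠ y → s x y + s y x = 1) ∧
      ∀ i j, S.Indep i j →
        chainParity s (S.src i) (S.tgt i) (N i) (S.src j) (S.tgt j) (N j) = 1 →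
        ∃ m p, S.CrossAt Γ i j m p := by
  obtain ⟨s, n, hs, hy⟩ := Γ.parity_exists
  refine ⟨fun x y => s (Sum.inl x) (Sum.inl y),
    fun i x => ∑ m ∈ Finset.range (S.len i), n (S.node i m) (S.node i (m + 1)) (Sum.inl x),
    fun x y h => hs _ _ (by simpa using h), ?_⟩
  intro i j hij h1
  by_contra hcon
  push Not at hcon
  have h0 : ∀ m ∈ Finset.range (S.len i), ∀ m' ∈ Finset.range (S.len j),
      (s (S.node i m) (S.node j m') + s (S.node i m) (S.node j (m' + 1)))
      + (s (S.node i (m + 1)) (S.node j m') + s (S.node i (m + 1)) (S.node j (m' + 1)))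
      + (n (S.node i m) (S.node i (m + 1)) (S.node j m') +
         n (S.node i m) (S.node i (m + 1)) (S.node j (m' + 1)))
      + (n (S.node j m') (S.node j (m' + 1)) (S.node i m) +
         n (S.node j m') (S.node j (m' + 1)) (S.node i (m + 1))) = 0 := by
    intro m hm m' hm'
    rw [Finset.mem_range] at hm hm'
    have hz : ∀ x : ZMod 2, x = 0 ∨ x = 1 := by decide
    refine (hz _).resolve_right fun hx => ?_
    obtain ⟨t, ht, t', ht', he⟩ := hy _ _ _ _ (S.adj_node hm) (S.adj_node hm')
      (hij.node_ne S (by omega) (by omega)) (hij.node_ne S (by omega) (by omega))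
      (hij.node_ne S (by omega) (by omega)) (hij.node_ne S (by omega) (by omega))
      (by rw [← hx]; ring)
    refine hcon m (Γ.arc (S.node i m) (S.node i (m + 1)) t) ⟨hm, m', hm', ?_⟩
    refine ⟨S.mem_edgeSet.2 ⟨i, m, hm, rfl⟩, S.mem_edgeSet.2 ⟨j, m', hm', rfl⟩,
      fun h => hij.ne S (S.edge_inj hm hm' h).1, ⟨t, ht, rfl⟩, ⟨t', ht', he.symm⟩, ?_⟩
    rintro ⟨v, hv⟩
    have hends : ∀ a b, S.graph.Adj a b → ∀ t ∈ Icc (0:ℝ) 1, Γ.vpos v = Γ.arc a b t →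
        v = a ∨ v = b := by
      intro a b hab t ht h
      rcases eq_or_lt_of_le ht.1 with h0 | h0
      · rw [← h0, Γ.arc_start a b hab] at h; exact Or.inl (Γ.vpos_inj h)
      rcases eq_or_lt_of_le ht.2 with h1 | h1
      · rw [h1, Γ.arc_end a b hab] at h; exact Or.inr (Γ.vpos_inj h)
      exact absurd ⟨v, h⟩ (Γ.arc_avoids a b hab t ⟨h0, h1⟩)
    have e1 := hends _ _ (S.adj_node hm) t ht hv
    have e2 := hends _ _ (S.adj_node hm') t' ht' (hv.trans he)
    rcases e1 with e1 | e1 <;> rcases e2 with e2 | e2 <;>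
      exact hij.node_ne S (by omega) (by omega) (e1.symm.trans e2)
  have hsum : ∑ m ∈ Finset.range (S.len i), ∑ m' ∈ Finset.range (S.len j),
      ((s (S.node i m) (S.node j m') + s (S.node i m) (S.node j (m' + 1)))
      + (s (S.node i (m + 1)) (S.node j m') + s (S.node i (m + 1)) (S.node j (m' + 1)))
      + (n (S.node i m) (S.node i (m + 1)) (S.node j m') +
         n (S.node i m) (S.node i (m + 1)) (S.node j (m' + 1)))
      + (n (S.node j m') (S.node j (m' + 1)) (S.node i m) +
         n (S.node j m') (S.node j (m' + 1)) (S.node i (m + 1)))) = 0 :=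
    Finset.sum_eq_zero fun m hm => Finset.sum_eq_zero fun m' hm' => h0 m hm m' hm'
  simp only [Finset.sum_add_distrib (s := Finset.range (S.len j))] at hsum
  simp only [← Finset.sum_add_distrib (s := Finset.range (S.len j)) (f := fun m' => s _ _)] at hsum
  simp only [← Finset.sum_add_distrib (s := Finset.range (S.len j))
    (f := fun m' => n (S.node i _) _ (S.node j m'))] at hsum
  rw [Finset.sum_add_distrib, Finset.sum_add_distrib] at hsum
  rw [zmod2_telescope
    (fun m => ∑ m' ∈ Finset.range (S.len j), (s (S.node i m) (S.node j m') +
      s (S.node i m) (S.node j (m' + 1))))] at hsum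
  rw [zmod2_telescope (fun m => ∑ m' ∈ Finset.range (S.len j),
      n (S.node j m') (S.node j (m' + 1)) (S.node i m))] at hsum
  rw [zmod2_telescope (fun m' => s (S.node i 0) (S.node j m')),
    zmod2_telescope (fun m' => s (S.node i (S.len i)) (S.node j m'))] at hsum
  simp only [zmod2_telescope (fun m' => n (S.node i _) (S.node i _) (S.node j m'))] at hsum
  rw [Finset.sum_add_distrib] at hsum
  simp only [node_zero, node_len] at hsum
  rw [chainParity] at h1
  have : (0 : ZMod 2) = 1 := by rw [← h1, ← hsum]; ring
  exact absurd this (by decide)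

lemma crossingSet_finite [Finite B] [Finite I] (Γ : Drawing S.graph) : Γ.crossingSet.Finite := by
  have hfin : ∀ e ∈ S.graph.edgeSet, ∀ f ∈ S.graph.edgeSet, e ≠ f →
      (Γ.img e ∩ Γ.img f).Finite := by
    intro e he f hf hef
    induction e with | h a b =>
    induction f with | h c d =>
    exact Γ.inter_finite a b c d he hf hef
  have h : (⋃ e : Sym2 S.Vert, ⋃ f : Sym2 S.Vert, {p | Γ.Crossing e f p}).Finite := by
    refine Set.finite_iUnion fun e => Set.finite_iUnion fun f => ?_
    by_cases h : e ∈ S.graph.edgeSet ∧ f ∈ S.graph.edgeSet ∧ e ≠ f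
    · exact (hfin e h.1 f h.2.1 h.2.2).subset fun p hp => ⟨hp.2.2.2.1, hp.2.2.2.2.1⟩
    · convert Set.finite_empty
      ext p
      simp only [mem_ofPred_eq, mem_empty_iff_false, iff_false]
      exact fun hp => h ⟨hp.1, hp.2.1, hp.2.2.1⟩
  refine h.subset ?_
  rintro p ⟨e, f, hp⟩
  simp only [mem_iUnion]
  exact ⟨e, f, hp⟩

lemma no_triple (Γ : Drawing S.graph) {e f g : Sym2 S.Vert} {p : ℝ × ℝ} (he : e ∈ S.graph.edgeSet)
    (hf : f ∈ S.graph.edgeSet) (hg : g ∈ S.graph.edgeSet) (h1 : e ≠ f) (h2 : e ≠ g) (h3 : f ≠ g)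
    (hp : p ∉ range Γ.vpos) (pe : p ∈ Γ.img e) (pf : p ∈ Γ.img f) (pg : p ∈ Γ.img g) : False := by
  induction e with | h a b =>
  induction f with | h c d =>
  induction g with | h x y =>
  exact Γ.no_triple_point p hp a b c d x y he hf hg h1 h2 h3 ⟨pe, pf, pg⟩

/-- In a `k`-planar drawing a path of length `n` crosses at most `n * k` other paths. -/
lemma card_crossing_le [Finite B] [Finite I] {Γ : Drawing S.graph} {k : ℕ} (hΓ : Γ.IsKPlanar k)
    (i : I) (T : Finset I) (hT : ∀ j ∈ T, i ≠ j ∧ ∃ m p, S.CrossAt Γ i j m p) :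
    T.card ≤ S.len i * k := by
  classical
  have hex : ∀ j ∈ T, ∃ m p, S.CrossAt Γ i j m p := fun j hj => (hT j hj).2
  choose! m p hmp using hex
  have hmaps : ∀ j ∈ T, m j ∈ Finset.range (S.len i) := fun j hj =>
    Finset.mem_range.2 (hmp j hj).1
  have := Finset.card_le_mul_card_image_of_maps_to hmaps k ?_
  · simpa [mul_comm] using this
  intro r hr
  have hfin : (Γ.edgeCrossings (S.edge i r)).Finite :=
    (S.crossingSet_finite Γ).subset fun p ⟨f, hp⟩ => ⟨_, f, hp⟩
  have hle := hΓ (S.edge i r) (S.mem_edgeSet.2 ⟨i, r, Finset.mem_range.1 hr, rfl⟩)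
  rw [Set.ncard_eq_toFinset_card _ hfin] at hle
  refine le_trans (Finset.card_le_card_of_injOn p ?_ ?_) hle
  · intro j hj
    simp only [Finset.coe_filter, mem_ofPred_eq] at hj
    obtain ⟨-, m', -, hc⟩ := hmp j hj.1
    simp only [Finite.coe_toFinset]
    rw [hj.2] at hc
    exact ⟨_, hc⟩
  · intro j hj j' hj' hpp
    simp only [Finset.coe_filter, mem_ofPred_eq] at hj hj'
    by_contra hne
    obtain ⟨-, a, ha, hc⟩ := hmp j hj.1
    obtain ⟨-, b, hb, hd⟩ := hmp j' hj'.1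
    rw [hj.2] at hc
    rw [hj'.2, ← hpp] at hd
    exact S.no_triple Γ hc.1 hc.2.1 hd.2.1 hc.2.2.1 hd.2.2.1
      (fun h => hne (S.edge_inj ha hb h).1) hc.2.2.2.2.2 hc.2.2.2.1 hc.2.2.2.2.1 hd.2.2.2.2.1

lemma card_le_crossings [Finite B] [Finite I] (Γ : Drawing S.graph) (T : Finset (I × I))
    (hT : ∀ q ∈ T, ∃ m p, S.CrossAt Γ q.1 q.2 m p) (hd : ∀ q ∈ T, ∀ q' ∈ T, q.1 ≠ q'.2) :
    T.card ≤ Γ.crossings := by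
  classical
  choose! m p hmp using hT
  rw [Drawing.crossings, Set.ncard_eq_toFinset_card _ (S.crossingSet_finite Γ)]
  refine Finset.card_le_card_of_injOn p ?_ ?_
  · intro q hq
    obtain ⟨-, a, -, hc⟩ := hmp q hq
    simp only [Finite.coe_toFinset]
    exact ⟨_, _, hc⟩
  · intro q hq q' hq' hpp
    obtain ⟨hm, a, ha, hc⟩ := hmp q hq
    obtain ⟨hm', b, hb, hd'⟩ := hmp q' hq'
    rw [← hpp] at hd'
    have e1 : q.1 = q'.1 := by
      by_contra hne
      exact S.no_triple Γ hc.1 hd'.1 hc.2.1 (fun h => hne (S.edge_inj hm hm' h).1) hc.2.2.1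
        (fun h => hd q' hq' q hq (S.edge_inj hm' ha h).1) hc.2.2.2.2.2 hc.2.2.2.1 hd'.2.2.2.1
        hc.2.2.2.2.1
    have e2 : q.2 = q'.2 := by
      by_contra hne
      exact S.no_triple Γ hc.1 hc.2.1 hd'.2.1 hc.2.2.1
        (fun h => hd q hq q' hq' (S.edge_inj hm hb h).1)
        (fun h => hne (S.edge_inj ha hb h).1) hc.2.2.2.2.2 hc.2.2.2.1 hc.2.2.2.2.1
        hd'.2.2.2.2.1
    exact Prod.ext e1 e2

end PathSystem

set_option synthInstance.maxHeartbeats 200000 in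
set_option synthInstance.maxSize 1000 in
lemma zmod2_three : ∀ x y z : ZMod 2, x + y + z = 0 → ¬ (x = 1 ∧ y = 1) → ¬ (x = 1 ∧ z = 1) →
    ¬ (y = 1 ∧ z = 1) → x = 0 ∧ y = 0 ∧ z = 0 := by decide

/-- Rows of a map and of its dual: the edge `r` runs from the vertex `tl r` to the vertex `hd r`
and separates the faces `lf r` and `rt r`. -/
structure Rows (B ρ : Type) where
  tl : ρ → B
  hd : ρ → B
  lf : ρ → B
  rt : ρ → B

namespace Rows

variable {B ρ : Type} (R : Rows B ρ)

/-- The row `r` is incident with `v`. -/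
def Inc (v : B) (r : ρ) : Prop := R.tl r = v ∨ R.hd r = v

/-- The rows `r₁`, `r₂`, `r₃` bound a triangle. -/
def Tri (r₁ r₂ r₃ : ρ) : Prop := R.tl r₁ = R.tl r₃ ∧ R.hd r₁ = R.tl r₂ ∧ R.hd r₂ = R.hd r₃

/-- The mod 2 sum of the boundary of every vertex star in the dual vanishes. -/
def StarClosed [Fintype ρ] : Prop := by
  classical exact ∀ (v : B) (D : B → ZMod 2),
    ∑ r, (if R.Inc v r then D (R.lf r) + D (R.rt r) else 0) = 0

lemma three_le_card_of_even [Fintype ρ] [DecidableEq ρ]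
    (hstar : R.StarClosed)
    (hsimp : ∀ r r', R.Inc (R.tl r) r' → R.Inc (R.hd r) r' → r = r')
    (D : B → ZMod 2) {r₀ : ρ} (h0 : D (R.lf r₀) + D (R.rt r₀) = 1) :
    3 ≤ (Finset.univ.filter fun r => D (R.lf r) + D (R.rt r) = 1).card := by
  classical
  have hother : ∀ v, R.Inc v r₀ → ∃ r, r ≠ r₀ ∧ R.Inc v r ∧ D (R.lf r) + D (R.rt r) = 1 := by
    intro v hv
    by_contra hcon
    push Not at hcon
    have h1 := hstar v D
    rw [Finset.sum_eq_single r₀, if_pos hv, h0] at h1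
    · exact absurd h1 (by decide)
    · intro r _ hr
      split_ifs with hi
      · have hz : ∀ x : ZMod 2, x ≠ 1 → x = 0 := by decide
        exact hz _ (hcon r hr hi)
      · rfl
    · simp
  obtain ⟨r₁, h1, i1, d1⟩ := hother (R.tl r₀) (Or.inl rfl)
  obtain ⟨r₂, h2, i2, d2⟩ := hother (R.hd r₀) (Or.inr rfl)
  have h12 : r₁ ≠ r₂ := by
    rintro rfl
    exact h1 (hsimp _ _ i1 i2).symm
  rw [← Finset.card_eq_three.2 ⟨r₀, r₁, r₂, h1.symm, h2.symm, h12, rfl⟩]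
  apply Finset.card_le_card
  intro r hr
  simp only [Finset.mem_insert, Finset.mem_singleton] at hr
  rcases hr with rfl | rfl | rfl <;> simp [*]

/-- If every row and every column of the crossing pattern of a bundled map with its bundled dual
has at most `K` entries, the pattern is empty or all rows are full. -/
lemma grid_dichotomy [Fintype ρ] [DecidableEq ρ] {K : ℕ} (hK : 0 < K)
    (hstar : R.StarClosed) (hloop : ∀ r, R.tl r ≠ R.hd r)
    (hsimp : ∀ r r', R.Inc (R.tl r) r' → R.Inc (R.hd r) r' → r = r')
    (e₀ : ρ) (he₀ : ∃ r r', R.Tri r r' e₀)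
    (hconn : ∀ p : ρ → Prop, (∀ r₁ r₂ r₃, R.Tri r₁ r₂ r₃ → (p r₁ ↔ p r₂) ∧ (p r₂ ↔ p r₃)) →
      ∀ r, p r ↔ p e₀)
    (A C : ρ × Fin K → B → ZMod 2) (Y : ρ × Fin K → ρ × Fin K → ZMod 2)
    (hY : ∀ π σ, Y π σ = A π (R.lf σ.1) + A π (R.rt σ.1) + C σ (R.tl π.1) + C σ (R.hd π.1))
    (hrow : ∀ π, (Finset.univ.filter fun σ => Y π σ = 1).card ≤ K)
    (hcol : ∀ σ, (Finset.univ.filter fun π => Y π σ = 1).card ≤ K) :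
    (∀ π σ, Y π σ = 0) ∨
      (Finset.univ.filter fun q : (ρ × Fin K) × (ρ × Fin K) => Y q.1 q.2 = 1).card
        = Fintype.card ρ * K * K := by
  have hz : ∀ x : ZMod 2, x = 0 ∨ x = 1 := by decide
  classical
  -- the rows of one bundle agree
  have hsame : ∀ r i i' σ, Y (r, i) σ = Y (r, i') σ := by
    intro r i i' σ
    set D : B → ZMod 2 := fun f => A (r, i) f + A (r, i') f with hD
    have hd : ∀ σ, Y (r, i) σ + Y (r, i') σ = D (R.lf σ.1) + D (R.rt σ.1) := by
      intro σ
      rw [hY, hY]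
      linear_combination CharTwo.add_self_eq_zero (C σ (R.tl r)) +
        CharTwo.add_self_eq_zero (C σ (R.hd r))
    rcases hz (Y (r, i) σ + Y (r, i') σ) with h | h
    · exact CharTwo.add_eq_zero.1 h
    exfalso
    have h3 := R.three_le_card_of_even hstar hsimp D (r₀ := σ.1) ((hd σ).symm.trans h)
    have hsub : (Finset.univ.filter fun r' => D (R.lf r') + D (R.rt r') = 1) ×ˢ
        (Finset.univ : Finset (Fin K)) ⊆
        (Finset.univ.filter fun σ => Y (r, i) σ = 1) ∪
          (Finset.univ.filter fun σ => Y (r, i') σ = 1) := by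
      intro q hq
      simp only [Finset.mem_product, Finset.mem_filter, Finset.mem_univ, true_and, and_true] at hq
      rw [← hd q] at hq
      simp only [Finset.mem_union, Finset.mem_filter, Finset.mem_univ, true_and]
      generalize Y (r, i) q = x at *
      generalize Y (r, i') q = y at *
      revert x y; decide
    have h4 := Finset.card_le_card hsub
    rw [Finset.card_product, Finset.card_univ, Fintype.card_fin] at h4
    have h5 := (h4.trans (Finset.card_union_le _ _)).trans (Nat.add_le_add (hrow _) (hrow _))
    nlinarith
  let i₀ : Fin K := ⟨0, hK⟩
  -- every column meets at most one bundle
  have hone : ∀ σ r r', Y (r, i₀) σ = 1 → Y (r', i₀) σ = 1 → r = r' := by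
    intro σ r r' h h'
    by_contra hne
    have hsub : ({r, r'} : Finset ρ) ×ˢ (Finset.univ : Finset (Fin K)) ⊆
        Finset.univ.filter fun π => Y π σ = 1 := by
      rintro ⟨q, i⟩ hq
      simp only [Finset.mem_product, Finset.mem_insert, Finset.mem_singleton, Finset.mem_univ,
        and_true] at hq
      simp only [Finset.mem_filter, Finset.mem_univ, true_and]
      rw [hsame q i i₀]
      rcases hq with rfl | rfl <;> assumption
    have h4 := (Finset.card_le_card hsub).trans (hcol σ)
    rw [Finset.card_product, Finset.card_pair hne, Finset.card_univ, Fintype.card_fin] at h4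
    omega
  let full : ρ → Prop := fun r => (Finset.univ.filter fun σ => Y (r, i₀) σ = 1).card = K
  let zero : ρ → Prop := fun r => ∀ σ, Y (r, i₀) σ = 0
  have hzf : ∀ r, zero r → ¬ full r := by
    intro r h1 h2
    have : (Finset.univ.filter fun σ => Y (r, i₀) σ = 1) = ∅ := by
      ext σ; simp [h1 σ]
    simp only [full, this, Finset.card_empty] at h2
    omega
  have htri : ∀ r₁ r₂ r₃, R.Tri r₁ r₂ r₃ →
      (zero r₁ ∧ zero r₂ ∧ zero r₃) ∨ (full r₁ ∧ full r₂ ∧ full r₃) := by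
    rintro r₁ r₂ r₃ ⟨t1, t2, t3⟩
    have hdist : r₁ ≠ r₂ ∧ r₁ ≠ r₃ ∧ r₂ ≠ r₃ := by
      refine ⟨?_, ?_, ?_⟩
      · rintro rfl; exact hloop _ t2.symm
      · rintro rfl; exact hloop _ (t2.symm.trans t3.symm)
      · rintro rfl; exact hloop _ (t1.trans t2.symm)
    set D : B → ZMod 2 := fun f => A (r₁, i₀) f + A (r₂, i₀) f + A (r₃, i₀) f with hD
    have hd : ∀ σ, Y (r₁, i₀) σ + Y (r₂, i₀) σ + Y (r₃, i₀) σ =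
        D (R.lf σ.1) + D (R.rt σ.1) := by
      intro σ
      simp only [hY, t1, t2, t3, hD]
      linear_combination CharTwo.add_self_eq_zero (C σ (R.tl r₃)) +
        CharTwo.add_self_eq_zero (C σ (R.tl r₂)) + CharTwo.add_self_eq_zero (C σ (R.hd r₃))
    by_cases hall : ∀ σ, Y (r₁, i₀) σ + Y (r₂, i₀) σ + Y (r₃, i₀) σ = 0
    · left
      have key : ∀ σ, Y (r₁, i₀) σ = 0 ∧ Y (r₂, i₀) σ = 0 ∧ Y (r₃, i₀) σ = 0 := by
        intro σ
        have a1 := hall σ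
        have a2 := fun h : _ ∧ _ => hdist.1 (hone σ r₁ r₂ h.1 h.2)
        have a3 := fun h : _ ∧ _ => hdist.2.1 (hone σ r₁ r₃ h.1 h.2)
        have a4 := fun h : _ ∧ _ => hdist.2.2 (hone σ r₂ r₃ h.1 h.2)
        generalize Y (r₁, i₀) σ = x at *
        generalize Y (r₂, i₀) σ = y at *
        generalize Y (r₃, i₀) σ = z at *
        exact zmod2_three x y z a1 a2 a3 a4
      exact ⟨fun σ => (key σ).1, fun σ => (key σ).2.1, fun σ => (key σ).2.2⟩
    · right
      push Not at hall
      obtain ⟨σ, hσ⟩ := hall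
      have hσ := (hz _).resolve_left hσ
      have h3 := R.three_le_card_of_even hstar hsimp D (r₀ := σ.1) ((hd σ).symm.trans hσ)
      have hsub : (Finset.univ.filter fun r' => D (R.lf r') + D (R.rt r') = 1) ×ˢ
          (Finset.univ : Finset (Fin K)) ⊆
          ((Finset.univ.filter fun σ => Y (r₁, i₀) σ = 1) ∪
            (Finset.univ.filter fun σ => Y (r₂, i₀) σ = 1)) ∪
              (Finset.univ.filter fun σ => Y (r₃, i₀) σ = 1) := by
        intro q hq
        simp only [Finset.mem_product, Finset.mem_filter, Finset.mem_univ, true_and,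
          and_true] at hq
        rw [← hd q] at hq
        simp only [Finset.mem_union, Finset.mem_filter, Finset.mem_univ, true_and]
        generalize Y (r₁, i₀) q = x at *
        generalize Y (r₂, i₀) q = y at *
        generalize Y (r₃, i₀) q = z at *
        revert x y z; decide
      have h4 := Finset.card_le_card hsub
      rw [Finset.card_product, Finset.card_univ, Fintype.card_fin] at h4
      have h5 := h4.trans ((Finset.card_union_le _ _).trans
        (Nat.add_le_add_right (Finset.card_union_le _ _) _))
      have b1 := hrow (r₁, i₀)
      have b2 := hrow (r₂, i₀)
      have b3 := hrow (r₃, i₀)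
      have h6 : 3 * K ≤ (Finset.univ.filter fun r' => D (R.lf r') + D (R.rt r') = 1).card * K :=
        Nat.mul_le_mul_right _ h3
      simp only [full]
      omega
  have hfull := hconn full (fun r₁ r₂ r₃ h => by
    rcases htri r₁ r₂ r₃ h with ⟨a1, a2, a3⟩ | ⟨a1, a2, a3⟩
    · exact ⟨iff_of_false (hzf _ a1) (hzf _ a2), iff_of_false (hzf _ a2) (hzf _ a3)⟩
    · exact ⟨iff_of_true a1 a2, iff_of_true a2 a3⟩)
  have hzero := hconn zero (fun r₁ r₂ r₃ h => by
    rcases htri r₁ r₂ r₃ h with ⟨a1, a2, a3⟩ | ⟨a1, a2, a3⟩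
    · exact ⟨iff_of_true a1 a2, iff_of_true a2 a3⟩
    · exact ⟨iff_of_false (fun h => hzf _ h a1) (fun h => hzf _ h a2),
        iff_of_false (fun h => hzf _ h a2) (fun h => hzf _ h a3)⟩)
  obtain ⟨r, r', ht⟩ := he₀
  rcases htri _ _ _ ht with ⟨-, -, h0⟩ | ⟨-, -, h0⟩
  · left
    rintro ⟨r, i⟩ σ
    rw [hsame r i i₀]
    exact (hzero r).2 h0 σ
  · right
    have hfib : ∀ π : ρ × Fin K, (Finset.univ.filter fun σ => Y π σ = 1).card = K := by
      rintro ⟨r, i⟩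
      refine Eq.trans ?_ ((hfull r).2 h0)
      simp only [hsame r i i₀]
    rw [Finset.card_eq_sum_card_fiberwise (f := Prod.fst) (t := Finset.univ) (by simp)]
    have : ∀ π ∈ (Finset.univ : Finset (ρ × Fin K)),
        (Finset.filter (fun q : (ρ × Fin K) × (ρ × Fin K) => q.1 = π)
          (Finset.univ.filter fun q => Y q.1 q.2 = 1)).card = K := by
      intro π _
      refine Eq.trans ?_ (hfib π)
      refine Finset.card_bij' (fun q _ => q.2) (fun σ _ => (π, σ)) ?_ ?_ ?_ ?_
      · rintro ⟨a, b⟩ h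
        simp only [Finset.mem_filter, Finset.mem_univ, true_and] at h ⊢
        rw [← h.2]; exact h.1
      · intro b h
        simpa using h
      · rintro ⟨a, b⟩ h
        simp only [Finset.mem_filter, Finset.mem_univ, true_and] at h ⊢
        rw [← h.2]
      · intros; rfl
    rw [Finset.sum_congr rfl this]
    simp

end Rows

lemma chainParity_comm {B : Type} {s : B → B → ZMod 2} (hs : ∀ x y, x ≠ y → s x y + s y x = 1)
    {x x' y y' : B} (h1 : x ≠ y) (h2 : x ≠ y') (h3 : x' ≠ y) (h4 : x' ≠ y') (N M : B → ZMod 2) :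
    chainParity s x x' N y y' M = chainParity s y y' M x x' N := by
  have h0 : (2 : ZMod 2) = 0 := by decide
  simp only [chainParity]
  linear_combination hs _ _ h1 + hs _ _ h2 + hs _ _ h3 + hs _ _ h4 -
    (s y x + s y x' + s y' x + s y' x' - 2) * h0

/-- The parity count of the complete graph on five vertices is odd. -/
lemma chainParity_k5 {B : Type} {s : B → B → ZMod 2} (hs : ∀ x y, x ≠ y → s x y + s y x = 1)
    {u z a b d : B} (hab : a ≠ b) (had : a ≠ d) (hbd : b ≠ d)
    (Nab Nza Nzb Nua Nub Nad Nbd Nzd Nud Nuz : B → ZMod 2) :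
    chainParity s a b Nab z d Nzd +
      chainParity s a b Nab u d Nud +
      chainParity s a b Nab u z Nuz +
      chainParity s a d Nad u b Nub +
      chainParity s a d Nad z b Nzb +
      chainParity s a d Nad u z Nuz +
      chainParity s b d Nbd u a Nua +
      chainParity s b d Nbd z a Nza +
      chainParity s b d Nbd u z Nuz +
      chainParity s u a Nua z b Nzb +
      chainParity s u a Nua z d Nzd +
      chainParity s u b Nub z a Nza +
      chainParity s u b Nub z d Nzd +
      chainParity s u d Nud z a Nza +
      chainParity s u d Nud z b Nzb = 1 := by
  have h2 : (2 : ZMod 2) = 0 := by decide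
  simp only [chainParity]
  linear_combination hs a b hab + hs a d had + hs b d hbd +
    (3 * s u z + 1 * s u a + 2 * s a u + 1 * s u b + 2 * s b u + 1 * s u d + 2 * s d u + 3 * s a z + 3 * s b z + 3 * s d z + 1 * s a b + 1 * s b a + 1 * s a d + 1 * s d a + 1 * s b d + 1 * s d b + Nab z + Nab d + Nzd a + Nzd b + Nab u + Nud a + Nud b + Nuz a + Nuz b + Nad u + Nad b + Nub a + Nub d + Nad z + Nzb a + Nzb d + Nuz d + Nbd u + Nbd a + Nua b + Nua d + Nbd z + Nza b + Nza d + Nua z + Nzb u + Nzd u + Nub z + Nza u + Nud z + 1) * h2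

/-- If a matrix of the form `α x + β y` has few ones in each row and column, it vanishes. -/
lemma sum_form_eq_zero {X X' : Type} [Fintype X] [Fintype X'] {K : ℕ} (hK : 0 < K)
    (hX : 4 * K ≤ Fintype.card X) (hX' : 3 * K ≤ Fintype.card X')
    (α : X → ZMod 2) (β : X' → ZMod 2)
    (hrow : ∀ x, (Finset.univ.filter fun y => α x + β y = 1).card ≤ 2 * K)
    (hcol : ∀ y, (Finset.univ.filter fun x => α x + β y = 1).card ≤ 2 * K)
    {x₀ : X} (hx₀ : (Finset.univ.filter fun y => α x₀ + β y = 1).card ≤ K)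
    {y₀ : X'} (hy₀ : (Finset.univ.filter fun x => α x + β y₀ = 1).card ≤ K) (x : X) (y : X') :
    α x + β y = 0 := by
  have hz : ∀ x : ZMod 2, x = 0 ∨ x = 1 := by decide
  have key : ∀ (α : X → ZMod 2) (β : X' → ZMod 2),
      (∀ x, (Finset.univ.filter fun y => α x + β y = 1).card ≤ 2 * K) →
      (∀ y, (Finset.univ.filter fun x => α x + β y = 1).card ≤ 2 * K) →
      (Finset.univ.filter fun y => α x₀ + β y = 1).card ≤ K →
      (Finset.univ.filter fun x => α x + β y₀ = 1).card ≤ K → α x₀ = 0 →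
      ∀ x y, α x + β y = 0 := by
    clear hrow hcol hx₀ hy₀ α β x y
    intro α β hrow hcol hx₀ hy₀ h0
    have ha : (Finset.univ.filter fun x => α x = 0).card +
        (Finset.univ.filter fun x => α x = 1).card = Fintype.card X := by
      have hc : (Finset.univ.filter fun x => α x = 1) =
          Finset.univ.filter fun x => ¬ α x = 0 :=
        Finset.filter_congr fun x _ => by rcases hz (α x) with h | h <;> simp [h]
      rw [hc, ← Finset.card_univ, Finset.card_filter_add_card_filter_not]
    have hb : (Finset.univ.filter fun x => β x = 0).card +
        (Finset.univ.filter fun x => β x = 1).card = Fintype.card X' := by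
      have hc : (Finset.univ.filter fun x => β x = 1) =
          Finset.univ.filter fun x => ¬ β x = 0 :=
        Finset.filter_congr fun x _ => by rcases hz (β x) with h | h <;> simp [h]
      rw [hc, ← Finset.card_univ, Finset.card_filter_add_card_filter_not]
    have e1 : ∀ t : ZMod 2, 1 + t = 1 ↔ t = 0 := by decide
    have e2 : ∀ t : ZMod 2, t + 1 = 1 ↔ t = 0 := by decide
    have r0 : ∀ x, α x = 0 → (Finset.univ.filter fun y => α x + β y = 1) =
        Finset.univ.filter fun y => β y = 1 := fun x hx => by simp [hx]
    have r1 : ∀ x, α x = 1 → (Finset.univ.filter fun y => α x + β y = 1) =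
        Finset.univ.filter fun y => β y = 0 := fun x hx => by simp only [hx, e1]
    have c0 : ∀ y, β y = 0 → (Finset.univ.filter fun x => α x + β y = 1) =
        Finset.univ.filter fun x => α x = 1 := fun x hx => by simp [hx]
    have c1 : ∀ y, β y = 1 → (Finset.univ.filter fun x => α x + β y = 1) =
        Finset.univ.filter fun x => α x = 0 := fun x hx => by simp only [hx, e2]
    rw [r0 _ h0] at hx₀
    have hαz : ∀ x, α x = 0 := by
      intro x
      refine (hz (α x)).resolve_right fun hx => ?_
      have h1 := hrow x
      rw [r1 x hx] at h1
      have hb1 : 0 < (Finset.univ.filter fun x => β x = 1).card := by omega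
      have hb0 : 0 < (Finset.univ.filter fun x => β x = 0).card := by omega
      obtain ⟨y1, hy1⟩ := Finset.card_pos.1 hb1
      obtain ⟨y2, hy2⟩ := Finset.card_pos.1 hb0
      have hy1 := (Finset.mem_filter.1 hy1).2
      have hy2 := (Finset.mem_filter.1 hy2).2
      have g1 := hcol y1
      have g2 := hcol y2
      rw [c1 _ hy1] at g1
      rw [c0 _ hy2] at g2
      rcases hz (β y₀) with h | h
      · rw [c0 _ h] at hy₀; omega
      · rw [c1 _ h] at hy₀; omega
    have hβz : ∀ y, β y = 0 := by
      intro y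
      refine (hz (β y)).resolve_right fun hy => ?_
      have g1 := hcol y
      rw [c1 _ hy] at g1
      have : (Finset.univ.filter fun x => α x = 1).card = 0 := by simp [hαz]
      omega
    intro x y
    rw [hαz, hβz, add_zero]
  rcases hz (α x₀) with h | h
  · exact key α β hrow hcol hx₀ hy₀ h x y
  · have e : ∀ x y, (α x + 1) + (β y + 1) = α x + β y := fun x y => by
      linear_combination CharTwo.add_self_eq_zero (1 : ZMod 2)
    have := key (fun x => α x + 1) (fun y => β y + 1) (by simpa only [e] using hrow)
      (by simpa only [e] using hcol) (by simpa only [e] using hx₀) (by simpa only [e] using hy₀)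
      (by simp only [h]; decide) x y
    rwa [e] at this

namespace Rows

variable {B ρ : Type} (R : Rows B ρ)

/-- The rows in `S` form a route from `x` to `y` modulo 2. -/
def Joins (S : Finset ρ) (x y : B) : Prop :=
  ∀ D : B → ZMod 2, ∑ r ∈ S, (D (R.tl r) + D (R.hd r)) = D x + D y

/-- The rows in `S` form a route from `x` to `y` in the dual modulo 2. -/
def CoJoins (S : Finset ρ) (x y : B) : Prop :=
  ∀ D : B → ZMod 2, ∑ r ∈ S, (D (R.lf r) + D (R.rt r)) = D x + D y

lemma sum_chainParity {S : Finset ρ} (tl hd : ρ → B) {x x' : B}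
    (h : ∀ D : B → ZMod 2, ∑ r ∈ S, (D (tl r) + D (hd r)) = D x + D x') (s : B → B → ZMod 2)
    (n : ρ → B → ZMod 2) (y y' : B) (M : B → ZMod 2) :
    ∑ r ∈ S, chainParity s (tl r) (hd r) (n r) y y' M =
      chainParity s x x' (fun p => ∑ r ∈ S, n r p) y y' M := by
  have e : ∀ r ∈ S, chainParity s (tl r) (hd r) (n r) y y' M =
      (s (tl r) y + s (hd r) y) + (s (tl r) y' + s (hd r) y') + (n r y + n r y') +
        (M (tl r) + M (hd r)) := fun r _ => by simp only [chainParity]; ring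
  rw [Finset.sum_congr rfl e, Finset.sum_add_distrib, Finset.sum_add_distrib,
    Finset.sum_add_distrib, h (fun t => s t y), h (fun t => s t y'), h M, Finset.sum_add_distrib,
    chainParity]
  ring

/-- A family of `T` disjoint routes of length at most two from `x` to `y`, one of which is a
single row. -/
structure Thick (x y : B) (T : ℕ) where
  route : Fin T → Finset ρ
  joins : ∀ τ, R.Joins (route τ) x y
  card_le : ∀ τ, (route τ).card ≤ 2
  direct : ∃ τ, (route τ).card = 1
  disj : ∀ τ τ' r, r ∈ route τ → r ∈ route τ' → τ = τ'

/-- The rows `r`, `r'` have no common end. -/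
def Sep (r r' : ρ) : Prop :=
  R.tl r ≠ R.tl r' ∧ R.tl r ≠ R.hd r' ∧ R.hd r ≠ R.tl r' ∧ R.hd r ≠ R.hd r'

variable {R}

namespace Thick

variable {x y : B} {T : ℕ} (A : R.Thick x y T)

/-- The rows of different routes are different, so few rows meet few routes. -/
lemma card_route_le {K c : ℕ} (g : ρ × Fin K → ZMod 2)
    (hg : ∀ S : Finset (ρ × Fin K), (∀ σ ∈ S, (∃ τ, σ.1 ∈ A.route τ) ∧ g σ = 1) → S.card ≤ c) :
    (Finset.univ.filter fun q : Fin T × Fin K => ∑ r ∈ A.route q.1, g (r, q.2) = 1).card ≤ c := by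
  classical
  have hex : ∀ q : Fin T × Fin K, ∑ r ∈ A.route q.1, g (r, q.2) = 1 →
      ∃ r ∈ A.route q.1, g (r, q.2) = 1 := by
    intro q hq
    by_contra hcon
    push Not at hcon
    have hz : ∀ x : ZMod 2, x ≠ 1 → x = 0 := by decide
    rw [Finset.sum_eq_zero fun r hr => hz _ (hcon r hr)] at hq
    exact absurd hq (by decide)
  have hex' : ∀ q : Fin T × Fin K, ∃ r, ∑ r ∈ A.route q.1, g (r, q.2) = 1 →
      r ∈ A.route q.1 ∧ g (r, q.2) = 1 := by
    intro q
    by_cases h : ∑ r ∈ A.route q.1, g (r, q.2) = 1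
    · obtain ⟨r, hr⟩ := hex q h
      exact ⟨r, fun _ => hr⟩
    · obtain ⟨τ, hτ⟩ := A.direct
      obtain ⟨r, -⟩ := Finset.card_eq_one.1 hτ
      exact ⟨r, fun h' => absurd h' h⟩
  choose f hf using hex'
  refine le_trans (Finset.card_le_card_of_injOn (t := Finset.image (fun q => (f q, q.2))
    (Finset.univ.filter fun q : Fin T × Fin K => ∑ r ∈ A.route q.1, g (r, q.2) = 1))
    (fun q => (f q, q.2)) ?_ ?_) (hg _ ?_)
  · intro q hq
    exact Finset.mem_coe.2 (Finset.mem_image_of_mem _ hq)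
  · intro q hq q' hq' h
    have hq := (Finset.mem_filter.1 (Finset.mem_coe.1 hq)).2
    have hq' := (Finset.mem_filter.1 (Finset.mem_coe.1 hq')).2
    have h1 := congrArg Prod.fst h
    have h2 := congrArg Prod.snd h
    simp only at h1 h2
    exact Prod.ext (A.disj _ _ (f q) (hf q hq).1 (h1 ▸ (hf q' hq').1)) h2
  · intro σ hσ
    obtain ⟨q, hq, rfl⟩ := Finset.mem_image.1 hσ
    have hq := (Finset.mem_filter.1 hq).2
    exact ⟨⟨_, (hf q hq).1⟩, (hf q hq).2⟩

lemma exists_avoiding {K c c' : ℕ} (h : c + c' < T * K) (g g' : ρ × Fin K → ZMod 2)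
    (hg : ∀ S : Finset (ρ × Fin K), (∀ σ ∈ S, (∃ τ, σ.1 ∈ A.route τ) ∧ g σ = 1) → S.card ≤ c)
    (hg' : ∀ S : Finset (ρ × Fin K), (∀ σ ∈ S, (∃ τ, σ.1 ∈ A.route τ) ∧ g' σ = 1) →
      S.card ≤ c') :
    ∃ τ i, ∑ r ∈ A.route τ, g (r, i) = 0 ∧ ∑ r ∈ A.route τ, g' (r, i) = 0 := by
  classical
  by_contra hcon
  push Not at hcon
  have hz : ∀ x : ZMod 2, x ≠ 0 → x = 1 := by decide
  have hsub : (Finset.univ : Finset (Fin T × Fin K)) ⊆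
      (Finset.univ.filter fun q : Fin T × Fin K => ∑ r ∈ A.route q.1, g (r, q.2) = 1) ∪
      (Finset.univ.filter fun q : Fin T × Fin K => ∑ r ∈ A.route q.1, g' (r, q.2) = 1) := by
    intro q _
    simp only [Finset.mem_union, Finset.mem_filter, Finset.mem_univ, true_and]
    by_cases h1 : ∑ r ∈ A.route q.1, g (r, q.2) = 0
    · exact Or.inr (hz _ (hcon _ _ h1))
    · exact Or.inl (hz _ h1)
  have h1 := (Finset.card_le_card hsub).trans ((Finset.card_union_le _ _).trans
    (Nat.add_le_add (A.card_route_le g hg) (A.card_route_le g' hg')))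
  rw [Finset.card_univ, Fintype.card_prod, Fintype.card_fin, Fintype.card_fin] at h1
  omega

variable {x' y' : B} {T' : ℕ} (A' : R.Thick x' y' T')

/-- The routes of two independent thick edges do not cross modulo 2. -/
lemma parity_eq_zero {K : ℕ} (hK : 0 < K) (hT : 4 ≤ T) (hT' : 3 ≤ T') {s : B → B → ZMod 2}
    (hs : ∀ x y, x ≠ y → s x y + s y x = 1) (n : ρ × Fin K → B → ZMod 2)
    (hcap : ∀ (π : ρ × Fin K) (S : Finset (ρ × Fin K)), (∀ σ ∈ S, R.Sep π.1 σ.1 ∧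
      chainParity s (R.tl π.1) (R.hd π.1) (n π) (R.tl σ.1) (R.hd σ.1) (n σ) = 1) → S.card ≤ K)
    (hsep : ∀ τ τ', ∀ r ∈ A.route τ, ∀ r' ∈ A'.route τ', R.Sep r r')
    (τ : Fin T) (i : Fin K) (τ' : Fin T') (i' : Fin K) :
    chainParity s x y (fun p => ∑ r ∈ A.route τ, n (r, i) p) x' y'
      (fun p => ∑ r ∈ A'.route τ', n (r, i') p) = 0 := by
  classical
  let p : ρ × Fin K → ρ × Fin K → ZMod 2 := fun π σ =>
    chainParity s (R.tl π.1) (R.hd π.1) (n π) (R.tl σ.1) (R.hd σ.1) (n σ)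
  have hpc : ∀ π σ, R.Sep π.1 σ.1 → p π σ = p σ π := fun π σ h =>
    chainParity_comm hs h.1 h.2.1 h.2.2.1 h.2.2.2 _ _
  let X : Fin T × Fin K → Fin T' × Fin K → ZMod 2 := fun q q' =>
    ∑ r ∈ A.route q.1, ∑ r' ∈ A'.route q'.1, p (r, q.2) (r', q'.2)
  let N : Fin T × Fin K → B → ZMod 2 := fun q p => ∑ r ∈ A.route q.1, n (r, q.2) p
  let M : Fin T' × Fin K → B → ZMod 2 := fun q p => ∑ r ∈ A'.route q.1, n (r, q.2) p
  have hX : ∀ q q', X q q' = chainParity s x y (N q) x' y' (M q') := by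
    intro q q'
    have e1 : ∀ r ∈ A.route q.1, ∑ r' ∈ A'.route q'.1, p (r, q.2) (r', q'.2) =
        chainParity s (R.tl r) (R.hd r) (n (r, q.2)) x' y' (M q') := by
      intro r hr
      have e2 : ∀ r' ∈ A'.route q'.1, p (r, q.2) (r', q'.2) = chainParity (fun a b => s b a)
          (R.tl r') (R.hd r') (n (r', q'.2)) (R.tl r) (R.hd r) (n (r, q.2)) := fun r' _ => by
        simp only [p, chainParity]; ring
      rw [Finset.sum_congr rfl e2, sum_chainParity R.tl R.hd (A'.joins q'.1)]
      simp only [M, chainParity]; ring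
    simp only [X]
    rw [Finset.sum_congr rfl e1,
      sum_chainParity R.tl R.hd (A.joins q.1) s (fun r => n (r, q.2))]
  have hX' : ∀ q q', X q q' = (N q x' + N q y') +
      (s x x' + s x y' + s y x' + s y y' + M q' x + M q' y) := by
    intro q q'
    rw [hX, chainParity]; ring
  have hrow : ∀ q, (Finset.univ.filter fun q' => X q q' = 1).card ≤ (A.route q.1).card * K := by
    intro q
    have hsub : (Finset.univ.filter fun q' => X q q' = 1) ⊆ (A.route q.1).biUnion fun r =>
        Finset.univ.filter fun q' : Fin T' × Fin K =>
          ∑ r' ∈ A'.route q'.1, p (r, q.2) (r', q'.2) = 1 := by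
      intro q' hq'
      have hq' := (Finset.mem_filter.1 hq').2
      simp only [Finset.mem_biUnion, Finset.mem_filter, Finset.mem_univ, true_and]
      by_contra hcon
      push Not at hcon
      have hz : ∀ x : ZMod 2, x ≠ 1 → x = 0 := by decide
      simp only [X] at hq'
      rw [Finset.sum_eq_zero fun r hr => hz _ (hcon r hr)] at hq'
      exact absurd hq' (by decide)
    refine (Finset.card_le_card hsub).trans (Finset.card_biUnion_le_card_mul _ _ _ ?_)
    intro r hr
    refine A'.card_route_le (fun σ => p (r, q.2) σ) fun S hS => hcap (r, q.2) S fun σ hσ => ?_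
    obtain ⟨⟨τ', hτ'⟩, h1⟩ := hS σ hσ
    exact ⟨hsep _ _ _ hr _ hτ', h1⟩
  have hcol : ∀ q', (Finset.univ.filter fun q => X q q' = 1).card ≤ (A'.route q'.1).card * K := by
    intro q'
    have hsub : (Finset.univ.filter fun q => X q q' = 1) ⊆ (A'.route q'.1).biUnion fun r' =>
        Finset.univ.filter fun q : Fin T × Fin K =>
          ∑ r ∈ A.route q.1, p (r, q.2) (r', q'.2) = 1 := by
      intro q hq
      have hq := (Finset.mem_filter.1 hq).2
      simp only [Finset.mem_biUnion, Finset.mem_filter, Finset.mem_univ, true_and]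
      by_contra hcon
      push Not at hcon
      have hz : ∀ x : ZMod 2, x ≠ 1 → x = 0 := by decide
      simp only [X] at hq
      rw [Finset.sum_comm, Finset.sum_eq_zero fun r hr => hz _ (hcon r hr)] at hq
      exact absurd hq (by decide)
    refine (Finset.card_le_card hsub).trans (Finset.card_biUnion_le_card_mul _ _ _ ?_)
    intro r' hr'
    refine A.card_route_le (fun σ => p σ (r', q'.2)) fun S hS => hcap (r', q'.2) S fun σ hσ => ?_
    obtain ⟨⟨τ, hτ⟩, h1⟩ := hS σ hσ
    have hsp := hsep _ _ _ hτ _ hr'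
    refine ⟨⟨hsp.1.symm, hsp.2.2.1.symm, hsp.2.1.symm, hsp.2.2.2.symm⟩, ?_⟩
    rw [← h1]
    exact (hpc σ (r', q'.2) hsp).symm
  obtain ⟨t₀, ht₀⟩ := A.direct
  obtain ⟨t₁, ht₁⟩ := A'.direct
  have h1 := hrow (t₀, ⟨0, hK⟩)
  have h2 := hcol (t₁, ⟨0, hK⟩)
  rw [ht₀, one_mul] at h1
  rw [ht₁, one_mul] at h2
  have := sum_form_eq_zero (X := Fin T × Fin K) (X' := Fin T' × Fin K) hK
    (by rw [Fintype.card_prod, Fintype.card_fin, Fintype.card_fin]; exact Nat.mul_le_mul_right _ hT)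
    (by rw [Fintype.card_prod, Fintype.card_fin, Fintype.card_fin]; exact Nat.mul_le_mul_right _ hT')
    (fun q => N q x' + N q y')
    (fun q' => s x x' + s x y' + s y x' + s y y' + M q' x + M q' y)
    (fun q => by
      simp only [← hX']
      exact (hrow q).trans (Nat.mul_le_mul_right _ (A.card_le _)))
    (fun q' => by
      simp only [← hX']
      exact (hcol q').trans (Nat.mul_le_mul_right _ (A'.card_le _)))
    (x₀ := (t₀, ⟨0, hK⟩)) (y₀ := (t₁, ⟨0, hK⟩))
    (by simp only [← hX']; exact h1) (by simp only [← hX']; exact h2) (τ, i) (τ', i')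
  rw [← hX', hX] at this
  exact this

end Thick

end Rows

/-- The paths of the construction: `K` parallel paths for every edge of the map and for every edge
of its dual, and the connecting paths. -/
inductive PathIdx (ρ : Type) (K : ℕ) : Type
  | primal (r : ρ) (i : Fin K)
  | dual (r : ρ) (i : Fin K)
  | link (c : Bool) (i : Fin K)
  | spoke (c : Bool)

namespace PathIdx

/-- The path indices as a sum type. -/
def equivSum (ρ : Type) (K : ℕ) :
    PathIdx ρ K ≃ ((ρ × Fin K) ⊕ (ρ × Fin K)) ⊕ ((Bool × Fin K) ⊕ Bool) where
  toFun
    | primal r i => Sum.inl (Sum.inl (r, i))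
    | dual r i => Sum.inl (Sum.inr (r, i))
    | link c i => Sum.inr (Sum.inl (c, i))
    | spoke c => Sum.inr (Sum.inr c)
  invFun
    | Sum.inl (Sum.inl (r, i)) => primal r i
    | Sum.inl (Sum.inr (r, i)) => dual r i
    | Sum.inr (Sum.inl (c, i)) => link c i
    | Sum.inr (Sum.inr c) => spoke c
  left_inv x := by cases x <;> rfl
  right_inv x := by rcases x with (x | x) | (x | x) <;> rfl

instance {ρ : Type} {K : ℕ} [Fintype ρ] : Fintype (PathIdx ρ K) :=
  Fintype.ofEquiv _ (equivSum ρ K).symm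

end PathIdx

/-- A map and its dual together with the data of the connecting paths: links run from `z` to
`linkEnd c`, spokes from `u` to `spokeEnd c`. -/
structure Frame (B ρ : Type) extends Rows B ρ where
  z : B
  u : B
  linkEnd : Bool → B
  spokeEnd : Bool → B
  face : B → Prop
  not_face_tl : ∀ r, ¬ face (tl r)
  not_face_hd : ∀ r, ¬ face (hd r)
  face_lf : ∀ r, face (lf r)
  face_rt : ∀ r, face (rt r)
  not_face_z : ¬ face z
  not_face_u : ¬ face u
  face_linkEnd : ∀ c, face (linkEnd c)
  face_spokeEnd : ∀ c, face (spokeEnd c)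
  z_ne_u : z ≠ u
  tl_ne_hd : ∀ r, tl r ≠ hd r
  lf_ne_rt : ∀ r, lf r ≠ rt r
  primal_simple : ∀ r r', s(tl r, hd r) = s(tl r', hd r') → r = r'
  dual_simple : ∀ r r', s(lf r, rt r) = s(lf r', rt r') → r = r'
  linkEnd_inj : ∀ c c', linkEnd c = linkEnd c' → c = c'
  spokeEnd_inj : ∀ c c', spokeEnd c = spokeEnd c' → c = c'

namespace Frame

variable {B ρ : Type} (F : Frame B ρ)

/-- The first vertex of a path. -/
def src {K : ℕ} : PathIdx ρ K → B
  | .primal r _ => F.tl r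
  | .dual r _ => F.lf r
  | .link _ _ => F.z
  | .spoke _ => F.u

/-- The last vertex of a path. -/
def tgt {K : ℕ} : PathIdx ρ K → B
  | .primal r _ => F.hd r
  | .dual r _ => F.rt r
  | .link c _ => F.linkEnd c
  | .spoke c => F.spokeEnd c

/-- The length of a path. -/
def len (k : ℕ) {K : ℕ} : PathIdx ρ K → ℕ
  | .spoke _ => 1
  | _ => k

/-- The path system with `K` parallel paths of length `k` for every edge. -/
def system (k K : ℕ) (hk : 1 ≤ k) (hK : k = 1 → K = 1) : PathSystem B (PathIdx ρ K) where
  src := F.src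
  tgt := F.tgt
  len := len k
  len_pos i := by cases i <;> simp only [len] <;> omega
  src_ne i := by
    cases i with
    | primal r i => exact F.tl_ne_hd r
    | dual r i => exact F.lf_ne_rt r
    | link c i => exact fun h => F.not_face_z ((show F.z = F.linkEnd c from h) ▸ F.face_linkEnd c)
    | spoke c => exact fun h => F.not_face_u ((show F.u = F.spokeEnd c from h) ▸ F.face_spokeEnd c)
  simple i j hi hj h := by
    have h1 := F.not_face_tl
    have h2 := F.not_face_hd
    have h3 := F.face_lf
    have h4 := F.face_rt
    have h5 := F.not_face_z
    have h6 := F.not_face_u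
    have h7 := F.face_linkEnd
    have h8 := F.face_spokeEnd
    have h9 := F.z_ne_u
    have hsub : k = 1 → ∀ i j : Fin K, i = j := by
      intro h i j
      have := hK h
      omega
    have key : ∀ x y x' y' : B, s(x, y) = s(x', y') → ¬ F.face x → F.face y' →
        x = x' ∧ y = y' := by
      intro x y x' y' h hx hy
      rcases Sym2.eq_iff.1 h with h | ⟨h, -⟩
      · exact h
      · exact absurd (h ▸ hy) hx
    rcases i with ⟨r, i⟩ | ⟨r, i⟩ | ⟨c, i⟩ | ⟨c⟩ <;>
    rcases j with ⟨r', j⟩ | ⟨r', j⟩ | ⟨c', j⟩ | ⟨c'⟩ <;>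
    simp only [src, tgt, len] at h hi hj
    · rw [F.primal_simple _ _ h, hsub hi i j]
    · exact absurd (key _ _ _ _ h (h1 _) (h4 _)).1 fun e => h1 r (e ▸ h3 _)
    · exact absurd (key _ _ _ _ h (h1 _) (h7 _)).2 fun e => h2 r (e ▸ h7 _)
    · exact absurd (key _ _ _ _ h (h1 _) (h8 _)).2 fun e => h2 r (e ▸ h8 _)
    · exact absurd (key _ _ _ _ h.symm (h1 _) (h4 _)).1 fun e => h1 r' (e ▸ h3 _)
    · rw [F.dual_simple _ _ h, hsub hi i j]
    · exact absurd (key _ _ _ _ h.symm h5 (h4 _)).1 fun e => h5 (e ▸ h3 _)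
    · exact absurd (key _ _ _ _ h.symm h6 (h4 _)).1 fun e => h6 (e ▸ h3 _)
    · exact absurd (key _ _ _ _ h.symm (h1 _) (h7 _)).2 fun e => h2 r' (e ▸ h7 _)
    · exact absurd (key _ _ _ _ h h5 (h4 _)).1 fun e => h5 (e ▸ h3 _)
    · rw [F.linkEnd_inj _ _ (key _ _ _ _ h h5 (h7 _)).2, hsub hi i j]
    · exact absurd (key _ _ _ _ h h5 (h8 _)).1 h9
    · exact absurd (key _ _ _ _ h.symm (h1 _) (h8 _)).2 fun e => h2 r' (e ▸ h8 _)
    · exact absurd (key _ _ _ _ h h6 (h4 _)).1 fun e => h6 (e ▸ h3 _)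
    · exact absurd (key _ _ _ _ h h6 (h7 _)).1 h9.symm
    · rw [F.spokeEnd_inj _ _ (key _ _ _ _ h h6 (h8 _)).2]

/-- The properties of a map that force many crossings. -/
structure Rigid [Fintype ρ] where
  a : B
  b : B
  d : B
  e₀ : ρ
  ab : a ≠ b
  ad : a ≠ d
  bd : b ≠ d
  au : a ≠ F.u
  bu : b ≠ F.u
  az : a ≠ F.z
  bz : b ≠ F.z
  ud : F.u ≠ d
  zd : F.z ≠ d
  tl_e₀ : F.tl e₀ = a
  hd_e₀ : F.hd e₀ = b
  star : F.StarClosed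
  simple : ∀ r r', F.Inc (F.tl r) r' → F.Inc (F.hd r) r' → r = r'
  tri : ∃ r r', F.Tri r r' e₀
  conn : ∀ p : ρ → Prop, (∀ r₁ r₂ r₃, F.Tri r₁ r₂ r₃ → (p r₁ ↔ p r₂) ∧ (p r₂ ↔ p r₃)) →
      ∀ r, p r ↔ p e₀
  detour : ∀ c c', ∃ T : Finset ρ, F.CoJoins T (F.spokeEnd c) (F.linkEnd c')
  tza : F.Thick F.z a 4
  tzb : F.Thick F.z b 4
  tua : F.Thick F.u a 4
  tub : F.Thick F.u b 4
  tad : F.Thick a d 3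
  tbd : F.Thick b d 3
  tzd : F.Thick F.z d 3
  tud : F.Thick F.u d 3
  sep_ub_ad : ∀ τ τ', ∀ r ∈ tub.route τ, ∀ r' ∈ tad.route τ', F.Sep r r'
  sep_zb_ad : ∀ τ τ', ∀ r ∈ tzb.route τ, ∀ r' ∈ tad.route τ', F.Sep r r'
  sep_ua_bd : ∀ τ τ', ∀ r ∈ tua.route τ, ∀ r' ∈ tbd.route τ', F.Sep r r'
  sep_za_bd : ∀ τ τ', ∀ r ∈ tza.route τ, ∀ r' ∈ tbd.route τ', F.Sep r r'
  sep_ua_zb : ∀ τ τ', ∀ r ∈ tua.route τ, ∀ r' ∈ tzb.route τ', F.Sep r r'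
  sep_ua_zd : ∀ τ τ', ∀ r ∈ tua.route τ, ∀ r' ∈ tzd.route τ', F.Sep r r'
  sep_ub_za : ∀ τ τ', ∀ r ∈ tub.route τ, ∀ r' ∈ tza.route τ', F.Sep r r'
  sep_ub_zd : ∀ τ τ', ∀ r ∈ tub.route τ, ∀ r' ∈ tzd.route τ', F.Sep r r'
  sep_za_ud : ∀ τ τ', ∀ r ∈ tza.route τ, ∀ r' ∈ tud.route τ', F.Sep r r'
  sep_zb_ud : ∀ τ τ', ∀ r ∈ tzb.route τ, ∀ r' ∈ tud.route τ', F.Sep r r'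
  avoid_ad : ∀ τ, ∀ r ∈ tad.route τ, (F.tl r ≠ F.u ∧ F.tl r ≠ F.z) ∧ F.hd r ≠ F.u ∧ F.hd r ≠ F.z
  avoid_bd : ∀ τ, ∀ r ∈ tbd.route τ, (F.tl r ≠ F.u ∧ F.tl r ≠ F.z) ∧ F.hd r ≠ F.u ∧ F.hd r ≠ F.z
  sep_zd : ∀ τ, ∀ r ∈ tzd.route τ, F.Sep e₀ r
  sep_ud : ∀ τ, ∀ r ∈ tud.route τ, F.Sep e₀ r

lemma chainParity_detour {T : Finset ρ} {f g : B} (hT : F.CoJoins T f g) (s : B → B → ZMod 2)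
    (x x' : B) (N : B → ZMod 2) (u z : B) (n : ρ → B → ZMod 2) (N₁ N₂ : B → ZMod 2) :
    chainParity s x x' N u z (fun p => N₁ p + ∑ r ∈ T, n r p + N₂ p) =
      chainParity s x x' N u f N₁ +
        ∑ r ∈ T, chainParity s x x' N (F.lf r) (F.rt r) (n r) + chainParity s x x' N z g N₂ := by
  have e : ∀ r ∈ T, chainParity s x x' N (F.lf r) (F.rt r) (n r) =
      (s x (F.lf r) + s x (F.rt r)) + (s x' (F.lf r) + s x' (F.rt r)) +
        (N (F.lf r) + N (F.rt r)) + (n r x + n r x') := fun r _ => by simp only [chainParity]; ring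
  have h2 : (2 : ZMod 2) = 0 := by decide
  rw [Finset.sum_congr rfl e, Finset.sum_add_distrib, Finset.sum_add_distrib,
    Finset.sum_add_distrib, hT (s x), hT (s x'), hT N, Finset.sum_add_distrib]
  simp only [chainParity]
  linear_combination -(s x f + s x g + s x' f + s x' g + N f + N g) * h2

variable {F}

/-- Every `k`-planar drawing of the graph of a rigid frame has many crossings. -/
lemma Rigid.le_crossings [Fintype ρ] [Finite B] (H : F.Rigid) {k K : ℕ} (hk : 1 ≤ k)
    (hk1 : k = 1 → K = 1) (hKdef : K = k * k) {Γ : Drawing (F.system k K hk hk1).graph} (hΓ : Γ.IsKPlanar k) :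
    Fintype.card ρ * K * K ≤ Γ.crossings := by
  classical
  have hK : 0 < K := hKdef ▸ Nat.mul_pos hk hk
  let S := F.system k K hk hk1
  obtain ⟨s, N, hs, hN⟩ := S.path_parity_exists Γ
  have h2 : (2 : ZMod 2) = 0 := by decide
  have hz : ∀ x : ZMod 2, x = 0 ∨ x = 1 := by decide
  set y : PathIdx ρ K → PathIdx ρ K → ZMod 2 := fun i j =>
    chainParity s (S.src i) (S.tgt i) (N i) (S.src j) (S.tgt j) (N j) with hy
  have hcomm : ∀ i j, S.Indep i j → y i j = y j i := fun i j h =>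
    chainParity_comm hs h.1 h.2.1 h.2.2.1 h.2.2.2 _ _
  have hcap : ∀ i (T : Finset (PathIdx ρ K)), (∀ j ∈ T, S.Indep i j ∧ y i j = 1) →
      T.card ≤ S.len i * k := fun i T hT =>
    S.card_crossing_le hΓ i T fun j hj => ⟨(hT j hj).1.ne S, hN _ _ (hT j hj).1 (hT j hj).2⟩
  -- caps for a family of paths
  have hcapm : ∀ {X : Type} [DecidableEq X] (f : X → PathIdx ρ K), Function.Injective f →
      ∀ i (T : Finset X), (∀ x ∈ T, S.Indep i (f x) ∧ y i (f x) = 1) → T.card ≤ S.len i * k := by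
    intro X _ f hf i T hT
    rw [← Finset.card_image_of_injective T hf]
    refine hcap i _ fun j hj => ?_
    obtain ⟨x, hx, rfl⟩ := Finset.mem_image.1 hj
    exact hT x hx
  have hcapK : ∀ {X : Type} [DecidableEq X] (f : X → PathIdx ρ K), Function.Injective f →
      ∀ i (T : Finset X), (∀ x ∈ T, S.Indep i (f x) ∧ y i (f x) = 1) → T.card ≤ K := by
    intro X _ f hf i T hT
    have hlen : S.len i ≤ k := by
      cases i
      exacts [le_rfl, le_rfl, le_rfl, hk]
    exact (hcapm f hf i T hT).trans ((Nat.mul_le_mul_right _ hlen).trans hKdef.ge)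
  have hp_inj : Function.Injective fun π : ρ × Fin K => PathIdx.primal π.1 π.2 := by
    rintro ⟨r, i⟩ ⟨r', i'⟩ h; cases h; rfl
  have hq_inj : Function.Injective fun π : ρ × Fin K => PathIdx.dual π.1 π.2 := by
    rintro ⟨r, i⟩ ⟨r', i'⟩ h; cases h; rfl
  have hb_inj : Function.Injective fun π : Bool × Fin K => (PathIdx.link π.1 π.2 : PathIdx ρ K) := by
    rintro ⟨r, i⟩ ⟨r', i'⟩ h; cases h; rfl
  have hs_inj : Function.Injective fun c : Bool => (PathIdx.spoke c : PathIdx ρ K) := by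
    rintro r r' h; cases h; rfl
  have hne : ∀ x y, ¬ F.face x → F.face y → x ≠ y := fun x y hx hy h => hx (h ▸ hy)
  have ipq : ∀ π σ : ρ × Fin K, S.Indep (.primal π.1 π.2) (.dual σ.1 σ.2) := fun π σ =>
    ⟨hne _ _ (F.not_face_tl _) (F.face_lf _), hne _ _ (F.not_face_tl _) (F.face_rt _),
      hne _ _ (F.not_face_hd _) (F.face_lf _), hne _ _ (F.not_face_hd _) (F.face_rt _)⟩
  have ips : ∀ (π : ρ × Fin K) c, F.tl π.1 ≠ F.u → F.hd π.1 ≠ F.u →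
      S.Indep (.primal π.1 π.2) (.spoke c) := fun π c h h' =>
    ⟨h, hne _ _ (F.not_face_tl _) (F.face_spokeEnd _), h',
      hne _ _ (F.not_face_hd _) (F.face_spokeEnd _)⟩
  have ipb : ∀ (π : ρ × Fin K) c i, F.tl π.1 ≠ F.z → F.hd π.1 ≠ F.z →
      S.Indep (.primal π.1 π.2) (.link c i) := fun π c i h h' =>
    ⟨h, hne _ _ (F.not_face_tl _) (F.face_linkEnd _), h',
      hne _ _ (F.not_face_hd _) (F.face_linkEnd _)⟩
  have ipp : ∀ π σ : ρ × Fin K, F.Sep π.1 σ.1 → S.Indep (.primal π.1 π.2) (.primal σ.1 σ.2) :=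
    fun π σ h => h
  set Y : ρ × Fin K → ρ × Fin K → ZMod 2 := fun π σ =>
    y (.primal π.1 π.2) (.dual σ.1 σ.2) with hYdef
  have hdich := F.toRows.grid_dichotomy hK H.star F.tl_ne_hd H.simple H.e₀ H.tri H.conn
    (fun π f => s (F.tl π.1) f + s (F.hd π.1) f + N (.primal π.1 π.2) f)
    (fun σ v => N (.dual σ.1 σ.2) v) Y
    (fun π σ => by
      change s (F.tl π.1) (F.lf σ.1) + s (F.tl π.1) (F.rt σ.1) + s (F.hd π.1) (F.lf σ.1) +
        s (F.hd π.1) (F.rt σ.1) + N _ (F.lf σ.1) + N _ (F.rt σ.1) + N _ (F.tl π.1) +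
          N _ (F.hd π.1) = _
      ring)
    (fun π => hcapK _ hq_inj (.primal π.1 π.2) _ fun σ hσ =>
      ⟨ipq π σ, (Finset.mem_filter.1 hσ).2⟩)
    (fun σ => hcapK _ hp_inj (.dual σ.1 σ.2) _ fun π hπ =>
      ⟨(ipq π σ).symm S, (hcomm _ _ (ipq π σ)).symm.trans (Finset.mem_filter.1 hπ).2⟩)
  rcases hdich with h0 | hfull
  swap
  · rw [← hfull, ← Finset.card_image_of_injective (f := fun q : (ρ × Fin K) × (ρ × Fin K) =>
      ((PathIdx.primal q.1.1 q.1.2 : PathIdx ρ K), (PathIdx.dual q.2.1 q.2.2 : PathIdx ρ K)))]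
    · refine S.card_le_crossings Γ _ ?_ ?_
      · intro q hq
        obtain ⟨x, hx, rfl⟩ := Finset.mem_image.1 hq
        exact hN _ _ (ipq _ _) (Finset.mem_filter.1 hx).2
      · intro q hq q' hq'
        obtain ⟨x, -, rfl⟩ := Finset.mem_image.1 hq
        obtain ⟨x', -, rfl⟩ := Finset.mem_image.1 hq'
        intro h; cases h
    · rintro ⟨⟨r, i⟩, r', i'⟩ ⟨⟨t, j⟩, t', j'⟩ h
      cases h; rfl
  exfalso
  set n : ρ × Fin K → B → ZMod 2 := fun π => N (.primal π.1 π.2) with hn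
  have hcapP : ∀ (π : ρ × Fin K) (T : Finset (ρ × Fin K)), (∀ σ ∈ T, F.Sep π.1 σ.1 ∧
      chainParity s (F.tl π.1) (F.hd π.1) (n π) (F.tl σ.1) (F.hd σ.1) (n σ) = 1) →
      T.card ≤ K := fun π T hT =>
    hcapK _ hp_inj (.primal π.1 π.2) _ fun σ hσ => ⟨ipp _ _ (hT σ hσ).1, (hT σ hσ).2⟩
  have hP := fun {x y x' y' : B} {T T' : ℕ} (A : F.Thick x y T) (A' : F.Thick x' y' T')
    (hT : 4 ≤ T) (hT' : 3 ≤ T') => A.parity_eq_zero A' hK hT hT' hs n hcapP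
  obtain ⟨τza, -⟩ := H.tza.direct
  obtain ⟨τzb, -⟩ := H.tzb.direct
  obtain ⟨τua, -⟩ := H.tua.direct
  obtain ⟨τub, -⟩ := H.tub.direct
  let o : Fin K := ⟨0, hK⟩
  -- the interaction of the bundle `e₀` with the connecting paths
  have key : ∀ (i : Fin K) (c c' : Bool) (j : Fin K),
      y (.primal H.e₀ i) (.spoke c) + y (.primal H.e₀ i) (.link c' j) = 1 := by
    intro i c c' j
    obtain ⟨T, hT⟩ := H.detour c c'
    have avoidP : ∀ {x : B} (A : F.Thick x H.d 3), (∀ τ, ∀ r ∈ A.route τ, F.Sep H.e₀ r) →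
        ∃ τ i', ∑ r ∈ A.route τ, y (.primal H.e₀ i) (.primal r i') = 0 := by
      intro x A hA
      obtain ⟨τ, i', h, -⟩ := A.exists_avoiding (K := K) (c := K) (c' := 0) (by omega)
        (fun σ => y (.primal H.e₀ i) (.primal σ.1 σ.2)) (fun _ => 0)
        (fun T hT => hcapP (H.e₀, i) T fun σ hσ =>
          ⟨hA _ _ (hT σ hσ).1.choose_spec, (hT σ hσ).2⟩)
        (fun T hT => by
          rw [Nat.le_zero, Finset.card_eq_zero, Finset.eq_empty_iff_forall_notMem]
          exact fun σ hσ => absurd (hT σ hσ).2 (by decide))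
      exact ⟨τ, i', h⟩
    obtain ⟨τzd, izd, hzd⟩ := avoidP H.tzd H.sep_zd
    obtain ⟨τud, iud, hud⟩ := avoidP H.tud H.sep_ud
    have avoidQ : ∀ {x : B} (A : F.Thick x H.d 3), (∀ τ, ∀ r ∈ A.route τ,
        (F.tl r ≠ F.u ∧ F.tl r ≠ F.z) ∧ F.hd r ≠ F.u ∧ F.hd r ≠ F.z) →
        ∃ τ i', ∑ r ∈ A.route τ, y (.primal r i') (.spoke c) = 0 ∧
          ∑ r ∈ A.route τ, y (.primal r i') (.link c' j) = 0 := by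
      intro x A hA
      have hk' : k ≤ K := hKdef ▸ Nat.le_mul_of_pos_left _ hk
      refine A.exists_avoiding (K := K) (c := 1 * k) (c' := K) (by omega)
        (fun σ => y (.primal σ.1 σ.2) (.spoke c)) (fun σ => y (.primal σ.1 σ.2) (.link c' j)) ?_ ?_
      · intro T hT
        refine hcapm _ hp_inj (.spoke c) T fun σ hσ => ?_
        obtain ⟨⟨τ, hτ⟩, h1⟩ := hT σ hσ
        have hi := ips σ c (hA τ _ hτ).1.1 (hA τ _ hτ).2.1
        exact ⟨hi.symm S, (hcomm _ _ hi).symm.trans h1⟩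
      · intro T hT
        refine hcapK _ hp_inj (.link c' j) T fun σ hσ => ?_
        obtain ⟨⟨τ, hτ⟩, h1⟩ := hT σ hσ
        have hi := ipb σ c' j (hA τ _ hτ).1.2 (hA τ _ hτ).2.2
        exact ⟨hi.symm S, (hcomm _ _ hi).symm.trans h1⟩
    obtain ⟨τad, iad, had, had'⟩ := avoidQ H.tad H.avoid_ad
    obtain ⟨τbd, ibd, hbd, hbd'⟩ := avoidQ H.tbd H.avoid_bd
    have huz : ∀ π : ρ × Fin K, chainParity s (F.tl π.1) (F.hd π.1) (n π) F.u F.z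
        (fun p => N (.spoke c) p + ∑ r ∈ T, N (.dual r o) p + N (.link c' j) p) =
        y (.primal π.1 π.2) (.spoke c) + y (.primal π.1 π.2) (.link c' j) := by
      intro π
      have hq : ∑ r ∈ T, chainParity s (F.tl π.1) (F.hd π.1) (n π) (F.lf r) (F.rt r)
          (N (.dual r o)) = 0 := Finset.sum_eq_zero fun r _ => h0 π (r, o)
      rw [F.chainParity_detour hT, hq, add_zero]
      rfl
    have huz' : ∀ {x : B} (A : F.Thick x H.d 3) τ i',
        ∑ r ∈ A.route τ, y (.primal r i') (.spoke c) = 0 →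
        ∑ r ∈ A.route τ, y (.primal r i') (.link c' j) = 0 →
        chainParity s x H.d (fun p => ∑ r ∈ A.route τ, n (r, i') p) F.u F.z
          (fun p => N (.spoke c) p + ∑ r ∈ T, N (.dual r o) p + N (.link c' j) p) = 0 := by
      intro x A τ i' e1 e2
      rw [← Rows.sum_chainParity F.tl F.hd (A.joins τ) s (fun r => n (r, i')),
        Finset.sum_congr rfl fun r _ => huz (r, i'), Finset.sum_add_distrib, e1, e2, add_zero]
    have hab' : ∀ {x : B} (A : F.Thick x H.d 3) τ i',
        ∑ r ∈ A.route τ, y (.primal H.e₀ i) (.primal r i') = 0 →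
        chainParity s H.a H.b (n (H.e₀, i)) x H.d (fun p => ∑ r ∈ A.route τ, n (r, i') p) = 0 := by
      intro x A τ i' e1
      have := Rows.sum_chainParity F.tl F.hd (A.joins τ) (fun a b => s b a) (fun r => n (r, i'))
        H.a H.b (n (H.e₀, i))
      have hsw : chainParity s H.a H.b (n (H.e₀, i)) x H.d
          (fun p => ∑ r ∈ A.route τ, n (r, i') p) = chainParity (fun a b => s b a) x H.d
          (fun p => ∑ r ∈ A.route τ, n (r, i') p) H.a H.b (n (H.e₀, i)) := by
        simp only [chainParity]; ring
      rw [hsw, ← this, ← e1]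
      refine Finset.sum_congr rfl fun r _ => ?_
      change _ = chainParity s (F.tl H.e₀) (F.hd H.e₀) _ (F.tl r) (F.hd r) _
      rw [H.tl_e₀, H.hd_e₀]
      simp only [chainParity]
      ring
    have hk5 := chainParity_k5 hs (u := F.u) (z := F.z) H.ab H.ad H.bd (n (H.e₀, i))
      (fun p => ∑ r ∈ H.tza.route τza, n (r, o) p) (fun p => ∑ r ∈ H.tzb.route τzb, n (r, o) p)
      (fun p => ∑ r ∈ H.tua.route τua, n (r, o) p) (fun p => ∑ r ∈ H.tub.route τub, n (r, o) p)
      (fun p => ∑ r ∈ H.tad.route τad, n (r, iad) p) (fun p => ∑ r ∈ H.tbd.route τbd, n (r, ibd) p)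
      (fun p => ∑ r ∈ H.tzd.route τzd, n (r, izd) p) (fun p => ∑ r ∈ H.tud.route τud, n (r, iud) p)
      (fun p => N (.spoke c) p + ∑ r ∈ T, N (.dual r o) p + N (.link c' j) p)
    have hcp : ∀ {x x' y y' : B} {N M : B → ZMod 2}, x ≠ y → x ≠ y' → x' ≠ y → x' ≠ y' →
        chainParity s y y' M x x' N = 0 → chainParity s x x' N y y' M = 0 :=
      fun h1 h2 h3 h4 h => (chainParity_comm hs h1 h2 h3 h4 _ _).trans h
    have e0 := huz (H.e₀, i)
    rw [H.tl_e₀, H.hd_e₀] at e0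
    rw [hab' H.tzd _ _ hzd, hab' H.tud _ _ hud, e0,
      hcp H.au H.ab H.ud.symm H.bd.symm (hP H.tub H.tad (by norm_num) (by norm_num) H.sep_ub_ad ..),
      hcp H.az H.ab H.zd.symm H.bd.symm (hP H.tzb H.tad (by norm_num) (by norm_num) H.sep_zb_ad ..),
      huz' H.tad _ _ had had',
      hcp H.bu H.ab.symm H.ud.symm H.ad.symm
        (hP H.tua H.tbd (by norm_num) (by norm_num) H.sep_ua_bd ..),
      hcp H.bz H.ab.symm H.zd.symm H.ad.symm
        (hP H.tza H.tbd (by norm_num) (by norm_num) H.sep_za_bd ..),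
      huz' H.tbd _ _ hbd hbd',
      hP H.tua H.tzb (by norm_num) (by norm_num) H.sep_ua_zb ..,
      hP H.tua H.tzd (by norm_num) (by norm_num) H.sep_ua_zd ..,
      hP H.tub H.tza (by norm_num) (by norm_num) H.sep_ub_za ..,
      hP H.tub H.tzd (by norm_num) (by norm_num) H.sep_ub_zd ..,
      hcp F.z_ne_u.symm H.au.symm H.zd.symm H.ad.symm
        (hP H.tza H.tud (by norm_num) (by norm_num) H.sep_za_ud ..),
      hcp F.z_ne_u.symm H.bu.symm H.zd.symm H.bd.symm
        (hP H.tzb H.tud (by norm_num) (by norm_num) H.sep_zb_ud ..)] at hk5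
    simpa using hk5
  have hau : F.tl H.e₀ ≠ F.u := H.tl_e₀ ▸ H.au
  have hbu : F.hd H.e₀ ≠ F.u := H.hd_e₀ ▸ H.bu
  have haz : F.tl H.e₀ ≠ F.z := H.tl_e₀ ▸ H.az
  have hbz : F.hd H.e₀ ≠ F.z := H.hd_e₀ ▸ H.bz
  have hone : ∀ i c, y (.primal H.e₀ i) (.spoke c) = 1 := by
    intro i c
    refine (hz _).resolve_left fun h => ?_
    have := hcapK _ hb_inj (.primal H.e₀ i) Finset.univ fun x _ =>
      ⟨ipb (H.e₀, i) x.1 x.2 haz hbz, by have := key i c x.1 x.2; rwa [h, zero_add] at this⟩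
    rw [Finset.card_univ, Fintype.card_prod, Fintype.card_bool, Fintype.card_fin] at this
    omega
  have hKk : K ≤ 1 * k := by
    have := hcapm (fun i : Fin K => (PathIdx.primal H.e₀ i : PathIdx ρ K))
      (fun i i' h => by cases h; rfl) (.spoke false) Finset.univ fun i _ =>
      ⟨(ips (H.e₀, i) false hau hbu).symm S,
        (hcomm _ _ (ips (H.e₀, i) false hau hbu)).symm.trans (hone i false)⟩
    rwa [Finset.card_univ, Fintype.card_fin] at this
  have hk2 := hcapK _ hs_inj (.primal H.e₀ o) Finset.univ fun c _ =>
      ⟨ips (H.e₀, o) c hau hbu, hone o c⟩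
  rw [Finset.card_univ, Fintype.card_bool] at hk2
  have : k ≤ 1 := by nlinarith
  have : k = 1 := by omega
  rw [hKdef, this] at hk2
  omega

end Frame

namespace PathSystem

variable {B I : Type}

/-- Curves in the plane drawing the paths of a path system. The colouring separates crossing
curves, so no three curves cross at one point. -/
structure Net (S : PathSystem B I) where
  pos : B → ℝ × ℝ
  pos_inj : Function.Injective pos
  curve : I → ℝ → ℝ × ℝ
  cont : ∀ i, ContinuousOn (curve i) (Icc 0 1)
  inj : ∀ i, InjOn (curve i) (Icc 0 1)
  start : ∀ i, curve i 0 = pos (S.src i)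
  finish : ∀ i, curve i 1 = pos (S.tgt i)
  avoids : ∀ i, ∀ t ∈ Ioo (0:ℝ) 1, ∀ b, curve i t ≠ pos b
  colour : I → Bool
  colour_ne : ∀ i j, i ≠ j → ∀ t ∈ Ioo (0:ℝ) 1, ∀ t' ∈ Ioo (0:ℝ) 1, curve i t = curve j t' →
    colour i ≠ colour j
  unique : ∀ i j, i ≠ j → ∀ t ∈ Ioo (0:ℝ) 1, ∀ t' ∈ Ioo (0:ℝ) 1, ∀ x ∈ Ioo (0:ℝ) 1,
    ∀ x' ∈ Ioo (0:ℝ) 1, curve i t = curve j t' → curve i x = curve j x' → t = x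
  cut : ∀ i j, i ≠ j → ∀ t ∈ Ioo (0:ℝ) 1, ∀ t' ∈ Ioo (0:ℝ) 1, curve i t = curve j t' →
    ∀ m : ℕ, t * S.len i ≠ m

namespace Net

variable {S : PathSystem B I} (Γ : S.Net)

lemma mem_Ioo_of_eq {i j : I} {t t' : ℝ} (ht : t ∈ Ioo (0:ℝ) 1) (ht' : t' ∈ Icc (0:ℝ) 1)
    (h : Γ.curve i t = Γ.curve j t') : t' ∈ Ioo (0:ℝ) 1 := by
  refine ⟨lt_of_le_of_ne ht'.1 ?_, lt_of_le_of_ne ht'.2 ?_⟩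
  · rintro rfl
    exact Γ.avoids i t ht _ (h.trans (Γ.start j))
  · rintro rfl
    exact Γ.avoids i t ht _ (h.trans (Γ.finish j))

/-- The position of a vertex. -/
def vpos : S.Vert → ℝ × ℝ
  | Sum.inl b => Γ.pos b
  | Sum.inr ⟨i, m⟩ => Γ.curve i (((m : ℕ) + 1 : ℝ) / S.len i)

lemma len_pos' (i : I) : (0:ℝ) < S.len i := by exact_mod_cast S.len_pos i

lemma vpos_node {i : I} {m : ℕ} (hm : m ≤ S.len i) :
    Γ.vpos (S.node i m) = Γ.curve i ((m : ℝ) / S.len i) := by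
  have hl := len_pos' (S := S) i
  rcases S.node_cases hm with ⟨h, h'⟩ | ⟨h, h'⟩ | ⟨h0, h1, h'⟩
  · rw [h', h, Nat.cast_zero, zero_div, Γ.start]; rfl
  · rw [h', h, div_self hl.ne', Γ.finish]; rfl
  · rw [h']
    have : ((m - 1 : ℕ) : ℝ) + 1 = m := by
      rw [← Nat.cast_add_one]; congr 1; omega
    simp only [vpos]
    rw [this]

lemma inner_mem {i : I} (m : Fin (S.len i - 1)) :
    ((m : ℕ) + 1 : ℝ) / S.len i ∈ Ioo (0:ℝ) 1 := by
  have hl := len_pos' (S := S) i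
  have h : (m : ℕ) + 1 < S.len i := by omega
  have h' : ((m : ℕ) + 1 : ℝ) < S.len i := by exact_mod_cast h
  exact ⟨by positivity, by rwa [div_lt_one hl]⟩

lemma vpos_inj : Function.Injective Γ.vpos := by
  rintro (b | ⟨i, m⟩) (b' | ⟨j, m'⟩) h
  · exact congrArg _ (Γ.pos_inj h)
  · exact absurd h.symm (Γ.avoids _ _ (inner_mem m') _)
  · exact absurd h (Γ.avoids _ _ (inner_mem m) _)
  · simp only [vpos] at h
    by_cases hij : i = j
    · subst hij
      have hl := len_pos' (S := S) i
      have := Γ.inj i (Ioo_subset_Icc_self (inner_mem m)) (Ioo_subset_Icc_self (inner_mem m')) h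
      rw [div_left_inj' hl.ne', add_left_inj, Nat.cast_inj] at this
      rw [Fin.ext this]
    · have hl := len_pos' (S := S) i
      refine absurd ?_ (Γ.cut i j hij _ (inner_mem m) _ (inner_mem m') h (m + 1))
      push_cast
      field_simp

open Classical in
/-- The arc of an edge. -/
def arc (a b : S.Vert) (t : ℝ) : ℝ × ℝ :=
  if h : ∃ q : I × ℕ, q.2 < S.len q.1 ∧ a = S.node q.1 q.2 ∧ b = S.node q.1 (q.2 + 1) then
    Γ.curve h.choose.1 ((h.choose.2 + t) / S.len h.choose.1)
  else if h : ∃ q : I × ℕ, q.2 < S.len q.1 ∧ b = S.node q.1 q.2 ∧ a = S.node q.1 (q.2 + 1) then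
    Γ.curve h.choose.1 ((h.choose.2 + (1 - t)) / S.len h.choose.1)
  else 0

lemma arc_node {i : I} {m : ℕ} (hm : m < S.len i) (t : ℝ) :
    Γ.arc (S.node i m) (S.node i (m + 1)) t = Γ.curve i ((m + t) / S.len i) := by
  have h : ∃ q : I × ℕ, q.2 < S.len q.1 ∧ S.node i m = S.node q.1 q.2 ∧
      S.node i (m + 1) = S.node q.1 (q.2 + 1) := ⟨(i, m), hm, rfl, rfl⟩
  rw [arc, dif_pos h]
  obtain ⟨h1, h2, h3⟩ := h.choose_spec
  obtain ⟨e1, e2⟩ := S.edge_inj hm h1 (by rw [edge, edge, ← h2, ← h3])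
  rw [← e1, ← e2]

lemma arc_node_symm {i : I} {m : ℕ} (hm : m < S.len i) (t : ℝ) :
    Γ.arc (S.node i (m + 1)) (S.node i m) t = Γ.curve i ((m + (1 - t)) / S.len i) := by
  have h' : ¬ ∃ q : I × ℕ, q.2 < S.len q.1 ∧ S.node i (m + 1) = S.node q.1 q.2 ∧
      S.node i m = S.node q.1 (q.2 + 1) := by
    rintro ⟨⟨j, m'⟩, h1, h2, h3⟩
    obtain ⟨e1, e2⟩ := S.edge_inj hm h1 (by rw [edge, edge, ← h2, ← h3, Sym2.eq_swap])
    simp only at e1 e2 h2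
    subst e1 e2
    have := S.node_inj (by omega) (by omega) h2
    omega
  have h : ∃ q : I × ℕ, q.2 < S.len q.1 ∧ S.node i m = S.node q.1 q.2 ∧
      S.node i (m + 1) = S.node q.1 (q.2 + 1) := ⟨(i, m), hm, rfl, rfl⟩
  rw [arc, dif_neg h', dif_pos h]
  obtain ⟨h1, h2, h3⟩ := h.choose_spec
  obtain ⟨e1, e2⟩ := S.edge_inj hm h1 (by rw [edge, edge, ← h2, ← h3])
  rw [← e1, ← e2]

lemma arc_symm (a b : S.Vert) (t : ℝ) : Γ.arc a b t = Γ.arc b a (1 - t) := by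
  by_cases h : ∃ q : I × ℕ, q.2 < S.len q.1 ∧ a = S.node q.1 q.2 ∧ b = S.node q.1 (q.2 + 1)
  · obtain ⟨⟨i, m⟩, hm, rfl, rfl⟩ := h
    rw [Γ.arc_node hm, Γ.arc_node_symm hm, sub_sub_cancel]
  by_cases h' : ∃ q : I × ℕ, q.2 < S.len q.1 ∧ b = S.node q.1 q.2 ∧ a = S.node q.1 (q.2 + 1)
  · obtain ⟨⟨i, m⟩, hm, rfl, rfl⟩ := h'
    rw [Γ.arc_node hm, Γ.arc_node_symm hm]
  rw [arc, arc, dif_neg h, dif_neg h', dif_neg h', dif_neg h]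

/-- The part of the curve `i` that draws the `m`-th edge. -/
def seg (i : I) (m : ℕ) : Set ℝ := {x | (m : ℝ) ≤ x * S.len i ∧ x * S.len i ≤ m + 1}

lemma seg_subset {i : I} {m : ℕ} (hm : m < S.len i) {x : ℝ} (hx : x ∈ seg (S := S) i m) :
    x ∈ Icc (0:ℝ) 1 := by
  have hl := len_pos' (S := S) i
  obtain ⟨h1, h2⟩ := hx
  have h3 : ((m : ℝ) + 1) ≤ S.len i := by exact_mod_cast hm
  have h4 : (0 : ℝ) ≤ m := m.cast_nonneg
  constructor <;> by_contra hc <;> nlinarith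

/-- Every edge is drawn by a reparametrization of part of a curve. -/
lemma exists_param {a b : S.Vert} (h : S.graph.Adj a b) :
    ∃ (i : I) (m : ℕ) (g : ℝ → ℝ), m < S.len i ∧ s(a, b) = S.edge i m ∧ Continuous g ∧
      Function.Injective g ∧ (∀ t, Γ.arc a b t = Γ.curve i (g t)) ∧
      (∀ t ∈ Icc (0:ℝ) 1, g t ∈ seg (S := S) i m) ∧
      (∀ t ∈ Ioo (0:ℝ) 1, (m : ℝ) < g t * S.len i ∧ g t * S.len i < m + 1) ∧
      (∀ x ∈ seg (S := S) i m, ∃ t ∈ Icc (0:ℝ) 1, g t = x) := by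
  obtain ⟨i, m, hm, h⟩ := h
  have hl := len_pos' (S := S) i
  rcases h with ⟨rfl, rfl⟩ | ⟨rfl, rfl⟩
  · refine ⟨i, m, fun t => (m + t) / S.len i, hm, rfl, by fun_prop, ?_, Γ.arc_node hm, ?_, ?_, ?_⟩
    · intro t t' h
      simpa [hl.ne'] using h
    · intro t ht
      simp only [seg, mem_ofPred_eq, div_mul_cancel₀ _ hl.ne']
      exact ⟨by linarith [ht.1], by linarith [ht.2]⟩
    · intro t ht
      simp only [div_mul_cancel₀ _ hl.ne']
      exact ⟨by linarith [ht.1], by linarith [ht.2]⟩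
    · intro x hx
      exact ⟨x * S.len i - m, ⟨by linarith [hx.1], by linarith [hx.2]⟩, by field_simp; ring⟩
  · refine ⟨i, m, fun t => (m + (1 - t)) / S.len i, hm, by rw [edge, Sym2.eq_swap], by fun_prop, ?_,
      Γ.arc_node_symm hm, ?_, ?_, ?_⟩
    · intro t t' h
      simpa [hl.ne'] using h
    · intro t ht
      simp only [seg, mem_ofPred_eq, div_mul_cancel₀ _ hl.ne']
      exact ⟨by linarith [ht.2], by linarith [ht.1]⟩
    · intro t ht
      simp only [div_mul_cancel₀ _ hl.ne']
      exact ⟨by linarith [ht.2], by linarith [ht.1]⟩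
    · intro x hx
      exact ⟨1 - (x * S.len i - m), ⟨by linarith [hx.2], by linarith [hx.1]⟩, by field_simp; ring⟩

lemma img_arc {a b : S.Vert} (h : S.graph.Adj a b) : ∃ (i : I) (m : ℕ), m < S.len i ∧
    s(a, b) = S.edge i m ∧ Γ.arc a b '' Icc 0 1 = Γ.curve i '' seg (S := S) i m := by
  obtain ⟨i, m, g, hm, he, -, -, harc, h1, -, h2⟩ := Γ.exists_param h
  refine ⟨i, m, hm, he, Subset.antisymm ?_ ?_⟩
  · rintro p ⟨t, ht, rfl⟩
    exact ⟨g t, h1 t ht, (harc t).symm⟩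
  · rintro p ⟨x, hx, rfl⟩
    obtain ⟨t, ht, rfl⟩ := h2 x hx
    exact ⟨t, ht, harc t⟩

lemma eq_of_mem_seg {i : I} {m m' : ℕ} (hne : m ≠ m') {x : ℝ} (hx : x ∈ seg (S := S) i m)
    (hx' : x ∈ seg (S := S) i m') : x * S.len i = m ∨ x * S.len i = (m + 1 : ℕ) := by
  obtain ⟨h1, h2⟩ := hx
  obtain ⟨h3, h4⟩ := hx'
  rcases lt_or_gt_of_ne hne with h | h
  · right
    have : (m : ℝ) + 1 ≤ m' := by exact_mod_cast h
    push_cast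
    linarith
  · left
    have : (m' : ℝ) + 1 ≤ m := by exact_mod_cast h
    linarith

lemma mem_range_of_eq {i : I} {m : ℕ} (hm : m ≤ S.len i) {x : ℝ} (hx : x * S.len i = m) :
    Γ.curve i x ∈ range Γ.vpos := by
  refine ⟨S.node i m, ?_⟩
  rw [Γ.vpos_node hm, ← hx, mul_div_cancel_right₀ _ (len_pos' (S := S) i).ne']

lemma mem_Ioo_of_not_range {i : I} {x : ℝ} (hx : x ∈ Icc (0:ℝ) 1)
    (h : Γ.curve i x ∉ range Γ.vpos) : x ∈ Ioo (0:ℝ) 1 := by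
  refine ⟨lt_of_le_of_ne hx.1 ?_, lt_of_le_of_ne hx.2 ?_⟩
  · rintro rfl
    exact h (Γ.mem_range_of_eq (Nat.zero_le _) (by simp))
  · rintro rfl
    exact h (Γ.mem_range_of_eq le_rfl (by simp))

lemma ne_of_meet {i j : I} {m m' : ℕ} (hm : m < S.len i) (hm' : m' < S.len j)
    (hne : S.edge i m ≠ S.edge j m') {x x' : ℝ} (hx : x ∈ seg (S := S) i m)
    (hx' : x' ∈ seg (S := S) j m') (h : Γ.curve i x = Γ.curve j x')
    (hr : Γ.curve i x ∉ range Γ.vpos) : i ≠ j := by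
  rintro rfl
  have hxx := Γ.inj i (seg_subset hm hx) (seg_subset hm' hx') h
  subst hxx
  have hmm : m ≠ m' := by rintro rfl; exact hne rfl
  rcases eq_of_mem_seg hmm hx hx' with h1 | h1
  · exact hr (Γ.mem_range_of_eq hm.le h1)
  · exact hr (Γ.mem_range_of_eq hm h1)

/-- The drawing given by a net. -/
def drawing : Drawing S.graph where
  vpos := Γ.vpos
  vpos_inj := Γ.vpos_inj
  arc := Γ.arc
  arc_symm := Γ.arc_symm
  arc_cont a b h := by
    obtain ⟨i, m, g, hm, -, hg, -, harc, h1, -⟩ := Γ.exists_param h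
    have : Γ.arc a b = Γ.curve i ∘ g := funext harc
    rw [this]
    exact (Γ.cont i).comp hg.continuousOn fun t ht => seg_subset hm (h1 t ht)
  arc_injOn a b h := by
    obtain ⟨i, m, g, hm, -, -, hg, harc, h1, -⟩ := Γ.exists_param h
    intro t ht t' ht' e
    rw [harc, harc] at e
    exact hg (Γ.inj i (seg_subset hm (h1 t ht)) (seg_subset hm (h1 t' ht')) e)
  arc_start a b h := by
    obtain ⟨i, m, hm, ⟨rfl, rfl⟩ | ⟨rfl, rfl⟩⟩ := h
    · rw [Γ.arc_node hm, Γ.vpos_node hm.le, add_zero]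
    · rw [Γ.arc_node_symm hm, Γ.vpos_node hm, sub_zero]; push_cast; rfl
  arc_end a b h := by
    obtain ⟨i, m, hm, ⟨rfl, rfl⟩ | ⟨rfl, rfl⟩⟩ := h
    · rw [Γ.arc_node hm, Γ.vpos_node hm]; push_cast; rfl
    · rw [Γ.arc_node_symm hm, Γ.vpos_node hm.le, sub_self, add_zero]
  arc_avoids a b h t ht := by
    obtain ⟨i, m, g, hm, -, -, -, harc, h1, h2, -⟩ := Γ.exists_param h
    have hl := len_pos' (S := S) i
    obtain ⟨h3, h4⟩ := h2 t ht
    have h0 := seg_subset hm (h1 t (Ioo_subset_Icc_self ht))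
    have hg : g t ∈ Ioo (0:ℝ) 1 := by
      have h5 : ((m : ℝ) + 1) ≤ S.len i := by exact_mod_cast hm
      have h6 : (0 : ℝ) ≤ m := m.cast_nonneg
      refine ⟨lt_of_le_of_ne h0.1 ?_, lt_of_le_of_ne h0.2 ?_⟩
      · intro h; rw [← h] at h3; linarith
      · intro h; rw [h] at h4; linarith
    rw [harc]
    rintro ⟨b' | ⟨j, m'⟩, hb⟩
    · exact Γ.avoids _ _ hg _ hb.symm
    · simp only [vpos] at hb
      by_cases hij : i = j
      · subst hij
        have := Γ.inj i (Ioo_subset_Icc_self (inner_mem m')) h0 hb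
        rw [← this, div_mul_cancel₀ _ hl.ne'] at h3 h4
        have h3 : m < m' + 1 := by exact_mod_cast h3
        have h4 : (m' : ℕ) + 1 < m + 1 := by exact_mod_cast h4
        omega
      · refine absurd ?_ (Γ.cut j i (Ne.symm hij) _ (inner_mem m') _ hg hb (m' + 1))
        have hl := len_pos' (S := S) j
        push_cast
        field_simp
  inter_finite a b c d h h' hne := by
    obtain ⟨i, m, hm, he, hi⟩ := Γ.img_arc h
    obtain ⟨j, m', hm', he', hj⟩ := Γ.img_arc h'
    rw [hi, hj]
    by_cases hij : i = j
    · subst hij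
      have hmm : m ≠ m' := by rintro rfl; exact hne (he.trans he'.symm)
      refine Set.Finite.subset (s := Γ.curve i '' {(m : ℝ) / S.len i, ((m + 1 : ℕ) : ℝ) / S.len i})
        ((Set.toFinite _).image _) ?_
      rintro p ⟨⟨x, hx, rfl⟩, ⟨x', hx', h⟩⟩
      have := Γ.inj i (seg_subset hm' hx') (seg_subset hm hx) h
      subst this
      refine ⟨x', ?_, rfl⟩
      have hl := len_pos' (S := S) i
      rcases eq_of_mem_seg hmm hx hx' with h1 | h1
      · left; rw [← h1]; field_simp
      · right; rw [mem_singleton_iff, ← h1]; field_simp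
    · have hsub : {t | t ∈ Ioo (0:ℝ) 1 ∧ ∃ t' ∈ Ioo (0:ℝ) 1, Γ.curve i t = Γ.curve j t'}.Subsingleton := by
        rintro t ⟨ht, t', ht', e⟩ x ⟨hx, x', hx', e'⟩
        exact Γ.unique i j hij t ht t' ht' x hx x' hx' e e'
      refine Set.Finite.subset (s := Γ.curve i '' ({0, 1} ∪ _))
        (((Set.toFinite _).union hsub.finite).image _) ?_
      rintro p ⟨⟨x, hx, rfl⟩, ⟨x', hx', h⟩⟩
      refine ⟨x, ?_, rfl⟩
      have hx0 := seg_subset hm hx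
      by_cases h0 : x = 0
      · exact Or.inl (Or.inl h0)
      by_cases h1 : x = 1
      · exact Or.inl (Or.inr h1)
      have hxo : x ∈ Ioo (0:ℝ) 1 := ⟨lt_of_le_of_ne hx0.1 (Ne.symm h0), lt_of_le_of_ne hx0.2 h1⟩
      exact Or.inr ⟨hxo, x', Γ.mem_Ioo_of_eq hxo (seg_subset hm' hx') h.symm, h.symm⟩
  no_triple_point p hp a₁ b₁ a₂ b₂ a₃ b₃ h₁ h₂ h₃ n12 n13 n23 := by
    obtain ⟨i, m, hm, he, hi⟩ := Γ.img_arc h₁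
    obtain ⟨i', m', hm', he', hi'⟩ := Γ.img_arc h₂
    obtain ⟨i'', m'', hm'', he'', hi''⟩ := Γ.img_arc h₃
    rw [hi, hi', hi'']
    rintro ⟨⟨x, hx, rfl⟩, ⟨x', hx', e'⟩, ⟨x'', hx'', e''⟩⟩
    have a1 := Γ.ne_of_meet hm hm' (by rwa [← he, ← he']) hx hx' e'.symm hp
    have a2 := Γ.ne_of_meet hm hm'' (by rwa [← he, ← he'']) hx hx'' e''.symm hp
    have a3 := Γ.ne_of_meet hm' hm'' (by rwa [← he', ← he'']) hx' hx'' (e'.trans e''.symm)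
      (by rwa [e'])
    have b1 := Γ.mem_Ioo_of_not_range (seg_subset hm hx) hp
    have b2 := Γ.mem_Ioo_of_eq b1 (seg_subset hm' hx') e'.symm
    have b3 := Γ.mem_Ioo_of_eq b1 (seg_subset hm'' hx'') e''.symm
    have c1 := Γ.colour_ne _ _ a1 _ b1 _ b2 e'.symm
    have c2 := Γ.colour_ne _ _ a2 _ b1 _ b3 e''.symm
    have c3 := Γ.colour_ne _ _ a3 _ b2 _ b3 (e'.trans e''.symm)
    revert c1 c2 c3
    cases Γ.colour i <;> cases Γ.colour i' <;> cases Γ.colour i'' <;> simp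

lemma exists_of_crossing {e f : Sym2 S.Vert} {p : ℝ × ℝ} (h : Γ.drawing.Crossing e f p) :
    ∃ i m j, i ≠ j ∧ m < S.len i ∧ e = S.edge i m ∧ ∃ x ∈ Ioo (0:ℝ) 1, ∃ x' ∈ Ioo (0:ℝ) 1,
      Γ.curve i x = p ∧ Γ.curve j x' = p ∧ (m : ℝ) < x * S.len i ∧ x * S.len i < m + 1 := by
  obtain ⟨he, hf, hef, hpe, hpf, hp⟩ := h
  induction e with | h a b =>
  induction f with | h c d =>
  change p ∈ Γ.arc a b '' Icc 0 1 at hpe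
  change p ∈ Γ.arc c d '' Icc 0 1 at hpf
  change p ∉ range Γ.vpos at hp
  obtain ⟨i, m, hm, he, hi⟩ := Γ.img_arc he
  obtain ⟨j, m', hm', he', hj⟩ := Γ.img_arc hf
  rw [hi] at hpe
  rw [hj] at hpf
  obtain ⟨x, hx, rfl⟩ := hpe
  obtain ⟨x', hx', e'⟩ := hpf
  have b1 := Γ.mem_Ioo_of_not_range (seg_subset hm hx) hp
  refine ⟨i, m, j, Γ.ne_of_meet hm hm' (by rwa [← he, ← he']) hx hx' e'.symm hp, hm, he, x, b1, x',
    Γ.mem_Ioo_of_eq b1 (seg_subset hm' hx') e'.symm, rfl, e', ?_, ?_⟩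
  · exact lt_of_le_of_ne hx.1 fun h => hp (Γ.mem_range_of_eq hm.le h.symm)
  · exact lt_of_le_of_ne hx.2 fun h => hp (Γ.mem_range_of_eq hm (by rw [h]; push_cast; rfl))

lemma isKPlanar {k : ℕ} (h : ∀ (i : I) (m : ℕ), ∃ T : Finset ℝ, T.card ≤ k ∧ ∀ j, i ≠ j →
    ∀ x ∈ Ioo (0:ℝ) 1, ∀ x' ∈ Ioo (0:ℝ) 1, Γ.curve i x = Γ.curve j x' → (m : ℝ) < x * S.len i →
      x * S.len i < m + 1 → x ∈ T) : Γ.drawing.IsKPlanar k := by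
  classical
  intro e he
  obtain ⟨i, m, hm, rfl⟩ := S.mem_edgeSet.1 he
  obtain ⟨T, hT, hx⟩ := h i m
  have hsub : Γ.drawing.edgeCrossings (S.edge i m) ⊆ (T.image (Γ.curve i) : Finset (ℝ × ℝ)) := by
    rintro p ⟨f, hp⟩
    obtain ⟨i', m', j, hij, hm', hee, x, h1, x', h2, rfl, h3, h4, h5⟩ := Γ.exists_of_crossing hp
    obtain ⟨rfl, rfl⟩ := S.edge_inj hm hm' hee
    exact Finset.mem_coe.2 (Finset.mem_image_of_mem _ (hx j hij x h1 x' h2 h3.symm h4 h5))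
  exact (Set.ncard_le_ncard hsub (Finset.finite_toSet _)).trans
    ((Set.ncard_coe_finset _).le.trans (Finset.card_image_le.trans hT))

lemma crossings_le {X : Type} (T : Finset X) (p : X → ℝ × ℝ)
    (h : ∀ i j, i ≠ j → ∀ x ∈ Ioo (0:ℝ) 1, ∀ x' ∈ Ioo (0:ℝ) 1, Γ.curve i x = Γ.curve j x' →
      ∃ c ∈ T, Γ.curve i x = p c) : Γ.drawing.crossings ≤ T.card := by
  classical
  have hsub : Γ.drawing.crossingSet ⊆ (T.image p : Finset (ℝ × ℝ)) := by
    rintro q ⟨e, f, hp⟩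
    obtain ⟨i, m, j, hij, hm, hee, x, h1, x', h2, rfl, h3, -⟩ := Γ.exists_of_crossing hp
    obtain ⟨c, hc, e⟩ := h i j hij x h1 x' h2 h3.symm
    rw [e]
    exact Finset.mem_coe.2 (Finset.mem_image_of_mem _ hc)
  exact (Set.ncard_le_ncard hsub (Finset.finite_toSet _)).trans
    ((Set.ncard_coe_finset _).le.trans Finset.card_image_le)

end Net

end PathSystem

/-- Finitely many points can be added outside of finitely many curves. -/
lemma exists_extend_pos {B J I : Type} [Finite I] [Finite B] [Finite J] (c : I → ℝ → ℝ × ℝ)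
    (hc : ∀ i, ContinuousOn (c i) (Icc 0 1)) (pos : B → ℝ × ℝ) (hpos : Function.Injective pos) :
    ∃ pos' : B ⊕ J → ℝ × ℝ, Function.Injective pos' ∧ (∀ b, pos' (Sum.inl b) = pos b) ∧
      ∀ i, ∀ t ∈ Icc (0:ℝ) 1, ∀ j, c i t ≠ pos' (Sum.inr j) := by
  have hcpt : IsCompact ((⋃ i, c i '' Icc 0 1) ∪ range pos) :=
    (isCompact_iUnion fun i => isCompact_Icc.image_of_continuousOn (hc i)).union
      (Set.finite_range pos).isCompact
  obtain ⟨M, hM⟩ := hcpt.isBounded.exists_norm_le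
  obtain ⟨e⟩ : Nonempty (J ≃ Fin (Nat.card J)) := ⟨Finite.equivFin J⟩
  have hfar : ∀ j, ((M + 1 + (e j : ℕ), 0) : ℝ × ℝ) ∉ (⋃ i, c i '' Icc 0 1) ∪ range pos := by
    intro j h
    have h1 := hM _ h
    have h2 := (norm_fst_le ((M + 1 + (e j : ℕ), 0) : ℝ × ℝ)).trans h1
    rw [Real.norm_eq_abs, abs_le] at h2
    have := ((e j : ℕ).cast_nonneg : (0:ℝ) ≤ _)
    linarith [h2.2]
  refine ⟨Sum.elim pos fun j => (M + 1 + (e j : ℕ), 0), ?_, fun b => rfl, ?_⟩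
  · rintro (b | j) (b' | j') h
    · exact congrArg _ (hpos h)
    · exact absurd (Or.inr ⟨b, h⟩) (hfar j')
    · exact absurd (Or.inr ⟨b', h.symm⟩) (hfar j)
    · simp only [Sum.elim_inr, Prod.mk.injEq, and_true, add_right_inj, Nat.cast_inj] at h
      rw [e.injective (Fin.ext h)]
  · intro i t ht j h
    exact hfar j (Or.inl (mem_iUnion.2 ⟨i, t, ht, h⟩))

/-- A cell of the integer grid, bounded by the heights `tl`, `hd` and the verticals `lf`, `rt`. -/
structure Cell where
  tl : ℤ
  hd : ℤ
  lf : ℤ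
  rt : ℤ

namespace Cell

/-- The cell with the coordinates exchanged. -/
def swap (c : Cell) : Cell := ⟨c.lf, c.rt, c.tl, c.hd⟩

/-- The number is an end of the vertical extent of the cell. -/
def End (c : Cell) (v : ℤ) : Prop := v = c.tl ∨ v = c.hd

/-- The interiors of the cells do not meet. -/
def Apart (c c' : Cell) : Prop := c.hd ≤ c'.tl ∨ c'.hd ≤ c.tl ∨ c.rt ≤ c'.lf ∨ c'.rt ≤ c.lf

/-- Near its ends, a vertical curve of `c` passes beside `c'`. -/
def Beside (L : ℤ → ℤ) (c c' : Cell) : Prop :=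
  ∀ v, c.End v → c'.tl < v → v < c'.hd → (c'.rt ≤ c.lf ∧ c'.rt ≤ L v) ∨ (c.rt ≤ c'.lf ∧ L v < c'.lf)

/-- Near its ends, a vertical curve of `c` does not meet the ends of the horizontal curves
of `c'`. -/
def Clear (L B : ℤ → ℤ) (c c' : Cell) : Prop :=
  ∀ v f, c.End v → c'.swap.End f → (f ≤ c.lf ∧ f ≤ L v) ∨ (c.rt ≤ f ∧ L v < f) ∨
    (v ≤ c'.tl ∧ v ≤ B f) ∨ (c'.hd ≤ v ∧ B f < v)

/-- Vertical curves in `c`, `c'` do not meet. -/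
def PP (L : ℤ → ℤ) (c c' : Cell) : Prop := c.Apart c' ∧ Beside L c c' ∧ Beside L c' c

/-- Vertical curves in `c` do not meet horizontal curves in `c'`. -/
def PQ (L B : ℤ → ℤ) (c c' : Cell) : Prop :=
  c.Apart c' ∧ Clear L B c c' ∧ Beside L c c' ∧ Beside B c'.swap c.swap

/-- The cell is not degenerate. -/
def Fat (c : Cell) : Prop := c.tl < c.hd ∧ c.lf < c.rt

/-- The position on the vertical side of the cell. -/
def ypos (c : Cell) (t : ℝ) : ℝ := c.tl + (c.hd - c.tl) * t

/-- The position on the horizontal side of the cell. -/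
def xpos (c : Cell) (t : ℝ) : ℝ := c.lf + (c.rt - c.lf) * t

end Cell

/-- The line `x` deformed near `lo` to end in `a` and near `hi` to end in `b`. -/
def bend (ε lo hi a x b y : ℝ) : ℝ :=
  x + (a - x) * max 0 (1 - (y - lo) / ε) + (b - x) * max 0 (1 - (hi - y) / ε)

lemma bend_cases {ε : ℝ} (h0 : 0 < ε) (h1 : ε ≤ 1 / 4) (L : ℤ → ℤ) {lo hi : ℤ} (h : lo < hi)
    (x : ℝ) {y : ℝ} (hy : y ∈ Icc (lo : ℝ) hi) :
    (∃ n : ℤ, (n = lo ∨ n = hi) ∧ ∃ s : ℝ, 0 < s ∧ s ≤ 1 ∧ |y - n| = ε * (1 - s) ∧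
      bend ε lo hi (L lo + 1 / 2) x (L hi + 1 / 2) y = x + (L n + 1 / 2 - x) * s) ∨
    (lo + ε ≤ y ∧ y ≤ hi - ε ∧ bend ε lo hi (L lo + 1 / 2) x (L hi + 1 / 2) y = x) := by
  have hlh : (lo : ℝ) + 1 ≤ hi := by exact_mod_cast h
  obtain ⟨hy1, hy2⟩ := hy
  have far : ∀ z : ℝ, ε ≤ z → max 0 (1 - z / ε) = 0 := fun z hz =>
    max_eq_left (by have := (one_le_div h0).2 hz; linarith)
  have near : ∀ z : ℝ, 0 ≤ z → z < ε → max 0 (1 - z / ε) = 1 - z / ε ∧ 0 < 1 - z / ε ∧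
      1 - z / ε ≤ 1 ∧ z = ε * (1 - (1 - z / ε)) := by
    intro z h2 h3
    have h4 := (div_lt_one h0).2 h3
    have h5 : 0 ≤ z / ε := by positivity
    refine ⟨max_eq_right (by linarith), by linarith, by linarith, by field_simp; ring⟩
  unfold bend
  by_cases c1 : y - lo < ε
  · left
    obtain ⟨e1, e2, e3, e4⟩ := near (y - lo) (by linarith) c1
    refine ⟨lo, Or.inl rfl, _, e2, e3, by rw [abs_of_nonneg (by linarith)]; exact e4, ?_⟩
    rw [e1, far (hi - y) (by linarith)]
    ring
  · by_cases c2 : hi - y < ε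
    · left
      obtain ⟨e1, e2, e3, e4⟩ := near (hi - y) (by linarith) c2
      refine ⟨hi, Or.inr rfl, _, e2, e3, by rw [abs_of_nonpos (by linarith), neg_sub]; exact e4, ?_⟩
      rw [e1, far (y - lo) (by linarith)]
      ring
    · right
      refine ⟨by linarith, by linarith, ?_⟩
      rw [far (y - lo) (by linarith), far (hi - y) (by linarith)]
      ring

/-- The vertical curve of the cell `c` with offset `o`. -/
def pc (L : ℤ → ℤ) (ε : ℝ) (c : Cell) (o t : ℝ) : ℝ × ℝ :=
  (bend ε c.tl c.hd (L c.tl + 1 / 2) (c.xpos o) (L c.hd + 1 / 2) (c.ypos t), c.ypos t)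

/-- The horizontal curve of the cell `c` with offset `o`. -/
def qc (B : ℤ → ℤ) (ε : ℝ) (c : Cell) (o t : ℝ) : ℝ × ℝ := (pc B ε c.swap o t).swap

namespace Cell

lemma ypos_mem {c : Cell} (hc : c.tl < c.hd) {t : ℝ} (ht : t ∈ Icc (0:ℝ) 1) :
    c.ypos t ∈ Icc (c.tl : ℝ) c.hd := by
  have : (c.tl : ℝ) < c.hd := by exact_mod_cast hc
  obtain ⟨h0, h1⟩ := ht
  constructor <;> unfold ypos <;> nlinarith

lemma ypos_mem_Ioo {c : Cell} (hc : c.tl < c.hd) {t : ℝ} (ht : t ∈ Ioo (0:ℝ) 1) :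
    c.ypos t ∈ Ioo (c.tl : ℝ) c.hd := by
  have : (c.tl : ℝ) < c.hd := by exact_mod_cast hc
  obtain ⟨h0, h1⟩ := ht
  constructor <;> unfold ypos <;> nlinarith

lemma ypos_inj {c : Cell} (hc : c.tl < c.hd) {t t' : ℝ} (h : c.ypos t = c.ypos t') : t = t' := by
  have : (c.tl : ℝ) < c.hd := by exact_mod_cast hc
  unfold ypos at h
  exact mul_left_cancel₀ (sub_pos.2 this).ne' (add_left_cancel h)

lemma ypos_bounds {c : Cell} (hc : c.tl < c.hd) {ε o : ℝ} (h1 : ε ≤ o) (h2 : o ≤ 1 - ε) (h0 : 0 < ε) :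
    c.tl + ε ≤ c.ypos o ∧ c.ypos o ≤ c.hd - ε := by
  have : (c.tl : ℝ) + 1 ≤ c.hd := by exact_mod_cast hc
  constructor <;> unfold ypos <;> nlinarith

end Cell

lemma pc_zero (L : ℤ → ℤ) {ε : ℝ} (h0 : 0 < ε) (h1 : ε ≤ 1 / 4) {c : Cell} (hc : c.tl < c.hd)
    (o : ℝ) : pc L ε c o 0 = ((L c.tl + 1 / 2 : ℝ), (c.tl : ℝ)) := by
  have : (c.tl : ℝ) + 1 ≤ c.hd := by exact_mod_cast hc
  have e : max 0 (1 - ((c.hd : ℝ) - c.tl) / ε) = 0 :=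
    max_eq_left (by have := (one_le_div h0).2 (show ε ≤ (c.hd : ℝ) - c.tl by linarith); linarith)
  simp [pc, Cell.ypos, bend, e]

lemma pc_one (L : ℤ → ℤ) {ε : ℝ} (h0 : 0 < ε) (h1 : ε ≤ 1 / 4) {c : Cell} (hc : c.tl < c.hd)
    (o : ℝ) : pc L ε c o 1 = ((L c.hd + 1 / 2 : ℝ), (c.hd : ℝ)) := by
  have : (c.tl : ℝ) + 1 ≤ c.hd := by exact_mod_cast hc
  have e : max 0 (1 - ((c.hd : ℝ) - c.tl) / ε) = 0 :=
    max_eq_left (by have := (one_le_div h0).2 (show ε ≤ (c.hd : ℝ) - c.tl by linarith); linarith)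
  simp [pc, Cell.ypos, bend, e]

lemma continuous_pc (L : ℤ → ℤ) (ε : ℝ) (c : Cell) (o : ℝ) : Continuous (pc L ε c o) := by
  unfold pc bend Cell.ypos
  fun_prop

lemma continuous_qc (B : ℤ → ℤ) (ε : ℝ) (c : Cell) (o : ℝ) : Continuous (qc B ε c o) :=
  continuous_swap.comp (continuous_pc B ε c.swap o)

/-- A vertical curve is straight away from its ends. -/
lemma pc_of_mem (L : ℤ → ℤ) {ε : ℝ} (h0 : 0 < ε) {c : Cell} (hc : c.tl < c.hd)
    (o : ℝ) {t : ℝ} (h1 : ε ≤ t) (h2 : t ≤ 1 - ε) : pc L ε c o t = (c.xpos o, c.ypos t) := by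
  obtain ⟨h3, h4⟩ := Cell.ypos_bounds hc h1 h2 h0
  have far : ∀ z : ℝ, ε ≤ z → max 0 (1 - z / ε) = 0 := fun z hz =>
    max_eq_left (by have := (one_le_div h0).2 hz; linarith)
  rw [pc, bend, far _ (by linarith), far _ (by linarith)]
  simp

lemma qc_of_mem (B : ℤ → ℤ) {ε : ℝ} (h0 : 0 < ε) {c : Cell} (hc : c.lf < c.rt)
    (o : ℝ) {t : ℝ} (h1 : ε ≤ t) (h2 : t ≤ 1 - ε) : qc B ε c o t = (c.xpos t, c.ypos o) := by
  rw [qc, pc_of_mem B h0 (c := c.swap) hc o h1 h2]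
  rfl

lemma pc_inj {L : ℤ → ℤ} {ε : ℝ} {c : Cell} (hc : c.tl < c.hd) {o t t' : ℝ}
    (h : pc L ε c o t = pc L ε c o t') : t = t' := c.ypos_inj hc (congrArg Prod.snd h)

lemma qc_inj {B : ℤ → ℤ} {ε : ℝ} {c : Cell} (hc : c.lf < c.rt) {o t t' : ℝ}
    (h : qc B ε c o t = qc B ε c o t') : t = t' :=
  pc_inj (c := c.swap) hc (Prod.swap_injective h)

/-- Vertical curves do not meet in interior points. -/
lemma pc_meet {L : ℤ → ℤ} {ε : ℝ} (h0 : 0 < ε) (h1 : ε ≤ 1 / 4) {c c' : Cell} (hc : c.Fat)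
    (hc' : c'.Fat) {o o' : ℝ} (ho : o ∈ Ioo (0:ℝ) 1) (ho' : o' ∈ Ioo (0:ℝ) 1)
    (hcc : Cell.PP L c c' ∨ (c = c' ∧ o ≠ o')) {t t' : ℝ} (ht : t ∈ Ioo (0:ℝ) 1)
    (ht' : t' ∈ Icc (0:ℝ) 1) : pc L ε c o t ≠ pc L ε c' o' t' := by
  intro h
  obtain ⟨hx, hy⟩ := Prod.ext_iff.1 h
  simp only [pc] at hx hy
  have y1 := c.ypos_mem_Ioo hc.1 ht
  have y2 := c'.ypos_mem hc'.1 ht'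
  rw [← hy] at y2 hx
  set y := c.ypos t
  have X1 := Cell.ypos_mem_Ioo (c := c.swap) hc.2 ho
  have X2 := Cell.ypos_mem_Ioo (c := c'.swap) hc'.2 ho'
  change c.xpos o ∈ Ioo (c.lf : ℝ) c.rt at X1
  change c'.xpos o' ∈ Ioo (c'.lf : ℝ) c'.rt at X2
  have hXX : c.xpos o ≠ c'.xpos o' := by
    rcases hcc with h2 | ⟨rfl, h2⟩
    · intro e
      have hy1 : (c.tl : ℝ) < c'.hd := y1.1.trans_le y2.2
      have hy2 : (c'.tl : ℝ) < c.hd := y2.1.trans_lt y1.2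
      have hx1 : (c.lf : ℝ) < c'.rt := X1.1.trans (e ▸ X2.2)
      have hx2 : (c'.lf : ℝ) < c.rt := X2.1.trans (e ▸ X1.2)
      norm_cast at hy1 hy2 hx1 hx2
      have := h2.1
      unfold Cell.Apart at this
      omega
    · exact fun e => h2 (Cell.ypos_inj (c := c.swap) hc.2 e)
  have side : ∀ {c c' : Cell} {o o' : ℝ} {n : ℤ} {s : ℝ}, c.xpos o ∈ Ioo (c.lf : ℝ) c.rt →
      c'.xpos o' ∈ Ioo (c'.lf : ℝ) c'.rt → (Cell.Beside L c c' ∨ (c = c' ∧ o ≠ o')) →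
      c.End n → 0 < s → s ≤ 1 → |y - n| = ε * (1 - s) → (c'.tl + ε ≤ y ∧ y ≤ c'.hd - ε) →
      c.xpos o + (L n + 1 / 2 - c.xpos o) * s ≠ c'.xpos o' := by
    intro c c' o o' n s X1 X2 hb hn s0 s1 hyn ⟨y1, y2⟩ e
    have ha : |y - n| < ε := by rw [hyn]; nlinarith
    rw [abs_lt] at ha
    have n1 : (c'.tl : ℝ) < n := by linarith
    have n2 : (n : ℝ) < c'.hd := by linarith
    norm_cast at n1 n2
    rcases hb with hb | ⟨rfl, -⟩
    · rcases hb n hn n1 n2 with ⟨h3, h4⟩ | ⟨h3, h4⟩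
      · have h3 : (c'.rt : ℝ) ≤ c.lf := by exact_mod_cast h3
        have h4 : (c'.rt : ℝ) ≤ L n := by exact_mod_cast h4
        nlinarith [X1.1, X2.2]
      · have h3 : (c.rt : ℝ) ≤ c'.lf := by exact_mod_cast h3
        have h4 : (L n : ℝ) + 1 ≤ c'.lf := by exact_mod_cast h4
        nlinarith [X1.2, X2.1]
    · rcases hn with rfl | rfl <;> omega
  rcases bend_cases h0 h1 L hc.1 (c.xpos o) ⟨y1.1.le, y1.2.le⟩ with
    ⟨n, hn, s, s0, s1, hs, e⟩ | ⟨a1, a2, e⟩ <;>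
  rcases bend_cases h0 h1 L hc'.1 (c'.xpos o') y2 with
    ⟨n', hn', s', s0', s1', hs', e'⟩ | ⟨a1', a2', e'⟩ <;> rw [e, e'] at hx
  · have hnn : n = n' := by
      have ha : |y - n| < 1 / 2 := by rw [hs]; nlinarith
      have hb : |y - n'| < 1 / 2 := by rw [hs']; nlinarith
      rw [abs_lt] at ha hb
      have h2 : (n : ℝ) < n' + 1 := by linarith
      have h3 : (n' : ℝ) < n + 1 := by linarith
      norm_cast at h2 h3
      omega
    subst hnn
    obtain rfl : s = s' := by
      have := hs.symm.trans hs'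
      have := mul_left_cancel₀ h0.ne' this
      linarith
    have h2 : (c.xpos o - c'.xpos o') * (1 - s) = 0 := by linear_combination hx
    rcases mul_eq_zero.1 h2 with h2 | h2
    · exact hXX (sub_eq_zero.1 h2)
    · rw [h2, mul_zero, abs_eq_zero] at hs
      have hyn : y = n := by linarith
      rw [hyn] at y1
      rcases hn with rfl | rfl
      · exact lt_irrefl _ y1.1
      · exact lt_irrefl _ y1.2
  · exact side X1 X2 (hcc.imp (fun h => h.2.1) id) hn s0 s1 hs ⟨a1', a2'⟩ hx
  · exact side X2 X1 (hcc.imp (fun h => h.2.2) fun h => ⟨h.1.symm, h.2.symm⟩) hn' s0' s1' hs'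
      ⟨a1, a2⟩ hx.symm
  · exact hXX hx

lemma qc_meet {B : ℤ → ℤ} {ε : ℝ} (h0 : 0 < ε) (h1 : ε ≤ 1 / 4) {c c' : Cell} (hc : c.Fat)
    (hc' : c'.Fat) {o o' : ℝ} (ho : o ∈ Ioo (0:ℝ) 1) (ho' : o' ∈ Ioo (0:ℝ) 1)
    (hcc : Cell.PP B c.swap c'.swap ∨ (c = c' ∧ o ≠ o')) {t t' : ℝ} (ht : t ∈ Ioo (0:ℝ) 1)
    (ht' : t' ∈ Icc (0:ℝ) 1) : qc B ε c o t ≠ qc B ε c' o' t' := fun h =>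
  pc_meet h0 h1 (c := c.swap) (c' := c'.swap) ⟨hc.2, hc.1⟩ ⟨hc'.2, hc'.1⟩ ho ho'
    (hcc.imp id fun h => ⟨congrArg _ h.1, h.2⟩) ht ht' (Prod.swap_injective h)

/-- Vertical and horizontal curves meet only if they belong to the same cell. -/
lemma pc_qc_meet {L B : ℤ → ℤ} {ε : ℝ} (h0 : 0 < ε) (h1 : ε ≤ 1 / 4) {c c' : Cell} (hc : c.Fat)
    (hc' : c'.Fat) {o o' : ℝ} (ho : o ∈ Icc ε (1 - ε)) (ho' : o' ∈ Icc ε (1 - ε))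
    (hcc : Cell.PQ L B c c' ∨ (c = c' ∧ Cell.Clear L B c c)) {t t' : ℝ} (ht : t ∈ Icc (0:ℝ) 1)
    (ht' : t' ∈ Icc (0:ℝ) 1) (h : pc L ε c o t = qc B ε c' o' t') : c = c' ∧ t = o' ∧ t' = o := by
  obtain ⟨hx, hy⟩ := Prod.ext_iff.1 h
  simp only [pc, qc, Prod.fst_swap, Prod.snd_swap] at hx hy
  have y1 := c.ypos_mem hc.1 ht
  have x2 := Cell.ypos_mem (c := c'.swap) hc'.2 ht'
  have X1 := Cell.ypos_bounds (c := c.swap) hc.2 ho.1 ho.2 h0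
  have Y2 := Cell.ypos_bounds (c := c') hc'.1 ho'.1 ho'.2 h0
  change c.lf + ε ≤ c.xpos o ∧ c.xpos o ≤ c.rt - ε at X1
  change _ = c'.xpos t' at hx
  change c'.xpos t' ∈ Icc (c'.lf : ℝ) c'.rt at x2
  have hclear : Cell.Clear L B c c' := hcc.elim (fun h => h.2.1) (fun h => h.1 ▸ h.2)
  have hb1 : Cell.Beside L c c' := by
    rcases hcc with h | ⟨rfl, -⟩
    · exact h.2.2.1
    · intro v hv h1 h2
      rcases hv with rfl | rfl <;> omega
  have hb2 : Cell.Beside B c'.swap c.swap := by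
    rcases hcc with h | ⟨rfl, -⟩
    · exact h.2.2.2
    · intro v hv h1 h2
      rcases hv with rfl | rfl <;> omega
  have key : ∀ {lo hi : ℤ} {r z w ε : ℝ} {m a : ℤ}, 0 < ε → ε ≤ 1/4 → (lo : ℝ) + ε ≤ r → r ≤ hi - ε →
      ∀ s : ℝ, 0 < s → s ≤ 1 → z = r + (a + 1 / 2 - r) * s → |z - m| < ε →
      ¬ ((m ≤ lo ∧ m ≤ a) ∨ (hi ≤ m ∧ a < m)) := by
    rintro lo hi r z w ε m a h0 h1 h2 h3 s s0 s1 hz hm (⟨k1, k2⟩ | ⟨k1, k2⟩) <;> rw [abs_lt] at hm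
    · have k1 : (m : ℝ) ≤ lo := by exact_mod_cast k1
      have k2 : (m : ℝ) ≤ a := by exact_mod_cast k2
      nlinarith
    · have k1 : (hi : ℝ) ≤ m := by exact_mod_cast k1
      have k2 : (a : ℝ) + 1 ≤ m := by exact_mod_cast k2
      nlinarith
  have hlt : ∀ {s : ℝ}, 0 < s → ε * (1 - s) < ε := by intro s hs; nlinarith
  rcases bend_cases h0 h1 L hc.1 (c.xpos o) y1 with
    ⟨n, hn, s, s0, s1, hs, e⟩ | ⟨a1, a2, e⟩ <;>
  rcases bend_cases (lo := c'.lf) (hi := c'.rt) h0 h1 B hc'.2 (c'.ypos o') x2 with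
    ⟨m, hm, s', s0', s1', hs', e'⟩ | ⟨b1, b2, e'⟩
  · exfalso
    rw [e] at hx
    replace hy := hy.trans e'
    rw [← hx] at hs'
    rw [hy] at hs
    rcases hclear n m hn hm with h | h | h | h
    · exact key (w := 0) h0 h1 X1.1 X1.2 s s0 s1 rfl (hs'.trans_lt (hlt s0')) (Or.inl h)
    · exact key (w := 0) h0 h1 X1.1 X1.2 s s0 s1 rfl (hs'.trans_lt (hlt s0')) (Or.inr h)
    · exact key (w := 0) h0 h1 Y2.1 Y2.2 s' s0' s1' rfl (hs.trans_lt (hlt s0)) (Or.inl h)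
    · exact key (w := 0) h0 h1 Y2.1 Y2.2 s' s0' s1' rfl (hs.trans_lt (hlt s0)) (Or.inr h)
  · exfalso
    rw [e] at hx
    replace hy := hy.trans e'
    have hs1 := hs.trans_lt (hlt s0)
    rw [hy, abs_lt] at hs1
    rw [← hx] at b1 b2
    have n1 : (c'.tl : ℝ) < n := by linarith
    have n2 : (n : ℝ) < c'.hd := by linarith
    norm_cast at n1 n2
    rcases hb1 n hn n1 n2 with ⟨k1, k2⟩ | ⟨k1, k2⟩
    · have k1 : (c'.rt : ℝ) ≤ c.lf := by exact_mod_cast k1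
      have k2 : (c'.rt : ℝ) ≤ L n := by exact_mod_cast k2
      nlinarith
    · have k1 : (c.rt : ℝ) ≤ c'.lf := by exact_mod_cast k1
      have k2 : (L n : ℝ) + 1 ≤ c'.lf := by exact_mod_cast k2
      nlinarith
  · exfalso
    rw [e] at hx
    replace hy := hy.trans e'
    have hs1 := hs'.trans_lt (hlt s0')
    rw [← hx, abs_lt] at hs1
    rw [hy] at a1 a2
    have n1 : (c.lf : ℝ) < m := by linarith
    have n2 : (m : ℝ) < c.rt := by linarith
    norm_cast at n1 n2
    rcases hb2 m hm n1 n2 with ⟨k1, k2⟩ | ⟨k1, k2⟩ <;> simp only [Cell.swap] at k1 k2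
    · have k1 : (c.hd : ℝ) ≤ c'.tl := by exact_mod_cast k1
      have k2 : (c.hd : ℝ) ≤ B m := by exact_mod_cast k2
      nlinarith
    · have k1 : (c'.hd : ℝ) ≤ c.tl := by exact_mod_cast k1
      have k2 : (B m : ℝ) + 1 ≤ c.tl := by exact_mod_cast k2
      nlinarith
  · rw [e] at hx
    replace hy := hy.trans e'
    have hcell : c = c' := by
      rcases hcc with h | h
      · exfalso
        have h2 := h.1
        have i1 : (c.tl : ℝ) < c'.hd := by linarith
        have i2 : (c'.tl : ℝ) < c.hd := by linarith
        have i3 : (c.lf : ℝ) < c'.rt := by linarith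
        have i4 : (c'.lf : ℝ) < c.rt := by linarith
        norm_cast at i1 i2 i3 i4
        unfold Cell.Apart at h2
        omega
      · exact h.1
    subst hcell
    exact ⟨rfl, c.ypos_inj hc.1 hy, (Cell.ypos_inj (c := c.swap) hc.2 hx).symm⟩

/-- The shape of a curve in a cell: vertical, horizontal, or vertical with a turn to the left or
to the right. -/
inductive Shape : Type
  | vert
  | horiz
  | turn (right : Bool)

/-- A curve in a cell. -/
structure Strand where
  cell : Cell
  shape : Shape
  off : ℝ

namespace Strand

/-- The offset of the vertical part. -/
def poff (s : Strand) : ℝ := match s.shape with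
  | .turn true => 1 - s.off
  | _ => s.off

/-- The curve of a strand. -/
def curve (L B : ℤ → ℤ) (ε : ℝ) (s : Strand) (t : ℝ) : ℝ × ℝ := match s.shape with
  | .vert => pc L ε s.cell s.off t
  | .horiz => qc B ε s.cell s.off t
  | .turn false => if t ≤ 1 / 2 then pc L ε s.cell s.off (2 * s.off * t)
      else qc B ε s.cell s.off (2 * s.off * (1 - t))
  | .turn true => if t ≤ 1 / 2 then pc L ε s.cell (1 - s.off) (2 * s.off * t)
      else qc B ε s.cell s.off (1 - 2 * s.off * (1 - t))

/-- The strand has a vertical part. -/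
def HasP (s : Strand) : Prop := s.shape ≠ .horiz

/-- The strand has a horizontal part. -/
def HasQ (s : Strand) : Prop := s.shape ≠ .vert

/-- The strand has one part only. -/
def Straight (s : Strand) : Prop := s.shape = .vert ∨ s.shape = .horiz

/-- The strand stays inside its cell and turns near the end. -/
structure Good (L B : ℤ → ℤ) (ε : ℝ) (s : Strand) : Prop where
  fat : s.cell.Fat
  lo : ε ≤ s.off
  hi : s.off ≤ 1 - ε
  small : ¬ s.Straight → s.off < 1 / 3
  clear : ¬ s.Straight → Cell.Clear L B s.cell s.cell

/-- Strands that meet only when a vertical one and a horizontal one belong to the same cell. -/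
structure Compat (L B : ℤ → ℤ) (s s' : Strand) : Prop where
  pp : s.HasP → s'.HasP → Cell.PP L s.cell s'.cell ∨ (s.cell = s'.cell ∧ s.poff ≠ s'.poff)
  qq : s.HasQ → s'.HasQ → Cell.PP B s.cell.swap s'.cell.swap ∨ (s.cell = s'.cell ∧ s.off ≠ s'.off)
  pq : s.HasP → s'.HasQ → Cell.PQ L B s.cell s'.cell ∨
    (s.cell = s'.cell ∧ Cell.Clear L B s.cell s.cell)
  qp : s.HasQ → s'.HasP → Cell.PQ L B s'.cell s.cell ∨
    (s.cell = s'.cell ∧ Cell.Clear L B s.cell s.cell)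
  turn : s.cell = s'.cell → (¬ s.Straight ∨ ¬ s'.Straight) → s.off ≠ s'.off ∧
    (s.Straight → s'.off < s.off ∧ s.off < 1 - s'.off) ∧
    (s'.Straight → s.off < s'.off ∧ s'.off < 1 - s.off)

lemma curve_part {L B : ℤ → ℤ} {ε : ℝ} (h0 : 0 < ε) {s : Strand} (hs : s.Good L B ε) {t : ℝ}
    (ht : t ∈ Icc (0:ℝ) 1) :
    (s.HasP ∧ ∃ w ∈ Icc (0:ℝ) 1, (t ∈ Ioo (0:ℝ) 1 → w ∈ Ioo (0:ℝ) 1) ∧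
      s.curve L B ε t = pc L ε s.cell s.poff w ∧ (s.Straight → w = t) ∧
      (¬ s.Straight → t ≤ 1 / 2 ∧ w ≤ s.off ∧ w = 2 * s.off * t)) ∨
    (s.HasQ ∧ ∃ w ∈ Icc (0:ℝ) 1, (t ∈ Ioo (0:ℝ) 1 → w ∈ Ioo (0:ℝ) 1) ∧
      s.curve L B ε t = qc B ε s.cell s.off w ∧ (s.Straight → w = t) ∧
      (¬ s.Straight → 1 / 2 < t ∧ ((s.poff = s.off ∧ w < s.off ∧ w = 2 * s.off * (1 - t)) ∨
        (s.poff = 1 - s.off ∧ 1 - s.off < w ∧ w = 1 - 2 * s.off * (1 - t))))) := by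
  obtain ⟨c, sh, o⟩ := s
  have hlo := hs.lo
  have hsm := hs.small
  obtain ⟨t0, t1⟩ := ht
  rcases sh with - | - | - | -
  · exact Or.inl ⟨by simp [HasP], t, ⟨t0, t1⟩, id, rfl, fun _ => rfl, by simp [Straight]⟩
  · exact Or.inr ⟨by simp [HasQ], t, ⟨t0, t1⟩, id, rfl, fun _ => rfl, by simp [Straight]⟩
  all_goals
    have hsm := hsm (by simp [Straight])
    simp only at hsm hlo
    by_cases ht : t ≤ 1 / 2
    · refine Or.inl ⟨by simp [HasP], 2 * o * t, ⟨by nlinarith, by nlinarith⟩,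
        fun h => ⟨by nlinarith [h.1], by nlinarith⟩, by simp only [curve, if_pos ht, poff], by simp [Straight],
        fun _ => ⟨ht, by simp only; nlinarith, rfl⟩⟩
  · refine Or.inr ⟨by simp [HasQ], 2 * o * (1 - t), ⟨by nlinarith, by nlinarith⟩,
      fun h => ⟨by nlinarith [h.2], by nlinarith⟩, by simp only [curve, if_neg ht], by simp [Straight],
      fun _ => ⟨not_le.1 ht, Or.inl ⟨rfl, by simp only; nlinarith, rfl⟩⟩⟩
  · refine Or.inr ⟨by simp [HasQ], 1 - 2 * o * (1 - t), ⟨by nlinarith, by nlinarith⟩,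
      fun h => ⟨by nlinarith, by nlinarith [h.2]⟩, by simp only [curve, if_neg ht], by simp [Straight],
      fun _ => ⟨not_le.1 ht, Or.inr ⟨rfl, by simp only; nlinarith, rfl⟩⟩⟩

lemma Good.poff_mem {L B : ℤ → ℤ} {ε : ℝ} {s : Strand} (hs : s.Good L B ε) :
    s.poff ∈ Icc ε (1 - ε) := by
  have h1 := hs.lo
  have h2 := hs.hi
  obtain ⟨c, sh, o⟩ := s
  rcases sh with - | - | - | - <;> simp only [poff] <;> constructor <;> linarith

lemma curve_meet_pq {L B : ℤ → ℤ} {ε : ℝ} (h0 : 0 < ε) (h1 : ε ≤ 1 / 4) {s s' : Strand}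
    (hs : s.Good L B ε) (hs' : s'.Good L B ε)
    (hcc : Cell.PQ L B s.cell s'.cell ∨ (s.cell = s'.cell ∧ Cell.Clear L B s.cell s.cell))
    (hturn : s.cell = s'.cell → (¬ s.Straight ∨ ¬ s'.Straight) → s.off ≠ s'.off ∧
      (s.Straight → s'.off < s.off ∧ s.off < 1 - s'.off) ∧
      (s'.Straight → s.off < s'.off ∧ s'.off < 1 - s.off)) {w w' : ℝ}
    (hw : w ∈ Icc (0:ℝ) 1) (hw' : w' ∈ Icc (0:ℝ) 1)
    (h : pc L ε s.cell s.poff w = qc B ε s'.cell s'.off w') (h2 : ¬ s.Straight → w ≤ s.off)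
    (h3 : ¬ s'.Straight → (s'.poff = s'.off ∧ w' < s'.off) ∨
      (s'.poff = 1 - s'.off ∧ 1 - s'.off < w')) :
    s.Straight ∧ s'.Straight ∧ s.cell = s'.cell ∧ w = s'.off ∧ w' = s.off := by
  obtain ⟨hc, rfl, rfl⟩ := pc_qc_meet h0 h1 hs.fat hs'.fat hs.poff_mem ⟨hs'.lo, hs'.hi⟩ hcc hw hw' h
  have hp : s.poff = s.off ∨ (¬ s.Straight ∧ s.poff = 1 - s.off) := by
    obtain ⟨c, sh, o⟩ := s
    rcases sh with - | - | - | - <;> simp [poff, Straight]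
  by_cases a1 : s.Straight <;> by_cases a2 : s'.Straight
  · rcases hp with hp | hp
    · exact ⟨a1, a2, hc, rfl, hp⟩
    · exact absurd a1 hp.1
  · exfalso
    have h4 := (hturn hc (Or.inr a2)).2.1 a1
    rcases hp with hp | hp
    · rw [hp] at h3
      rcases h3 a2 with h5 | h5 <;> linarith [h5.2]
    · exact hp.1 a1
  · exfalso
    have h4 := (hturn hc (Or.inl a1)).2.2 a2
    linarith [h2 a1]
  · exfalso
    have h4 := (hturn hc (Or.inl a1)).1
    have h5 := h2 a1
    have h6 := lt_of_le_of_ne h5 h4.symm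
    have h7 := hs.small a1
    have h8 := hs'.small a2
    rcases h3 a2 with h9 | h9 <;> rcases hp with hp | ⟨-, hp⟩ <;> rw [hp] at h9 <;> linarith [h9.2]

/-- The meetings of compatible strands. -/
lemma curve_meet {L B : ℤ → ℤ} {ε : ℝ} (h0 : 0 < ε) (h1 : ε ≤ 1 / 4) {s s' : Strand}
    (hs : s.Good L B ε) (hs' : s'.Good L B ε) (hc : s.Compat L B s') {t t' : ℝ}
    (ht : t ∈ Ioo (0:ℝ) 1) (ht' : t' ∈ Icc (0:ℝ) 1) (h : s.curve L B ε t = s'.curve L B ε t') :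
    s.Straight ∧ s'.Straight ∧ s.shape ≠ s'.shape ∧ s.cell = s'.cell ∧ t = s'.off ∧
      t' = s.off := by
  have i : ∀ {s : Strand}, s.Good L B ε → s.off ∈ Ioo (0:ℝ) 1 := fun hs =>
    ⟨by linarith [hs.lo], by linarith [hs.hi]⟩
  have j : ∀ {s : Strand}, s.Good L B ε → s.poff ∈ Ioo (0:ℝ) 1 := fun hs =>
    ⟨by linarith [hs.poff_mem.1], by linarith [hs.poff_mem.2]⟩
  rcases curve_part h0 hs (Ioo_subset_Icc_self ht) with
    ⟨p, w, hw, hw2, e, h3, h4⟩ | ⟨p, w, hw, hw2, e, h3, h4⟩ <;>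
  rcases curve_part h0 hs' ht' with
    ⟨p', w', hw', hw2', e', h3', h4'⟩ | ⟨p', w', hw', hw2', e', h3', h4'⟩ <;> rw [e, e'] at h
  · exact absurd h (pc_meet h0 h1 hs.fat hs'.fat (j hs) (j hs') (hc.pp p p') (hw2 ht) hw')
  · obtain ⟨a1, a2, a3, a4, a5⟩ := curve_meet_pq h0 h1 hs hs' (hc.pq p p') hc.turn hw hw' h
      (fun n => (h4 n).2.1) (fun n => (h4' n).2.imp (fun h => ⟨h.1, h.2.1⟩) fun h => ⟨h.1, h.2.1⟩)
    refine ⟨a1, a2, ?_, a3, by rw [← h3 a1, a4], by rw [← h3' a2, a5]⟩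
    rcases a1 with a1 | a1 <;> rcases a2 with a2 | a2 <;> simp_all [HasP, HasQ]
  · have hqp : Cell.PQ L B s'.cell s.cell ∨ (s'.cell = s.cell ∧ Cell.Clear L B s'.cell s'.cell) := by
      rcases hc.qp p p' with h | ⟨h, h'⟩
      · exact Or.inl h
      · exact Or.inr ⟨h.symm, h ▸ h'⟩
    obtain ⟨a1, a2, a3, a4, a5⟩ := curve_meet_pq h0 h1 hs' hs hqp
      (fun h n => by
        obtain ⟨b1, b2, b3⟩ := hc.turn h.symm n.symm
        exact ⟨b1.symm, b3, b2⟩) hw' hw h.symm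
      (fun n => (h4' n).2.1) (fun n => (h4 n).2.imp (fun h => ⟨h.1, h.2.1⟩) fun h => ⟨h.1, h.2.1⟩)
    refine ⟨a2, a1, ?_, a3.symm, by rw [← h3 a2, a5], by rw [← h3' a1, a4]⟩
    rcases a1 with a1 | a1 <;> rcases a2 with a2 | a2 <;> simp_all [HasP, HasQ]
  · exact absurd h (qc_meet h0 h1 hs.fat hs'.fat (i hs) (i hs') (hc.qq p p') (hw2 ht) hw')

lemma curve_injOn {L B : ℤ → ℤ} {ε : ℝ} (h0 : 0 < ε) (h1 : ε ≤ 1 / 4) {s : Strand}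
    (hs : s.Good L B ε) : InjOn (s.curve L B ε) (Icc 0 1) := by
  have ho : 0 < s.off := h0.trans_le hs.lo
  have mixed : ∀ t ∈ Icc (0:ℝ) 1, ∀ t' ∈ Icc (0:ℝ) 1, ∀ w ∈ Icc (0:ℝ) 1, ∀ w' ∈ Icc (0:ℝ) 1,
      ¬ s.Straight → pc L ε s.cell s.poff w = qc B ε s.cell s.off w' → 1 / 2 < t' →
      ((s.poff = s.off ∧ w' < s.off ∧ w' = 2 * s.off * (1 - t')) ∨
        (s.poff = 1 - s.off ∧ 1 - s.off < w' ∧ w' = 1 - 2 * s.off * (1 - t'))) → False := by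
    intro t ht t' ht' w hw w' hw' hn h h2 h3
    obtain ⟨-, -, e⟩ := pc_qc_meet h0 h1 hs.fat hs.fat hs.poff_mem ⟨hs.lo, hs.hi⟩
      (Or.inr ⟨rfl, hs.clear hn⟩) hw hw' h
    rcases h3 with ⟨h3, h4, -⟩ | ⟨h3, h4, -⟩ <;> linarith
  have single : s.HasP → s.HasQ → ¬ s.Straight := fun h h' h'' => h''.elim h' h
  intro t ht t' ht' h
  rcases curve_part h0 hs ht with ⟨p, w, hw, hw2, e, h3, h4⟩ | ⟨p, w, hw, hw2, e, h3, h4⟩ <;>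
  rcases curve_part h0 hs ht' with
    ⟨p', w', hw', hw2', e', h3', h4'⟩ | ⟨p', w', hw', hw2', e', h3', h4'⟩ <;> rw [e, e'] at h
  · have := pc_inj hs.fat.1 h
    by_cases hn : s.Straight
    · rw [← h3 hn, ← h3' hn, this]
    · have e1 := (h4 hn).2.2
      rw [this, (h4' hn).2.2] at e1
      exact (mul_left_cancel₀ (by positivity) e1).symm
  · exact (mixed t ht t' ht' w hw w' hw' (single p p') h (h4' (single p p')).1
      (h4' (single p p')).2).elim
  · exact (mixed t' ht' t ht w' hw' w hw (single p' p) h.symm (h4 (single p' p)).1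
      (h4 (single p' p)).2).elim
  · have := qc_inj hs.fat.2 h
    by_cases hn : s.Straight
    · rw [← h3 hn, ← h3' hn, this]
    · have hsm := hs.small hn
      have h5 : 2 * s.off * t = 2 * s.off * t' := by
        rcases (h4 hn).2 with ⟨a1, a2, a3⟩ | ⟨a1, a2, a3⟩ <;>
          rcases (h4' hn).2 with ⟨b1, b2, b3⟩ | ⟨b1, b2, b3⟩ <;> linarith
      exact mul_left_cancel₀ (by positivity) h5

lemma curve_continuous {L B : ℤ → ℤ} {ε : ℝ} (h0 : 0 < ε) {s : Strand}
    (hs : s.Good L B ε) : Continuous (s.curve L B ε) := by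
  obtain ⟨c, sh, o⟩ := s
  have h3 := hs.lo
  have h4 := hs.hi
  rcases sh with - | - | - | -
  · exact continuous_pc _ _ _ _
  · exact continuous_qc _ _ _ _
  · refine Continuous.if_le ((continuous_pc _ _ _ _).comp (by fun_prop))
      ((continuous_qc _ _ _ _).comp (by fun_prop)) continuous_id continuous_const ?_
    rintro t rfl
    change pc L ε c o (2 * o * (1 / 2)) = qc B ε c o (2 * o * (1 - 1 / 2))
    rw [show 2 * o * (1 / 2) = o by ring, show 2 * o * (1 - 1 / 2) = o by ring,
      pc_of_mem L h0 hs.fat.1 o h3 h4, qc_of_mem B h0 hs.fat.2 o h3 h4]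
  · refine Continuous.if_le ((continuous_pc _ _ _ _).comp (by fun_prop))
      ((continuous_qc _ _ _ _).comp (by fun_prop)) continuous_id continuous_const ?_
    rintro t rfl
    change pc L ε c (1 - o) (2 * o * (1 / 2)) = qc B ε c o (1 - 2 * o * (1 - 1 / 2))
    rw [show 2 * o * (1 / 2) = o by ring, show 1 - 2 * o * (1 - 1 / 2) = 1 - o by ring,
      pc_of_mem L h0 hs.fat.1 (1 - o) h3 h4,
      qc_of_mem B h0 hs.fat.2 o (by simp only at h4; linarith) (by simp only at h3; linarith)]

/-- The first point of a strand. -/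
lemma curve_zero (L B : ℤ → ℤ) {ε : ℝ} (h0 : 0 < ε) (h1 : ε ≤ 1 / 4) {s : Strand}
    (hs : s.cell.Fat) : s.curve L B ε 0 = match s.shape with
      | .horiz => ((s.cell.lf : ℝ), (B s.cell.lf + 1 / 2 : ℝ))
      | _ => ((L s.cell.tl + 1 / 2 : ℝ), (s.cell.tl : ℝ)) := by
  obtain ⟨c, sh, o⟩ := s
  rcases sh with - | - | - | - <;> simp only [curve]
  · exact pc_zero L h0 h1 hs.1 o
  · rw [qc, pc_zero B h0 h1 (c := c.swap) hs.2 o]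
    rfl
  · rw [if_pos (by norm_num), mul_zero]
    exact pc_zero L h0 h1 hs.1 o
  · rw [if_pos (by norm_num), mul_zero]
    exact pc_zero L h0 h1 hs.1 _

/-- The last point of a strand. -/
lemma curve_one (L B : ℤ → ℤ) {ε : ℝ} (h0 : 0 < ε) (h1 : ε ≤ 1 / 4) {s : Strand}
    (hs : s.cell.Fat) : s.curve L B ε 1 = match s.shape with
      | .vert => ((L s.cell.hd + 1 / 2 : ℝ), (s.cell.hd : ℝ))
      | .turn false => ((s.cell.lf : ℝ), (B s.cell.lf + 1 / 2 : ℝ))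
      | _ => ((s.cell.rt : ℝ), (B s.cell.rt + 1 / 2 : ℝ)) := by
  obtain ⟨c, sh, o⟩ := s
  rcases sh with - | - | - | - <;> simp only [curve]
  · exact pc_one L h0 h1 hs.1 o
  · rw [qc, pc_one B h0 h1 (c := c.swap) hs.2 o]
    rfl
  · rw [if_neg (by norm_num), sub_self, mul_zero, qc, pc_zero B h0 h1 (c := c.swap) hs.2 o]
    rfl
  · rw [if_neg (by norm_num), sub_self, mul_zero, sub_zero, qc, pc_one B h0 h1 (c := c.swap) hs.2 o]
    rfl

end Strand

/-- A family of curves that meet in an orderly way is a net, after adding isolated vertices. -/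
lemma PathSystem.exists_net {B J I : Type} [Finite B] [Finite J] [Finite I]
    (S : PathSystem (B ⊕ J) I) (pos : B → ℝ × ℝ) (hpos : Function.Injective pos)
    (curve : I → ℝ → ℝ × ℝ) (hcont : ∀ i, ContinuousOn (curve i) (Icc 0 1))
    (hinj : ∀ i, InjOn (curve i) (Icc 0 1))
    (hstart : ∀ i, ∃ b, S.src i = Sum.inl b ∧ curve i 0 = pos b)
    (hfinish : ∀ i, ∃ b, S.tgt i = Sum.inl b ∧ curve i 1 = pos b) (colour : I → Bool)
    (hmeet : ∀ i j, i ≠ j → ∀ t ∈ Ioo (0:ℝ) 1, ∀ t' ∈ Icc (0:ℝ) 1, curve i t = curve j t' →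
      t' ∈ Ioo (0:ℝ) 1 ∧ colour i ≠ colour j ∧ ∀ m : ℕ, t * S.len i ≠ m)
    (hunique : ∀ i j, i ≠ j → ∀ t ∈ Ioo (0:ℝ) 1, ∀ t' ∈ Ioo (0:ℝ) 1, ∀ x ∈ Ioo (0:ℝ) 1,
      ∀ x' ∈ Ioo (0:ℝ) 1, curve i t = curve j t' → curve i x = curve j x' → t = x)
    (hcover : ∀ b, ∃ i, ∃ e : ℝ, (e = 0 ∨ e = 1) ∧ curve i e = pos b) :
    ∃ Γ : S.Net, Γ.curve = curve := by
  obtain ⟨pos', h1, h2, h3⟩ := exists_extend_pos (J := J) curve hcont pos hpos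
  refine ⟨⟨pos', h1, curve, hcont, hinj, fun i => ?_, fun i => ?_, ?_, colour,
    fun i j h t ht t' ht' e => (hmeet i j h t ht t' (Ioo_subset_Icc_self ht') e).2.1, hunique,
    fun i j h t ht t' ht' e => (hmeet i j h t ht t' (Ioo_subset_Icc_self ht') e).2.2⟩, rfl⟩
  · obtain ⟨b, hb, e⟩ := hstart i
    rw [hb, h2, e]
  · obtain ⟨b, hb, e⟩ := hfinish i
    rw [hb, h2, e]
  · rintro i t ht (b | j) e
    · obtain ⟨j, s, hs, hb⟩ := hcover b
      rw [h2, ← hb] at e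
      have hs' : s ∈ Icc (0:ℝ) 1 := by rcases hs with rfl | rfl <;> norm_num
      have hs'' : s ∉ Ioo (0:ℝ) 1 := by rcases hs with rfl | rfl <;> norm_num
      by_cases hij : i = j
      · subst hij
        exact hs'' (hinj i (Ioo_subset_Icc_self ht) hs' e ▸ ht)
      · exact hs'' (hmeet i j hij t ht s hs' e).1
    · exact h3 i t (Ioo_subset_Icc_self ht) j e

namespace PathIdx

variable {ρ : Type} {K : ℕ}

/-- The shape of the curve of a path. -/
def shape : PathIdx ρ K → Shape
  | primal _ _ => .vert
  | dual _ _ => .horiz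
  | link c _ => .turn c
  | spoke c => .turn c

/-- The offset of the curve of a path in its cell. -/
def off : PathIdx ρ K → ℝ
  | primal _ i => (i + 1 / 3) / K
  | dual _ i => (i + 1 / 3) / K
  | link c i => (2 * i + c.toNat + 1) / (12 * K ^ 2)
  | spoke c => (c.toNat + 1) / (12 * K ^ 2)

/-- The width of the strip where the curves are not straight. -/
def width (K : ℕ) : ℝ := 1 / (24 * K ^ 2)

lemma width_pos (hK : 1 ≤ K) : 0 < width K := by
  have : (0:ℝ) < K := by exact_mod_cast hK
  unfold width
  positivity

lemma width_le (hK : 1 ≤ K) : width K ≤ 1 / 24 := by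
  have : (1:ℝ) ≤ K := by exact_mod_cast hK
  unfold width
  rw [div_le_div_iff₀ (by positivity) (by norm_num)]
  nlinarith

lemma off_straight (i : Fin K) : 1 / (3 * K) ≤ ((i : ℝ) + 1 / 3) / K ∧
    ((i : ℝ) + 1 / 3) / K ≤ 1 - 2 / (3 * K) := by
  have hK : (0:ℝ) < K := by exact_mod_cast i.pos
  have hi : (i : ℝ) + 1 ≤ K := by exact_mod_cast i.2
  have hi' : (0 : ℝ) ≤ i := Nat.cast_nonneg _
  constructor
  · rw [div_le_div_iff₀ (by positivity) hK]
    nlinarith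
  · rw [div_le_iff₀ hK, sub_mul]
    have : 2 / (3 * (K:ℝ)) * K = 2 / 3 := by field_simp
    rw [this]
    linarith

lemma off_turn (hK : 1 ≤ K) {n : ℕ} (h1 : 1 ≤ n) (h2 : n ≤ 2 * K) :
    2 * width K ≤ (n : ℝ) / (12 * K ^ 2) ∧ (n : ℝ) / (12 * K ^ 2) ≤ 1 / (6 * K) := by
  have hK : (0:ℝ) < K := by exact_mod_cast hK
  have h1 : (1:ℝ) ≤ n := by exact_mod_cast h1
  have h2 : (n : ℝ) ≤ 2 * K := by exact_mod_cast h2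
  unfold width
  constructor
  · rw [mul_one_div, div_le_div_iff₀ (by positivity) (by positivity)]
    nlinarith [pow_pos hK 2]
  · rw [div_le_div_iff₀ (by positivity) (by positivity)]
    nlinarith [pow_pos hK 2]

lemma link_num (c : Bool) (i : Fin K) : 1 ≤ 2 * (i : ℕ) + c.toNat + 1 ∧
    2 * (i : ℕ) + c.toNat + 1 ≤ 2 * K := by
  have := i.2
  cases c <;> simp only [Bool.toNat_true, Bool.toNat_false] <;> omega

lemma spoke_num (hK : 1 ≤ K) (c : Bool) : 1 ≤ c.toNat + 1 ∧ c.toNat + 1 ≤ 2 * K := by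
  cases c <;> simp only [Bool.toNat_true, Bool.toNat_false] <;> omega

lemma off_link (c : Bool) (i : Fin K) :
    (link c i : PathIdx ρ K).off = ((2 * (i : ℕ) + c.toNat + 1 : ℕ) : ℝ) / (12 * K ^ 2) := by
  simp [off]

lemma off_spoke (c : Bool) :
    (spoke c : PathIdx ρ K).off = ((c.toNat + 1 : ℕ) : ℝ) / (12 * K ^ 2) := by
  simp [off]

/-- The strand of a path in a given cell. -/
def strand (cell : PathIdx ρ K → Cell) (i : PathIdx ρ K) : Strand := ⟨cell i, i.shape, i.off⟩

lemma off_bounds (hK : 1 ≤ K) (i : PathIdx ρ K) :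
    (((i.shape = .vert ∨ i.shape = .horiz) ∧ 1 / (3 * K) ≤ i.off ∧ i.off ≤ 1 - 2 / (3 * K)) ∨
      (∃ c, i.shape = .turn c) ∧ 2 * width K ≤ i.off ∧ i.off ≤ 1 / (6 * K)) := by
  rcases i with ⟨r, i⟩ | ⟨r, i⟩ | ⟨c, i⟩ | c
  · exact Or.inl ⟨Or.inl rfl, off_straight i⟩
  · exact Or.inl ⟨Or.inr rfl, off_straight i⟩
  · rw [off_link]
    exact Or.inr ⟨⟨c, rfl⟩, off_turn hK (link_num c i).1 (link_num c i).2⟩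
  · rw [off_spoke]
    exact Or.inr ⟨⟨c, rfl⟩, off_turn hK (spoke_num hK c).1 (spoke_num hK c).2⟩

lemma strand_good {L B : ℤ → ℤ} (hK : 1 ≤ K) {cell : PathIdx ρ K → Cell} {i : PathIdx ρ K}
    (hf : (cell i).Fat) (hc : (∃ c, i.shape = .turn c) → Cell.Clear L B (cell i) (cell i)) :
    (strand cell i).Good L B (width K) := by
  have hK' : (1:ℝ) ≤ K := by exact_mod_cast hK
  have hw : width K ≤ 1 / (6 * K) := by
    have := off_turn hK (n := 1) le_rfl (by omega)
    have h0 := width_pos hK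
    linarith
  have h6 : 1 / (6 * (K:ℝ)) ≤ 1 / 6 := by
    rw [div_le_div_iff₀ (by positivity) (by norm_num)]
    linarith
  have h3 : 1 / (3 * (K:ℝ)) = 2 * (1 / (6 * K)) := by field_simp; norm_num
  have h23 : 2 / (3 * (K:ℝ)) = 4 * (1 / (6 * K)) := by field_simp; norm_num
  have hp : 0 < 1 / (6 * (K:ℝ)) := by positivity
  rcases off_bounds hK i with ⟨h, h1, h2⟩ | ⟨⟨c, h⟩, h1, h2⟩
  · rw [h3] at h1
    rw [h23] at h2
    exact ⟨hf, show width K ≤ i.off by linarith, show i.off ≤ _ by linarith, fun hn => (hn h).elim,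
      fun hn => (hn h).elim⟩
  · have h0 := width_pos hK
    exact ⟨hf, show width K ≤ i.off by linarith, show i.off ≤ _ by linarith,
      fun _ => show i.off < _ by linarith, fun _ => hc ⟨c, h⟩⟩

/-- Paths in one cell are compatible. -/
lemma strand_compat {L B : ℤ → ℤ} (hK : 1 ≤ K) {cell : PathIdx ρ K → Cell} {i j : PathIdx ρ K}
    (hij : i ≠ j) (he : cell i = cell j) (hp : ∀ r x r' y, i = primal r x → j = primal r' y → r = r')
    (hd : ∀ r x r' y, i = dual r x → j = dual r' y → r = r')
    (h1 : ∀ c x c', i = link c x → j ≠ spoke c') (h2 : ∀ c x c', j = link c x → i ≠ spoke c')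
    (hc : (i.shape ≠ .vert ∨ j.shape ≠ .vert) → (i.shape ≠ .horiz ∨ j.shape ≠ .horiz) →
      Cell.Clear L B (cell i) (cell i)) :
    (strand cell i).Compat L B (strand cell j) := by
  have hK' : (1:ℝ) ≤ K := by exact_mod_cast hK
  have h6 : 1 / (6 * (K:ℝ)) ≤ 1 / 6 := by
    rw [div_le_div_iff₀ (by positivity) (by norm_num)]
    linarith
  have h3 : 1 / (3 * (K:ℝ)) = 2 * (1 / (6 * K)) := by field_simp; norm_num
  have h23 : 2 / (3 * (K:ℝ)) = 4 * (1 / (6 * K)) := by field_simp; norm_num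
  have hpos : 0 < 1 / (6 * (K:ℝ)) := by positivity
  have hb := off_bounds hK i
  have hb' := off_bounds hK j
  rw [h3, h23] at hb hb'
  have hns : ∀ i : PathIdx ρ K, ¬ (strand cell i).Straight ↔ ∃ c, i.shape = .turn c := by
    intro i
    unfold Strand.Straight strand
    rcases i.shape with - | - | c <;> simp
  have noturn : ∀ i : PathIdx ρ K, (i.shape = .vert ∨ i.shape = .horiz) →
      ¬ ∃ c, i.shape = .turn c := by
    rintro i (h | h) ⟨c, h'⟩ <;> rw [h] at h' <;> cases h'
  have offne : (i.shape = j.shape ∨ (∃ c, i.shape = .turn c) ∨ ∃ c, j.shape = .turn c) →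
      i.off ≠ j.off := by
    intro h
    rcases hb with ⟨s1, b1, b2⟩ | ⟨s1, b1, b2⟩ <;> rcases hb' with ⟨s2, b3, b4⟩ | ⟨s2, b3, b4⟩
    · have hsh : i.shape = j.shape := by
        rcases h with h | h | h
        · exact h
        · exact (noturn i s1 h).elim
        · exact (noturn j s2 h).elim
      intro ho
      have hK0 : (K:ℝ) ≠ 0 := by positivity
      rcases i with ⟨r, x⟩ | ⟨r, x⟩ | ⟨c, x⟩ | c <;> rcases j with ⟨r', y⟩ | ⟨r', y⟩ | ⟨c', y⟩ | c' <;>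
        simp only [shape, reduceCtorEq, or_self] at hsh s1 s2 <;> simp only [off] at ho <;>
        rw [div_left_inj' hK0, add_left_inj] at ho
      · obtain rfl := hp _ _ _ _ rfl rfl
        exact hij (by rw [Fin.ext (by exact_mod_cast ho : (x:ℕ) = y)])
      · obtain rfl := hd _ _ _ _ rfl rfl
        exact hij (by rw [Fin.ext (by exact_mod_cast ho : (x:ℕ) = y)])
    · exact fun ho => by linarith
    · exact fun ho => by linarith
    · intro ho
      have hK0 : (12 * (K:ℝ) ^ 2) ≠ 0 := by positivity
      rcases i with ⟨r, x⟩ | ⟨r, x⟩ | ⟨c, x⟩ | c <;> rcases j with ⟨r', y⟩ | ⟨r', y⟩ | ⟨c', y⟩ | c' <;>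
        simp only [shape, reduceCtorEq, exists_false] at s1 s2 
      · rw [off_link, off_link, div_left_inj' hK0, Nat.cast_inj] at ho
        have : c = c' ∧ x = y := by
          rw [Fin.ext_iff]
          cases c <;> cases c' <;> simp at ho ⊢ <;> omega
        exact hij (by rw [this.1, this.2])
      · exact h1 _ _ _ rfl rfl
      · exact h2 _ _ _ rfl rfl
      · rw [off_spoke, off_spoke, div_left_inj' hK0, Nat.cast_inj] at ho
        have : c = c' := by cases c <;> cases c' <;> simp at ho ⊢
        exact hij (by rw [this])
  have poff : ∀ i : PathIdx ρ K, (strand cell i).poff = i.off ∨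
      (i.shape = .turn true ∧ (strand cell i).poff = 1 - i.off) := by
    intro i
    unfold Strand.poff strand
    rcases i.shape with - | - | - | - <;> simp
  have key : ∀ {i j : PathIdx ρ K}, ((i.shape = .vert ∨ i.shape = .horiz) ∧
      2 * (1 / (6 * (K:ℝ))) ≤ i.off ∧ i.off ≤ 1 - 4 * (1 / (6 * K)) ∨
      (∃ c, i.shape = .turn c) ∧ 2 * width K ≤ i.off ∧ i.off ≤ 1 / (6 * K)) →
      ((j.shape = .vert ∨ j.shape = .horiz) ∧
      2 * (1 / (6 * (K:ℝ))) ≤ j.off ∧ j.off ≤ 1 - 4 * (1 / (6 * K)) ∨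
      (∃ c, j.shape = .turn c) ∧ 2 * width K ≤ j.off ∧ j.off ≤ 1 / (6 * K)) →
      (¬ (strand cell i).Straight ∨ ¬ (strand cell j).Straight) → (strand cell i).Straight →
      j.off < i.off ∧ i.off < 1 - j.off := by
    intro i j hb hb' h h'
    have hj := (hns j).1 (h.resolve_left (not_not.2 h'))
    have hi := fun h => (hns i).2 h h'
    rcases hb with ⟨s1, b1, b2⟩ | ⟨s1, b1, b2⟩
    · rcases hb' with ⟨s2, b3, b4⟩ | ⟨s2, b3, b4⟩
      · exact (noturn j s2 hj).elim
      · constructor <;> linarith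
    · exact (hi s1).elim
  refine ⟨fun hP hP' => Or.inr ⟨he, ?_⟩, fun hQ hQ' => Or.inr ⟨he, offne ?_⟩,
    fun hP hQ => Or.inr ⟨he, hc (Or.inr hQ) (Or.inl hP)⟩,
    fun hP hQ => Or.inr ⟨he, hc (Or.inl hP) (Or.inr hQ)⟩,
    fun _ h => ⟨offne (Or.inr (h.imp (hns i).1 (hns j).1)), key hb hb' h, key hb' hb h.symm⟩⟩
  · have hne : i.off ≠ j.off := by
      refine offne ?_
      change i.shape ≠ _ at hP
      change j.shape ≠ _ at hP'
      revert hP hP'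
      rcases i.shape with - | - | - <;> rcases j.shape with - | - | - <;> simp
    rcases poff i with e | ⟨t1, e⟩ <;> rcases poff j with e' | ⟨t2, e'⟩ <;> rw [e, e']
    · exact hne
    · rcases hb' with ⟨s2, b3, b4⟩ | ⟨s2, b3, b4⟩
      · exact (noturn j s2 ⟨_, t2⟩).elim
      · rcases hb with ⟨s1, b1, b2⟩ | ⟨s1, b1, b2⟩ <;> intro h <;> linarith
    · rcases hb with ⟨s2, b3, b4⟩ | ⟨s2, b3, b4⟩
      · exact (noturn i s2 ⟨_, t1⟩).elim
      · rcases hb' with ⟨s1, b1, b2⟩ | ⟨s1, b1, b2⟩ <;> intro h <;> linarith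
    · exact fun h => hne (by linarith)
  · change i.shape ≠ _ at hQ
    change j.shape ≠ _ at hQ'
    revert hQ hQ'
    rcases i.shape with - | - | - <;> rcases j.shape with - | - | - <;> simp

end PathIdx

/-- A tiling of a rectangle by cells such that the vertical curves draw a map with outer edge `e₀`
and the horizontal curves draw its dual. -/
structure Layout (ρ : Type) where
  cell : ρ → Cell
  e₀ : ρ
  H : ℤ
  W : ℤ
  fz : ℤ
  fu : ℤ
  L : ℤ → ℤ
  B : ℤ → ℤ
  link : Bool → ρ
  spoke : Bool → ρ
  three_le : 3 ≤ H
  fz_pos : 0 < fz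
  fz_lt_fu : fz < fu
  fu_lt : fu < W
  cell_e₀ : cell e₀ = ⟨0, H, 0, W⟩
  fat : ∀ r, (cell r).Fat
  tl_nonneg : ∀ r, 0 ≤ (cell r).tl
  hd_le : ∀ r, (cell r).hd ≤ H
  lf_nonneg : ∀ r, 0 ≤ (cell r).lf
  rt_le : ∀ r, (cell r).rt ≤ W
  L_mem : ∀ v, 0 ≤ v → v ≤ H → 0 ≤ L v ∧ L v < W
  B_mem : ∀ f, 0 ≤ f → f ≤ W → 0 ≤ B f ∧ B f < H
  pp : ∀ r r', r ≠ e₀ → r' ≠ e₀ → r ≠ r' → Cell.PP L (cell r) (cell r')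
  qq : ∀ r r', r ≠ e₀ → r' ≠ e₀ → r ≠ r' → Cell.PP B (cell r).swap (cell r').swap
  pq : ∀ r r', r ≠ e₀ → r' ≠ e₀ → r ≠ r' → Cell.PQ L B (cell r) (cell r')
  clear : ∀ r, r ≠ e₀ → Cell.Clear L B (cell r) (cell r)
  exists_tl : ∀ v, 0 ≤ v → v ≤ H → ∃ r, r ≠ e₀ ∧ (cell r).End v
  exists_lf : ∀ f, 0 ≤ f → f ≤ W → ∃ r, r ≠ e₀ ∧ (cell r).swap.End f
  link_ne : ∀ c, link c ≠ e₀
  spoke_ne : ∀ c, spoke c ≠ e₀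
  link_ne_spoke : ∀ c c', link c ≠ spoke c'
  link_tl : ∀ c, (cell (link c)).tl = 1
  link_lf : (cell (link false)).lf = 0
  link_rt : (cell (link true)).rt = fz
  spoke_tl : ∀ c, (cell (spoke c)).tl = 2
  spoke_lf : (cell (spoke false)).lf = fu
  spoke_rt : (cell (spoke true)).rt = W
  right_of_one : ∀ r, r ≠ e₀ → (cell r).tl < 1 → 1 < (cell r).hd → L 1 < (cell r).lf
  left_of_two : ∀ r, r ≠ e₀ → (cell r).tl < 2 → 2 < (cell r).hd → (cell r).rt ≤ L 2
  above : ∀ r, r ≠ e₀ → ∀ f, f = fz ∨ f = fu → (cell r).lf < f → f < (cell r).rt → B f < (cell r).tl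
  primal_inj : ∀ r r', (cell r).tl = (cell r').tl → (cell r).hd = (cell r').hd → r = r'
  dual_inj : ∀ r r', (cell r).lf = (cell r').lf → (cell r).rt = (cell r').rt → r = r'

namespace Layout

variable {ρ : Type} (Λ : Layout ρ)

/-- The vertices and faces of a layout. -/
abbrev Pt : Type := Icc (0:ℤ) Λ.H ⊕ Icc (0:ℤ) Λ.W

/-- The vertex of a given height. -/
def vert (v : ℤ) (h0 : 0 ≤ v) (h1 : v ≤ Λ.H) : Λ.Pt := Sum.inl ⟨v, h0, h1⟩

/-- The face with a given number. -/
def face (f : ℤ) (h0 : 0 ≤ f) (h1 : f ≤ Λ.W) : Λ.Pt := Sum.inr ⟨f, h0, h1⟩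

lemma vert_inj {Λ : Layout ρ} {v v' : ℤ} {h0 h1 h0' h1'} : Λ.vert v h0 h1 = Λ.vert v' h0' h1' ↔ v = v' :=
  ⟨fun h => congrArg Subtype.val (Sum.inl_injective h), by rintro rfl; rfl⟩

lemma face_inj {Λ : Layout ρ} {v v' : ℤ} {h0 h1 h0' h1'} : Λ.face v h0 h1 = Λ.face v' h0' h1' ↔ v = v' :=
  ⟨fun h => congrArg Subtype.val (Sum.inr_injective h), by rintro rfl; rfl⟩

lemma tl_le (r : ρ) : (Λ.cell r).tl ≤ Λ.H := (Λ.fat r).1.le.trans (Λ.hd_le r)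
lemma hd_nonneg (r : ρ) : 0 ≤ (Λ.cell r).hd := (Λ.tl_nonneg r).trans (Λ.fat r).1.le
lemma lf_le (r : ρ) : (Λ.cell r).lf ≤ Λ.W := (Λ.fat r).2.le.trans (Λ.rt_le r)
lemma rt_nonneg (r : ρ) : 0 ≤ (Λ.cell r).rt := (Λ.lf_nonneg r).trans (Λ.fat r).2.le

/-- The face at the end of a link. -/
def linkFace : Bool → Λ.Pt
  | false => Λ.face 0 le_rfl (by linarith [Λ.fz_pos, Λ.fz_lt_fu, Λ.fu_lt])
  | true => Λ.face Λ.fz Λ.fz_pos.le (Λ.fz_lt_fu.trans Λ.fu_lt).le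

/-- The face at the end of a spoke. -/
def spokeFace : Bool → Λ.Pt
  | false => Λ.face Λ.fu (Λ.fz_pos.trans Λ.fz_lt_fu).le Λ.fu_lt.le
  | true => Λ.face Λ.W (by linarith [Λ.fz_pos, Λ.fz_lt_fu, Λ.fu_lt]) le_rfl

/-- The frame of a layout, with additional isolated vertices. -/
def frame (J : Type) : Frame (Λ.Pt ⊕ J) ρ where
  tl r := .inl (Λ.vert (Λ.cell r).tl (Λ.tl_nonneg r) (Λ.tl_le r))
  hd r := .inl (Λ.vert (Λ.cell r).hd (Λ.hd_nonneg r) (Λ.hd_le r))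
  lf r := .inl (Λ.face (Λ.cell r).lf (Λ.lf_nonneg r) (Λ.lf_le r))
  rt r := .inl (Λ.face (Λ.cell r).rt (Λ.rt_nonneg r) (Λ.rt_le r))
  z := .inl (Λ.vert 1 (by norm_num) (by linarith [Λ.three_le]))
  u := .inl (Λ.vert 2 (by norm_num) (by linarith [Λ.three_le]))
  linkEnd c := .inl (Λ.linkFace c)
  spokeEnd c := .inl (Λ.spokeFace c)
  face b := ∃ f, b = .inl (.inr f)
  not_face_tl r := by simp [vert]
  not_face_hd r := by simp [vert]
  face_lf r := ⟨_, rfl⟩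
  face_rt r := ⟨_, rfl⟩
  not_face_z := by simp [vert]
  not_face_u := by simp [vert]
  face_linkEnd c := by cases c <;> exact ⟨_, rfl⟩
  face_spokeEnd c := by cases c <;> exact ⟨_, rfl⟩
  z_ne_u h := by simpa using vert_inj.1 (Sum.inl_injective h)
  tl_ne_hd r h := (Λ.fat r).1.ne (vert_inj.1 (Sum.inl_injective h))
  lf_ne_rt r h := (Λ.fat r).2.ne (face_inj.1 (Sum.inl_injective h))
  primal_simple r r' h := by
    simp only [Sym2.eq_iff, Sum.inl.injEq, vert_inj] at h
    have h1 := (Λ.fat r).1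
    have h2 := (Λ.fat r').1
    rcases h with h | h
    · exact Λ.primal_inj _ _ h.1 h.2
    · omega
  dual_simple r r' h := by
    simp only [Sym2.eq_iff, Sum.inl.injEq, face_inj] at h
    have h1 := (Λ.fat r).2
    have h2 := (Λ.fat r').2
    rcases h with h | h
    · exact Λ.dual_inj _ _ h.1 h.2
    · omega
  linkEnd_inj c c' h := by
    have := Λ.fz_pos
    cases c <;> cases c' <;> simp [linkFace, face_inj] at h ⊢ <;> omega
  spokeEnd_inj c c' h := by
    have := Λ.fu_lt
    cases c <;> cases c' <;> simp [spokeFace, face_inj] at h ⊢ <;> omega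

end Layout

namespace PathIdx

variable {ρ : Type} {K : ℕ}

/-- Two straight strands of one cell meet away from the vertices of their paths. -/
lemma off_mul_ne {k : ℕ} (hk : 1 ≤ k) (hK : K = k * k) {i : PathIdx ρ K}
    (hi : i.shape = .vert ∨ i.shape = .horiz) (m : ℕ) : i.off * k ≠ m := by
  have key : ∀ x : Fin K, ((x:ℝ) + 1 / 3) / K * k ≠ m := by
    intro x h
    have hk' : (k:ℝ) ≠ 0 := by positivity
    have hKR : (K:ℝ) = k * k := by exact_mod_cast hK
    rw [hKR] at h
    field_simp at h
    have h2 : 3 * (x:ℕ) + 1 = 3 * (k * m) := by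
      have : (3 * (x:ℝ) + 1) = 3 * (k * m) := by linarith
      exact_mod_cast this
    omega
  rcases i with ⟨r, x⟩ | ⟨r, x⟩ | ⟨c, x⟩ | c <;> simp only [shape, reduceCtorEq, or_self] at hi
  · exact key x
  · exact key x

/-- At most `k` offsets lie in one segment. -/
lemma exists_offs {k : ℕ} (hk : 1 ≤ k) (hK : K = k * k) (m : ℕ) : ∃ T : Finset ℝ, T.card ≤ k ∧
    ∀ i : PathIdx ρ K, (i.shape = .vert ∨ i.shape = .horiz) → (m:ℝ) < i.off * k →
      i.off * k < m + 1 → i.off ∈ T := by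
  classical
  refine ⟨(Finset.range k).image fun x => (((m * k + x : ℕ) : ℝ) + 1 / 3) / K,
    Finset.card_image_le.trans (by simp), ?_⟩
  have key : ∀ x : Fin K, (m:ℝ) < ((x:ℝ) + 1 / 3) / K * k → ((x:ℝ) + 1 / 3) / K * k < m + 1 →
      ((x:ℝ) + 1 / 3) / K ∈ (Finset.range k).image fun x => (((m * k + x : ℕ) : ℝ) + 1 / 3) / K := by
    intro x h1 h2
    have hk0 : (0:ℝ) < k := by exact_mod_cast hk
    have hKR : (K:ℝ) = k * k := by exact_mod_cast hK
    have e : ((x:ℝ) + 1 / 3) / K * k = ((x:ℝ) + 1 / 3) / k := by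
      rw [hKR]
      field_simp
    rw [e] at h1 h2
    rw [lt_div_iff₀ hk0] at h1
    rw [div_lt_iff₀ hk0] at h2
    have h3 : m * k < (x:ℕ) + 1 := by
      have : (m:ℝ) * k < (x:ℕ) + 1 := by linarith
      exact_mod_cast this
    have h4 : (x:ℕ) < m * k + k := by
      have : ((x:ℕ):ℝ) < m * k + k := by linarith
      exact_mod_cast this
    refine Finset.mem_image.2 ⟨x - m * k, Finset.mem_range.2 (by omega), ?_⟩
    rw [show m * k + ((x:ℕ) - m * k) = x by omega]
  intro i hi h1 h2
  rcases i with ⟨r, x⟩ | ⟨r, x⟩ | ⟨c, x⟩ | c <;> simp only [shape, reduceCtorEq, or_self] at hi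
  · exact key x h1 h2
  · exact key x h1 h2

end PathIdx

/-- The inversion in the unit sphere. -/
def invert (q : ℝ × ℝ) : ℝ × ℝ := (‖q‖ ^ 2)⁻¹ • q

lemma norm_invert (q : ℝ × ℝ) : ‖invert q‖ = ‖q‖⁻¹ := by
  rw [invert, norm_smul, norm_inv, norm_pow, norm_norm]
  rcases eq_or_ne ‖q‖ 0 with h | h
  · simp [h]
  · field_simp

lemma invert_invert (q : ℝ × ℝ) : invert (invert q) = q := by
  rcases eq_or_ne ‖q‖ 0 with h | h
  · simp [invert, norm_eq_zero.1 h]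
  · rw [invert, norm_invert, invert, smul_smul]
    rw [show ((‖q‖⁻¹ ^ 2)⁻¹ * (‖q‖ ^ 2)⁻¹ : ℝ) = 1 by field_simp, one_smul]

lemma invert_of_norm {q : ℝ × ℝ} (h : ‖q‖ = 1) : invert q = q := by simp [invert, h]

lemma continuousOn_invert : ContinuousOn invert {0}ᶜ := by
  have : ∀ q ∈ ({0}ᶜ : Set (ℝ × ℝ)), ‖q‖ ^ 2 ≠ 0 := fun q hq => by
    have := norm_ne_zero_iff.2 hq
    positivity
  unfold invert
  fun_prop (disch := assumption)

lemma pc_fst_mem {L : ℤ → ℤ} {ε : ℝ} (h0 : 0 < ε) (h1 : ε ≤ 1 / 4) {c : Cell} (hc : c.Fat)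
    {o : ℝ} (ho : o ∈ Ioo (0:ℝ) 1) {t : ℝ} (ht : t ∈ Icc (0:ℝ) 1) {W : ℤ} (h2 : 0 ≤ c.lf)
    (h3 : c.rt ≤ W) (h4 : ∀ v, c.End v → 0 ≤ L v ∧ L v < W) :
    (pc L ε c o t).1 ∈ Ioo (0:ℝ) W := by
  have hx : c.xpos o ∈ Ioo (c.lf : ℝ) c.rt := Cell.ypos_mem_Ioo (c := c.swap) hc.2 ho
  have h2 : (0:ℝ) ≤ c.lf := by exact_mod_cast h2
  have h3 : (c.rt : ℝ) ≤ W := by exact_mod_cast h3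
  have hx0 : 0 < c.xpos o := h2.trans_lt hx.1
  have hx1 : c.xpos o < W := hx.2.trans_le h3
  rcases bend_cases h0 h1 L hc.1 (c.xpos o) (c.ypos_mem hc.1 ht) with
    ⟨n, hn, s, hs, hs1, -, e⟩ | ⟨-, -, e⟩ <;> simp only [pc] <;> rw [e]
  · obtain ⟨a1, a2⟩ := h4 n hn
    have a1 : (0:ℝ) ≤ L n := by exact_mod_cast a1
    have a2 : (L n : ℝ) + 1 ≤ W := by exact_mod_cast a2
    constructor <;> nlinarith
  · exact ⟨hx0, hx1⟩

namespace PathIdx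

variable {ρ : Type} {K : ℕ}

/-- The colour of a path. -/
def colour (i : PathIdx ρ K) : Bool := match i.shape with
  | .vert => true
  | _ => false

/-- The straight paths. -/
def IsStraight (i : PathIdx ρ K) : Prop := i.shape = .vert ∨ i.shape = .horiz

lemma colour_ne {i j : PathIdx ρ K} (hi : i.IsStraight) (hj : j.IsStraight)
    (h : i.shape ≠ j.shape) : i.colour ≠ j.colour := by
  unfold IsStraight at hi hj
  unfold colour
  rcases hi with hi | hi <;> rcases hj with hj | hj <;> rw [hi, hj] at h ⊢ <;> simp at h ⊢

lemma off_ne_half (x : Fin K) : ((x:ℝ) + 1 / 3) / K ≠ 1 / 2 := by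
  have hK : (0:ℝ) < K := by exact_mod_cast x.pos
  intro h
  field_simp at h
  have : 2 * (3 * (x:ℕ) + 1) = K * 3 := by
    have : 2 * (3 * (x:ℝ) + 1) = K * 3 := by linarith
    exact_mod_cast this
  omega

end PathIdx

namespace Layout

variable {ρ : Type} (Λ : Layout ρ) {K : ℕ}

/-- The row of a path. -/
def row : PathIdx ρ K → ρ
  | .primal r _ => r
  | .dual r _ => r
  | .link c _ => Λ.link c
  | .spoke c => Λ.spoke c

/-- The strand of a path in the tiling. -/
def strand (i : PathIdx ρ K) : Strand := PathIdx.strand (fun i => Λ.cell (Λ.row i)) i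

/-- The point of a vertex or face in the tiling. -/
def pos : Λ.Pt → ℝ × ℝ
  | .inl v => ((Λ.L v + 1 / 2 : ℝ), ((v : ℤ) : ℝ))
  | .inr f => (((f : ℤ) : ℝ), (Λ.B f + 1 / 2 : ℝ))

lemma pos_inj : Function.Injective Λ.pos := by
  have half : ∀ a b : ℤ, (a : ℝ) + 1 / 2 ≠ b := by
    intro a b h
    have : 2 * a + 1 = 2 * b := by
      have : 2 * (a:ℝ) + 1 = 2 * b := by linarith
      exact_mod_cast this
    omega
  rintro (v | f) (v' | f') h <;> simp only [pos, Prod.mk.injEq] at h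
  · rw [Subtype.ext (by exact_mod_cast h.2 : (v:ℤ) = v')]
  · exact (half _ _ h.1).elim
  · exact (half _ _ h.1.symm).elim
  · rw [Subtype.ext (by exact_mod_cast h.1 : (f:ℤ) = f')]

lemma row_turn {i : PathIdx ρ K} (h : ∃ c, i.shape = .turn c) : Λ.row i ≠ Λ.e₀ := by
  rcases i with ⟨r, i⟩ | ⟨r, i⟩ | ⟨c, i⟩ | c
  · simp [PathIdx.shape] at h
  · simp [PathIdx.shape] at h
  · exact Λ.link_ne c
  · exact Λ.spoke_ne c

lemma good (hK : 1 ≤ K) (i : PathIdx ρ K) : (Λ.strand i).Good Λ.L Λ.B (PathIdx.width K) :=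
  PathIdx.strand_good hK (Λ.fat _) fun h => Λ.clear _ (Λ.row_turn h)

lemma clear_outer : Cell.Clear Λ.L Λ.B (Λ.cell Λ.e₀) (Λ.cell Λ.e₀) := by
  rw [Λ.cell_e₀]
  intro v f hv hf
  have h1 := Λ.three_le
  have h2 := Λ.fz_pos
  have h3 := Λ.fz_lt_fu
  have h4 := Λ.fu_lt
  have h5 : 0 ≤ v ∧ v ≤ Λ.H := by rcases hv with rfl | rfl <;> constructor <;> simp <;> omega
  obtain ⟨h6, h7⟩ := Λ.L_mem v h5.1 h5.2
  rcases hf with rfl | rfl <;> simp only [Cell.swap] <;> omega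

lemma compat (hK : 1 ≤ K) {i j : PathIdx ρ K} (hij : i ≠ j)
    (h : Λ.row i = Λ.e₀ ↔ Λ.row j = Λ.e₀) : (Λ.strand i).Compat Λ.L Λ.B (Λ.strand j) := by
  by_cases hr : Λ.row i = Λ.row j
  · refine PathIdx.strand_compat hK hij (congrArg Λ.cell hr) ?_ ?_ ?_ ?_ fun _ _ => ?_
    · rintro r x r' y rfl rfl
      exact hr
    · rintro r x r' y rfl rfl
      exact hr
    · rintro c x c' rfl rfl
      exact Λ.link_ne_spoke _ _ hr
    · rintro c x c' rfl rfl
      exact Λ.link_ne_spoke _ _ hr.symm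
    · by_cases he : Λ.row i = Λ.e₀
      · rw [he]
        exact Λ.clear_outer
      · exact Λ.clear _ he
  · have hi : Λ.row i ≠ Λ.e₀ := fun e => hr (e.trans (h.1 e).symm)
    have hj : Λ.row j ≠ Λ.e₀ := fun e => hi (h.2 e)
    refine ⟨fun _ _ => Or.inl (Λ.pp _ _ hi hj hr), fun _ _ => Or.inl (Λ.qq _ _ hi hj hr),
      fun _ _ => Or.inl (Λ.pq _ _ hi hj hr), fun _ _ => Or.inl (Λ.pq _ _ hj hi (Ne.symm hr)),
      fun hc => (hr ?_).elim⟩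
    have hc : Λ.cell (Λ.row i) = Λ.cell (Λ.row j) := hc
    exact Λ.primal_inj _ _ (congrArg Cell.tl hc) (congrArg Cell.hd hc)

/-- The curve of a path in the tiling. -/
def base (i : PathIdx ρ K) (t : ℝ) : ℝ × ℝ := (Λ.strand i).curve Λ.L Λ.B (PathIdx.width K) t

lemma width_le (hK : 1 ≤ K) : PathIdx.width K ≤ 1 / 4 := by
  linarith [PathIdx.width_le hK]

lemma base_meet (hK : 1 ≤ K) {i j : PathIdx ρ K} (hij : i ≠ j)
    (h : Λ.row i = Λ.e₀ ↔ Λ.row j = Λ.e₀) {t t' : ℝ} (ht : t ∈ Ioo (0:ℝ) 1)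
    (ht' : t' ∈ Icc (0:ℝ) 1) (e : Λ.base i t = Λ.base j t') :
    i.IsStraight ∧ j.IsStraight ∧ i.shape ≠ j.shape ∧ Λ.cell (Λ.row i) = Λ.cell (Λ.row j) ∧
      t = j.off ∧ t' = i.off :=
  Strand.curve_meet (PathIdx.width_pos hK) (width_le hK) (Λ.good hK i) (Λ.good hK j)
    (Λ.compat hK hij h) ht ht' e

lemma off_mem (Λ : Layout ρ) (hK : 1 ≤ K) (i : PathIdx ρ K) : i.off ∈ Ioo (0:ℝ) 1 := by
  have h1 := (Λ.good hK i).lo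
  have h2 := (Λ.good hK i).hi
  have h3 := PathIdx.width_pos hK
  exact ⟨h3.trans_le h1, lt_of_le_of_lt h2 (by linarith)⟩

lemma vert_exists (hK : 1 ≤ K) (b : Λ.Pt) : ∃ i : PathIdx ρ K, Λ.row i ≠ Λ.e₀ ∧
    ∃ e : ℝ, (e = 0 ∨ e = 1) ∧ Λ.base i e = Λ.pos b := by
  have h0 := PathIdx.width_pos hK
  have h1 := width_le hK
  rcases b with v | f
  · obtain ⟨r, hr, hv⟩ := Λ.exists_tl v v.2.1 v.2.2
    refine ⟨.primal r ⟨0, hK⟩, hr, ?_⟩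
    rcases hv with hv | hv
    · exact ⟨0, Or.inl rfl, (pc_zero Λ.L h0 h1 (Λ.fat r).1 _).trans (by rw [pos, hv])⟩
    · exact ⟨1, Or.inr rfl, (pc_one Λ.L h0 h1 (Λ.fat r).1 _).trans (by rw [pos, hv])⟩
  · obtain ⟨r, hr, hv⟩ := Λ.exists_lf f f.2.1 f.2.2
    refine ⟨.dual r ⟨0, hK⟩, hr, ?_⟩
    have hc := (Λ.fat r).2
    rcases hv with hv | hv
    · refine ⟨0, Or.inl rfl, ?_⟩
      change (pc Λ.B _ (Λ.cell r).swap _ 0).swap = _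
      rw [pc_zero Λ.B h0 h1 (c := (Λ.cell r).swap) hc, pos, hv]
      rfl
    · refine ⟨1, Or.inr rfl, ?_⟩
      change (pc Λ.B _ (Λ.cell r).swap _ 1).swap = _
      rw [pc_one Λ.B h0 h1 (c := (Λ.cell r).swap) hc, pos, hv]
      rfl

lemma base_zero (hK : 1 ≤ K) (J : Type) (i : PathIdx ρ K) :
    ∃ b, (Λ.frame J).src i = .inl b ∧ Λ.base i 0 = Λ.pos b := by
  have e := Strand.curve_zero Λ.L Λ.B (PathIdx.width_pos hK) (width_le hK) (Λ.good hK i).fat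
  rcases i with ⟨r, i⟩ | ⟨r, i⟩ | ⟨c, i⟩ | c
  · exact ⟨_, rfl, e⟩
  · exact ⟨_, rfl, e⟩
  · refine ⟨_, rfl, e.trans ?_⟩
    simp only [strand, PathIdx.strand, PathIdx.shape, row, Λ.link_tl]
    rfl
  · refine ⟨_, rfl, e.trans ?_⟩
    simp only [strand, PathIdx.strand, PathIdx.shape, row, Λ.spoke_tl]
    rfl

lemma base_one (hK : 1 ≤ K) (J : Type) (i : PathIdx ρ K) :
    ∃ b, (Λ.frame J).tgt i = .inl b ∧ Λ.base i 1 = Λ.pos b := by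
  have e := Strand.curve_one Λ.L Λ.B (PathIdx.width_pos hK) (width_le hK) (Λ.good hK i).fat
  rcases i with ⟨r, i⟩ | ⟨r, i⟩ | ⟨- | -, i⟩ | - | -
  · exact ⟨_, rfl, e⟩
  · exact ⟨_, rfl, e⟩
  · refine ⟨_, rfl, e.trans ?_⟩
    simp only [strand, PathIdx.strand, PathIdx.shape, row, Λ.link_lf]
    rfl
  · refine ⟨_, rfl, e.trans ?_⟩
    simp only [strand, PathIdx.strand, PathIdx.shape, row, Λ.link_rt]
    rfl
  · refine ⟨_, rfl, e.trans ?_⟩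
    simp only [strand, PathIdx.strand, PathIdx.shape, row, Λ.spoke_lf]
    rfl
  · refine ⟨_, rfl, e.trans ?_⟩
    simp only [strand, PathIdx.strand, PathIdx.shape, row, Λ.spoke_rt]
    rfl

/-- The affine map of the tiled rectangle to the unit square. -/
def norml (q : ℝ × ℝ) : ℝ × ℝ := ((2 * q.1 - Λ.W) / Λ.W, (2 * q.2 - Λ.H) / Λ.H)

lemma H_pos : (0:ℝ) < Λ.H := by exact_mod_cast (by linarith [Λ.three_le] : 0 < Λ.H)
lemma W_pos : (0:ℝ) < Λ.W := by
  exact_mod_cast (Λ.fz_pos.trans (Λ.fz_lt_fu.trans Λ.fu_lt) : 0 < Λ.W)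

lemma norml_inj : Function.Injective Λ.norml := by
  intro p q h
  have hH := Λ.H_pos
  have hW := Λ.W_pos
  simp only [norml, Prod.mk.injEq] at h
  rw [div_left_inj' hW.ne', div_left_inj' hH.ne'] at h
  exact Prod.ext (by linarith [h.1]) (by linarith [h.2])

lemma abs_norml {W x : ℝ} (hW : 0 < W) :
    (x ∈ Icc 0 W → |(2 * x - W) / W| ≤ 1) ∧ (x ∈ Ioo 0 W → |(2 * x - W) / W| < 1) := by
  rw [abs_div, abs_of_pos hW]
  constructor
  · rintro ⟨h1, h2⟩
    rw [div_le_one hW, abs_le]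
    constructor <;> linarith
  · rintro ⟨h1, h2⟩
    rw [div_lt_one hW, abs_lt]
    constructor <;> linarith

lemma base_mem (hK : 1 ≤ K) (i : PathIdx ρ K) {t : ℝ} (ht : t ∈ Icc (0:ℝ) 1) :
    ((Λ.base i t).1 ∈ Icc (0:ℝ) Λ.W ∧ (Λ.base i t).2 ∈ Icc (0:ℝ) Λ.H) ∧
      (i.IsStraight → t ∈ Ioo (0:ℝ) 1 →
        (Λ.base i t).1 ∈ Ioo (0:ℝ) Λ.W ∧ (Λ.base i t).2 ∈ Ioo (0:ℝ) Λ.H) := by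
  have h0 := PathIdx.width_pos hK
  have h1 := width_le hK
  have hg := Λ.good hK i
  have hp := hg.poff_mem
  have hp : (Λ.strand i).poff ∈ Ioo (0:ℝ) 1 := ⟨h0.trans_le hp.1, by linarith [hp.2]⟩
  set r := Λ.row i with hr
  have c1 : (0:ℝ) ≤ (Λ.cell r).tl := by exact_mod_cast Λ.tl_nonneg r
  have c2 : ((Λ.cell r).hd : ℝ) ≤ Λ.H := by exact_mod_cast Λ.hd_le r
  have c3 : (0:ℝ) ≤ (Λ.cell r).lf := by exact_mod_cast Λ.lf_nonneg r
  have c4 : ((Λ.cell r).rt : ℝ) ≤ Λ.W := by exact_mod_cast Λ.rt_le r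
  rcases Strand.curve_part h0 hg ht with ⟨-, w, hw, hw2, e, -⟩ | ⟨-, w, hw, hw2, e, -⟩
  · have a1 := pc_fst_mem h0 h1 hg.fat hp hw (W := Λ.W) (Λ.lf_nonneg r) (Λ.rt_le r) (L := Λ.L)
      fun v hv => Λ.L_mem v (by rcases hv with rfl | rfl; exacts [Λ.tl_nonneg r, Λ.hd_nonneg r])
        (by rcases hv with rfl | rfl; exacts [Λ.tl_le r, Λ.hd_le r])
    have a2 := Cell.ypos_mem hg.fat.1 hw
    rw [base, e]
    refine ⟨⟨Ioo_subset_Icc_self a1, c1.trans a2.1, a2.2.trans c2⟩, fun _ h => ⟨a1, ?_⟩⟩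
    have a3 := Cell.ypos_mem_Ioo hg.fat.1 (hw2 h)
    exact ⟨c1.trans_lt a3.1, a3.2.trans_le c2⟩
  · have a1 := pc_fst_mem h0 h1 (c := (Λ.cell r).swap) ⟨hg.fat.2, hg.fat.1⟩ (Λ.off_mem hK i) hw
      (W := Λ.H) (Λ.tl_nonneg r) (Λ.hd_le r) (L := Λ.B)
      fun v hv => Λ.B_mem v (by rcases hv with rfl | rfl; exacts [Λ.lf_nonneg r, Λ.rt_nonneg r])
        (by rcases hv with rfl | rfl; exacts [Λ.lf_le r, Λ.rt_le r])
    have a2 := Cell.ypos_mem (c := (Λ.cell r).swap) hg.fat.2 hw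
    rw [base, e]
    refine ⟨⟨⟨c3.trans a2.1, a2.2.trans c4⟩, Ioo_subset_Icc_self a1⟩, fun _ h => ⟨?_, a1⟩⟩
    have a3 := Cell.ypos_mem_Ioo (c := (Λ.cell r).swap) hg.fat.2 (hw2 h)
    exact ⟨c3.trans_lt a3.1, a3.2.trans_le c4⟩

lemma norm_base_le (hK : 1 ≤ K) (i : PathIdx ρ K) {t : ℝ} (ht : t ∈ Icc (0:ℝ) 1) :
    ‖Λ.norml (Λ.base i t)‖ ≤ 1 :=
  norm_prod_le_iff.2 ⟨(abs_norml Λ.W_pos).1 (Λ.base_mem hK i ht).1.1,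
    (abs_norml Λ.H_pos).1 (Λ.base_mem hK i ht).1.2⟩

lemma straight_of_row {i : PathIdx ρ K} (h : Λ.row i = Λ.e₀) : i.IsStraight := by
  rcases i with ⟨r, i⟩ | ⟨r, i⟩ | ⟨c, i⟩ | c
  · exact Or.inl rfl
  · exact Or.inr rfl
  · exact (Λ.link_ne c h).elim
  · exact (Λ.spoke_ne c h).elim

lemma norm_base_lt (hK : 1 ≤ K) {i : PathIdx ρ K} (hi : Λ.row i = Λ.e₀) {t : ℝ}
    (ht : t ∈ Ioo (0:ℝ) 1) : ‖Λ.norml (Λ.base i t)‖ < 1 := by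
  have h := (Λ.base_mem hK i (Ioo_subset_Icc_self ht)).2 (Λ.straight_of_row hi) ht
  exact max_lt ((abs_norml Λ.W_pos).2 h.1) ((abs_norml Λ.H_pos).2 h.2)

lemma norml_base_ne (hK : 1 ≤ K) {i : PathIdx ρ K} (hi : Λ.row i = Λ.e₀) {t : ℝ} :
    Λ.norml (Λ.base i t) ≠ 0 := by
  have hH := Λ.H_pos
  have hW := Λ.W_pos
  have h0 := PathIdx.width_pos hK
  have h1 := width_le hK
  intro h
  simp only [norml, Prod.mk_eq_zero, div_eq_zero_iff, hH.ne', hW.ne', or_false] at h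
  rcases i with ⟨r, x⟩ | ⟨r, x⟩ | ⟨c, i⟩ | c
  · obtain rfl : r = Λ.e₀ := hi
    have e : Λ.base (.primal Λ.e₀ x) t = pc Λ.L (PathIdx.width K) ⟨0, Λ.H, 0, Λ.W⟩ (((x:ℝ) + 1 / 3) / K) t := by
      rw [← Λ.cell_e₀]; rfl
    rw [e] at h
    have ht : t = 1 / 2 := by
      have := h.2
      simp only [pc, Cell.ypos, Int.cast_zero] at this
      have : Λ.H * (2 * t - 1) = 0 := by linarith
      rcases mul_eq_zero.1 this with h | h
      · exact (hH.ne' h).elim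
      · linarith
    subst ht
    rw [pc_of_mem Λ.L h0 (by exact_mod_cast hH) _ (by linarith) (by linarith)] at h
    have := h.1
    simp only [Cell.xpos, Int.cast_zero] at this
    refine PathIdx.off_ne_half x ?_
    have : Λ.W * (2 * (((x:ℝ) + 1 / 3) / K) - 1) = 0 := by
      linarith
    rcases mul_eq_zero.1 this with h | h
    · exact (hW.ne' h).elim
    · linarith
  · obtain rfl : r = Λ.e₀ := hi
    have e : Λ.base (.dual Λ.e₀ x) t = qc Λ.B (PathIdx.width K) ⟨0, Λ.H, 0, Λ.W⟩ (((x:ℝ) + 1 / 3) / K) t := by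
      rw [← Λ.cell_e₀]; rfl
    rw [e] at h
    have ht : t = 1 / 2 := by
      have := h.1
      simp only [qc, pc, Cell.swap, Cell.ypos, Int.cast_zero, Prod.fst_swap] at this
      have : Λ.W * (2 * t - 1) = 0 := by linarith
      rcases mul_eq_zero.1 this with h | h
      · exact (hW.ne' h).elim
      · linarith
    subst ht
    rw [qc_of_mem Λ.B h0 (by exact_mod_cast hW) _ (by linarith) (by linarith)] at h
    have := h.2
    simp only [Cell.ypos, Int.cast_zero] at this
    refine PathIdx.off_ne_half x ?_
    have : Λ.H * (2 * (((x:ℝ) + 1 / 3) / K) - 1) = 0 := by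
      linarith
    rcases mul_eq_zero.1 this with h | h
    · exact (hH.ne' h).elim
    · linarith
  · exact Λ.link_ne c hi
  · exact Λ.spoke_ne c hi

lemma norm_base_eq (hK : 1 ≤ K) {i : PathIdx ρ K} (hi : Λ.row i = Λ.e₀) {e : ℝ}
    (he : e = 0 ∨ e = 1) : ‖Λ.norml (Λ.base i e)‖ = 1 := by
  have hH := Λ.H_pos
  have hW := Λ.W_pos
  refine le_antisymm (Λ.norm_base_le hK i (by rcases he with rfl | rfl <;> norm_num)) ?_
  have h1 : ∀ x : ℝ, 0 < x → |((2 * 0 - x) / x)| = 1 := fun x hx => by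
    rw [abs_div, abs_of_pos hx, mul_zero, zero_sub, abs_neg, abs_of_pos hx, div_self hx.ne']
  have h2 : ∀ x : ℝ, 0 < x → |((2 * x - x) / x)| = 1 := fun x hx => by
    rw [two_mul, add_sub_cancel_right, div_self hx.ne', abs_one]
  have hc := Λ.cell_e₀
  rcases i with ⟨r, x⟩ | ⟨r, x⟩ | ⟨c, i⟩ | c
  · obtain rfl : r = Λ.e₀ := hi
    refine le_trans (le_of_eq ?_) (norm_snd_le _)
    have e : (Λ.base (.primal Λ.e₀ x) e).2 = (⟨0, Λ.H, 0, Λ.W⟩ : Cell).ypos e := by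
      rw [← Λ.cell_e₀]; rfl
    rw [norml, e, Real.norm_eq_abs]
    rcases he with rfl | rfl <;> simp only [Cell.ypos, Int.cast_zero]
    · rw [mul_zero, add_zero, h1 _ hH]
    · rw [mul_one, sub_zero, zero_add, h2 _ hH]
  · obtain rfl : r = Λ.e₀ := hi
    refine le_trans (le_of_eq ?_) (norm_fst_le _)
    have e : (Λ.base (.dual Λ.e₀ x) e).1 = (⟨0, Λ.H, 0, Λ.W⟩ : Cell).xpos e := by
      rw [← Λ.cell_e₀]; rfl
    rw [norml, e, Real.norm_eq_abs]
    rcases he with rfl | rfl <;> simp only [Cell.xpos, Int.cast_zero]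
    · rw [mul_zero, add_zero, h1 _ hW]
    · rw [mul_one, sub_zero, zero_add, h2 _ hW]
  · exact (Λ.link_ne c hi).elim
  · exact (Λ.spoke_ne c hi).elim

open Classical in
/-- The curves of the drawing in which the edge `e₀` lies in the outer face. -/
def outerCurve (i : PathIdx ρ K) (t : ℝ) : ℝ × ℝ :=
  if Λ.row i = Λ.e₀ then invert (Λ.norml (Λ.base i t)) else Λ.norml (Λ.base i t)

lemma outerCurve_end (hK : 1 ≤ K) (i : PathIdx ρ K) {e : ℝ} (he : e = 0 ∨ e = 1) :
    Λ.outerCurve i e = Λ.norml (Λ.base i e) := by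
  unfold outerCurve
  split_ifs with h
  · exact invert_of_norm (Λ.norm_base_eq hK h he)
  · rfl

lemma base_injOn (hK : 1 ≤ K) (i : PathIdx ρ K) : InjOn (Λ.base i) (Icc 0 1) :=
  Strand.curve_injOn (PathIdx.width_pos hK) (width_le hK) (Λ.good hK i)

lemma outerCurve_meet (hK : 1 ≤ K) {i j : PathIdx ρ K} (hij : i ≠ j) {t t' : ℝ}
    (ht : t ∈ Ioo (0:ℝ) 1) (ht' : t' ∈ Icc (0:ℝ) 1) (e : Λ.outerCurve i t = Λ.outerCurve j t') :
    i.IsStraight ∧ j.IsStraight ∧ i.shape ≠ j.shape ∧ t = j.off ∧ t' = i.off := by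
  have key : (Λ.row i = Λ.e₀ ↔ Λ.row j = Λ.e₀) → Λ.base i t = Λ.base j t' →
      i.IsStraight ∧ j.IsStraight ∧ i.shape ≠ j.shape ∧ t = j.off ∧ t' = i.off := fun h h' =>
    have := Λ.base_meet hK hij h ht ht' h'
    ⟨this.1, this.2.1, this.2.2.1, this.2.2.2.2⟩
  unfold outerCurve at e
  split_ifs at e with hi hj hj
  · exact key (by simp [hi, hj])
      (Λ.norml_inj (by rw [← invert_invert (Λ.norml (Λ.base i t)), e, invert_invert]))
  · have h1 := Λ.norm_base_lt hK hi ht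
    have h2 := Λ.norm_base_le hK j ht'
    have h3 := norm_pos_iff.2 (Λ.norml_base_ne hK hi (t := t))
    rw [← e, norm_invert] at h2
    have := (inv_le_one₀ h3).1 h2
    linarith
  · by_cases h : t' ∈ Ioo (0:ℝ) 1
    · have h1 := Λ.norm_base_lt hK hj h
      have h2 := Λ.norm_base_le hK i (Ioo_subset_Icc_self ht)
      have h3 := norm_pos_iff.2 (Λ.norml_base_ne hK hj (t := t'))
      rw [e, norm_invert] at h2
      have := (inv_le_one₀ h3).1 h2
      linarith
    · have h' : t' = 0 ∨ t' = 1 := by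
        by_contra hn
        rw [not_or] at hn
        exact h ⟨lt_of_le_of_ne ht'.1 (Ne.symm hn.1), lt_of_le_of_ne ht'.2 hn.2⟩
      rw [invert_of_norm (Λ.norm_base_eq hK hj h')] at e
      have e := Λ.norml_inj e
      obtain ⟨b, hb⟩ : ∃ b, Λ.base j t' = Λ.pos b := by
        rcases h' with rfl | rfl
        · obtain ⟨b, -, h⟩ := Λ.base_zero hK PUnit j
          exact ⟨b, h⟩
        · obtain ⟨b, -, h⟩ := Λ.base_one hK PUnit j
          exact ⟨b, h⟩
      obtain ⟨j', hj', s, hs, hs'⟩ := Λ.vert_exists hK b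
      have hsI : s ∈ Icc (0:ℝ) 1 := by rcases hs with rfl | rfl <;> norm_num
      have hsn : s ∉ Ioo (0:ℝ) 1 := by rcases hs with rfl | rfl <;> norm_num
      rw [hb, ← hs'] at e
      by_cases hij' : i = j'
      · subst hij'
        exact (hsn (Λ.base_injOn hK i (Ioo_subset_Icc_self ht) hsI e ▸ ht)).elim
      · have := Λ.base_meet hK hij' (by simp [hi, hj']) ht hsI e
        exact (hsn (this.2.2.2.2.2 ▸ Λ.off_mem hK i)).elim
  · exact key (by simp [hi, hj]) (Λ.norml_inj e)

lemma len_of_straight (k : ℕ) {i : PathIdx ρ K} (h : i.IsStraight) :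
    Frame.len k i = k := by
  rcases i with ⟨r, x⟩ | ⟨r, x⟩ | ⟨c, i⟩ | c
  · rfl
  · rfl
  · simp [PathIdx.IsStraight, PathIdx.shape] at h
  · simp [PathIdx.IsStraight, PathIdx.shape] at h

theorem exists_kPlanar [Finite ρ] (J : Type) [Finite J] {k : ℕ} (hk : 1 ≤ k)
    (hk1 : k = 1 → K = 1) (hK : K = k * k) :
    ∃ Γ : Drawing ((Λ.frame J).system k K hk hk1).graph, Γ.IsKPlanar k := by
  have := Fintype.ofFinite ρ
  have hK1 : 1 ≤ K := hK ▸ Nat.mul_pos hk hk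
  have h0 := PathIdx.width_pos hK1
  have hcont : Continuous Λ.norml := by
    unfold norml
    fun_prop
  have hbase : ∀ i : PathIdx ρ K, Continuous (Λ.base i) := fun i =>
    Strand.curve_continuous h0 (Λ.good hK1 i)
  refine Exists.elim (((Λ.frame J).system k K hk hk1).exists_net (fun b => Λ.norml (Λ.pos b))
    (Λ.norml_inj.comp Λ.pos_inj) Λ.outerCurve ?_ ?_ ?_ ?_ PathIdx.colour ?_ ?_ ?_) fun Γ hΓ => ?_
  · intro i
    by_cases hi : Λ.row i = Λ.e₀
    · refine (continuousOn_invert.comp (hcont.comp (hbase i)).continuousOn (t := {0}ᶜ)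
        fun t _ => Λ.norml_base_ne hK1 hi).congr fun t _ => ?_
      simp [outerCurve, hi]
    · refine (hcont.comp (hbase i)).continuousOn.congr fun t _ => ?_
      simp [outerCurve, hi]
  · intro i t ht t' ht' e
    refine Λ.base_injOn hK1 i ht ht' ?_
    unfold outerCurve at e
    split_ifs at e
    · exact Λ.norml_inj (by rw [← invert_invert (Λ.norml (Λ.base i t)), e, invert_invert])
    · exact Λ.norml_inj e
  · intro i
    obtain ⟨b, h, e⟩ := Λ.base_zero hK1 J i
    exact ⟨b, h, by rw [Λ.outerCurve_end hK1 i (Or.inl rfl), e]⟩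
  · intro i
    obtain ⟨b, h, e⟩ := Λ.base_one hK1 J i
    exact ⟨b, h, by rw [Λ.outerCurve_end hK1 i (Or.inr rfl), e]⟩
  · intro i j hij t ht t' ht' e
    obtain ⟨hi, hj, hs, rfl, rfl⟩ := Λ.outerCurve_meet hK1 hij ht ht' e
    have hl : ((Λ.frame J).system k K hk hk1).len i = k := len_of_straight k hi
    refine ⟨Λ.off_mem hK1 i, PathIdx.colour_ne hi hj hs, fun m => ?_⟩
    rw [hl]
    exact PathIdx.off_mul_ne hk hK hj m
  · intro i j hij t ht t' ht' x hx x' hx' e e'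
    rw [(Λ.outerCurve_meet hK1 hij ht (Ioo_subset_Icc_self ht') e).2.2.2.1,
      (Λ.outerCurve_meet hK1 hij hx (Ioo_subset_Icc_self hx') e').2.2.2.1]
  · intro b
    obtain ⟨i, -, e, he, h⟩ := Λ.vert_exists hK1 b
    exact ⟨i, e, he, by rw [Λ.outerCurve_end hK1 i he, h]⟩
  · refine ⟨Γ.drawing, Γ.isKPlanar fun i m => ?_⟩
    obtain ⟨T, hT, h⟩ := PathIdx.exists_offs (ρ := ρ) hk hK m
    refine ⟨T, hT, fun j hij x hx x' hx' e h1 h2 => ?_⟩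
    rw [hΓ] at e
    obtain ⟨hi, hj, -, rfl, -⟩ := Λ.outerCurve_meet hK1 hij hx (Ioo_subset_Icc_self hx') e
    have hl : ((Λ.frame J).system k K hk hk1).len i = k := len_of_straight k hi
    rw [hl] at h1 h2
    exact h j hj h1 h2

end Layout

namespace Cell

lemma pp_of {L : ℤ → ℤ} {a b c d a' b' c' d' p q p' q' : ℤ} (hp : L a = p) (hq : L b = q)
    (hp' : L a' = p') (hq' : L b' = q')
    (h : (b ≤ a' ∨ b' ≤ a ∨ d ≤ c' ∨ d' ≤ c) ∧
      (a' < a → a < b' → (d' ≤ c ∧ d' ≤ p) ∨ (d ≤ c' ∧ p < c')) ∧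
      (a' < b → b < b' → (d' ≤ c ∧ d' ≤ q) ∨ (d ≤ c' ∧ q < c')) ∧
      (a < a' → a' < b → (d ≤ c' ∧ d ≤ p') ∨ (d' ≤ c ∧ p' < c)) ∧
      (a < b' → b' < b → (d ≤ c' ∧ d ≤ q') ∨ (d' ≤ c ∧ q' < c))) :
    PP L ⟨a, b, c, d⟩ ⟨a', b', c', d'⟩ := by
  subst hp hq hp' hq'
  refine ⟨h.1, ?_, ?_⟩
  · rintro v (rfl | rfl)
    exacts [h.2.1, h.2.2.1]
  · rintro v (rfl | rfl)
    exacts [h.2.2.2.1, h.2.2.2.2]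

lemma clear_of {L B : ℤ → ℤ} {a b c d a' b' c' d' p q s t : ℤ} (hp : L a = p) (hq : L b = q)
    (hs : B c' = s) (ht : B d' = t)
    (h : ((c' ≤ c ∧ c' ≤ p) ∨ (d ≤ c' ∧ p < c') ∨ (a ≤ a' ∧ a ≤ s) ∨ (b' ≤ a ∧ s < a)) ∧
      ((d' ≤ c ∧ d' ≤ p) ∨ (d ≤ d' ∧ p < d') ∨ (a ≤ a' ∧ a ≤ t) ∨ (b' ≤ a ∧ t < a)) ∧
      ((c' ≤ c ∧ c' ≤ q) ∨ (d ≤ c' ∧ q < c') ∨ (b ≤ a' ∧ b ≤ s) ∨ (b' ≤ b ∧ s < b)) ∧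
      ((d' ≤ c ∧ d' ≤ q) ∨ (d ≤ d' ∧ q < d') ∨ (b ≤ a' ∧ b ≤ t) ∨ (b' ≤ b ∧ t < b))) :
    Clear L B ⟨a, b, c, d⟩ ⟨a', b', c', d'⟩ := by
  subst hp hq hs ht
  rintro v f (rfl | rfl) (rfl | rfl)
  exacts [h.1, h.2.1, h.2.2.1, h.2.2.2]

lemma pq_of {L B : ℤ → ℤ} {a b c d a' b' c' d' p q s t : ℤ} (hp : L a = p) (hq : L b = q)
    (hs : B c' = s) (ht : B d' = t)
    (h : ((c' ≤ c ∧ c' ≤ p) ∨ (d ≤ c' ∧ p < c') ∨ (a ≤ a' ∧ a ≤ s) ∨ (b' ≤ a ∧ s < a)) ∧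
      ((d' ≤ c ∧ d' ≤ p) ∨ (d ≤ d' ∧ p < d') ∨ (a ≤ a' ∧ a ≤ t) ∨ (b' ≤ a ∧ t < a)) ∧
      ((c' ≤ c ∧ c' ≤ q) ∨ (d ≤ c' ∧ q < c') ∨ (b ≤ a' ∧ b ≤ s) ∨ (b' ≤ b ∧ s < b)) ∧
      ((d' ≤ c ∧ d' ≤ q) ∨ (d ≤ d' ∧ q < d') ∨ (b ≤ a' ∧ b ≤ t) ∨ (b' ≤ b ∧ t < b)))
    (h' : (b ≤ a' ∨ b' ≤ a ∨ d ≤ c' ∨ d' ≤ c) ∧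
      (a' < a → a < b' → (d' ≤ c ∧ d' ≤ p) ∨ (d ≤ c' ∧ p < c')) ∧
      (a' < b → b < b' → (d' ≤ c ∧ d' ≤ q) ∨ (d ≤ c' ∧ q < c')) ∧
      (c < c' → c' < d → (b ≤ a' ∧ b ≤ s) ∨ (b' ≤ a ∧ s < a)) ∧
      (c < d' → d' < d → (b ≤ a' ∧ b ≤ t) ∨ (b' ≤ a ∧ t < a))) :
    PQ L B ⟨a, b, c, d⟩ ⟨a', b', c', d'⟩ := by
  refine ⟨h'.1, clear_of hp hq hs ht h, ?_⟩
  subst hp hq hs ht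
  constructor
  · rintro v (rfl | rfl)
    exacts [h'.2.1, h'.2.2.1]
  · rintro v (rfl | rfl)
    exacts [h'.2.2.2.1, h'.2.2.2.2]

lemma Apart.ne {c c' : Cell} (h : c.Apart c') (hc : c.Fat) : c ≠ c' := by
  rintro rfl
  obtain ⟨h1, h2⟩ := hc
  unfold Apart at h
  omega

lemma PP.symm {L : ℤ → ℤ} {c c' : Cell} (h : PP L c c') : PP L c' c := by
  obtain ⟨h1, h2, h3⟩ := h
  refine ⟨?_, h3, h2⟩
  unfold Apart at h1 ⊢
  omega

end Cell

lemma Strand.Compat.symm {L B : ℤ → ℤ} {s s' : Strand} (h : s.Compat L B s') :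
    s'.Compat L B s where
  pp h1 h2 := (h.pp h2 h1).imp Cell.PP.symm fun h => ⟨h.1.symm, h.2.symm⟩
  qq h1 h2 := (h.qq h2 h1).imp Cell.PP.symm fun h => ⟨h.1.symm, h.2.symm⟩
  pq h1 h2 := (h.qp h2 h1).imp id fun ⟨e, c⟩ => ⟨e.symm, e ▸ c⟩
  qp h1 h2 := (h.pq h2 h1).imp id fun ⟨e, c⟩ => ⟨e.symm, e ▸ c⟩
  turn h1 h2 := (h.turn h1.symm h2.symm).imp Ne.symm And.symm

namespace Layout

variable {ρ : Type} (Λ : Layout ρ) {K : ℕ}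

/-- The horizontal position of a face in the drawing with few crossings. -/
def up (f : ℤ) : ℤ := (Λ.W + 3) * (f - Λ.fz) - 1

lemma up_fz : Λ.up Λ.fz = -1 := by simp [up]

lemma W_nonneg : 0 ≤ Λ.W := (Λ.fz_pos.trans (Λ.fz_lt_fu.trans Λ.fu_lt)).le

lemma up_lt {a b : ℤ} (h : a < b) : Λ.up a + Λ.W + 3 ≤ Λ.up b := by
  have := Λ.W_nonneg
  unfold up
  nlinarith

lemma up_cases (a b : ℤ) : (a < b ∧ Λ.up a + Λ.W + 3 ≤ Λ.up b) ∨ (a = b ∧ Λ.up a = Λ.up b) ∨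
    (b < a ∧ Λ.up b + Λ.W + 3 ≤ Λ.up a) := by
  rcases lt_trichotomy a b with h | rfl | h
  · exact Or.inl ⟨h, Λ.up_lt h⟩
  · exact Or.inr (Or.inl ⟨rfl, rfl⟩)
  · exact Or.inr (Or.inr ⟨h, Λ.up_lt h⟩)

/-- The ends of vertical curves in the drawing with few crossings. -/
def lowL (v : ℤ) : ℤ := if v ≤ Λ.H then Λ.L v else if v = Λ.H + 1 then Λ.up 0 else Λ.up Λ.fu

/-- The ends of horizontal curves in the drawing with few crossings. -/
def lowB (x : ℤ) : ℤ := Λ.B ((x + 1) / (Λ.W + 3) + Λ.fz) + (Λ.H + 2)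

lemma lowL_of_le {v : ℤ} (h : v ≤ Λ.H) : Λ.lowL v = Λ.L v := if_pos h

lemma lowL_one : Λ.lowL (Λ.H + 1) = Λ.up 0 := by simp [lowL]

lemma lowL_two : Λ.lowL (Λ.H + 2) = Λ.up Λ.fu := by simp [lowL]

lemma lowB_up (f : ℤ) : Λ.lowB (Λ.up f) = Λ.B f + (Λ.H + 2) := by
  have := Λ.W_nonneg
  rw [lowB, up, sub_add_cancel, Int.mul_ediv_cancel_left _ (by omega), sub_add_cancel]

lemma lowB_neg_one : Λ.lowB (-1) = Λ.B Λ.fz + (Λ.H + 2) := by rw [← up_fz, lowB_up]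

open Classical in
/-- The cell of the vertical curves of a row. -/
def pcell (r : ρ) : Cell :=
  if r = Λ.e₀ then ⟨0, Λ.H, Λ.W, Λ.W + 1⟩ else
    ⟨(Λ.cell r).tl, (Λ.cell r).hd, (Λ.cell r).lf, (Λ.cell r).rt⟩

open Classical in
/-- The cell of the horizontal curves of a row. -/
def qcell (r : ρ) : Cell :=
  if r = Λ.e₀ then ⟨Λ.H + 2 + Λ.H, Λ.H + 2 + Λ.H + 1, Λ.up 0, Λ.up Λ.W⟩ else
    ⟨(Λ.cell r).tl + (Λ.H + 2), (Λ.cell r).hd + (Λ.H + 2), Λ.up (Λ.cell r).lf,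
      Λ.up (Λ.cell r).rt⟩

/-- The cell of the links. -/
def linkCell : Cell := ⟨1, Λ.H + 1, Λ.up 0, -1⟩

/-- The cell of the spokes. -/
def spokeCell : Cell := ⟨2, Λ.H + 2, Λ.up Λ.fu, Λ.up Λ.W⟩

lemma bounds : 3 ≤ Λ.H ∧ 0 < Λ.fz ∧ Λ.fz < Λ.fu ∧ Λ.fu < Λ.W ∧ Λ.up 0 + Λ.W + 3 ≤ -1 ∧
    Λ.W + 2 ≤ Λ.up Λ.fu ∧ Λ.up Λ.fu + Λ.W + 3 ≤ Λ.up Λ.W ∧ (0 ≤ Λ.L 0 ∧ Λ.L 0 < Λ.W) ∧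
    (0 ≤ Λ.L 1 ∧ Λ.L 1 < Λ.W) ∧ (0 ≤ Λ.L 2 ∧ Λ.L 2 < Λ.W) ∧ (0 ≤ Λ.L Λ.H ∧ Λ.L Λ.H < Λ.W) ∧
    (0 ≤ Λ.B 0 ∧ Λ.B 0 < Λ.H) ∧ (0 ≤ Λ.B Λ.fz ∧ Λ.B Λ.fz < Λ.H) ∧
    (0 ≤ Λ.B Λ.fu ∧ Λ.B Λ.fu < Λ.H) ∧ (0 ≤ Λ.B Λ.W ∧ Λ.B Λ.W < Λ.H) := by
  have h1 := Λ.three_le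
  have h2 := Λ.fz_pos
  have h3 := Λ.fz_lt_fu
  have h4 := Λ.fu_lt
  have h5 := Λ.up_lt h2
  have h6 := Λ.up_lt h3
  have h7 := Λ.up_lt h4
  rw [Λ.up_fz] at h5 h6
  exact ⟨h1, h2, h3, h4, h5, by omega, h7, Λ.L_mem _ (by omega) (by omega),
    Λ.L_mem _ (by omega) (by omega), Λ.L_mem _ (by omega) (by omega),
    Λ.L_mem _ (by omega) (by omega), Λ.B_mem _ (by omega) (by omega),
    Λ.B_mem _ (by omega) (by omega), Λ.B_mem _ (by omega) (by omega),
    Λ.B_mem _ (by omega) (by omega)⟩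

lemma row_bounds (r : ρ) : 0 ≤ (Λ.cell r).tl ∧ (Λ.cell r).tl < (Λ.cell r).hd ∧
    (Λ.cell r).hd ≤ Λ.H ∧ 0 ≤ (Λ.cell r).lf ∧ (Λ.cell r).lf < (Λ.cell r).rt ∧
    (Λ.cell r).rt ≤ Λ.W ∧
    (0 ≤ Λ.L (Λ.cell r).tl ∧ Λ.L (Λ.cell r).tl < Λ.W) ∧
    (0 ≤ Λ.L (Λ.cell r).hd ∧ Λ.L (Λ.cell r).hd < Λ.W) ∧
    (0 ≤ Λ.B (Λ.cell r).lf ∧ Λ.B (Λ.cell r).lf < Λ.H) ∧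
    (0 ≤ Λ.B (Λ.cell r).rt ∧ Λ.B (Λ.cell r).rt < Λ.H) ∧
    Λ.up (Λ.cell r).lf + Λ.W + 3 ≤ Λ.up (Λ.cell r).rt :=
  ⟨Λ.tl_nonneg r, (Λ.fat r).1, Λ.hd_le r, Λ.lf_nonneg r, (Λ.fat r).2, Λ.rt_le r,
    Λ.L_mem _ (Λ.tl_nonneg r) (Λ.tl_le r), Λ.L_mem _ (Λ.hd_nonneg r) (Λ.hd_le r),
    Λ.B_mem _ (Λ.lf_nonneg r) (Λ.lf_le r), Λ.B_mem _ (Λ.rt_nonneg r) (Λ.rt_le r),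
    Λ.up_lt (Λ.fat r).2⟩

lemma lowL_tl (r : ρ) : Λ.lowL (Λ.cell r).tl = Λ.L (Λ.cell r).tl := Λ.lowL_of_le (Λ.tl_le r)
lemma lowL_hd (r : ρ) : Λ.lowL (Λ.cell r).hd = Λ.L (Λ.cell r).hd := Λ.lowL_of_le (Λ.hd_le r)
lemma lowL_1 : Λ.lowL 1 = Λ.L 1 := Λ.lowL_of_le (by linarith [Λ.three_le])
lemma lowL_2 : Λ.lowL 2 = Λ.L 2 := Λ.lowL_of_le (by linarith [Λ.three_le])
lemma lowL_0 : Λ.lowL 0 = Λ.L 0 := Λ.lowL_of_le (by linarith [Λ.three_le])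
lemma lowL_H : Λ.lowL Λ.H = Λ.L Λ.H := Λ.lowL_of_le le_rfl

lemma pp_pcell {r r' : ρ} (h : r ≠ r') : Cell.PP Λ.lowL (Λ.pcell r) (Λ.pcell r') := by
  have key : ∀ r, r ≠ Λ.e₀ → Cell.PP Λ.lowL ⟨0, Λ.H, Λ.W, Λ.W + 1⟩
      ⟨(Λ.cell r).tl, (Λ.cell r).hd, (Λ.cell r).lf, (Λ.cell r).rt⟩ := by
    intro r hr
    have hb := Λ.bounds
    have hrb := Λ.row_bounds r
    exact Cell.pp_of Λ.lowL_0 Λ.lowL_H (Λ.lowL_tl r) (Λ.lowL_hd r) (by omega)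
  unfold pcell
  split_ifs with h1 h2 h2
  · exact (h (h1.trans h2.symm)).elim
  · exact key r' h2
  · exact (key r h1).symm
  · obtain ⟨a, b, c⟩ := Λ.pp r r' h1 h2 h
    have b1 := b _ (Or.inl rfl)
    have b2 := b _ (Or.inr rfl)
    have c1 := c _ (Or.inl rfl)
    have c2 := c _ (Or.inr rfl)
    exact Cell.pp_of (Λ.lowL_tl r) (Λ.lowL_hd r) (Λ.lowL_tl r') (Λ.lowL_hd r')
      ⟨a, b1, b2, c1, c2⟩

lemma pp_pcell_link (r : ρ) : Cell.PP Λ.lowL (Λ.pcell r) Λ.linkCell := by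
  have hb := Λ.bounds
  unfold pcell
  split_ifs with h
  · exact Cell.pp_of Λ.lowL_0 Λ.lowL_H Λ.lowL_1 Λ.lowL_one (by omega)
  · have hrb := Λ.row_bounds r
    have hr := Λ.right_of_one r h
    exact Cell.pp_of (Λ.lowL_tl r) (Λ.lowL_hd r) Λ.lowL_1 Λ.lowL_one (by omega)

lemma pp_pcell_spoke {r : ρ} (h : r ≠ Λ.e₀) : Cell.PP Λ.lowL (Λ.pcell r) Λ.spokeCell := by
  have hb := Λ.bounds
  have hrb := Λ.row_bounds r
  have hr := Λ.left_of_two r h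
  rw [pcell, if_neg h]
  exact Cell.pp_of (Λ.lowL_tl r) (Λ.lowL_hd r) Λ.lowL_2 Λ.lowL_two (by omega)

lemma pp_link_spoke : Cell.PP Λ.lowL Λ.linkCell Λ.spokeCell := by
  have hb := Λ.bounds
  exact Cell.pp_of Λ.lowL_1 Λ.lowL_one Λ.lowL_2 Λ.lowL_two (by omega)

lemma qq_qcell {r r' : ρ} (h : r ≠ r') :
    Cell.PP Λ.lowB (Λ.qcell r).swap (Λ.qcell r').swap := by
  have key : ∀ r, r ≠ Λ.e₀ → Cell.PP Λ.lowB
      ⟨Λ.up 0, Λ.up Λ.W, Λ.H + 2 + Λ.H, Λ.H + 2 + Λ.H + 1⟩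
      ⟨Λ.up (Λ.cell r).lf, Λ.up (Λ.cell r).rt, (Λ.cell r).tl + (Λ.H + 2),
        (Λ.cell r).hd + (Λ.H + 2)⟩ := by
    intro r hr
    have hb := Λ.bounds
    have hrb := Λ.row_bounds r
    have h1 := Λ.up_cases 0 (Λ.cell r).lf
    have h2 := Λ.up_cases (Λ.cell r).rt Λ.W
    exact Cell.pp_of (Λ.lowB_up _) (Λ.lowB_up _) (Λ.lowB_up _) (Λ.lowB_up _) (by omega)
  unfold qcell
  split_ifs with h1 h2 h2
  · exact (h (h1.trans h2.symm)).elim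
  · exact key r' h2
  · exact (key r h1).symm
  · obtain ⟨a, b, c⟩ := Λ.qq r r' h1 h2 h
    have b1 := b _ (Or.inl rfl)
    have b2 := b _ (Or.inr rfl)
    have c1 := c _ (Or.inl rfl)
    have c2 := c _ (Or.inr rfl)
    simp only [Cell.swap, Cell.Apart] at a b1 b2 c1 c2
    have u1 := Λ.up_cases (Λ.cell r).lf (Λ.cell r').lf
    have u2 := Λ.up_cases (Λ.cell r).lf (Λ.cell r').rt
    have u3 := Λ.up_cases (Λ.cell r).rt (Λ.cell r').lf
    have u4 := Λ.up_cases (Λ.cell r).rt (Λ.cell r').rt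
    have hw := Λ.W_nonneg
    simp only [Cell.swap]
    refine Cell.pp_of (Λ.lowB_up _) (Λ.lowB_up _) (Λ.lowB_up _) (Λ.lowB_up _)
      ⟨by omega, by omega, by omega, by omega, by omega⟩

lemma qq_qcell_link (r : ρ) : Cell.PP Λ.lowB (Λ.qcell r).swap Λ.linkCell.swap := by
  have hb := Λ.bounds
  unfold qcell
  split_ifs with h
  · simp only [Cell.swap, linkCell]
    exact Cell.pp_of (Λ.lowB_up _) (Λ.lowB_up _) (Λ.lowB_up _) Λ.lowB_neg_one (by omega)
  · have hrb := Λ.row_bounds r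
    have h1 := Λ.up_cases 0 (Λ.cell r).lf
    have h2 := Λ.up_cases (Λ.cell r).lf Λ.fz
    have h3 := Λ.up_cases (Λ.cell r).rt Λ.fz
    have h4 := Λ.up_fz
    have ha := Λ.above r h Λ.fz (Or.inl rfl)
    simp only [Cell.swap, linkCell]
    exact Cell.pp_of (Λ.lowB_up _) (Λ.lowB_up _) (Λ.lowB_up _) Λ.lowB_neg_one
      ⟨by omega, by omega, by omega, by omega, by omega⟩

lemma qq_qcell_spoke (r : ρ) : Cell.PP Λ.lowB (Λ.qcell r).swap Λ.spokeCell.swap := by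
  have hb := Λ.bounds
  unfold qcell
  split_ifs with h
  · simp only [Cell.swap, spokeCell]
    exact Cell.pp_of (Λ.lowB_up _) (Λ.lowB_up _) (Λ.lowB_up _) (Λ.lowB_up _) (by omega)
  · have hrb := Λ.row_bounds r
    have h1 := Λ.up_cases (Λ.cell r).rt Λ.W
    have h2 := Λ.up_cases (Λ.cell r).lf Λ.fu
    have h3 := Λ.up_cases (Λ.cell r).rt Λ.fu
    have ha := Λ.above r h Λ.fu (Or.inr rfl)
    simp only [Cell.swap, spokeCell]
    exact Cell.pp_of (Λ.lowB_up _) (Λ.lowB_up _) (Λ.lowB_up _) (Λ.lowB_up _)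
      ⟨by omega, by omega, by omega, by omega, by omega⟩

lemma qq_link_spoke : Cell.PP Λ.lowB Λ.linkCell.swap Λ.spokeCell.swap := by
  have hb := Λ.bounds
  simp only [Cell.swap, linkCell, spokeCell]
  exact Cell.pp_of (Λ.lowB_up _) Λ.lowB_neg_one (Λ.lowB_up _) (Λ.lowB_up _) (by omega)

lemma pq_pcell_qcell (r r' : ρ) : Cell.PQ Λ.lowL Λ.lowB (Λ.pcell r) (Λ.qcell r') := by
  have hb := Λ.bounds
  have hrb := Λ.row_bounds r
  have hrb' := Λ.row_bounds r'
  unfold pcell qcell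
  split_ifs with h h'
  · exact Cell.pq_of Λ.lowL_0 Λ.lowL_H (Λ.lowB_up _) (Λ.lowB_up _) (by omega) (by omega)
  · exact Cell.pq_of Λ.lowL_0 Λ.lowL_H (Λ.lowB_up _) (Λ.lowB_up _) (by omega) (by omega)
  · exact Cell.pq_of (Λ.lowL_tl r) (Λ.lowL_hd r) (Λ.lowB_up _) (Λ.lowB_up _) (by omega) (by omega)
  · exact Cell.pq_of (Λ.lowL_tl r) (Λ.lowL_hd r) (Λ.lowB_up _) (Λ.lowB_up _) (by omega) (by omega)

lemma pq_pcell_link (r : ρ) : Cell.PQ Λ.lowL Λ.lowB (Λ.pcell r) Λ.linkCell := by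
  have hb := Λ.bounds
  have hrb := Λ.row_bounds r
  unfold pcell
  split_ifs with h
  · exact Cell.pq_of Λ.lowL_0 Λ.lowL_H (Λ.lowB_up _) Λ.lowB_neg_one (by omega) (by omega)
  · exact Cell.pq_of (Λ.lowL_tl r) (Λ.lowL_hd r) (Λ.lowB_up _) Λ.lowB_neg_one (by omega) (by omega)

lemma pq_pcell_spoke (r : ρ) : Cell.PQ Λ.lowL Λ.lowB (Λ.pcell r) Λ.spokeCell := by
  have hb := Λ.bounds
  have hrb := Λ.row_bounds r
  unfold pcell
  split_ifs with h
  · exact Cell.pq_of Λ.lowL_0 Λ.lowL_H (Λ.lowB_up _) (Λ.lowB_up _) (by omega) (by omega)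
  · exact Cell.pq_of (Λ.lowL_tl r) (Λ.lowL_hd r) (Λ.lowB_up _) (Λ.lowB_up _) (by omega) (by omega)

lemma pq_link_qcell (r : ρ) : Cell.PQ Λ.lowL Λ.lowB Λ.linkCell (Λ.qcell r) := by
  have hb := Λ.bounds
  have hrb := Λ.row_bounds r
  unfold qcell
  split_ifs with h
  · exact Cell.pq_of Λ.lowL_1 Λ.lowL_one (Λ.lowB_up _) (Λ.lowB_up _) (by omega) (by omega)
  · exact Cell.pq_of Λ.lowL_1 Λ.lowL_one (Λ.lowB_up _) (Λ.lowB_up _) (by omega) (by omega)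

lemma pq_spoke_qcell (r : ρ) : Cell.PQ Λ.lowL Λ.lowB Λ.spokeCell (Λ.qcell r) := by
  have hb := Λ.bounds
  have hrb := Λ.row_bounds r
  unfold qcell
  split_ifs with h
  · exact Cell.pq_of Λ.lowL_2 Λ.lowL_two (Λ.lowB_up _) (Λ.lowB_up _) (by omega) (by omega)
  · exact Cell.pq_of Λ.lowL_2 Λ.lowL_two (Λ.lowB_up _) (Λ.lowB_up _) (by omega) (by omega)

lemma pq_link_spoke : Cell.PQ Λ.lowL Λ.lowB Λ.linkCell Λ.spokeCell := by
  have hb := Λ.bounds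
  exact Cell.pq_of Λ.lowL_1 Λ.lowL_one (Λ.lowB_up _) (Λ.lowB_up _) (by omega) (by omega)

lemma pq_spoke_link : Cell.PQ Λ.lowL Λ.lowB Λ.spokeCell Λ.linkCell := by
  have hb := Λ.bounds
  exact Cell.pq_of Λ.lowL_2 Λ.lowL_two (Λ.lowB_up _) Λ.lowB_neg_one (by omega) (by omega)

lemma clear_link : Cell.Clear Λ.lowL Λ.lowB Λ.linkCell Λ.linkCell := by
  have hb := Λ.bounds
  exact Cell.clear_of Λ.lowL_1 Λ.lowL_one (Λ.lowB_up _) Λ.lowB_neg_one (by omega)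

lemma clear_spoke : Cell.Clear Λ.lowL Λ.lowB Λ.spokeCell Λ.spokeCell := by
  have hb := Λ.bounds
  exact Cell.clear_of Λ.lowL_2 Λ.lowL_two (Λ.lowB_up _) (Λ.lowB_up _) (by omega)

lemma fat_pcell (r : ρ) : (Λ.pcell r).Fat := by
  have hb := Λ.bounds
  have hrb := Λ.row_bounds r
  unfold pcell
  split_ifs <;> constructor <;> dsimp only <;> omega

lemma fat_qcell (r : ρ) : (Λ.qcell r).Fat := by
  have hb := Λ.bounds
  have hrb := Λ.row_bounds r
  unfold qcell
  split_ifs <;> constructor <;> dsimp only <;> omega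

lemma fat_linkCell : Λ.linkCell.Fat := by
  have hb := Λ.bounds
  unfold linkCell
  constructor <;> dsimp only <;> omega

lemma fat_spokeCell : Λ.spokeCell.Fat := by
  have hb := Λ.bounds
  unfold spokeCell
  constructor <;> dsimp only <;> omega

end Layout

namespace Layout

variable {ρ : Type} (Λ : Layout ρ) {K : ℕ}

/-- The cell of a path in the drawing with few crossings. -/
def lowCell : PathIdx ρ K → Cell
  | .primal r _ => Λ.pcell r
  | .dual r _ => Λ.qcell r
  | .link _ _ => Λ.linkCell
  | .spoke _ => Λ.spokeCell

/-- The strand of a path in the drawing with few crossings. -/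
def lowStrand (i : PathIdx ρ K) : Strand := PathIdx.strand Λ.lowCell i

/-- The point of a vertex or face in the drawing with few crossings. -/
def lowPos : Λ.Pt → ℝ × ℝ
  | .inl v => ((Λ.L v + 1 / 2 : ℝ), ((v : ℤ) : ℝ))
  | .inr f => ((Λ.up f : ℝ), ((Λ.B f + (Λ.H + 2) : ℤ) + 1 / 2 : ℝ))

lemma lowPos_inj : Function.Injective Λ.lowPos := by
  have half : ∀ a b : ℤ, (a : ℝ) + 1 / 2 ≠ b := by
    intro a b h
    have : 2 * a + 1 = 2 * b := by
      have : 2 * (a:ℝ) + 1 = 2 * b := by linarith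
      exact_mod_cast this
    omega
  have up_inj : ∀ a b, Λ.up a = Λ.up b → a = b := by
    intro a b h
    have h1 := Λ.up_cases a b
    have h2 := Λ.W_nonneg
    omega
  rintro (v | f) (v' | f') h <;> simp only [lowPos, Prod.mk.injEq] at h
  · rw [Subtype.ext (by exact_mod_cast h.2 : (v:ℤ) = v')]
  · exact (half _ _ h.1).elim
  · exact (half _ _ h.1.symm).elim
  · have h2 : (f:ℤ) = f' := up_inj _ _ (by exact_mod_cast h.1)
    rw [Subtype.ext h2]

lemma fat_lowCell (i : PathIdx ρ K) : (Λ.lowCell i).Fat := by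
  rcases i with ⟨r, i⟩ | ⟨r, i⟩ | ⟨c, i⟩ | c
  exacts [Λ.fat_pcell r, Λ.fat_qcell r, Λ.fat_linkCell, Λ.fat_spokeCell]

lemma low_good (hK : 1 ≤ K) (i : PathIdx ρ K) :
    (Λ.lowStrand i).Good Λ.lowL Λ.lowB (PathIdx.width K) := by
  refine PathIdx.strand_good hK (Λ.fat_lowCell i) ?_
  rcases i with ⟨r, i⟩ | ⟨r, i⟩ | ⟨c, i⟩ | c
  · simp [PathIdx.shape]
  · simp [PathIdx.shape]
  · exact fun _ => Λ.clear_link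
  · exact fun _ => Λ.clear_spoke

/-- The only curves that meet in the drawing with few crossings. -/
def Special (i j : PathIdx ρ K) : Prop := ∃ c x, i = .spoke c ∧ j = .primal Λ.e₀ x

lemma compat_primal_dual (r r' : ρ) (x y : Fin K) :
    (Λ.lowStrand (.primal r x)).Compat Λ.lowL Λ.lowB (Λ.lowStrand (.dual r' y)) :=
  ⟨fun _ h => (h rfl).elim, fun h _ => (h rfl).elim, fun _ _ => Or.inl (Λ.pq_pcell_qcell r r'),
    fun h _ => (h rfl).elim,
    fun h _ => ((Λ.pq_pcell_qcell r r').1.ne (Λ.fat_pcell r) h).elim⟩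

lemma compat_primal_link (r : ρ) (c : Bool) (x y : Fin K) :
    (Λ.lowStrand (.primal r x)).Compat Λ.lowL Λ.lowB (Λ.lowStrand (.link c y)) :=
  ⟨fun _ _ => Or.inl (Λ.pp_pcell_link r), fun h _ => (h rfl).elim,
    fun _ _ => Or.inl (Λ.pq_pcell_link r), fun h _ => (h rfl).elim,
    fun h _ => ((Λ.pq_pcell_link r).1.ne (Λ.fat_pcell r) h).elim⟩

lemma compat_primal_spoke {r : ρ} (hr : r ≠ Λ.e₀) (c : Bool) (x : Fin K) :
    (Λ.lowStrand (.primal r x)).Compat Λ.lowL Λ.lowB (Λ.lowStrand (.spoke c : PathIdx ρ K)) :=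
  ⟨fun _ _ => Or.inl (Λ.pp_pcell_spoke hr), fun h _ => (h rfl).elim,
    fun _ _ => Or.inl (Λ.pq_pcell_spoke r), fun h _ => (h rfl).elim,
    fun h _ => ((Λ.pq_pcell_spoke r).1.ne (Λ.fat_pcell r) h).elim⟩

lemma compat_link_dual (r : ρ) (c : Bool) (x y : Fin K) :
    (Λ.lowStrand (.link c y)).Compat Λ.lowL Λ.lowB (Λ.lowStrand (.dual r x)) :=
  ⟨fun _ h => (h rfl).elim, fun _ _ => Or.inl (Λ.qq_qcell_link r).symm,
    fun _ _ => Or.inl (Λ.pq_link_qcell r), fun _ h => (h rfl).elim,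
    fun h _ => ((Λ.pq_link_qcell r).1.ne Λ.fat_linkCell h).elim⟩

lemma compat_spoke_dual (r : ρ) (c : Bool) (x : Fin K) :
    (Λ.lowStrand (.spoke c : PathIdx ρ K)).Compat Λ.lowL Λ.lowB (Λ.lowStrand (.dual r x)) :=
  ⟨fun _ h => (h rfl).elim, fun _ _ => Or.inl (Λ.qq_qcell_spoke r).symm,
    fun _ _ => Or.inl (Λ.pq_spoke_qcell r), fun _ h => (h rfl).elim,
    fun h _ => ((Λ.pq_spoke_qcell r).1.ne Λ.fat_spokeCell h).elim⟩

lemma compat_link_spoke (c c' : Bool) (x : Fin K) :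
    (Λ.lowStrand (.link c x)).Compat Λ.lowL Λ.lowB (Λ.lowStrand (.spoke c' : PathIdx ρ K)) :=
  ⟨fun _ _ => Or.inl Λ.pp_link_spoke, fun _ _ => Or.inl Λ.qq_link_spoke,
    fun _ _ => Or.inl Λ.pq_link_spoke, fun _ _ => Or.inl Λ.pq_spoke_link,
    fun h _ => (Λ.pq_link_spoke.1.ne Λ.fat_linkCell h).elim⟩

lemma low_compat (hK : 1 ≤ K) {i j : PathIdx ρ K} (hij : i ≠ j) (h : ¬ Λ.Special i j)
    (h' : ¬ Λ.Special j i) : (Λ.lowStrand i).Compat Λ.lowL Λ.lowB (Λ.lowStrand j) := by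
  have hstraight : ∀ {i j : PathIdx ρ K}, i.IsStraight → j.IsStraight →
      (¬ (Λ.lowStrand i).Straight ∨ ¬ (Λ.lowStrand j).Straight) → False := by
    rintro i j hi hj (h | h)
    exacts [h hi, h hj]
  rcases i with ⟨r, x⟩ | ⟨r, x⟩ | ⟨c, x⟩ | c <;> rcases j with ⟨r', y⟩ | ⟨r', y⟩ | ⟨c', y⟩ | c'
  · by_cases hr : r = r'
    · subst hr
      refine PathIdx.strand_compat hK hij rfl ?_ ?_ ?_ ?_ fun h _ => ?_
      · rintro r x r' y ⟨⟩ ⟨⟩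
        rfl
      · rintro r x r' y ⟨⟩
      · rintro c x c' ⟨⟩
      · rintro c x c' ⟨⟩
      · simp [PathIdx.shape] at h
    · exact ⟨fun _ _ => Or.inl (Λ.pp_pcell hr), fun h _ => (h rfl).elim, fun _ h => (h rfl).elim,
        fun h _ => (h rfl).elim, fun _ h => (hstraight (Or.inl rfl) (Or.inl rfl) h).elim⟩
  · exact Λ.compat_primal_dual r r' x y
  · exact Λ.compat_primal_link r c' x y
  · exact Λ.compat_primal_spoke (fun e => h' ⟨c', x, rfl, by rw [e]⟩) c' x
  · exact (Λ.compat_primal_dual r' r y x).symm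
  · by_cases hr : r = r'
    · subst hr
      refine PathIdx.strand_compat hK hij rfl ?_ ?_ ?_ ?_ fun _ h => ?_
      · rintro r x r' y ⟨⟩
      · rintro r x r' y ⟨⟩ ⟨⟩
        rfl
      · rintro c x c' ⟨⟩
      · rintro c x c' ⟨⟩
      · simp [PathIdx.shape] at h
    · exact ⟨fun h _ => (h rfl).elim, fun _ _ => Or.inl (Λ.qq_qcell hr), fun h _ => (h rfl).elim,
        fun _ h => (h rfl).elim, fun _ h => (hstraight (Or.inr rfl) (Or.inr rfl) h).elim⟩
  · exact (Λ.compat_link_dual r c' x y).symm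
  · exact (Λ.compat_spoke_dual r c' x).symm
  · exact (Λ.compat_primal_link r' c y x).symm
  · exact Λ.compat_link_dual r' c y x
  · exact PathIdx.strand_compat hK hij rfl (by rintro r x r' y ⟨⟩) (by rintro r x r' y ⟨⟩)
      (by rintro c x c' - ⟨⟩) (by rintro c x c' - ⟨⟩) fun _ _ => Λ.clear_link
  · exact Λ.compat_link_spoke c c' x
  · exact (Λ.compat_primal_spoke (fun e => h ⟨c, y, rfl, by rw [e]⟩) c y).symm
  · exact Λ.compat_spoke_dual r' c y
  · exact (Λ.compat_link_spoke c' c y).symm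
  · exact PathIdx.strand_compat hK hij rfl (by rintro r x r' y ⟨⟩) (by rintro r x r' y ⟨⟩)
      (by rintro c x c' ⟨⟩) (by rintro c x c' ⟨⟩) fun _ _ => Λ.clear_spoke

/-- The curve of a path in the drawing with few crossings. -/
def low (i : PathIdx ρ K) (t : ℝ) : ℝ × ℝ :=
  (Λ.lowStrand i).curve Λ.lowL Λ.lowB (PathIdx.width K) t

lemma low_zero (hK : 1 ≤ K) (J : Type) (i : PathIdx ρ K) :
    ∃ b, (Λ.frame J).src i = .inl b ∧ Λ.low i 0 = Λ.lowPos b := by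
  have e := Strand.curve_zero Λ.lowL Λ.lowB (PathIdx.width_pos hK) (width_le hK) (Λ.low_good hK i).fat
  rcases i with ⟨r, i⟩ | ⟨r, i⟩ | ⟨c, i⟩ | c
  · refine ⟨_, rfl, e.trans ?_⟩
    have h : (Λ.pcell r).tl = (Λ.cell r).tl := by
      unfold pcell
      split_ifs with h
      · rw [h, Λ.cell_e₀]
      · rfl
    simp only [lowStrand, PathIdx.strand, PathIdx.shape, lowCell, h, Λ.lowL_tl]
    rfl
  · refine ⟨_, rfl, e.trans ?_⟩
    have h : (Λ.qcell r).lf = Λ.up (Λ.cell r).lf := by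
      unfold qcell
      split_ifs with h
      · rw [h, Λ.cell_e₀]
      · rfl
    simp only [lowStrand, PathIdx.strand, PathIdx.shape, lowCell, h, Λ.lowB_up]
    rfl
  · refine ⟨_, rfl, e.trans ?_⟩
    simp only [lowStrand, PathIdx.strand, PathIdx.shape, lowCell, linkCell, Λ.lowL_1]
    rfl
  · refine ⟨_, rfl, e.trans ?_⟩
    simp only [lowStrand, PathIdx.strand, PathIdx.shape, lowCell, spokeCell, Λ.lowL_2]
    rfl

lemma low_one (hK : 1 ≤ K) (J : Type) (i : PathIdx ρ K) :
    ∃ b, (Λ.frame J).tgt i = .inl b ∧ Λ.low i 1 = Λ.lowPos b := by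
  have e := Strand.curve_one Λ.lowL Λ.lowB (PathIdx.width_pos hK) (width_le hK) (Λ.low_good hK i).fat
  rcases i with ⟨r, i⟩ | ⟨r, i⟩ | ⟨- | -, i⟩ | - | -
  · refine ⟨_, rfl, e.trans ?_⟩
    have h : (Λ.pcell r).hd = (Λ.cell r).hd := by
      unfold pcell
      split_ifs with h
      · rw [h, Λ.cell_e₀]
      · rfl
    simp only [lowStrand, PathIdx.strand, PathIdx.shape, lowCell, h, Λ.lowL_hd]
    rfl
  · refine ⟨_, rfl, e.trans ?_⟩
    have h : (Λ.qcell r).rt = Λ.up (Λ.cell r).rt := by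
      unfold qcell
      split_ifs with h
      · rw [h, Λ.cell_e₀]
      · rfl
    simp only [lowStrand, PathIdx.strand, PathIdx.shape, lowCell, h, Λ.lowB_up]
    rfl
  · refine ⟨_, rfl, e.trans ?_⟩
    simp only [lowStrand, PathIdx.strand, PathIdx.shape, lowCell, linkCell, Λ.lowB_up]
    rfl
  · refine ⟨_, rfl, e.trans ?_⟩
    simp only [lowStrand, PathIdx.strand, PathIdx.shape, lowCell, linkCell, linkFace, lowPos, face,
      Λ.lowB_neg_one, Λ.up_fz]
  · refine ⟨_, rfl, e.trans ?_⟩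
    simp only [lowStrand, PathIdx.strand, PathIdx.shape, lowCell, spokeCell, Λ.lowB_up]
    rfl
  · refine ⟨_, rfl, e.trans ?_⟩
    simp only [lowStrand, PathIdx.strand, PathIdx.shape, lowCell, spokeCell, Λ.lowB_up]
    rfl

lemma low_exists (hK : 1 ≤ K) (b : Λ.Pt) : ∃ i : PathIdx ρ K,
    ∃ e : ℝ, (e = 0 ∨ e = 1) ∧ Λ.low i e = Λ.lowPos b := by
  rcases b with v | f
  · obtain ⟨r, hr, hv⟩ := Λ.exists_tl v v.2.1 v.2.2
    refine ⟨.primal r ⟨0, hK⟩, ?_⟩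
    rcases hv with hv | hv
    · obtain ⟨b, hb, e⟩ := Λ.low_zero hK PUnit (.primal r ⟨0, hK⟩)
      obtain rfl : _ = b := Sum.inl_injective hb
      exact ⟨0, Or.inl rfl, e.trans (congrArg Λ.lowPos (congrArg Sum.inl (Subtype.ext hv.symm)))⟩
    · obtain ⟨b, hb, e⟩ := Λ.low_one hK PUnit (.primal r ⟨0, hK⟩)
      obtain rfl : _ = b := Sum.inl_injective hb
      exact ⟨1, Or.inr rfl, e.trans (congrArg Λ.lowPos (congrArg Sum.inl (Subtype.ext hv.symm)))⟩
  · obtain ⟨r, hr, hv⟩ := Λ.exists_lf f f.2.1 f.2.2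
    refine ⟨.dual r ⟨0, hK⟩, ?_⟩
    rcases hv with hv | hv
    · obtain ⟨b, hb, e⟩ := Λ.low_zero hK PUnit (.dual r ⟨0, hK⟩)
      obtain rfl : _ = b := Sum.inl_injective hb
      exact ⟨0, Or.inl rfl, e.trans (congrArg Λ.lowPos (congrArg Sum.inr (Subtype.ext hv.symm)))⟩
    · obtain ⟨b, hb, e⟩ := Λ.low_one hK PUnit (.dual r ⟨0, hK⟩)
      obtain rfl : _ = b := Sum.inl_injective hb
      exact ⟨1, Or.inr rfl, e.trans (congrArg Λ.lowPos (congrArg Sum.inr (Subtype.ext hv.symm)))⟩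

lemma low_ne (hK : 1 ≤ K) {i j : PathIdx ρ K} (hij : i ≠ j) (h : ¬ Λ.Special i j)
    (h' : ¬ Λ.Special j i) {t t' : ℝ} (ht : t ∈ Ioo (0:ℝ) 1) (ht' : t' ∈ Icc (0:ℝ) 1) :
    Λ.low i t ≠ Λ.low j t' := by
  intro e
  obtain ⟨h1, h2, h3, h4, -⟩ := Strand.curve_meet (PathIdx.width_pos hK) (width_le hK)
    (Λ.low_good hK i) (Λ.low_good hK j) (Λ.low_compat hK hij h h') ht ht' e
  have h4 : Λ.lowCell i = Λ.lowCell j := h4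
  rcases i with ⟨r, x⟩ | ⟨r, x⟩ | ⟨c, x⟩ | c <;> rcases j with ⟨r', y⟩ | ⟨r', y⟩ | ⟨c', y⟩ | c'
  case primal.primal => exact h3 rfl
  case dual.dual => exact h3 rfl
  case primal.dual => exact (Λ.pq_pcell_qcell r r').1.ne (Λ.fat_pcell r) h4
  case dual.primal => exact (Λ.pq_pcell_qcell r' r).1.ne (Λ.fat_pcell r') h4.symm
  all_goals simp [lowStrand, Strand.Straight, PathIdx.strand, PathIdx.shape] at h1 h2

/-- The horizontal position of the vertical part of a spoke. -/
def spokeX (K : ℕ) (c : Bool) : ℝ :=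
  Λ.spokeCell.xpos (Λ.lowStrand (.spoke c : PathIdx ρ K)).poff

set_option maxHeartbeats 1000000 in
lemma low_special (hK : 1 ≤ K) (c : Bool) (x : Fin K) {t t' : ℝ} (ht : t ∈ Icc (0:ℝ) 1)
    (ht' : t' ∈ Icc (0:ℝ) 1)
    (e : Λ.low (.primal Λ.e₀ x) t = Λ.low (.spoke c : PathIdx ρ K) t') :
    0 < t' ∧ t' < 1 ∧ ∃ s : ℝ, 0 < s ∧ s < 1 ∧ Λ.H * t = 2 + PathIdx.width K * (1 - s) ∧
      0 < Λ.spokeX K c - (Λ.L 2 + 1 / 2) ∧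
      (Λ.spokeX K c - (Λ.L 2 + 1 / 2)) * s = Λ.spokeX K c - (Λ.W + ((x:ℝ) + 1 / 3) / K) := by
  have h0 := PathIdx.width_pos hK
  have h1 := width_le hK
  have hH : (3:ℝ) ≤ Λ.H := by exact_mod_cast Λ.three_le
  have hb := Λ.bounds
  have hL2 : (Λ.L 2 : ℝ) + 1 ≤ Λ.W := by exact_mod_cast hb.2.2.2.2.2.2.2.2.2.1.2
  have hfu : (Λ.W : ℝ) + 2 ≤ Λ.up Λ.fu := by exact_mod_cast hb.2.2.2.2.2.1
  set S := Λ.lowStrand (.spoke c : PathIdx ρ K) with hS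
  set E := Λ.lowStrand (.primal Λ.e₀ x : PathIdx ρ K) with hE
  have gS := Λ.low_good hK (.spoke c)
  have gE := Λ.low_good hK (.primal Λ.e₀ x)
  rw [← hS] at gS
  rw [← hE] at gE
  have cE : E.cell = ⟨0, Λ.H, Λ.W, Λ.W + 1⟩ := if_pos rfl
  have cS : S.cell = ⟨2, Λ.H + 2, Λ.up Λ.fu, Λ.up Λ.W⟩ := rfl
  have curveE : Λ.low (.primal Λ.e₀ x) t = pc Λ.lowL (PathIdx.width K) E.cell E.off t := rfl
  have oE : E.off = ((x:ℝ) + 1 / 3) / K := rfl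
  have oE1 : 0 < E.off ∧ E.off < 1 := ⟨by linarith [gE.lo], by linarith [gE.hi]⟩
  have hn : ¬ S.Straight := by simp [hS, lowStrand, Strand.Straight, PathIdx.strand, PathIdx.shape]
  have hoff : S.off ≤ 1 / 6 := by
    rcases PathIdx.off_bounds hK (.spoke c : PathIdx ρ K) with ⟨h, -⟩ | ⟨-, -, h⟩
    · simp [PathIdx.shape] at h
    · refine le_trans h ?_
      have hK' : (1:ℝ) ≤ K := by exact_mod_cast hK
      rw [div_le_div_iff₀ (by positivity) (by norm_num)]
      linarith
  have hX : (Λ.W : ℝ) + 2 < Λ.spokeX K c := by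
    have hp := gS.poff_mem
    have := Cell.ypos_mem_Ioo (c := Λ.spokeCell.swap) Λ.fat_spokeCell.2
      (t := S.poff) ⟨by linarith [hp.1], by linarith [hp.2]⟩
    exact hfu.trans_lt this.1
  rw [curveE] at e
  rcases Strand.curve_part h0 gS ht' with ⟨-, w, hw, -, e', -, h4⟩ | ⟨-, w, hw, -, e', -⟩
  · obtain ⟨h5, h6, h7⟩ := h4 hn
    have e' : Λ.low (.spoke c) t' = pc Λ.lowL (PathIdx.width K) S.cell S.poff w := e'
    rw [e'] at e
    have ey : (Λ.H : ℝ) * t = 2 + Λ.H * w := by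
      have := congrArg Prod.snd e
      simp only [pc, Cell.ypos, cE, cS] at this
      push_cast at this
      linarith
    have ex := congrArg Prod.fst e
    have wy : 2 + Λ.H * w ≤ (Λ.H : ℝ) - PathIdx.width K := by nlinarith [hw.1]
    rcases bend_cases h0 h1 Λ.lowL gE.fat.1 (E.cell.xpos E.off) (E.cell.ypos_mem gE.fat.1 ht) with
      ⟨n, hn', s, hs0, hs1, hs, -⟩ | ⟨-, -, f1⟩
    · exfalso
      have hys : E.cell.ypos t = 2 + Λ.H * w := by
        rw [← ey, cE]; simp [Cell.ypos]
      rw [hys] at hs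
      have h9 := hw.1
      rw [cE] at hn'
      rcases hn' with rfl | rfl
      · have := le_abs_self (2 + Λ.H * w - ((0:ℤ):ℝ))
        push_cast at this hs
        nlinarith
      · have := neg_abs_le (2 + Λ.H * w - (Λ.H:ℝ))
        simp only at hs
        nlinarith
    · rcases bend_cases h0 h1 Λ.lowL gS.fat.1 (S.cell.xpos S.poff) (S.cell.ypos_mem gS.fat.1 hw) with
        ⟨n, hn', s, hs0, hs1, hs, f2⟩ | ⟨-, -, f2⟩
      · have hys : S.cell.ypos w = 2 + Λ.H * w := by
          rw [cS]; simp [Cell.ypos]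
        rw [hys] at hs
        have h9 := hw.1
        have exx : Λ.W + E.off = Λ.spokeX K c + (Λ.lowL n + 1 / 2 - Λ.spokeX K c) * s := by
          have h10 := f1.symm.trans (ex.trans f2)
          have h11 : E.cell.xpos E.off = Λ.W + E.off := by rw [cE]; simp [Cell.xpos]
          rw [h11] at h10
          exact h10
        rw [cS] at hn'
        rcases hn' with rfl | rfl
        · simp only [Λ.lowL_2] at exx
          have h12 : |2 + Λ.H * w - ((2:ℤ):ℝ)| = Λ.H * w := by
            rw [abs_of_nonneg] <;> push_cast <;> nlinarith
          simp only [h12] at hs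
          have hs' : s < 1 := by
            refine lt_of_le_of_ne hs1 ?_
            rintro rfl
            linarith
          have hw0 : 0 < w := by
            by_contra hcon
            have : w = 0 := le_antisymm (not_lt.1 hcon) h9
            rw [this, mul_zero] at hs
            nlinarith
          have ht0 : 0 < t' := by
            rcases lt_or_eq_of_le ht'.1 with h | h
            · exact h
            · rw [← h, mul_zero] at h7
              linarith
          refine ⟨ht0, by linarith, s, hs0, hs', by rw [ey, hs], by linarith, ?_⟩
          rw [← oE]
          linarith
        · exfalso
          have := neg_abs_le (2 + Λ.H * w - ((Λ.H + 2 : ℤ):ℝ))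
          simp only at hs
          push_cast at hs this
          nlinarith
      · exfalso
        have h10 := f1.symm.trans (ex.trans f2)
        have h11 : E.cell.xpos E.off = Λ.W + E.off := by rw [cE]; simp [Cell.xpos]
        rw [h11] at h10
        have h12 : S.cell.xpos S.poff = Λ.spokeX K c := rfl
        linarith
  · exfalso
    have e' : Λ.low (.spoke c) t' = qc Λ.lowB (PathIdx.width K) S.cell S.off w := e'
    rw [e'] at e
    have hpq : Cell.PQ Λ.lowL Λ.lowB E.cell S.cell := Λ.pq_pcell_spoke Λ.e₀
    have := (pc_qc_meet h0 h1 gE.fat gS.fat ⟨gE.lo, gE.hi⟩ ⟨gS.lo, gS.hi⟩ (Or.inl hpq) ht hw e).1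
    exact hpq.1.ne gE.fat this

lemma low_special_unique (hK : 1 ≤ K) {c : Bool} {x : Fin K} {t t' u u' : ℝ}
    (ht : t ∈ Icc (0:ℝ) 1) (ht' : t' ∈ Icc (0:ℝ) 1) (hu : u ∈ Icc (0:ℝ) 1) (hu' : u' ∈ Icc (0:ℝ) 1)
    (e : Λ.low (.primal Λ.e₀ x) t = Λ.low (.spoke c : PathIdx ρ K) t')
    (e' : Λ.low (.primal Λ.e₀ x) u = Λ.low (.spoke c : PathIdx ρ K) u') : t = u ∧ t' = u' := by
  obtain ⟨-, -, s, -, -, h1, h2, h3⟩ := Λ.low_special hK c x ht ht' e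
  obtain ⟨-, -, s', -, -, h1', -, h3'⟩ := Λ.low_special hK c x hu hu' e'
  have hs : s = s' := mul_left_cancel₀ h2.ne' (h3.trans h3'.symm)
  subst hs
  have htu : t = u := mul_left_cancel₀ Λ.H_pos.ne' (h1.trans h1'.symm)
  subst htu
  exact ⟨rfl, Strand.curve_injOn (PathIdx.width_pos hK) (width_le hK) (Λ.low_good hK (.spoke c))
    ht' hu' (e.symm.trans e')⟩

open Classical in
/-- The crossing of a spoke with a vertical curve of the outer edge. -/
def lowCrossing (K : ℕ) (p : Bool × Fin K) : ℝ × ℝ :=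
  if h : ∃ t ∈ Icc (0:ℝ) 1, ∃ t' ∈ Icc (0:ℝ) 1,
    Λ.low (.primal Λ.e₀ p.2) t = Λ.low (.spoke p.1 : PathIdx ρ K) t'
  then Λ.low (.primal Λ.e₀ p.2) h.choose else 0

lemma low_eq_lowCrossing (hK : 1 ≤ K) {c : Bool} {x : Fin K} {t t' : ℝ}
    (ht : t ∈ Icc (0:ℝ) 1) (ht' : t' ∈ Icc (0:ℝ) 1)
    (e : Λ.low (.primal Λ.e₀ x) t = Λ.low (.spoke c : PathIdx ρ K) t') :
    Λ.low (.primal Λ.e₀ x) t = Λ.lowCrossing K (c, x) := by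
  have h : ∃ t ∈ Icc (0:ℝ) 1, ∃ t' ∈ Icc (0:ℝ) 1,
    Λ.low (.primal Λ.e₀ x) t = Λ.low (.spoke c : PathIdx ρ K) t' := ⟨t, ht, t', ht', e⟩
  obtain ⟨hu, u', hu', e'⟩ := h.choose_spec
  rw [lowCrossing, dif_pos h, (Λ.low_special_unique hK ht ht' hu hu' e e').1]

theorem exists_few_crossings [Finite ρ] (J : Type) [Finite J] {k : ℕ} (hk : 1 ≤ k)
    (hk1 : k = 1 → K = 1) (hK : K = k * k) :
    ∃ Γ : Drawing ((Λ.frame J).system k K hk hk1).graph, Γ.crossings ≤ 2 * K := by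
  have := Fintype.ofFinite ρ
  have hK1 : 1 ≤ K := hK ▸ Nat.mul_pos hk hk
  have h0 := PathIdx.width_pos hK1
  have h1 := width_le hK1
  have hcases : ∀ {i j : PathIdx ρ K}, i ≠ j → ∀ {t}, t ∈ Ioo (0:ℝ) 1 → ∀ {t'}, t' ∈ Icc (0:ℝ) 1 →
      Λ.low i t = Λ.low j t' → Λ.Special i j ∨ Λ.Special j i := by
    intro i j hij t ht t' ht' e
    by_contra! h
    exact Λ.low_ne hK1 hij h.1 h.2 ht ht' e
  have inner : ∀ {c : Bool} {x : Fin K} {t t' : ℝ}, t ∈ Icc (0:ℝ) 1 → t' ∈ Icc (0:ℝ) 1 →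
      Λ.low (.primal Λ.e₀ x) t = Λ.low (.spoke c : PathIdx ρ K) t' →
      t ∈ Ioo (0:ℝ) 1 ∧ t' ∈ Ioo (0:ℝ) 1 ∧ (∀ m : ℕ, t * k ≠ m) ∧ ∀ m : ℕ, t' ≠ m := by
    intro c x t t' ht ht' e
    obtain ⟨a1, a2, s, a3, a4, a5, -⟩ := Λ.low_special hK1 c x ht ht' e
    have hH : (3:ℝ) ≤ Λ.H := by exact_mod_cast Λ.three_le
    have b1 : 0 < PathIdx.width K * (1 - s) := mul_pos h0 (by linarith)
    have b2 : PathIdx.width K * (1 - s) < PathIdx.width K := by nlinarith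
    refine ⟨⟨by nlinarith, by nlinarith⟩, ⟨a1, a2⟩, fun m hm => ?_, fun m hm => ?_⟩
    · have hk0 : (1:ℝ) ≤ k := by exact_mod_cast hk
      have c1 : (m:ℝ) * Λ.H = k * 2 + k * (PathIdx.width K * (1 - s)) := by
        rw [← hm]
        linear_combination (k:ℝ) * a5
      have c2 : k * PathIdx.width K < 1 := by
        have hKR : (K:ℝ) = k * k := by exact_mod_cast hK
        unfold PathIdx.width
        rw [hKR, mul_one_div, div_lt_one (by positivity)]
        nlinarith [mul_le_mul hk0 hk0 zero_le_one (by linarith), pow_le_pow_left₀ zero_le_one hk0 2,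
          one_le_pow₀ hk0 (n := 3)]
      have d1 : (k * 2 : ℤ) < m * Λ.H := by
        have : (k * 2 : ℝ) < m * Λ.H := by nlinarith
        exact_mod_cast this
      have d2 : m * Λ.H < (k * 2 + 1 : ℤ) := by
        have : (m : ℝ) * Λ.H < k * 2 + 1 := by nlinarith
        exact_mod_cast this
      omega
    · rw [hm] at a1 a2
      have : 0 < m := by exact_mod_cast a1
      have : m < 1 := by exact_mod_cast a2
      omega
  refine Exists.elim (((Λ.frame J).system k K hk hk1).exists_net Λ.lowPos Λ.lowPos_inj Λ.low
    (fun i => (Strand.curve_continuous h0 (Λ.low_good hK1 i)).continuousOn)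
    (fun i => Strand.curve_injOn h0 h1 (Λ.low_good hK1 i)) (Λ.low_zero hK1 J) (Λ.low_one hK1 J)
    PathIdx.colour ?_ ?_ (Λ.low_exists hK1)) fun Γ hΓ => ?_
  · intro i j hij t ht t' ht' e
    rcases hcases hij ht ht' e with ⟨c, x, rfl, rfl⟩ | ⟨c, x, rfl, rfl⟩
    · obtain ⟨a1, a2, a3, a4⟩ := inner ht' (Ioo_subset_Icc_self ht) e.symm
      refine ⟨a1, by simp [PathIdx.colour, PathIdx.shape], fun m => ?_⟩
      change t * ((1:ℕ):ℝ) ≠ m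
      simpa using a4 m
    · obtain ⟨a1, a2, a3, a4⟩ := inner (Ioo_subset_Icc_self ht) ht' e
      exact ⟨a2, by simp [PathIdx.colour, PathIdx.shape], a3⟩
  · intro i j hij t ht t' ht' x hx x' hx' e e'
    have ht := Ioo_subset_Icc_self ht
    have ht' := Ioo_subset_Icc_self ht'
    have hx2 := Ioo_subset_Icc_self hx
    have hx' := Ioo_subset_Icc_self hx'
    rcases hcases hij hx hx' e' with ⟨c, x, rfl, rfl⟩ | ⟨c, x, rfl, rfl⟩
    · exact (Λ.low_special_unique hK1 ht' ht hx' hx2 e.symm e'.symm).2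
    · exact (Λ.low_special_unique hK1 ht ht' hx2 hx' e e').1
  · refine ⟨Γ.drawing, (Γ.crossings_le Finset.univ (Λ.lowCrossing K) ?_).trans (by simp)⟩
    intro i j hij x hx x' hx' e
    rw [hΓ] at e ⊢
    have hx' := Ioo_subset_Icc_self hx'
    rcases hcases hij hx hx' e with ⟨c, y, rfl, rfl⟩ | ⟨c, y, rfl, rfl⟩
    · exact ⟨(c, y), Finset.mem_univ _, e.trans
        (Λ.low_eq_lowCrossing hK1 hx' (Ioo_subset_Icc_self hx) e.symm)⟩
    · exact ⟨(c, y), Finset.mem_univ _,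
        Λ.low_eq_lowCrossing hK1 (Ioo_subset_Icc_self hx) hx' e⟩

end Layout

/-- A cell with natural coordinates. -/
structure Quad where
  tl : ℕ
  hd : ℕ
  lf : ℕ
  rt : ℕ

namespace Quad

/-- The curves of `c` pass beside `c'`. -/
def Near (L B : ℕ → ℕ) (c c' : Quad) : Prop :=
  (c.hd ≤ c'.tl ∨ c'.hd ≤ c.tl ∨ c.rt ≤ c'.lf ∨ c'.rt ≤ c.lf) ∧
  (∀ v ∈ [c.tl, c.hd], c'.tl < v → v < c'.hd →
    (c'.rt ≤ c.lf ∧ c'.rt ≤ L v) ∨ (c.rt ≤ c'.lf ∧ L v < c'.lf)) ∧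
  ∀ f ∈ [c.lf, c.rt], c'.lf < f → f < c'.rt →
    (c'.hd ≤ c.tl ∧ c'.hd ≤ B f) ∨ (c.hd ≤ c'.tl ∧ B f < c'.tl)

/-- The vertical curves of `c` do not meet the horizontal curves of `c'` near their ends. -/
def Clear (L B : ℕ → ℕ) (c c' : Quad) : Prop :=
  ∀ v ∈ [c.tl, c.hd], ∀ f ∈ [c'.lf, c'.rt], (f ≤ c.lf ∧ f ≤ L v) ∨ (c.rt ≤ f ∧ L v < f) ∨
    (v ≤ c'.tl ∧ v ≤ B f) ∨ (c'.hd ≤ v ∧ B f < v)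

instance (L B : ℕ → ℕ) (c c' : Quad) : Decidable (Clear L B c c') := by
  unfold Clear; infer_instance

/-- A fast check of the condition `Near` for one curve. -/
def besideB (L : ℕ → ℕ) (v tl hd lf rt lf' rt' : ℕ) : Bool :=
  Nat.ble v tl || Nat.ble hd v || (Nat.ble rt lf' && Nat.ble rt (L v)) ||
    (Nat.ble rt' lf && Nat.ble (L v + 1) lf)

/-- A fast check of the condition `Clear` for one pair of curves. -/
def clearB (L B : ℕ → ℕ) (v f tl hd lf rt : ℕ) : Bool :=
  (Nat.ble f lf && Nat.ble f (L v)) || (Nat.ble rt f && Nat.ble (L v + 1) f) ||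
    (Nat.ble v tl && Nat.ble v (B f)) || (Nat.ble hd v && Nat.ble (B f + 1) v)

/-- A fast check of the conditions `Near` and `Clear` for cells with distinct ends and sides. -/
def okB (L B : ℕ → ℕ) : Quad → Quad → Bool
  | ⟨tl, hd, lf, rt⟩, ⟨tl', hd', lf', rt'⟩ =>
    (Nat.ble hd tl' || Nat.ble hd' tl || Nat.ble rt lf' || Nat.ble rt' lf) &&
    besideB L tl tl' hd' lf' rt' lf rt && besideB L hd tl' hd' lf' rt' lf rt &&
    besideB B lf lf' rt' tl' hd' tl hd && besideB B rt lf' rt' tl' hd' tl hd &&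
    clearB L B tl lf' tl' hd' lf rt && clearB L B tl rt' tl' hd' lf rt &&
    clearB L B hd lf' tl' hd' lf rt && clearB L B hd rt' tl' hd' lf rt &&
    (Nat.blt tl tl' || Nat.blt tl' tl || Nat.blt hd hd' || Nat.blt hd' hd) &&
    (Nat.blt lf lf' || Nat.blt lf' lf || Nat.blt rt rt' || Nat.blt rt' rt)

lemma near_clear_of_okB {L B : ℕ → ℕ} {c c' : Quad} (h : okB L B c c' = true) :
    c.Near L B c' ∧ c.Clear L B c' ∧ (c.tl ≠ c'.tl ∨ c.hd ≠ c'.hd) ∧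
      (c.lf ≠ c'.lf ∨ c.rt ≠ c'.rt) := by
  obtain ⟨tl, hd, lf, rt⟩ := c
  obtain ⟨tl', hd', lf', rt'⟩ := c'
  simp only [okB, besideB, clearB, Bool.and_eq_true, Bool.or_eq_true, Nat.ble_eq, Nat.blt_eq] at h
  simp only [Near, Clear, List.forall_mem_cons, List.not_mem_nil, false_imp_iff, implies_true,
    and_true]
  obtain ⟨⟨⟨⟨⟨⟨⟨⟨⟨⟨h1, h2⟩, h3⟩, h4⟩, h5⟩, h6⟩, h7⟩, h8⟩, h9⟩, h10⟩, h11⟩ := h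
  refine ⟨⟨?_, ⟨?_, ?_⟩, ?_, ?_⟩, ⟨⟨?_, ?_⟩, ?_, ?_⟩, ?_, ?_⟩
  · clear h2 h3 h4 h5 h6 h7 h8 h9 h10 h11; omega
  · clear h1 h3 h4 h5 h6 h7 h8 h9 h10 h11; omega
  · clear h2 h1 h4 h5 h6 h7 h8 h9 h10 h11; omega
  · clear h2 h3 h1 h5 h6 h7 h8 h9 h10 h11; omega
  · clear h2 h3 h4 h1 h6 h7 h8 h9 h10 h11; omega
  · clear h2 h3 h4 h5 h1 h7 h8 h9 h10 h11; omega
  · clear h2 h3 h4 h5 h6 h1 h8 h9 h10 h11; omega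
  · clear h2 h3 h4 h5 h6 h7 h1 h9 h10 h11; omega
  · clear h2 h3 h4 h5 h6 h7 h8 h1 h10 h11; omega
  · clear h2 h3 h4 h5 h6 h7 h8 h9 h1 h11; omega
  · clear h2 h3 h4 h5 h6 h7 h8 h9 h10 h1; omega

/-- The incidences of the ends with the sides. -/
def flags (c : Quad) : List (ℕ × ℕ) := [(c.tl, c.lf), (c.tl, c.rt), (c.hd, c.lf), (c.hd, c.rt)]

end Quad

/-- The elements with an odd number of occurrences. -/
def oddPart : List (ℕ × ℕ) → List (ℕ × ℕ)
  | [] => []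
  | x :: l => if x ∈ oddPart l then (oddPart l).erase x else x :: oddPart l

lemma sum_oddPart (D : ℕ × ℕ → ZMod 2) (l : List (ℕ × ℕ)) :
    ((oddPart l).map D).sum = (l.map D).sum := by
  induction l with
  | nil => rfl
  | cons x l ih =>
    rw [oddPart]
    split_ifs with h
    · have h1 := ((List.perm_cons_erase h).map D).sum_eq
      rw [List.map_cons, List.sum_cons] at h1
      have h2 : (2 : ZMod 2) = 0 := by decide
      rw [List.map_cons, List.sum_cons, ← ih, h1]
      linear_combination -D x * h2
    · rw [List.map_cons, List.sum_cons, ih, List.map_cons, List.sum_cons]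

/-- The pairs that can be reached through triangles. -/
def reach (E : List (ℕ × ℕ)) : List (ℕ × ℕ × ℕ) → List (ℕ × ℕ) → List (ℕ × ℕ)
  | [], S => S
  | (x, y, z) :: l, S => reach E l
      (if ((x, y) ∈ E ∧ (y, z) ∈ E ∧ (x, z) ∈ E) ∧ ((x, y) ∈ S ∨ (y, z) ∈ S ∨ (x, z) ∈ S)
        then (x, y) :: (y, z) :: (x, z) :: S else S)

lemma of_mem_reach {E : List (ℕ × ℕ)} {P : ℕ × ℕ → Prop}
    (h : ∀ x y z, (x, y) ∈ E → (y, z) ∈ E → (x, z) ∈ E →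
      (P (x, y) ↔ P (y, z)) ∧ (P (y, z) ↔ P (x, z))) (l : List (ℕ × ℕ × ℕ)) :
    ∀ S : List (ℕ × ℕ), (∀ e ∈ S, P e) → ∀ e ∈ reach E l S, P e := by
  induction l with
  | nil => exact fun S hS => hS
  | cons t l ih =>
    obtain ⟨x, y, z⟩ := t
    intro S hS
    refine ih _ ?_
    split_ifs with hc
    · obtain ⟨⟨h1, h2, h3⟩, h4⟩ := hc
      obtain ⟨h5, h6⟩ := h x y z h1 h2 h3
      have h7 : P (y, z) := h4.elim (fun h => h5.1 (hS _ h))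
        fun h => h.elim (hS _) fun h => h6.2 (hS _ h)
      simp only [List.mem_cons]
      rintro e (rfl | rfl | rfl | he)
      exacts [h5.2 h7, h7, h6.1 h7, hS _ he]
    · exact hS

/-- A tiling of the region outside a stack of triangles: vertices `0, …, 24` and faces. -/
structure Table where
  ch : ℕ
  fz : ℕ
  fu : ℕ
  rows : List Quad
  Lt : List ℕ
  Bt : List ℕ

namespace Table

/-- The face left of a vertex. -/
def L (T : Table) (v : ℕ) : ℕ := T.Lt.getD v 0

/-- The vertex below a face. -/
def B (T : Table) (f : ℕ) : ℕ := T.Bt.getD f 0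

/-- The vertex pairs of the rows. -/
def pairs (T : Table) : List (ℕ × ℕ) := T.rows.map fun c => (c.tl, c.hd)

/-- All vertex pairs of a tiling with one vertex in the stack. -/
def edges (T : Table) : List (ℕ × ℕ) := (0, 24) :: (0, 2) :: (2, 24) :: (2, 23) :: (23, 24) :: T.pairs

/-- Enough triangles to connect all rows. -/
def triangles : List (ℕ × ℕ × ℕ) := [
  (0, 1, 3), (0, 1, 4), (0, 1, 5), (0, 1, 15), (0, 3, 4), (0, 4, 5), (0, 5, 7), (0, 5, 15),
  (0, 6, 7), (0, 6, 15), (0, 7, 15), (0, 10, 15), (1, 13, 15), (1, 13, 16), (1, 14, 15),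
  (1, 15, 16), (1, 15, 24), (1, 16, 24), (1, 17, 24), (1, 18, 24), (2, 10, 15), (2, 11, 15),
  (2, 12, 15), (2, 15, 21), (10, 11, 15), (11, 12, 15), (13, 14, 15), (15, 19, 21), (15, 19, 24),
  (15, 20, 24), (15, 21, 24), (17, 18, 24), (19, 20, 24), (0, 9, 10), (2, 9, 10), (0, 8, 9),
  (2, 8, 9), (2, 21, 22), (1, 16, 17), (1, 17, 18)]

/-- The vertices on the routes of length two between `x` and `y`. -/
def Via (T : Table) (x y : ℕ) (m : List ℕ) : Prop :=
  ((x, y) ∈ T.edges ∨ (y, x) ∈ T.edges) ∧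
    ∀ v ∈ m, ((x, v) ∈ T.edges ∨ (v, x) ∈ T.edges) ∧ ((y, v) ∈ T.edges ∨ (v, y) ∈ T.edges)

instance (T : Table) (x y : ℕ) (m : List ℕ) : Decidable (T.Via x y m) := by
  unfold Via; infer_instance

/-- The properties of a tiling that allow to insert a stack of triangles. -/
structure Good (T : Table) : Prop where
  param : 0 < T.fz ∧ T.fz < T.fu ∧ T.fu + 1 < T.ch ∧ T.L 0 = 0 ∧ T.L 1 = 0 ∧ T.L 2 = T.fu ∧
    T.L 23 = T.ch ∧ T.L 24 = 0 ∧
    T.B 0 = 0 ∧ T.B T.fu = 0 ∧ T.B T.ch = 22 ∧ T.B (T.ch + 1) = 2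
  L_lt : ∀ v < 23, T.L v < T.ch
  B_lt : ∀ f < T.ch + 2, T.B f < 23 ∧ (T.fu < f → 2 ≤ T.B f)
  row : ∀ c ∈ T.rows, (c.tl < c.hd ∧ c.lf < c.rt) ∧ (c.tl < 23 ∧ c.hd ≤ 24 ∧ c.rt ≤ T.ch + 1) ∧
    (c.rt = T.ch + 1 → c.hd ≤ 23) ∧ (c.hd = 23 → T.ch ≤ c.lf) ∧ (2 ≤ c.tl ∨ c.rt ≤ T.fu) ∧
    (c.tl = 2 → c.hd < 23) ∧ (c.tl = 0 → c.hd < 23 ∧ c.hd ≠ 2) ∧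
    (c.tl < 1 → 1 < c.hd → 0 < c.lf)
  above : ∀ c ∈ T.rows, ∀ f ∈ [T.fz, T.fu], c.lf < f → f < c.rt → T.B f < c.tl
  clear : ∀ c ∈ T.rows, c.Clear T.L T.B c
  pair : T.rows.Pairwise fun c c' =>
    c.okB T.L T.B c' = true ∧ c'.okB T.L T.B c = true
  exists_tl : ∀ v < 23, ∃ c ∈ T.rows, v = c.tl ∨ v = c.hd
  exists_lf : ∀ f < T.ch + 2, ∃ c ∈ T.rows, f = c.lf ∨ f = c.rt
  az : ∃ c ∈ T.rows, c.tl = 0 ∧ c.hd = 1 ∧ c.lf = 0 ∧ c.rt = T.fz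
  zb : ∃ c ∈ T.rows, c.tl = 1 ∧ c.hd = 24 ∧ c.lf = 0
  link : ∃ c ∈ T.rows, c.tl = 1 ∧ c.hd = 3 ∧ c.rt = T.fz
  spoke : ∃ c ∈ T.rows, c.tl = 2 ∧ c.hd = 8 ∧ c.lf = T.fu
  star : oddPart ((0, 0) :: (0, T.fu) :: (2, T.fu) :: (2, T.ch + 1) :: (24, 0) :: (24, T.ch) ::
    (23, T.ch) :: (23, T.ch + 1) :: T.rows.flatMap Quad.flags) = []
  conn : ∀ e ∈ T.pairs, e ∈ reach T.pairs triangles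
    [(0, 1), (22, 23), (22, 24), (2, 22)]
  below : (22, 23) ∈ T.pairs ∧ (22, 24) ∈ T.pairs ∧ (2, 22) ∈ T.pairs
  via : T.Via 1 0 [3, 4, 5] ∧ T.Via 1 24 [16, 17, 18] ∧ T.Via 2 0 [8, 9, 10] ∧
    T.Via 2 24 [21, 22, 23] ∧ T.Via 0 15 [6, 7] ∧ T.Via 24 15 [19, 20] ∧ T.Via 1 15 [13, 14] ∧
    T.Via 2 15 [11, 12]

end Table

/-- The three tilings. -/
def table : Fin 3 → Table
  | 0 => ⟨42, 15, 26, [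
      ⟨0, 1, 0, 15⟩, ⟨0, 3, 15, 16⟩, ⟨0, 4, 16, 17⟩, ⟨0, 5, 17, 19⟩, ⟨0, 6, 20, 22⟩,
      ⟨0, 7, 19, 20⟩, ⟨0, 8, 25, 26⟩, ⟨0, 9, 24, 25⟩, ⟨0, 10, 23, 24⟩, ⟨0, 15, 22, 23⟩,
      ⟨1, 3, 14, 15⟩, ⟨1, 4, 13, 14⟩, ⟨1, 5, 12, 13⟩, ⟨1, 13, 6, 10⟩, ⟨1, 14, 10, 11⟩,
      ⟨1, 15, 11, 12⟩, ⟨1, 16, 4, 6⟩, ⟨1, 17, 2, 4⟩, ⟨1, 18, 1, 2⟩, ⟨1, 24, 0, 1⟩, ⟨2, 8, 26, 27⟩,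
      ⟨2, 9, 27, 28⟩, ⟨2, 10, 28, 31⟩, ⟨2, 11, 31, 32⟩, ⟨2, 12, 32, 33⟩, ⟨2, 15, 33, 40⟩,
      ⟨2, 21, 40, 41⟩, ⟨2, 22, 41, 43⟩, ⟨3, 4, 14, 16⟩, ⟨4, 5, 13, 17⟩, ⟨5, 7, 18, 19⟩,
      ⟨5, 15, 12, 18⟩, ⟨6, 7, 20, 21⟩, ⟨6, 15, 21, 22⟩, ⟨7, 15, 18, 21⟩, ⟨8, 9, 25, 27⟩,
      ⟨9, 10, 24, 28⟩, ⟨10, 11, 29, 31⟩, ⟨10, 15, 23, 29⟩, ⟨11, 12, 30, 32⟩, ⟨11, 15, 29, 30⟩,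
      ⟨12, 15, 30, 33⟩, ⟨13, 14, 9, 10⟩, ⟨13, 15, 7, 9⟩, ⟨13, 16, 6, 7⟩, ⟨14, 15, 9, 11⟩,
      ⟨15, 16, 7, 8⟩, ⟨15, 19, 35, 39⟩, ⟨15, 20, 34, 35⟩, ⟨15, 21, 39, 40⟩, ⟨15, 24, 8, 34⟩,
      ⟨16, 17, 4, 5⟩, ⟨16, 24, 5, 8⟩, ⟨17, 18, 2, 3⟩, ⟨17, 24, 3, 5⟩, ⟨18, 24, 1, 3⟩,
      ⟨19, 20, 35, 36⟩, ⟨19, 21, 37, 39⟩, ⟨19, 24, 36, 37⟩, ⟨20, 24, 34, 36⟩, ⟨21, 22, 38, 41⟩,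
      ⟨21, 24, 37, 38⟩, ⟨22, 23, 42, 43⟩, ⟨22, 24, 38, 42⟩],
      [
      0, 0, 26, 14, 13, 12, 20, 18, 25, 24, 23, 29, 30, 6, 9, 7, 4, 2, 1, 35, 34, 37, 38, 42],
      [
      0, 1, 1, 17, 1, 16, 1, 13, 15, 13, 1, 1, 1, 1, 1, 0, 0, 0, 5, 0, 0, 6, 0, 0, 0, 0, 0, 2, 2,
      10, 11, 2, 2, 2, 15, 15, 19, 19, 21, 15, 2, 2, 22, 2]⟩
  | 1 => ⟨41, 14, 25, [
      ⟨0, 1, 0, 14⟩, ⟨0, 3, 14, 15⟩, ⟨0, 4, 15, 16⟩, ⟨0, 5, 16, 18⟩, ⟨0, 6, 19, 21⟩,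
      ⟨0, 7, 18, 19⟩, ⟨0, 8, 24, 25⟩, ⟨0, 9, 23, 24⟩, ⟨0, 10, 22, 23⟩, ⟨0, 15, 21, 22⟩,
      ⟨1, 3, 13, 14⟩, ⟨1, 4, 12, 13⟩, ⟨1, 5, 11, 12⟩, ⟨1, 13, 5, 9⟩, ⟨1, 14, 9, 10⟩,
      ⟨1, 15, 10, 11⟩, ⟨1, 16, 4, 5⟩, ⟨1, 17, 2, 4⟩, ⟨1, 18, 1, 2⟩, ⟨1, 24, 0, 1⟩, ⟨2, 8, 25, 26⟩,
      ⟨2, 9, 26, 27⟩, ⟨2, 10, 27, 30⟩, ⟨2, 11, 30, 31⟩, ⟨2, 12, 31, 32⟩, ⟨2, 15, 32, 39⟩,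
      ⟨2, 21, 39, 40⟩, ⟨2, 22, 40, 42⟩, ⟨3, 4, 13, 15⟩, ⟨4, 5, 12, 16⟩, ⟨5, 7, 17, 18⟩,
      ⟨5, 15, 11, 17⟩, ⟨6, 7, 19, 20⟩, ⟨6, 15, 20, 21⟩, ⟨7, 15, 17, 20⟩, ⟨8, 9, 24, 26⟩,
      ⟨9, 10, 23, 27⟩, ⟨10, 11, 28, 30⟩, ⟨10, 15, 22, 28⟩, ⟨11, 12, 29, 31⟩, ⟨11, 15, 28, 29⟩,
      ⟨12, 15, 29, 32⟩, ⟨13, 14, 8, 9⟩, ⟨13, 15, 6, 8⟩, ⟨13, 16, 5, 6⟩, ⟨14, 15, 8, 10⟩,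
      ⟨15, 16, 6, 7⟩, ⟨15, 19, 34, 38⟩, ⟨15, 20, 33, 34⟩, ⟨15, 21, 38, 39⟩, ⟨15, 24, 7, 33⟩,
      ⟨16, 24, 4, 7⟩, ⟨17, 18, 2, 3⟩, ⟨17, 24, 3, 4⟩, ⟨18, 24, 1, 3⟩, ⟨19, 20, 34, 35⟩,
      ⟨19, 21, 36, 38⟩, ⟨19, 24, 35, 36⟩, ⟨20, 24, 33, 35⟩, ⟨21, 22, 37, 40⟩, ⟨21, 24, 36, 37⟩,
      ⟨22, 23, 41, 42⟩, ⟨22, 24, 37, 41⟩],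
      [
      0, 0, 25, 13, 12, 11, 19, 17, 24, 23, 22, 28, 29, 5, 8, 6, 4, 2, 1, 34, 33, 36, 37, 41],
      [
      0, 1, 1, 17, 1, 1, 13, 15, 13, 1, 1, 1, 1, 1, 0, 0, 0, 5, 0, 0, 6, 0, 0, 0, 0, 0, 2, 2, 10,
      11, 2, 2, 2, 15, 15, 19, 19, 21, 15, 2, 2, 22, 2]⟩
  | 2 => ⟨40, 14, 25, [
      ⟨0, 1, 0, 14⟩, ⟨0, 3, 14, 15⟩, ⟨0, 4, 15, 16⟩, ⟨0, 5, 16, 18⟩, ⟨0, 6, 19, 21⟩,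
      ⟨0, 7, 18, 19⟩, ⟨0, 8, 24, 25⟩, ⟨0, 9, 23, 24⟩, ⟨0, 10, 22, 23⟩, ⟨0, 15, 21, 22⟩,
      ⟨1, 3, 13, 14⟩, ⟨1, 4, 12, 13⟩, ⟨1, 5, 11, 12⟩, ⟨1, 13, 5, 9⟩, ⟨1, 14, 9, 10⟩,
      ⟨1, 15, 10, 11⟩, ⟨1, 16, 4, 5⟩, ⟨1, 17, 2, 4⟩, ⟨1, 18, 1, 2⟩, ⟨1, 24, 0, 1⟩, ⟨2, 8, 25, 26⟩,
      ⟨2, 9, 26, 27⟩, ⟨2, 10, 27, 30⟩, ⟨2, 11, 30, 31⟩, ⟨2, 12, 31, 32⟩, ⟨2, 15, 32, 38⟩,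
      ⟨2, 21, 38, 39⟩, ⟨2, 22, 39, 41⟩, ⟨3, 4, 13, 15⟩, ⟨4, 5, 12, 16⟩, ⟨5, 7, 17, 18⟩,
      ⟨5, 15, 11, 17⟩, ⟨6, 7, 19, 20⟩, ⟨6, 15, 20, 21⟩, ⟨7, 15, 17, 20⟩, ⟨8, 9, 24, 26⟩,
      ⟨9, 10, 23, 27⟩, ⟨10, 11, 28, 30⟩, ⟨10, 15, 22, 28⟩, ⟨11, 12, 29, 31⟩, ⟨11, 15, 28, 29⟩,
      ⟨12, 15, 29, 32⟩, ⟨13, 14, 8, 9⟩, ⟨13, 15, 6, 8⟩, ⟨13, 16, 5, 6⟩, ⟨14, 15, 8, 10⟩,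
      ⟨15, 16, 6, 7⟩, ⟨15, 19, 34, 37⟩, ⟨15, 20, 33, 34⟩, ⟨15, 21, 37, 38⟩, ⟨15, 24, 7, 33⟩,
      ⟨16, 24, 4, 7⟩, ⟨17, 18, 2, 3⟩, ⟨17, 24, 3, 4⟩, ⟨18, 24, 1, 3⟩, ⟨19, 20, 34, 35⟩,
      ⟨19, 21, 36, 37⟩, ⟨19, 24, 35, 36⟩, ⟨20, 24, 33, 35⟩, ⟨21, 24, 36, 39⟩, ⟨22, 23, 40, 41⟩,
      ⟨22, 24, 39, 40⟩],
      [
      0, 0, 25, 13, 12, 11, 19, 17, 24, 23, 22, 28, 29, 5, 8, 6, 4, 2, 1, 34, 33, 36, 39, 40],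
      [
      0, 1, 1, 17, 1, 1, 13, 15, 13, 1, 1, 1, 1, 1, 0, 0, 0, 5, 0, 0, 6, 0, 0, 0, 0, 0, 2, 2, 10,
      11, 2, 2, 2, 15, 15, 19, 19, 15, 2, 2, 22, 2]⟩

lemma table_good (i : Fin 3) : (table i).Good := by
  constructor <;> revert i <;> decide +kernel

/-- The rows of a tiling with a stack of triangles. -/
inductive Tile (m t : ℕ) : Type
  | reg (i : Fin m)
  | outer
  | au
  | ub
  | left (i : Fin (t + 1))
  | right (i : Fin (t + 1))
  | mid (i : Fin t)

namespace Table

variable (T : Table) (t : ℕ)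

/-- The stretched height of a vertex. -/
def stretch (v : ℕ) : ℤ := if v ≤ 23 then v else v + t

/-- The cell of a row. -/
def cell : Tile T.rows.length t → Cell
  | .reg i => ⟨stretch t T.rows[i].tl, stretch t T.rows[i].hd, T.rows[i].lf, T.rows[i].rt⟩
  | .outer => ⟨0, 24 + t, 0, T.ch + 2 * t + 3⟩
  | .au => ⟨0, 2, T.fu, T.ch + 2 * t + 3⟩
  | .ub => ⟨2, 24 + t, T.ch + 2 * t + 2, T.ch + 2 * t + 3⟩
  | .left i => ⟨23 + i, 24 + t, T.ch + 2 * i, T.ch + 2 * i + 2⟩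
  | .right i => ⟨2, 23 + i, T.ch + 2 * i + 1, if (i : ℕ) < t then T.ch + 2 * i + 3 else T.ch + 2 * i + 2⟩
  | .mid i => ⟨23 + i, 24 + i, T.ch + 2 * i + 2, T.ch + 2 * i + 3⟩

/-- The face left of a vertex in the tiling with the stack. -/
def leftFace (v : ℤ) : ℤ :=
  if v < 23 then T.L v.toNat else if v ≤ 23 + t then T.ch + 2 * (v - 23) else 0

/-- The vertex below a face in the tiling with the stack. -/
def foot (f : ℤ) : ℤ :=
  if f ≤ T.ch + 1 then T.B f.toNat else if f = T.ch + 2 * t + 3 then 0 else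
    if f = T.ch + 2 * t + 2 ∨ (f - T.ch) % 2 = 1 then 2 else 22 + (f - T.ch) / 2

variable {T}

lemma Good.leftFace_stretch (G : T.Good) {v : ℕ} (hv : v ≤ 24) :
    T.leftFace t (stretch t v) = T.L v := by
  obtain ⟨-, -, -, -, -, -, h23, h24, -⟩ := G.param
  rcases lt_or_ge v 23 with h | h
  · rw [leftFace, stretch, if_pos (by omega), if_pos (by omega), Int.toNat_natCast]
  · rcases (by omega : v = 23 ∨ v = 24) with rfl | rfl
    · rw [h23]; simp [leftFace, stretch]
    · rw [h24]; simp [leftFace, stretch]; omega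

lemma Good.leftFace_natCast (G : T.Good) {v : ℕ} (hv : v ≤ 23) : T.leftFace t v = T.L v := by
  rw [← G.leftFace_stretch t (by omega), stretch, if_pos hv]

lemma leftFace_stack {i : ℤ} (h0 : 0 ≤ i) (h1 : i ≤ t) : T.leftFace t (23 + i) = T.ch + 2 * i := by
  rw [leftFace, if_neg (by omega), if_pos (by omega)]; ring

lemma leftFace_top : T.leftFace t (24 + t) = 0 := by
  rw [leftFace, if_neg (by omega), if_neg (by omega)]

lemma foot_natCast {f : ℕ} (hf : f ≤ T.ch + 1) : T.foot t f = T.B f := by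
  rw [foot, if_pos (by omega), Int.toNat_natCast]

lemma Good.foot_even (G : T.Good) {i : ℤ} (h0 : 0 ≤ i) (h1 : i ≤ t) :
    T.foot t (T.ch + 2 * i) = 22 + i := by
  obtain ⟨-, -, -, -, -, -, -, -, -, -, h22, -⟩ := G.param
  rcases h0.eq_or_lt with rfl | h0
  · have := foot_natCast (T := T) t (f := T.ch) (by omega)
    rw [h22] at this; simpa using this
  · rw [foot, if_neg (by omega), if_neg (by omega), if_neg (by omega)]; omega

lemma Good.foot_odd (G : T.Good) {i : ℤ} (h0 : 0 ≤ i) (h1 : i ≤ t) :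
    T.foot t (T.ch + 2 * i + 1) = 2 := by
  obtain ⟨-, -, -, -, -, -, -, -, -, -, -, h2⟩ := G.param
  rcases h0.eq_or_lt with rfl | h0
  · have := foot_natCast (T := T) t (f := T.ch + 1) (by omega)
    rw [h2] at this; simpa using this
  · rw [foot, if_neg (by omega), if_neg (by omega), if_pos (by omega)]

lemma foot_right : T.foot t (T.ch + 2 * t + 3) = 0 := by
  rw [foot, if_neg (by omega), if_pos rfl]

lemma foot_right' : T.foot t (T.ch + 2 * t + 2) = 2 := by
  rw [foot, if_neg (by omega), if_neg (by omega), if_pos (by omega)]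

end Table

/-- Curves in the two cells meet at most as prescribed. -/
def Cell.Full (L B : ℤ → ℤ) (c c' : Cell) : Prop :=
  c.Apart c' ∧ Cell.Beside L c c' ∧ Cell.Beside B c.swap c'.swap ∧ Cell.Clear L B c c'

/-- The condition `Cell.Full` in terms of coordinates. -/
def FullAt (a b x y p q g h a' b' x' y' g' h' : ℤ) : Prop :=
  (b ≤ a' ∨ b' ≤ a ∨ y ≤ x' ∨ y' ≤ x) ∧
  (a' < a → a < b' → (y' ≤ x ∧ y' ≤ p) ∨ (y ≤ x' ∧ p < x')) ∧
  (a' < b → b < b' → (y' ≤ x ∧ y' ≤ q) ∨ (y ≤ x' ∧ q < x')) ∧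
  (x' < x → x < y' → (b' ≤ a ∧ b' ≤ g) ∨ (b ≤ a' ∧ g < a')) ∧
  (x' < y → y < y' → (b' ≤ a ∧ b' ≤ h) ∨ (b ≤ a' ∧ h < a')) ∧
  ((x' ≤ x ∧ x' ≤ p) ∨ (y ≤ x' ∧ p < x') ∨ (a ≤ a' ∧ a ≤ g') ∨ (b' ≤ a ∧ g' < a)) ∧
  ((y' ≤ x ∧ y' ≤ p) ∨ (y ≤ y' ∧ p < y') ∨ (a ≤ a' ∧ a ≤ h') ∨ (b' ≤ a ∧ h' < a)) ∧
  ((x' ≤ x ∧ x' ≤ q) ∨ (y ≤ x' ∧ q < x') ∨ (b ≤ a' ∧ b ≤ g') ∨ (b' ≤ b ∧ g' < b)) ∧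
  ((y' ≤ x ∧ y' ≤ q) ∨ (y ≤ y' ∧ q < y') ∨ (b ≤ a' ∧ b ≤ h') ∨ (b' ≤ b ∧ h' < b))

lemma FullAt.full {L B : ℤ → ℤ} {c c' : Cell}
    (h : FullAt c.tl c.hd c.lf c.rt (L c.tl) (L c.hd) (B c.lf) (B c.rt) c'.tl c'.hd c'.lf c'.rt
      (B c'.lf) (B c'.rt)) : Cell.Full L B c c' := by
  obtain ⟨h1, h2, h3, h4, h5, h6, h7, h8, h9⟩ := h
  refine ⟨h1, ?_, ?_, ?_⟩
  · rintro v (rfl | rfl)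
    exacts [h2, h3]
  · rintro v (rfl | rfl)
    exacts [h4, h5]
  · rintro v f (rfl | rfl) (rfl | rfl)
    exacts [h6, h7, h8, h9]

/-- The coordinates of a regular cell, with the faces and vertices assigned to its ends. -/
structure RegAt (ch fu t a b x y p q g h : ℤ) : Prop where
  a_nonneg : 0 ≤ a
  a_lt : a < 23
  a_lt_b : a < b
  x_nonneg : 0 ≤ x
  x_lt : x < y
  y_le : y ≤ ch + 1
  b_le : y = ch + 1 → b ≤ 23
  le_x : b = 23 → ch ≤ x
  side : 2 ≤ a ∨ y ≤ fu
  two : a = 2 → b < 23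
  zero : a = 0 → b < 23 ∧ b ≠ 2
  p_mem : 0 ≤ p ∧ p < ch
  p_zero : a ≤ 1 → p = 0
  q_zero : b ≤ 1 → q = 0
  q_mem : (b < 23 ∧ 0 ≤ q ∧ q < ch) ∨ (b = 23 ∧ q = ch) ∨ (b = 24 + t ∧ q = 0)
  g_mem : 0 ≤ g ∧ g < 23
  h_mem : 0 ≤ h ∧ h < 23
  two_le_g : fu < x → 2 ≤ g
  two_le_h : fu < y → 2 ≤ h

/-- The coordinates of the cells that touch the stack, with the faces and vertices assigned to
their ends. -/
inductive StackAt (ch fu t : ℤ) : ℤ → ℤ → ℤ → ℤ → ℤ → ℤ → ℤ → ℤ → Prop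
  | au : StackAt ch fu t 0 2 fu (ch + 2 * t + 3) 0 fu 0 0
  | ub : StackAt ch fu t 2 (24 + t) (ch + 2 * t + 2) (ch + 2 * t + 3) fu 0 2 0
  | left {i h : ℤ} (h0 : 0 ≤ i) (h1 : i ≤ t) (hh : (i < t ∧ h = 23 + i) ∨ (i = t ∧ h = 2)) :
      StackAt ch fu t (23 + i) (24 + t) (ch + 2 * i) (ch + 2 * i + 2) (ch + 2 * i) 0 (22 + i) h
  | right {i y : ℤ} (h0 : 0 ≤ i) (h1 : i ≤ t)
      (hy : (i < t ∧ y = ch + 2 * i + 3) ∨ (i = t ∧ y = ch + 2 * i + 2)) :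
      StackAt ch fu t 2 (23 + i) (ch + 2 * i + 1) y fu (ch + 2 * i) 2 2
  | mid {i : ℤ} (h0 : 0 ≤ i) (h1 : i < t) :
      StackAt ch fu t (23 + i) (24 + i) (ch + 2 * i + 2) (ch + 2 * i + 3) (ch + 2 * i)
        (ch + 2 * i + 2) (23 + i) 2

variable {ch fu t a b x y p q g h a' b' x' y' p' q' g' h' : ℤ}

set_option maxHeartbeats 1000000 in
lemma StackAt.fullAt (hfu : 0 < fu) (hch : fu + 1 < ch) (ht : 0 ≤ t)
    (h1 : StackAt ch fu t a b x y p q g h) (h2 : StackAt ch fu t a' b' x' y' p' q' g' h')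
    (hne : a ≠ a' ∨ b ≠ b') : FullAt a b x y p q g h a' b' x' y' g' h' := by
  unfold FullAt
  cases h1 <;> cases h2 <;> refine ⟨?_, ?_, ?_, ?_, ?_, ?_, ?_, ?_, ?_⟩ <;> omega

set_option maxHeartbeats 1000000 in
lemma RegAt.fullAt (hfu : 0 < fu) (hch : fu + 1 < ch) (ht : 0 ≤ t)
    (h1 : RegAt ch fu t a b x y p q g h) (h2 : StackAt ch fu t a' b' x' y' p' q' g' h') :
    FullAt a b x y p q g h a' b' x' y' g' h' := by
  unfold FullAt
  obtain ⟨_, _, _, _, _, _, h3, h4, h5, h6, h7, h8, h14, h15, h9 | h9 | h9, h10, h11, h12, h13⟩ := h1 <;>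
  cases h2 <;> refine ⟨?_, ?_, ?_, ?_, ?_, ?_, ?_, ?_, ?_⟩ <;> omega

set_option maxHeartbeats 1000000 in
lemma StackAt.fullAt_reg (hfu : 0 < fu) (hch : fu + 1 < ch) (ht : 0 ≤ t)
    (h1 : StackAt ch fu t a b x y p q g h) (h2 : RegAt ch fu t a' b' x' y' p' q' g' h') :
    FullAt a b x y p q g h a' b' x' y' g' h' := by
  unfold FullAt
  obtain ⟨_, _, _, _, _, _, h3, h4, h5, h6, h7, h8, h14, h15, h9 | h9 | h9, h10, h11, h12, h13⟩ := h2 <;>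
  cases h1 <;> refine ⟨?_, ?_, ?_, ?_, ?_, ?_, ?_, ?_, ?_⟩ <;> omega

namespace Table

variable {T : Table} (t : ℕ)

lemma stretch_of_lt {v : ℕ} (hv : v ≤ 23) : stretch t v = v := if_pos hv

lemma stretch_cases {v : ℕ} (hv : v ≤ 24) :
    (v ≤ 23 ∧ stretch t v = v) ∨ (v = 24 ∧ stretch t v = 24 + t) := by
  rcases (by omega : v ≤ 23 ∨ v = 24) with h | rfl
  · exact .inl ⟨h, if_pos h⟩
  · exact .inr ⟨rfl, by simp [stretch]⟩

lemma Good.regAt (G : T.Good) {c : Quad} (hc : c ∈ T.rows) :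
    RegAt T.ch T.fu t (stretch t c.tl) (stretch t c.hd) c.lf c.rt (T.L c.tl) (T.L c.hd) (T.B c.lf)
      (T.B c.rt) := by
  obtain ⟨⟨h1, h2⟩, ⟨h3, h4, h5⟩, h6, h7, h8, h9, h10, -⟩ := G.row c hc
  obtain ⟨-, -, -, l0, l1, -, l23, l24, -⟩ := G.param
  have hp := G.L_lt c.tl h3
  have hg := G.B_lt c.lf (by omega)
  have hh := G.B_lt c.rt (by omega)
  have s1 := stretch_of_lt t (v := c.tl) (by omega)
  have s2 := stretch_cases t h4
  have q0 : c.hd ≤ 1 → T.L c.hd = 0 := fun h => by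
    rcases (by omega : c.hd = 0 ∨ c.hd = 1) with e | e <;> rw [e] <;> assumption
  have p0 : c.tl ≤ 1 → T.L c.tl = 0 := fun h => by
    rcases (by omega : c.tl = 0 ∨ c.tl = 1) with e | e <;> rw [e] <;> assumption
  have hq : (c.hd < 23 ∧ T.L c.hd < T.ch) ∨ (c.hd = 23 ∧ T.L c.hd = T.ch) ∨
      (c.hd = 24 ∧ T.L c.hd = 0) := by
    rcases (by omega : c.hd < 23 ∨ c.hd = 23 ∨ c.hd = 24) with e | e | e
    · exact .inl ⟨e, G.L_lt _ e⟩
    · exact .inr (.inl ⟨e, by rw [e, l23]⟩)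
    · exact .inr (.inr ⟨e, by rw [e, l24]⟩)
  constructor <;> omega

lemma Good.full_of_near (G : T.Good) {c c' : Quad} (hc : c ∈ T.rows) (hc' : c' ∈ T.rows)
    (hn : c.Near T.L T.B c') (hcl : c.Clear T.L T.B c') :
    FullAt (stretch t c.tl) (stretch t c.hd) c.lf c.rt (T.L c.tl) (T.L c.hd) (T.B c.lf) (T.B c.rt)
      (stretch t c'.tl) (stretch t c'.hd) c'.lf c'.rt (T.B c'.lf) (T.B c'.rt) := by
  obtain ⟨-, ⟨h3, h4, h5⟩, -⟩ := G.row c hc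
  obtain ⟨-, ⟨h3', h4', h5'⟩, -⟩ := G.row c' hc'
  have hg := (G.B_lt c.lf (by have := (G.row c hc).1; omega)).1
  have hh := (G.B_lt c.rt (by omega)).1
  have hg' := (G.B_lt c'.lf (by have := (G.row c' hc').1; omega)).1
  have hh' := (G.B_lt c'.rt (by omega)).1
  have s1 := stretch_of_lt t (v := c.tl) (by omega)
  have s1' := stretch_of_lt t (v := c'.tl) (by omega)
  have s2 := stretch_cases t h4
  have s2' := stretch_cases t h4'
  simp only [Quad.Near, Quad.Clear, List.forall_mem_cons, List.not_mem_nil, false_imp_iff,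
    implies_true, and_true] at hn hcl
  obtain ⟨n1, ⟨n2, n3⟩, n4, n5⟩ := hn
  obtain ⟨⟨c1, c2⟩, c3, c4⟩ := hcl
  rw [s1, s1']
  refine ⟨?_, ?_, ?_, ?_, ?_, ?_, ?_, ?_, ?_⟩
  · clear n2 n3 n4 n5 c1 c2 c3 c4; omega
  · clear n1 n3 n4 n5 c1 c2 c3 c4; omega
  · clear n2 n1 n4 n5 c1 c2 c3 c4; omega
  · clear n2 n3 n1 n5 c1 c2 c3 c4; omega
  · clear n2 n3 n4 n1 c1 c2 c3 c4; omega
  · clear n2 n3 n4 n5 n1 c2 c3 c4; omega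
  · clear n2 n3 n4 n5 c1 n1 c3 c4; omega
  · clear n2 n3 n4 n5 c1 c2 n1 c4; omega
  · clear n2 n3 n4 n5 c1 c2 c3 n1; omega

lemma Good.pair_of_ne (G : T.Good) {i j : Fin T.rows.length} (h : i ≠ j) :
    T.rows[i].Near T.L T.B T.rows[j] ∧ T.rows[i].Clear T.L T.B T.rows[j] ∧
      (T.rows[i].tl ≠ T.rows[j].tl ∨ T.rows[i].hd ≠ T.rows[j].hd) ∧
      (T.rows[i].lf ≠ T.rows[j].lf ∨ T.rows[i].rt ≠ T.rows[j].rt) := by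
  have hp := List.pairwise_iff_getElem.1 G.pair
  rcases lt_or_gt_of_ne h with h | h
  · exact Quad.near_clear_of_okB (hp i j i.2 j.2 h).1
  · exact Quad.near_clear_of_okB (hp j i j.2 i.2 h).2

/-- The numbers assigned to the cells other than regular ones. -/
lemma Good.stackAt (G : T.Good) (r : Tile T.rows.length t) (h0 : r ≠ .outer)
    (h1 : ∀ i, r ≠ .reg i) :
    StackAt T.ch T.fu t (T.cell t r).tl (T.cell t r).hd (T.cell t r).lf (T.cell t r).rt
      (T.leftFace t (T.cell t r).tl) (T.leftFace t (T.cell t r).hd)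
      (T.foot t (T.cell t r).lf) (T.foot t (T.cell t r).rt) := by
  obtain ⟨-, -, hch, l0, l1, l2, l23, l24, b0, bf, -⟩ := G.param
  have e0 := G.leftFace_natCast t (v := 0) (by norm_num)
  have e2 := G.leftFace_natCast t (v := 2) (by norm_num)
  rw [l0] at e0
  rw [l2] at e2
  have ef := foot_natCast t (T := T) (f := T.fu) (by omega)
  rw [bf] at ef
  push_cast at e0 e2 ef
  cases r with
  | reg i => exact absurd rfl (h1 i)
  | outer => exact absurd rfl h0
  | au =>
    simp only [cell]
    rw [e0, e2, ef, foot_right]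
    exact .au
  | ub =>
    simp only [cell]
    rw [e2, leftFace_top, foot_right, foot_right']
    exact .ub
  | left i =>
    have hi := i.2
    simp only [cell]
    rw [leftFace_stack t (by omega) (by omega), leftFace_top, G.foot_even t (by omega) (by omega)]
    refine .left (by omega) (by omega) ?_
    rcases (by omega : (i : ℕ) < t ∨ (i : ℕ) = t) with h | h
    · have := G.foot_even t (i := i + 1) (by omega) (by omega)
      rw [show (T.ch + 2 * i + 2 : ℤ) = T.ch + 2 * (i + 1) by ring, this]
      omega
    · rw [h, foot_right']
      omega
  | right i =>
    have hi := i.2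
    simp only [cell]
    rw [e2, leftFace_stack t (by omega) (by omega), G.foot_odd t (by omega) (by omega)]
    split_ifs with h
    · have := G.foot_odd t (i := i + 1) (by omega) (by omega)
      rw [show (T.ch + 2 * i + 3 : ℤ) = T.ch + 2 * (i + 1) + 1 by ring, this]
      exact .right (by omega) (by omega) (by omega)
    · rw [show ((i : ℕ) : ℤ) = t by omega, foot_right']
      exact .right (by omega) (by omega) (by omega)
  | mid i =>
    have hi := i.2
    simp only [cell]
    have f1 := G.foot_even t (i := i + 1) (by omega) (by omega)
    have f2 := G.foot_odd t (i := i + 1) (by omega) (by omega)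
    have l1 := leftFace_stack t (T := T) (i := i + 1) (by omega) (by omega)
    rw [leftFace_stack t (by omega) (by omega), show (24 + i : ℤ) = 23 + (i + 1) by ring, l1,
      show (T.ch + 2 * i + 2 : ℤ) = T.ch + 2 * (i + 1) by ring, f1,
      show (T.ch + 2 * i + 3 : ℤ) = T.ch + 2 * (i + 1) + 1 by ring, f2]
    have := StackAt.mid (ch := T.ch) (fu := T.fu) (t := t) (i := i) (by omega) (by omega)
    convert this using 1 <;> ring

/-- The values at the ends of a regular cell. -/
lemma Good.reg_values (G : T.Good) (i : Fin T.rows.length) :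
    T.leftFace t (T.cell t (.reg i)).tl = T.L T.rows[i].tl ∧
    T.leftFace t (T.cell t (.reg i)).hd = T.L T.rows[i].hd ∧
    T.foot t (T.cell t (.reg i)).lf = T.B T.rows[i].lf ∧
    T.foot t (T.cell t (.reg i)).rt = T.B T.rows[i].rt := by
  obtain ⟨h0, ⟨h3, h4, h5⟩, -⟩ := G.row _ (List.getElem_mem i.2)
  exact ⟨G.leftFace_stretch t (h3.le.trans (by norm_num)), G.leftFace_stretch t h4,
    foot_natCast t (h0.2.le.trans h5), foot_natCast t h5⟩

lemma Good.primal_inj (G : T.Good) (r r' : Tile T.rows.length t)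
    (h : (T.cell t r).tl = (T.cell t r').tl) (h' : (T.cell t r).hd = (T.cell t r').hd) : r = r' := by
  have reg (i : Fin T.rows.length) (r' : Tile T.rows.length t)
      (h : (T.cell t (.reg i)).tl = (T.cell t r').tl)
      (h' : (T.cell t (.reg i)).hd = (T.cell t r').hd) : .reg i = r' := by
    obtain ⟨h0, ⟨h3, h4, h5⟩, g1, g2, g3, g4, g5, -⟩ := G.row _ (List.getElem_mem i.2)
    have s1 := stretch_of_lt t (v := T.rows[i].tl) (h3.le)
    have s2 := stretch_cases t h4
    cases r' with
    | reg j =>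
      by_contra hne
      obtain ⟨-, -, hp, -⟩ := G.pair_of_ne (i := i) (j := j) (by rintro rfl; exact hne rfl)
      obtain ⟨-, ⟨k3, k4, -⟩, -⟩ := G.row _ (List.getElem_mem j.2)
      have s1' := stretch_of_lt t (v := T.rows[j].tl) (k3.le)
      have s2' := stretch_cases t k4
      simp only [cell, Fin.getElem_fin] at *
      omega
    | outer | au | ub | left j | right j | mid j => simp only [cell, Fin.getElem_fin] at *; omega
  cases r with
  | reg i => exact reg i r' h h'
  | outer | au | ub | left i | right i | mid i =>
    cases r' with
    | reg j => exact (reg j _ h.symm h'.symm).symm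
    | outer | au | ub | left j | right j | mid j =>
      simp only [cell, Tile.left.injEq, Tile.right.injEq, Tile.mid.injEq, reduceCtorEq] at * <;>
      omega

lemma Good.dual_inj (G : T.Good) (r r' : Tile T.rows.length t)
    (h : (T.cell t r).lf = (T.cell t r').lf) (h' : (T.cell t r).rt = (T.cell t r').rt) : r = r' := by
  obtain ⟨f0, f1, f2, -⟩ := G.param
  have reg (i : Fin T.rows.length) (r' : Tile T.rows.length t)
      (h : (T.cell t (.reg i)).lf = (T.cell t r').lf)
      (h' : (T.cell t (.reg i)).rt = (T.cell t r').rt) : .reg i = r' := by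
    obtain ⟨h0, ⟨h3, h4, h5⟩, -⟩ := G.row _ (List.getElem_mem i.2)
    cases r' with
    | reg j =>
      by_contra hne
      obtain ⟨-, -, -, hp⟩ := G.pair_of_ne (i := i) (j := j) (by rintro rfl; exact hne rfl)
      simp only [cell, Fin.getElem_fin] at *
      omega
    | outer | au | ub | left j | mid j => simp only [cell, Fin.getElem_fin] at *; omega
    | right j => simp only [cell, Fin.getElem_fin] at *; split_ifs at h' <;> omega
  cases r with
  | reg i => exact reg i r' h h'
  | outer | au | ub | left i | right i | mid i =>
    cases r' with
    | reg j => exact (reg j _ h.symm h'.symm).symm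
    | outer | au | ub | left j | right j | mid j =>
      simp only [cell, Tile.left.injEq, Tile.right.injEq, Tile.mid.injEq, reduceCtorEq] at * <;>
      (try split_ifs at h') <;> omega

lemma Good.full (G : T.Good) {r r' : Tile T.rows.length t} (h : r ≠ .outer) (h' : r' ≠ .outer)
    (hne : r ≠ r') : Cell.Full (T.leftFace t) (T.foot t) (T.cell t r) (T.cell t r') := by
  obtain ⟨f0, f1, f2, -⟩ := G.param
  have hd : (T.cell t r).tl ≠ (T.cell t r').tl ∨ (T.cell t r).hd ≠ (T.cell t r').hd := by
    by_contra! hc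
    exact hne (G.primal_inj t _ _ hc.1 hc.2)
  apply FullAt.full
  by_cases hr : ∃ i, r = .reg i
  · obtain ⟨i, rfl⟩ := hr
    obtain ⟨e1, e2, e3, e4⟩ := G.reg_values t i
    rw [e1, e2, e3, e4]
    by_cases hr' : ∃ j, r' = .reg j
    · obtain ⟨j, rfl⟩ := hr'
      obtain ⟨-, -, e3, e4⟩ := G.reg_values t j
      rw [e3, e4]
      obtain ⟨hn, hc, -⟩ := G.pair_of_ne (i := i) (j := j) (by rintro rfl; exact hne rfl)
      exact G.full_of_near t (List.getElem_mem i.2) (List.getElem_mem j.2) hn hc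
    · push Not at hr'
      exact RegAt.fullAt (by omega) (by omega) (by omega) (G.regAt t (List.getElem_mem i.2))
        (G.stackAt t r' h' hr')
  · push Not at hr
    by_cases hr' : ∃ j, r' = .reg j
    · obtain ⟨j, rfl⟩ := hr'
      obtain ⟨e1, e2, e3, e4⟩ := G.reg_values t j
      rw [e3, e4]
      exact StackAt.fullAt_reg (by omega) (by omega) (by omega)
        (G.stackAt t r h hr) (G.regAt t (List.getElem_mem j.2))
    · push Not at hr'
      exact StackAt.fullAt (by omega) (by omega) (by omega) (G.stackAt t r h hr)
        (G.stackAt t r' h' hr') hd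

end Table

lemma StackAt.clear_self {ch fu t a b x y p q g h : ℤ} (hfu : 0 < fu) (hch : fu + 1 < ch)
    (ht : 0 ≤ t) (hs : StackAt ch fu t a b x y p q g h) :
    ((x ≤ x ∧ x ≤ p) ∨ (y ≤ x ∧ p < x) ∨ (a ≤ a ∧ a ≤ g) ∨ (b ≤ a ∧ g < a)) ∧
    ((y ≤ x ∧ y ≤ p) ∨ (y ≤ y ∧ p < y) ∨ (a ≤ a ∧ a ≤ h) ∨ (b ≤ a ∧ h < a)) ∧
    ((x ≤ x ∧ x ≤ q) ∨ (y ≤ x ∧ q < x) ∨ (b ≤ a ∧ b ≤ g) ∨ (b ≤ b ∧ g < b)) ∧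
    ((y ≤ x ∧ y ≤ q) ∨ (y ≤ y ∧ q < y) ∨ (b ≤ a ∧ b ≤ h) ∨ (b ≤ b ∧ h < b)) := by
  cases hs <;> refine ⟨?_, ?_, ?_, ?_⟩ <;> omega

namespace Table

variable {T : Table} (t : ℕ)

lemma Good.clear_self (G : T.Good) {r : Tile T.rows.length t} (h : r ≠ .outer) :
    Cell.Clear (T.leftFace t) (T.foot t) (T.cell t r) (T.cell t r) := by
  obtain ⟨f0, f1, f2, -⟩ := G.param
  by_cases hr : ∃ i, r = .reg i
  · obtain ⟨i, rfl⟩ := hr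
    obtain ⟨e1, e2, e3, e4⟩ := G.reg_values t i
    have hc := G.clear _ (List.getElem_mem i.2)
    obtain ⟨h0, ⟨h3, h4, h5⟩, -⟩ := G.row _ (List.getElem_mem i.2)
    have s1 := stretch_of_lt t (v := T.rows[i].tl) (h3.le)
    have s2 := stretch_cases t h4
    have hg := (G.B_lt T.rows[i].lf (by have := h0.2; simp only [Fin.getElem_fin]; omega)).1
    have hh := (G.B_lt T.rows[i].rt (by simp only [Fin.getElem_fin]; omega)).1
    simp only [Quad.Clear, List.forall_mem_cons, List.not_mem_nil, false_imp_iff,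
      implies_true, and_true] at hc
    obtain ⟨⟨c1, c2⟩, c3, c4⟩ := hc
    rintro v f (rfl | rfl) (rfl | rfl)
    · change (_ ≤ _ ∧ _ ≤ T.leftFace t (T.cell t (.reg i)).tl) ∨
        (_ ≤ _ ∧ T.leftFace t (T.cell t (.reg i)).tl < _) ∨
        (_ ≤ _ ∧ _ ≤ T.foot t (T.cell t (.reg i)).lf) ∨
        (_ ≤ _ ∧ T.foot t (T.cell t (.reg i)).lf < _)
      rw [e1, e3]; simp only [cell, Cell.swap, Fin.getElem_fin] at *; omega
    · change (_ ≤ _ ∧ _ ≤ T.leftFace t (T.cell t (.reg i)).tl) ∨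
        (_ ≤ _ ∧ T.leftFace t (T.cell t (.reg i)).tl < _) ∨
        (_ ≤ _ ∧ _ ≤ T.foot t (T.cell t (.reg i)).rt) ∨
        (_ ≤ _ ∧ T.foot t (T.cell t (.reg i)).rt < _)
      rw [e1, e4]; simp only [cell, Cell.swap, Fin.getElem_fin] at *; omega
    · change (_ ≤ _ ∧ _ ≤ T.leftFace t (T.cell t (.reg i)).hd) ∨
        (_ ≤ _ ∧ T.leftFace t (T.cell t (.reg i)).hd < _) ∨
        (_ ≤ _ ∧ _ ≤ T.foot t (T.cell t (.reg i)).lf) ∨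
        (_ ≤ _ ∧ T.foot t (T.cell t (.reg i)).lf < _)
      rw [e2, e3]; simp only [cell, Cell.swap, Fin.getElem_fin] at *; omega
    · change (_ ≤ _ ∧ _ ≤ T.leftFace t (T.cell t (.reg i)).hd) ∨
        (_ ≤ _ ∧ T.leftFace t (T.cell t (.reg i)).hd < _) ∨
        (_ ≤ _ ∧ _ ≤ T.foot t (T.cell t (.reg i)).rt) ∨
        (_ ≤ _ ∧ T.foot t (T.cell t (.reg i)).rt < _)
      rw [e2, e4]; simp only [cell, Cell.swap, Fin.getElem_fin] at *; omega
  · push Not at hr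
    have hs := G.stackAt t r h hr
    obtain ⟨c1, c2, c3, c4⟩ := hs.clear_self (by omega) (by omega) (by omega)
    rintro v f (rfl | rfl) (rfl | rfl)
    exacts [c1, c2, c3, c4]

lemma Good.leftFace_mem (G : T.Good) {v : ℤ} (h0 : 0 ≤ v) :
    0 ≤ T.leftFace t v ∧ T.leftFace t v < T.ch + 2 * t + 3 := by
  rw [leftFace]
  split_ifs with h h'
  · have := G.L_lt v.toNat (by omega)
    omega
  all_goals omega

lemma Good.foot_mem (G : T.Good) {f : ℤ} (h1 : f ≤ T.ch + 2 * t + 3) :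
    0 ≤ T.foot t f ∧ T.foot t f < 24 + t := by
  rw [foot]
  split_ifs with h h'
  · have := (G.B_lt f.toNat (by omega)).1
    omega
  all_goals omega

lemma exists_index {P : Quad → Prop} (h : ∃ c ∈ T.rows, P c) :
    ∃ i : Fin T.rows.length, P T.rows[i] := by
  obtain ⟨c, hc, hP⟩ := h
  obtain ⟨i, hi, rfl⟩ := List.getElem_of_mem hc
  exact ⟨⟨i, hi⟩, hP⟩

/-- The layout of a tiling with a stack. -/
def Good.layout (G : T.Good) : Layout (Tile T.rows.length t) where
  cell := T.cell t
  e₀ := .outer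
  H := 24 + t
  W := T.ch + 2 * t + 3
  fz := T.fz
  fu := T.fu
  L := T.leftFace t
  B := T.foot t
  link c := bif c then .reg (exists_index G.link).choose else .reg (exists_index G.zb).choose
  spoke c := bif c then .ub else .reg (exists_index G.spoke).choose
  three_le := by omega
  fz_pos := by have := G.param.1; omega
  fz_lt_fu := by have := G.param.2.1; omega
  fu_lt := by have := G.param.2.2.1; omega
  cell_e₀ := rfl
  fat r := by
    obtain ⟨f0, f1, f2, -⟩ := G.param
    cases r with
    | reg i =>
      obtain ⟨h0, ⟨h3, h4, h5⟩, -⟩ := G.row _ (List.getElem_mem i.2)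
      have s1 := stretch_of_lt t (v := T.rows[i].tl) (h3.le)
      have s2 := stretch_cases t h4
      simp only [cell, Cell.Fat, Fin.getElem_fin] at *; omega
    | right i => simp only [cell, Cell.Fat]; split_ifs <;> omega
    | outer | au | ub | left i | mid i => simp only [cell, Cell.Fat]; omega
  tl_nonneg r := by
    cases r with
    | reg i => simp only [cell, stretch]; split_ifs <;> omega
    | outer | au | ub | left i | right i | mid i => simp only [cell]; omega
  hd_le r := by
    cases r with
    | reg i =>
      obtain ⟨h0, ⟨h3, h4, h5⟩, -⟩ := G.row _ (List.getElem_mem i.2)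
      have s2 := stretch_cases t h4
      simp only [cell, Fin.getElem_fin] at *; omega
    | outer | au | ub | left i | right i | mid i => simp only [cell]; omega
  lf_nonneg r := by
    cases r <;> simp only [cell] <;> omega
  rt_le r := by
    obtain ⟨f0, f1, f2, -⟩ := G.param
    cases r with
    | reg i =>
      obtain ⟨h0, ⟨h3, h4, h5⟩, -⟩ := G.row _ (List.getElem_mem i.2)
      simp only [cell, Fin.getElem_fin] at *; omega
    | right i => simp only [cell]; split_ifs <;> omega
    | outer | au | ub | left i | mid i => simp only [cell]; omega
  L_mem v h0 _ := G.leftFace_mem t h0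
  B_mem f _ h1 := G.foot_mem t h1
  pp r r' h h' hne := ⟨(G.full t h h' hne).1, (G.full t h h' hne).2.1, (G.full t h' h hne.symm).2.1⟩
  qq r r' h h' hne := by
    obtain ⟨h1, -, h2, -⟩ := G.full t h h' hne
    refine ⟨?_, h2, (G.full t h' h hne.symm).2.2.1⟩
    simp only [Cell.Apart, Cell.swap] at h1 ⊢
    omega
  pq r r' h h' hne := ⟨(G.full t h h' hne).1, (G.full t h h' hne).2.2.2, (G.full t h h' hne).2.1,
    (G.full t h' h hne.symm).2.2.1⟩
  clear r h := G.clear_self t h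
  exists_tl v h0 h1 := by
    rcases lt_or_ge v 23 with h | h
    · obtain ⟨i, hi⟩ := exists_index (G.exists_tl v.toNat (by omega))
      obtain ⟨-, ⟨h3, h4, h5⟩, -⟩ := G.row _ (List.getElem_mem i.2)
      have s1 := stretch_of_lt t (v := T.rows[i].tl) (h3.le)
      have s2 := stretch_cases t h4
      refine ⟨.reg i, by simp, ?_⟩
      simp only [cell, Cell.End, Fin.getElem_fin] at *; omega
    · rcases (by omega : v = 24 + t ∨ v < 24 + t) with h | h
      · exact ⟨.ub, by simp, .inr h⟩
      · refine ⟨.left ⟨(v - 23).toNat, by omega⟩, by simp, .inl ?_⟩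
        simp only [cell]; omega
  exists_lf f h0 h1 := by
    rcases lt_or_ge f (T.ch + 2) with h | h
    · obtain ⟨i, hi⟩ := exists_index (G.exists_lf f.toNat (by omega))
      refine ⟨.reg i, by simp, ?_⟩
      simp only [cell, Cell.End, Cell.swap]; omega
    · rcases (by omega : f = T.ch + 2 * t + 3 ∨ f = T.ch + 2 * t + 2 ∨ f < T.ch + 2 * t + 2)
        with h | h | h
      · exact ⟨.ub, by simp, .inr h⟩
      · exact ⟨.ub, by simp, .inl h⟩
      · rcases Int.emod_two_eq_zero_or_one (f - T.ch) with e | e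
        · refine ⟨.left ⟨((f - T.ch) / 2).toNat, by omega⟩, by simp, .inl ?_⟩
          simp only [cell, Cell.swap]; omega
        · refine ⟨.right ⟨((f - T.ch) / 2).toNat, by omega⟩, by simp, .inl ?_⟩
          simp only [cell, Cell.swap]; omega
  link_ne c := by cases c <;> simp
  spoke_ne c := by cases c <;> simp
  link_ne_spoke c c' := by
    have h1 := (exists_index G.link).choose_spec.1
    have h2 := (exists_index G.zb).choose_spec.1
    have h3 := (exists_index G.spoke).choose_spec.1
    cases c <;> cases c' <;> simp only [cond_true, cond_false, ne_eq, reduceCtorEq,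
      not_false_eq_true, Tile.reg.injEq] <;> intro he
    · rw [he] at h2; omega
    · rw [he] at h1; omega
  link_tl c := by
    have h1 := (exists_index G.link).choose_spec.1
    have h2 := (exists_index G.zb).choose_spec.1
    cases c
    · simp only [cond_false, cell, h2, stretch]; norm_num
    · simp only [cond_true, cell, h1, stretch]; norm_num
  link_lf := by simp only [cond_false, cell, (exists_index G.zb).choose_spec.2.2]; rfl
  link_rt := by simp only [cond_true, cell, (exists_index G.link).choose_spec.2.2]
  spoke_tl c := by
    have h1 := (exists_index G.spoke).choose_spec.1
    cases c
    · simp only [cond_false, cell, h1, stretch]; norm_num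
    · simp only [cond_true, cell]
  spoke_lf := by simp only [cond_false, cell, (exists_index G.spoke).choose_spec.2.2]
  spoke_rt := by simp only [cond_true, cell]
  right_of_one r hr h h' := by
    obtain ⟨f0, f1, f2, -, l1, -⟩ := G.param
    have e1 := G.leftFace_natCast t (v := 1) (by norm_num)
    rw [l1] at e1
    push_cast at e1
    rw [e1]
    cases r with
    | reg i =>
      obtain ⟨h0, ⟨h3, h4, h5⟩, -, -, -, -, -, h6⟩ := G.row _ (List.getElem_mem i.2)
      have s1 := stretch_of_lt t (v := T.rows[i].tl) (h3.le)
      have s2 := stretch_cases t h4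
      simp only [cell, Fin.getElem_fin] at *; omega
    | outer => exact absurd rfl hr
    | au | ub | left i | right i | mid i => simp only [cell] at *; omega
  left_of_two r hr h h' := by
    obtain ⟨f0, f1, f2, -, -, l2, -⟩ := G.param
    have e1 := G.leftFace_natCast t (v := 2) (by norm_num)
    rw [l2] at e1
    push_cast at e1
    rw [e1]
    cases r with
    | reg i =>
      obtain ⟨h0, ⟨h3, h4, h5⟩, -, -, h6, -⟩ := G.row _ (List.getElem_mem i.2)
      have s1 := stretch_of_lt t (v := T.rows[i].tl) (h3.le)
      simp only [cell, Fin.getElem_fin] at *; omega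
    | outer => exact absurd rfl hr
    | au | ub | left i | right i | mid i => simp only [cell] at *; omega
  above r hr f hf h h' := by
    obtain ⟨f0, f1, f2, -⟩ := G.param
    cases r with
    | reg i =>
      have ha := G.above _ (List.getElem_mem i.2)
      simp only [List.forall_mem_cons, List.not_mem_nil, false_imp_iff, implies_true,
        and_true] at ha
      obtain ⟨h0, ⟨h3, h4, h5⟩, -⟩ := G.row _ (List.getElem_mem i.2)
      have s1 := stretch_of_lt t (v := T.rows[i].tl) (h3.le)
      rcases hf with rfl | rfl <;> rw [foot_natCast t (by omega)] <;>
        simp only [cell, Fin.getElem_fin] at * <;> omega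
    | outer => exact absurd rfl hr
    | au | ub | left i | right i | mid i => simp only [cell] at *; omega
  primal_inj := G.primal_inj t
  dual_inj := G.dual_inj t

end Table

namespace Tile

variable {m t : ℕ}

/-- The rows as a disjoint union. -/
def equivSum : Tile m t ≃ ((Fin m ⊕ Fin 3) ⊕ Fin (t + 1)) ⊕ (Fin (t + 1) ⊕ Fin t) where
  toFun
    | .reg i => .inl (.inl (.inl i))
    | .outer => .inl (.inl (.inr 0))
    | .au => .inl (.inl (.inr 1))
    | .ub => .inl (.inl (.inr 2))
    | .left i => .inl (.inr i)
    | .right i => .inr (.inl i)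
    | .mid i => .inr (.inr i)
  invFun
    | .inl (.inl (.inl i)) => .reg i
    | .inl (.inl (.inr 0)) => .outer
    | .inl (.inl (.inr 1)) => .au
    | .inl (.inl (.inr 2)) => .ub
    | .inl (.inr i) => .left i
    | .inr (.inl i) => .right i
    | .inr (.inr i) => .mid i
  left_inv r := by cases r <;> rfl
  right_inv x := by
    rcases x with ((i | i) | i) | (i | i) <;> try rfl
    fin_cases i <;> rfl

instance : Fintype (Tile m t) := Fintype.ofEquiv _ equivSum.symm

lemma card : Fintype.card (Tile m t) = m + 3 * t + 5 := by
  rw [Fintype.card_congr equivSum]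
  simp only [Fintype.card_sum, Fintype.card_fin]
  ring

lemma sum_eq {A : Type*} [AddCommMonoid A] (f : Tile m t → A) :
    ∑ r, f r = ((∑ i, f (.reg i) + (f .outer + f .au + f .ub)) + ∑ i, f (.left i)) +
      (∑ i, f (.right i) + ∑ i, f (.mid i)) := by
  rw [← equivSum.symm.sum_comp, Fintype.sum_sum_type, Fintype.sum_sum_type, Fintype.sum_sum_type,
    Fintype.sum_sum_type, Fin.sum_univ_three]
  rfl

end Tile

namespace Layout

variable {ρ : Type} (Λ : Layout ρ) {J : Type}

/-- The vertex of a height as a base vertex of the frame. -/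
def vx (J : Type) (v : ℤ) : Λ.Pt ⊕ J :=
  if h : 0 ≤ v ∧ v ≤ Λ.H then .inl (Λ.vert v h.1 h.2)
  else .inl (Λ.vert 0 le_rfl (by linarith [Λ.three_le]))

/-- The face of a number as a base vertex of the frame. -/
def fx (J : Type) (f : ℤ) : Λ.Pt ⊕ J :=
  if h : 0 ≤ f ∧ f ≤ Λ.W then .inl (Λ.face f h.1 h.2)
  else .inl (Λ.face 0 le_rfl (by linarith [Λ.fz_pos, Λ.fz_lt_fu, Λ.fu_lt]))

lemma vx_of_mem {v : ℤ} (h0 : 0 ≤ v) (h1 : v ≤ Λ.H) : Λ.vx J v = .inl (Λ.vert v h0 h1) :=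
  dif_pos ⟨h0, h1⟩

lemma fx_of_mem {f : ℤ} (h0 : 0 ≤ f) (h1 : f ≤ Λ.W) : Λ.fx J f = .inl (Λ.face f h0 h1) :=
  dif_pos ⟨h0, h1⟩

lemma vx_inj {v w : ℤ} (h0 : 0 ≤ v) (h1 : v ≤ Λ.H) (h0' : 0 ≤ w) (h1' : w ≤ Λ.H) :
    Λ.vx J v = Λ.vx J w ↔ v = w := by
  rw [Λ.vx_of_mem h0 h1, Λ.vx_of_mem h0' h1', Sum.inl.injEq, vert_inj]

lemma frame_tl (r : ρ) : (Λ.frame J).tl r = Λ.vx J (Λ.cell r).tl := (Λ.vx_of_mem _ _).symm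
lemma frame_hd (r : ρ) : (Λ.frame J).hd r = Λ.vx J (Λ.cell r).hd := (Λ.vx_of_mem _ _).symm
lemma frame_lf (r : ρ) : (Λ.frame J).lf r = Λ.fx J (Λ.cell r).lf := (Λ.fx_of_mem _ _).symm
lemma frame_rt (r : ρ) : (Λ.frame J).rt r = Λ.fx J (Λ.cell r).rt := (Λ.fx_of_mem _ _).symm

end Layout

/-- The boundary of the vertex stars in a stack of triangles. -/
lemma sum_stack (e X Y : ℕ → ZMod 2) (b u : ZMod 2) (n : ℕ) :
    ∑ i ∈ Finset.range (n + 1), (e i + b) * (X i + X (i + 1)) +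
      (∑ i ∈ Finset.range (n + 1), (u + e i) * (Y i + Y (i + 1)) +
      ∑ i ∈ Finset.range n, (e i + e (i + 1)) * (X (i + 1) + Y (i + 1))) =
    b * (X 0 + X (n + 1)) + u * (Y 0 + Y (n + 1)) + e 0 * (X 0 + Y 0) +
      e n * (X (n + 1) + Y (n + 1)) := by
  have h2 : (2 : ZMod 2) = 0 := by decide
  induction n with
  | zero => simp; ring
  | succ n ih =>
    simp only [Finset.sum_range_succ _ (n + 1), Finset.sum_range_succ _ n] at ih ⊢
    linear_combination ih + (b * X (n + 1) + u * Y (n + 1) + e (n + 1) * (X (n + 1) + Y (n + 1)) + e n * (X (n + 1) + Y (n + 1))) * h2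

namespace Table

variable {T : Table} (t : ℕ)

lemma Good.sum_reg (G : T.Good) (e : ℕ → ZMod 2) (d : ℕ → ZMod 2) :
    ∑ i : Fin T.rows.length, (e T.rows[i].tl + e T.rows[i].hd) * (d T.rows[i].lf + d T.rows[i].rt) =
      e 0 * (d 0 + d T.fu) + e 2 * (d T.fu + d (T.ch + 1)) + e 24 * (d 0 + d T.ch) +
        e 23 * (d T.ch + d (T.ch + 1)) := by
  have h := sum_oddPart (fun p => e p.1 * d p.2) ((0, 0) :: (0, T.fu) :: (2, T.fu) ::
    (2, T.ch + 1) :: (24, 0) :: (24, T.ch) :: (23, T.ch) :: (23, T.ch + 1) ::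
    T.rows.flatMap Quad.flags)
  rw [G.star] at h
  simp only [List.map_nil, List.sum_nil, List.map_cons, List.sum_cons] at h
  have h3 : ((T.rows.flatMap Quad.flags).map fun p => e p.1 * d p.2).sum =
      (T.rows.map fun c => (e c.tl + e c.hd) * (d c.lf + d c.rt)).sum := by
    generalize T.rows = l
    induction l with
    | nil => rfl
    | cons c l ih =>
      rw [List.flatMap_cons, List.map_append, List.sum_append, ih, List.map_cons, List.sum_cons]
      simp only [Quad.flags, List.map_cons, List.map_nil, List.sum_cons, List.sum_nil]
      ring
  rw [h3] at h
  have h4 : (T.rows.map fun c => (e c.tl + e c.hd) * (d c.lf + d c.rt)).sum =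
      ∑ i : Fin T.rows.length,
        (e T.rows[i].tl + e T.rows[i].hd) * (d T.rows[i].lf + d T.rows[i].rt) := by
    rw [← Fin.sum_univ_fun_getElem]
    rfl
  rw [← h4]
  have h2 : (2 : ZMod 2) = 0 := by decide
  linear_combination -h - (e 0 * (d 0 + d T.fu) + e 2 * (d T.fu + d (T.ch + 1)) +
    e 24 * (d 0 + d T.ch) + e 23 * (d T.ch + d (T.ch + 1))) * h2

lemma Good.starClosed (G : T.Good) (J : Type) : ((G.layout t).frame J).StarClosed := by
  classical
  obtain ⟨-, -, hch, -⟩ := G.param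
  unfold Rows.StarClosed
  intro v D
  obtain ⟨e, he⟩ : ∃ e : ℤ → ZMod 2, e = fun w => if (G.layout t).vx J w = v then 1 else 0 :=
    ⟨_, rfl⟩
  obtain ⟨d, hd⟩ : ∃ d : ℤ → ZMod 2, d = fun f => D ((G.layout t).fx J f) := ⟨_, rfl⟩
  have h2 : (2 : ZMod 2) = 0 := by decide
  have key : ∀ r, (if ((G.layout t).frame J).Inc v r then D (((G.layout t).frame J).lf r) + D (((G.layout t).frame J).rt r) else 0) =
      (e (T.cell t r).tl + e (T.cell t r).hd) * (d (T.cell t r).lf + d (T.cell t r).rt) := by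
    intro r
    have hne : ((G.layout t).frame J).tl r ≠ ((G.layout t).frame J).hd r := ((G.layout t).frame J).tl_ne_hd r
    have e1 := (G.layout t).frame_tl (J := J) r
    have e2 := (G.layout t).frame_hd (J := J) r
    have e3 := (G.layout t).frame_lf (J := J) r
    have e4 := (G.layout t).frame_rt (J := J) r
    change _ = (e ((G.layout t).cell r).tl + e ((G.layout t).cell r).hd) * (d ((G.layout t).cell r).lf + d ((G.layout t).cell r).rt)
    simp only [he, hd, ← e1, ← e2, ← e3, ← e4, Rows.Inc]
    by_cases h : ((G.layout t).frame J).tl r = v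
    · have h' : ((G.layout t).frame J).hd r ≠ v := fun h' => hne (h.trans h'.symm)
      simp [h, h']
    · by_cases h' : ((G.layout t).frame J).hd r = v <;> simp [h, h']
  rw [Finset.sum_congr rfl fun r _ => key r, Tile.sum_eq]
  have hreg := G.sum_reg (fun n => e (stretch t n)) fun f => d f
  have s0 : stretch t 0 = 0 := rfl
  have s2 : stretch t 2 = 2 := rfl
  have s23 : stretch t 23 = 23 := rfl
  have s24 : stretch t 24 = 24 + t := by simp [stretch]
  simp only [s0, s2, s23, s24] at hreg
  have hst := sum_stack (fun i => e (23 + i)) (fun i => d (T.ch + 2 * i))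
    (fun i => if i ≤ t then d (T.ch + 2 * i + 1) else d (T.ch + 2 * i)) (e (24 + t)) (e 2) t
  have hl : ∑ i : Fin (t + 1), (e (T.cell t (.left i)).tl + e (T.cell t (.left i)).hd) *
      (d (T.cell t (.left i)).lf + d (T.cell t (.left i)).rt) =
      ∑ i ∈ Finset.range (t + 1), (e (23 + i) + e (24 + t)) *
        (d (T.ch + 2 * i) + d (T.ch + 2 * ((i + 1 : ℕ) : ℤ))) := by
    rw [Finset.sum_range]
    refine Finset.sum_congr rfl fun i _ => ?_
    simp only [cell]
    push_cast
    ring_nf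
  have hr : ∑ i : Fin (t + 1), (e (T.cell t (.right i)).tl + e (T.cell t (.right i)).hd) *
      (d (T.cell t (.right i)).lf + d (T.cell t (.right i)).rt) =
      ∑ i ∈ Finset.range (t + 1), (e 2 + e (23 + i)) *
        ((if i ≤ t then d (T.ch + 2 * i + 1) else d (T.ch + 2 * i)) +
          if i + 1 ≤ t then d (T.ch + 2 * ((i + 1 : ℕ) : ℤ) + 1)
          else d (T.ch + 2 * ((i + 1 : ℕ) : ℤ))) := by
    rw [Finset.sum_range]
    refine Finset.sum_congr rfl fun i _ => ?_
    simp only [cell]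
    rw [if_pos (Nat.le_of_lt_succ i.2)]
    split_ifs <;> first | omega | (push_cast; ring_nf)
  have hm : ∑ i : Fin t, (e (T.cell t (.mid i)).tl + e (T.cell t (.mid i)).hd) *
      (d (T.cell t (.mid i)).lf + d (T.cell t (.mid i)).rt) =
      ∑ i ∈ Finset.range t, (e (23 + i) + e (23 + ((i + 1 : ℕ) : ℤ))) *
        (d (T.ch + 2 * ((i + 1 : ℕ) : ℤ)) +
          if i + 1 ≤ t then d (T.ch + 2 * ((i + 1 : ℕ) : ℤ) + 1)
          else d (T.ch + 2 * ((i + 1 : ℕ) : ℤ))) := by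
    rw [Finset.sum_range]
    refine Finset.sum_congr rfl fun i _ => ?_
    simp only [cell]
    rw [if_pos (by have := i.2; omega)]
    push_cast
    ring_nf
  rw [hl, hr, hm, add_assoc, hst]
  have hreg' : ∑ i, (e (T.cell t (.reg i)).tl + e (T.cell t (.reg i)).hd) *
      (d (T.cell t (.reg i)).lf + d (T.cell t (.reg i)).rt) = _ := hreg
  rw [hreg', if_pos t.zero_le, if_neg (by omega)]
  simp only [cell]
  push_cast
  have w : (T.ch : ℤ) + 2 * (t + 1) = T.ch + 2 * t + 2 := by ring
  rw [w]
  simp only [add_zero]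
  linear_combination (e 0 * (d 0 + d T.fu + d (T.ch + 2 * t + 3)) +
    e 2 * (d T.fu + d (T.ch + 1) + d (T.ch + 2 * t + 2) + d (T.ch + 2 * t + 3)) +
    e (24 + t) * (d 0 + d T.ch + d (T.ch + 2 * t + 2) + d (T.ch + 2 * t + 3)) +
    e 23 * (d T.ch + d (T.ch + 1)) + e (23 + t) * d (T.ch + 2 * t + 2)) * h2

end Table

namespace Layout

variable {ρ : Type} (Λ : Layout ρ) (J : Type)

lemma linkEnd_false : (Λ.frame J).linkEnd false = Λ.fx J 0 :=
  (Λ.fx_of_mem le_rfl (by linarith [Λ.fz_pos, Λ.fz_lt_fu, Λ.fu_lt])).symm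

lemma linkEnd_true : (Λ.frame J).linkEnd true = Λ.fx J Λ.fz :=
  (Λ.fx_of_mem Λ.fz_pos.le (Λ.fz_lt_fu.trans Λ.fu_lt).le).symm

lemma spokeEnd_false : (Λ.frame J).spokeEnd false = Λ.fx J Λ.fu :=
  (Λ.fx_of_mem (Λ.fz_pos.trans Λ.fz_lt_fu).le Λ.fu_lt.le).symm

lemma spokeEnd_true : (Λ.frame J).spokeEnd true = Λ.fx J Λ.W :=
  (Λ.fx_of_mem (by linarith [Λ.fz_pos, Λ.fz_lt_fu, Λ.fu_lt]) le_rfl).symm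

end Layout

namespace Rows

variable {B ρ : Type} {R : Rows B ρ}

lemma exists_thick {x y : B} (hxy : x ≠ y) {m : List B} (hm : m.Nodup) (hx : x ∉ m) (hy : y ∉ m)
    (h0 : ∃ r, s(R.tl r, R.hd r) = s(x, y))
    (h : ∀ v ∈ m, (∃ r, s(R.tl r, R.hd r) = s(x, v)) ∧ ∃ r, s(R.tl r, R.hd r) = s(y, v)) :
    ∃ th : R.Thick x y (m.length + 1), ∀ τ, ∀ r ∈ th.route τ,
      R.tl r ∈ x :: y :: m ∧ R.hd r ∈ x :: y :: m := by
  classical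
  obtain ⟨r₀, h0⟩ := h0
  choose f hf using fun i : Fin m.length => (h m[i] (List.getElem_mem i.2)).1
  choose g hg using fun i : Fin m.length => (h m[i] (List.getElem_mem i.2)).2
  have hD : ∀ {a b c d : B} (D : B → ZMod 2), s(a, b) = s(c, d) → D a + D b = D c + D d := by
    intro a b c d D he
    rcases Sym2.eq_iff.1 he with ⟨rfl, rfl⟩ | ⟨rfl, rfl⟩
    exacts [rfl, add_comm _ _]
  have hmx : ∀ i : Fin m.length, m[i] ≠ x := fun i he => hx (he ▸ List.getElem_mem i.2)
  have hmy : ∀ i : Fin m.length, m[i] ≠ y := fun i he => hy (he ▸ List.getElem_mem i.2)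
  have hinj : ∀ i j : Fin m.length, m[i] = m[j] → i = j := fun i j he =>
    Fin.ext ((hm.getElem_inj_iff).1 he)
  have hfg : ∀ i, f i ≠ g i := fun i he => by
    have := (hf i).symm.trans (he ▸ hg i)
    rcases Sym2.eq_iff.1 this with ⟨e, -⟩ | ⟨e, -⟩
    exacts [hxy e, hmx i e.symm]
  have hmem : ∀ {a b c d : B} {l : List B}, s(a, b) = s(c, d) → c ∈ l → d ∈ l → a ∈ l ∧ b ∈ l := by
    intro a b c d l he hc hd
    rcases Sym2.eq_iff.1 he with ⟨rfl, rfl⟩ | ⟨rfl, rfl⟩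
    exacts [⟨hc, hd⟩, ⟨hd, hc⟩]
  refine ⟨⟨Fin.cases {r₀} fun i => {f i, g i}, fun τ => ?_, fun τ => ?_, ⟨0, rfl⟩, ?_⟩, ?_⟩
  · intro D
    induction τ using Fin.cases with
    | zero => simpa using hD D h0
    | succ i =>
      have h2 : (2 : ZMod 2) = 0 := by decide
      simp only [Fin.cases_succ]
      rw [Finset.sum_pair (hfg i), hD D (hf i), hD D (hg i)]
      linear_combination D m[i] * h2
  · induction τ using Fin.cases with
    | zero => simp
    | succ i => exact Finset.card_le_two
  · intro τ τ' r
    induction τ using Fin.cases with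
    | zero =>
      induction τ' using Fin.cases with
      | zero => exact fun _ _ => rfl
      | succ j =>
        simp only [Fin.cases_zero, Fin.cases_succ, Finset.mem_singleton, Finset.mem_insert]
        rintro rfl (e | e)
        · have := hf j; rw [← e, h0, Sym2.eq_iff] at this
          rcases this with ⟨-, e⟩ | ⟨e, -⟩
          exacts [absurd e.symm (hmy j), absurd e.symm (hmx j)]
        · have := hg j; rw [← e, h0, Sym2.eq_iff] at this
          rcases this with ⟨e, -⟩ | ⟨e, -⟩
          exacts [absurd e hxy, absurd e.symm (hmx j)]
    | succ i =>
      induction τ' using Fin.cases with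
      | zero =>
        simp only [Fin.cases_zero, Fin.cases_succ, Finset.mem_singleton, Finset.mem_insert]
        rintro (e | e) rfl
        · have := hf i; rw [← e, h0, Sym2.eq_iff] at this
          rcases this with ⟨-, e⟩ | ⟨e, -⟩
          exacts [absurd e.symm (hmy i), absurd e.symm (hmx i)]
        · have := hg i; rw [← e, h0, Sym2.eq_iff] at this
          rcases this with ⟨e, -⟩ | ⟨e, -⟩
          exacts [absurd e hxy, absurd e.symm (hmx i)]
      | succ j =>
        simp only [Fin.cases_succ, Finset.mem_singleton, Finset.mem_insert]
        rintro (rfl | rfl) (e | e)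
        · have := hf i; rw [e, hf j, Sym2.eq_iff] at this
          rcases this with ⟨-, e⟩ | ⟨e, -⟩
          exacts [congrArg _ (hinj _ _ e).symm, absurd e.symm (hmx i)]
        · have := hf i; rw [e, hg j, Sym2.eq_iff] at this
          rcases this with ⟨e, -⟩ | ⟨e, -⟩
          exacts [absurd e.symm hxy, absurd e.symm (hmy i)]
        · have := hg i; rw [e, hf j, Sym2.eq_iff] at this
          rcases this with ⟨e, -⟩ | ⟨e, -⟩
          exacts [absurd e hxy, absurd e.symm (hmx i)]
        · have := hg i; rw [e, hg j, Sym2.eq_iff] at this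
          rcases this with ⟨-, e⟩ | ⟨e, -⟩
          exacts [congrArg _ (hinj _ _ e).symm, absurd e.symm (hmy i)]
  · intro τ r
    have hxl : x ∈ x :: y :: m := List.mem_cons_self
    have hyl : y ∈ x :: y :: m := List.mem_cons_of_mem _ List.mem_cons_self
    have hml : ∀ i : Fin m.length, m[i] ∈ x :: y :: m := fun i =>
      List.mem_cons_of_mem _ (List.mem_cons_of_mem _ (List.getElem_mem i.2))
    induction τ using Fin.cases with
    | zero =>
      simp only [Fin.cases_zero, Finset.mem_singleton]
      rintro rfl
      exact hmem h0 hxl hyl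
    | succ i =>
      simp only [Fin.cases_succ, Finset.mem_insert, Finset.mem_singleton]
      rintro (rfl | rfl)
      exacts [hmem (hf i) hxl (hml i), hmem (hg i) hyl (hml i)]

lemma sep_of_disjoint {l l' : List B} (h : l.Disjoint l') {r r' : ρ} (hr : R.tl r ∈ l ∧ R.hd r ∈ l)
    (hr' : R.tl r' ∈ l' ∧ R.hd r' ∈ l') : R.Sep r r' :=
  ⟨fun e => h hr.1 (e ▸ hr'.1), fun e => h hr.1 (e ▸ hr'.2), fun e => h hr.2 (e ▸ hr'.1),
    fun e => h hr.2 (e ▸ hr'.2)⟩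

end Rows

namespace Table

variable {T : Table} (t : ℕ)

namespace Good

/-- The base vertex of the frame with a given number. -/
def base (G : T.Good) (J : Type) (n : ℕ) : (G.layout t).Pt ⊕ J :=
  (G.layout t).vx J (stretch t n)

variable (G : T.Good) (J : Type)

lemma base_inj {m n : ℕ} (hm : m ≤ 24) (hn : n ≤ 24) : G.base t J m = G.base t J n ↔ m = n := by
  have h1 := stretch_cases t hm
  have h2 := stretch_cases t hn
  have hH : (G.layout t).H = 24 + t := rfl
  rw [base, base, (G.layout t).vx_inj (by omega) (by omega) (by omega) (by omega)]
  omega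

lemma exists_reg {x y : ℕ} (h : (x, y) ∈ T.pairs) :
    ∃ i : Fin T.rows.length, T.rows[i].tl = x ∧ T.rows[i].hd = y := by
  obtain ⟨c, hc, he⟩ := List.mem_map.1 h
  obtain ⟨i, hi⟩ := exists_index (P := fun c => c.tl = x ∧ c.hd = y)
    ⟨c, hc, congrArg Prod.fst he, congrArg Prod.snd he⟩
  exact ⟨i, hi⟩

lemma tl_reg (i : Fin T.rows.length) :
    ((G.layout t).frame J).tl (.reg i) = G.base t J T.rows[i].tl := (G.layout t).frame_tl _

lemma hd_reg (i : Fin T.rows.length) :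
    ((G.layout t).frame J).hd (.reg i) = G.base t J T.rows[i].hd := (G.layout t).frame_hd _

lemma base_of_le {n : ℕ} (hn : n ≤ 23) : G.base t J n = (G.layout t).vx J n := by
  rw [base, stretch_of_lt t hn]

lemma base_top : G.base t J 24 = (G.layout t).vx J (24 + t) := by
  rw [base]; simp [stretch]

lemma exists_tile {x y : ℕ} (h : (x, y) ∈ T.edges) :
    ∃ r, ((G.layout t).frame J).tl r = G.base t J x ∧ ((G.layout t).frame J).hd r = G.base t J y := by
  simp only [edges, List.mem_cons, Prod.mk.injEq] at h
  rcases h with ⟨rfl, rfl⟩ | ⟨rfl, rfl⟩ | ⟨rfl, rfl⟩ | ⟨rfl, rfl⟩ | ⟨rfl, rfl⟩ | h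
  · rw [base_top, base_of_le t G J (by omega)]
    exact ⟨.outer, (G.layout t).frame_tl _, (G.layout t).frame_hd _⟩
  · rw [base_of_le t G J (by omega), base_of_le t G J (by omega)]
    exact ⟨.au, (G.layout t).frame_tl _, (G.layout t).frame_hd _⟩
  · rw [base_top, base_of_le t G J (by omega)]
    exact ⟨.ub, (G.layout t).frame_tl _, (G.layout t).frame_hd _⟩
  · rw [base_of_le t G J (by omega), base_of_le t G J (by omega)]
    refine ⟨.right 0, (G.layout t).frame_tl _, ((G.layout t).frame_hd _).trans ?_⟩
    simp [layout, cell]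
  · rw [base_top, base_of_le t G J (by omega)]
    refine ⟨.left 0, ((G.layout t).frame_tl _).trans ?_, (G.layout t).frame_hd _⟩
    simp [layout, cell]
  · obtain ⟨i, rfl, rfl⟩ := exists_reg h
    exact ⟨.reg i, tl_reg t G J i, hd_reg t G J i⟩

lemma exists_thick {x y : ℕ} {m : List ℕ} (h : T.Via x y m) (hn : (x :: y :: m).Nodup)
    (hl : ∀ v ∈ x :: y :: m, v ≤ 24) {bx b' : (G.layout t).Pt ⊕ J} (hx : G.base t J x = bx)
    (hy : G.base t J y = b') : ∃ th : ((G.layout t).frame J).Thick bx b'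
      ((m.map (G.base t J)).length + 1), ∀ τ, ∀ r ∈ th.route τ,
      ((G.layout t).frame J).tl r ∈ (x :: y :: m).map (G.base t J) ∧
      ((G.layout t).frame J).hd r ∈ (x :: y :: m).map (G.base t J) := by
  subst hx hy
  have hs : ∀ {v w : ℕ}, (v, w) ∈ T.edges ∨ (w, v) ∈ T.edges → ∃ r,
      s(((G.layout t).frame J).tl r, ((G.layout t).frame J).hd r) =
        s(G.base t J v, G.base t J w) := by
    rintro v w (h | h) <;> obtain ⟨r, h1, h2⟩ := G.exists_tile t J h <;>
      refine ⟨r, by rw [h1, h2]; try rw [Sym2.eq_swap]⟩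
  have hn' : ((x :: y :: m).map (G.base t J)).Nodup := (List.nodup_map_iff_inj_on hn).2
    fun v hv w hw he => (G.base_inj t J (hl v hv) (hl w hw)).1 he
  simp only [List.map_cons, List.nodup_cons, List.mem_cons, not_or] at hn'
  refine Rows.exists_thick hn'.1.1 hn'.2.2 hn'.1.2 hn'.2.1 (hs h.1) fun v hv => ?_
  obtain ⟨w, hw, rfl⟩ := List.mem_map.1 hv
  exact ⟨hs (h.2 w hw).1, hs (h.2 w hw).2⟩

lemma disjoint_base {l l' : List ℕ} (h : ∀ v ∈ l, v ∉ l') (hl : ∀ v ∈ l, v ≤ 24)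
    (hl' : ∀ v ∈ l', v ≤ 24) : (l.map (G.base t J)).Disjoint (l'.map (G.base t J)) := by
  intro b hb hb'
  obtain ⟨v, hv, rfl⟩ := List.mem_map.1 hb
  obtain ⟨w, hw, he⟩ := List.mem_map.1 hb'
  rw [G.base_inj t J (hl' w hw) (hl v hv)] at he
  exact h v hv (he ▸ hw)

lemma tri {r₁ r₂ r₃ : Tile T.rows.length t} (h₁ : (T.cell t r₁).tl = (T.cell t r₃).tl)
    (h₂ : (T.cell t r₁).hd = (T.cell t r₂).tl) (h₃ : (T.cell t r₂).hd = (T.cell t r₃).hd) :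
    ((G.layout t).frame J).Tri r₁ r₂ r₃ := by
  refine ⟨?_, ?_, ?_⟩ <;> simp only [Layout.frame_tl, Layout.frame_hd]
  exacts [congrArg _ h₁, congrArg _ h₂, congrArg _ h₃]

lemma iff_outer (q : Tile T.rows.length t → Prop) (hq : ∀ r₁ r₂ r₃, ((G.layout t).frame J).Tri r₁ r₂ r₃ →
    (q r₁ ↔ q r₂) ∧ (q r₂ ↔ q r₃)) (r : Tile T.rows.length t) : q r ↔ q .outer := by
  have tri : ∀ r₁ r₂ r₃ : Tile T.rows.length t, (T.cell t r₁).tl = (T.cell t r₃).tl →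
      (T.cell t r₁).hd = (T.cell t r₂).tl → (T.cell t r₂).hd = (T.cell t r₃).hd →
      (q r₁ ↔ q r₂) ∧ (q r₂ ↔ q r₃) := fun r₁ r₂ r₃ h₁ h₂ h₃ => hq _ _ _ (G.tri t J h₁ h₂ h₃)
  have s0 : stretch t 0 = 0 := rfl
  have s1 : stretch t 1 = 1 := rfl
  have s2 : stretch t 2 = 2 := rfl
  have s22 : stretch t 22 = 22 := rfl
  have s23 : stretch t 23 = 23 := rfl
  have s24 : stretch t 24 = 24 + t := by simp [stretch]
  have hub : (q .au ↔ q .outer) ∧ (q .ub ↔ q .outer) := by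
    have := tri .au .ub .outer rfl rfl rfl
    tauto
  have hst : ∀ i ≤ t, ∀ h : t - i < t + 1, (q (.left ⟨t - i, h⟩) ↔ q .outer) ∧
      (q (.right ⟨t - i, h⟩) ↔ q .outer) ∧
      ∀ h' : t - i < t, q (.mid ⟨t - i, h'⟩) ↔ q .outer := by
    intro i
    induction i with
    | zero =>
      intro _ h
      have := tri (.right ⟨t - 0, h⟩) (.left ⟨t - 0, h⟩) .ub (by simp only [cell])
        (by simp only [cell]) (by simp only [cell])
      exact ⟨this.2.trans hub.2, this.1.trans (this.2.trans hub.2), fun h' => absurd h' (by simp)⟩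
    | succ i ih =>
      intro hi h
      obtain ⟨ih1, ih2, -⟩ := ih (by omega) (by omega)
      have h' : t - (i + 1) < t := by omega
      have e1 := tri (.right ⟨t - (i + 1), h⟩) (.mid ⟨t - (i + 1), h'⟩) (.right ⟨t - i, by omega⟩)
        (by simp only [cell]) (by simp only [cell]) (by simp only [cell]; omega)
      have e2 := tri (.mid ⟨t - (i + 1), h'⟩) (.left ⟨t - i, by omega⟩) (.left ⟨t - (i + 1), h⟩)
        (by simp only [cell]) (by simp only [cell]; omega) (by simp only [cell])
      exact ⟨(e2.1.trans e2.2).symm.trans (e1.2.trans ih2), e1.1.trans (e1.2.trans ih2),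
        fun _ => e1.2.trans ih2⟩
  have hstack : ∀ i : Fin (t + 1), (q (.left i) ↔ q .outer) ∧ (q (.right i) ↔ q .outer) := by
    intro i
    have := hst (t - i) (by omega) (by omega)
    have e : t - (t - (i : ℕ)) = i := by omega
    simp only [e] at this
    exact ⟨this.1, this.2.1⟩
  have hmid : ∀ i : Fin t, q (.mid i) ↔ q .outer := by
    intro i
    have := hst (t - i) (by omega) (by omega)
    have e : t - (t - (i : ℕ)) = i := by omega
    simp only [e] at this
    exact this.2.2 i.2
  cases r with
  | outer => rfl
  | au => exact hub.1
  | ub => exact hub.2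
  | left i => exact (hstack i).1
  | right i => exact (hstack i).2
  | mid i => exact hmid i
  | reg i =>
    have huniq : ∀ i j : Fin T.rows.length, T.rows[i].tl = T.rows[j].tl →
        T.rows[i].hd = T.rows[j].hd → i = j := by
      intro i j h h'
      have := G.primal_inj t (.reg i) (.reg j) (by simp only [cell, h]) (by simp only [cell, h'])
      exact Tile.reg.inj this
    have seed : ∀ {i j : Fin T.rows.length} {x y : ℕ}, T.rows[j].tl = x ∧ T.rows[j].hd = y →
        (q (.reg j) ↔ q .outer) → T.rows[i].tl = x → T.rows[i].hd = y →
        (q (.reg i) ↔ q .outer) := by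
      intro i j x y hj hq h h'
      rwa [huniq i j (h.trans hj.1.symm) (h'.trans hj.2.symm)]
    let P : ℕ × ℕ → Prop := fun e => ∀ i : Fin T.rows.length, T.rows[i].tl = e.1 →
      T.rows[i].hd = e.2 → (q (.reg i) ↔ q .outer)
    have hPq : ∀ i : Fin T.rows.length, P (T.rows[i].tl, T.rows[i].hd) ↔
        (q (.reg i) ↔ q .outer) :=
      fun i => ⟨fun h => h i rfl rfl, fun h j h1 h2 => seed ⟨rfl, rfl⟩ h h1 h2⟩
    refine of_mem_reach (P := P) ?_ triangles [(0, 1), (22, 23), (22, 24), (2, 22)] ?_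
      (T.rows[i].tl, T.rows[i].hd)
      (G.conn _ (List.mem_map.2 ⟨T.rows[i], List.getElem_mem i.2, rfl⟩)) i rfl rfl
    · intro x y z h1 h2 h3
      obtain ⟨i1, rfl, rfl⟩ := exists_reg h1
      obtain ⟨i2, k2, rfl⟩ := exists_reg h2
      obtain ⟨i3, k3, h4⟩ := exists_reg h3
      have e := tri (.reg i1) (.reg i2) (.reg i3) (by simp only [cell, k3])
        (by simp only [cell, k2]) (by simp only [cell, h4])
      have p1 := hPq i1
      have p2 := hPq i2
      have p3 := hPq i3
      rw [k2] at p2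
      rw [k3, h4] at p3
      rw [p1, p2, p3, e.1, e.2]
      exact ⟨Iff.rfl, Iff.rfl⟩
    · obtain ⟨j1, k1, k1'⟩ := exists_reg G.below.1
      obtain ⟨j2, k2, k2'⟩ := exists_reg G.below.2.1
      obtain ⟨j3, k3, k3'⟩ := exists_reg G.below.2.2
      obtain ⟨j4, k4, k4', -⟩ := exists_index G.az
      obtain ⟨j5, k5, k5', -⟩ := exists_index G.zb
      have e1 := tri (.reg j1) (.left 0) (.reg j2) (by simp only [cell, k1, k2])
        (by simp only [cell, k1', s23]; simp) (by simp only [cell, k2', s24])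
      have e2 := tri (.reg j3) (.reg j1) (.right 0) (by simp only [cell, k3, s2])
        (by simp only [cell, k3', k1]) (by simp only [cell, k1', s23]; simp)
      have e3 := tri (.reg j4) (.reg j5) .outer (by simp only [cell, k4, s0])
        (by simp only [cell, k4', k5]) (by simp only [cell, k5', s24])
      have h0 := hstack 0
      simp only [List.forall_mem_cons, List.not_mem_nil, false_imp_iff, implies_true, and_true]
      exact ⟨fun i => seed ⟨k4, k4'⟩ (e3.1.trans e3.2),
        fun i => seed ⟨k1, k1'⟩ (e1.1.trans h0.1),
        fun i => seed ⟨k2, k2'⟩ (e1.2.symm.trans h0.1),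
        fun i => seed ⟨k3, k3'⟩ (e2.1.trans (e1.1.trans h0.1))⟩

lemma detour (c c' : Bool) : ∃ S : Finset (Tile T.rows.length t), ((G.layout t).frame J).CoJoins S
    (((G.layout t).frame J).spokeEnd c) (((G.layout t).frame J).linkEnd c') := by
  classical
  obtain ⟨j, k, k', k1, k2⟩ := exists_index G.az
  have h2 : (2 : ZMod 2) = 0 := by decide
  have hlf : ∀ r, ((G.layout t).frame J).lf r = (G.layout t).fx J (T.cell t r).lf :=
    (G.layout t).frame_lf
  have hrt : ∀ r, ((G.layout t).frame J).rt r = (G.layout t).fx J (T.cell t r).rt :=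
    (G.layout t).frame_rt
  have e1 : ((G.layout t).frame J).spokeEnd false = (G.layout t).fx J T.fu :=
    (G.layout t).spokeEnd_false J
  have e2 : ((G.layout t).frame J).spokeEnd true = (G.layout t).fx J (T.ch + 2 * t + 3) :=
    (G.layout t).spokeEnd_true J
  have e3 : ((G.layout t).frame J).linkEnd false = (G.layout t).fx J 0 :=
    (G.layout t).linkEnd_false J
  have e4 : ((G.layout t).frame J).linkEnd true = (G.layout t).fx J T.fz :=
    (G.layout t).linkEnd_true J
  cases c <;> cases c'
  · refine ⟨{.au, .outer}, fun D => ?_⟩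
    rw [Finset.sum_pair (by simp)]
    simp only [hlf, hrt, cell, e1, e3]
    linear_combination D ((G.layout t).fx J (T.ch + 2 * t + 3)) * h2
  · refine ⟨{.au, .outer, .reg j}, fun D => ?_⟩
    rw [Finset.sum_insert (by simp), Finset.sum_pair (by simp)]
    simp only [hlf, hrt, cell, e1, e4, k1, k2]
    push_cast
    linear_combination (D ((G.layout t).fx J (T.ch + 2 * t + 3)) + D ((G.layout t).fx J 0)) * h2
  · refine ⟨{.outer}, fun D => ?_⟩
    rw [Finset.sum_singleton]
    simp only [hlf, hrt, cell, e2, e3]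
    ring
  · refine ⟨{.outer, .reg j}, fun D => ?_⟩
    rw [Finset.sum_pair (by simp)]
    simp only [hlf, hrt, cell, e2, e4, k1, k2]
    push_cast
    linear_combination D ((G.layout t).fx J 0) * h2

lemma exists_rigid : Nonempty ((G.layout t).frame J).Rigid := by
  have hv := G.via
  have hz : G.base t J 1 = ((G.layout t).frame J).z := (G.layout t).vx_of_mem _ _
  have hu : G.base t J 2 = ((G.layout t).frame J).u := (G.layout t).vx_of_mem _ _
  obtain ⟨tza, hza⟩ := G.exists_thick t J hv.1 (by decide) (by decide) hz rfl
  obtain ⟨tzb, hzb⟩ := G.exists_thick t J hv.2.1 (by decide) (by decide) hz rfl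
  obtain ⟨tua, hua⟩ := G.exists_thick t J hv.2.2.1 (by decide) (by decide) hu rfl
  obtain ⟨tub, hub⟩ := G.exists_thick t J hv.2.2.2.1 (by decide) (by decide) hu rfl
  obtain ⟨tad, had⟩ := G.exists_thick t J hv.2.2.2.2.1 (by decide) (by decide) rfl rfl
  obtain ⟨tbd, hbd⟩ := G.exists_thick t J hv.2.2.2.2.2.1 (by decide) (by decide) rfl rfl
  obtain ⟨tzd, hzd⟩ := G.exists_thick t J hv.2.2.2.2.2.2.1 (by decide) (by decide) hz rfl
  obtain ⟨tud, hud⟩ := G.exists_thick t J hv.2.2.2.2.2.2.2 (by decide) (by decide) hu rfl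
  have ho : ((G.layout t).frame J).tl .outer = G.base t J 0 ∧
      ((G.layout t).frame J).hd .outer = G.base t J 24 := by
    rw [base_top, base_of_le t G J (by omega)]
    exact ⟨(G.layout t).frame_tl _, (G.layout t).frame_hd _⟩
  have ho' : ((G.layout t).frame J).tl .outer ∈ [0, 24].map (G.base t J) ∧
      ((G.layout t).frame J).hd .outer ∈ [0, 24].map (G.base t J) := by
    rw [ho.1, ho.2]; simp
  have hne : ∀ {m n : ℕ}, m ≤ 24 → n ≤ 24 → m ≠ n → G.base t J m ≠ G.base t J n :=
    fun hm hn h he => h ((G.base_inj t J hm hn).1 he)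
  have hav : ∀ {l : List ℕ}, (∀ v ∈ l, v ≤ 24) → 1 ∉ l → 2 ∉ l → ∀ {r},
      ((G.layout t).frame J).tl r ∈ l.map (G.base t J) ∧
      ((G.layout t).frame J).hd r ∈ l.map (G.base t J) →
      (((G.layout t).frame J).tl r ≠ ((G.layout t).frame J).u ∧
        ((G.layout t).frame J).tl r ≠ ((G.layout t).frame J).z) ∧
      ((G.layout t).frame J).hd r ≠ ((G.layout t).frame J).u ∧
        ((G.layout t).frame J).hd r ≠ ((G.layout t).frame J).z := by
    intro l hl h1 h2 r hr
    obtain ⟨v, hv, hv'⟩ := List.mem_map.1 hr.1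
    obtain ⟨w, hw, hw'⟩ := List.mem_map.1 hr.2
    rw [← hv', ← hw', ← hu, ← hz]
    exact ⟨⟨hne (hl v hv) (by omega) fun h => h2 (h ▸ hv),
      hne (hl v hv) (by omega) fun h => h1 (h ▸ hv)⟩, hne (hl w hw) (by omega) fun h => h2 (h ▸ hw),
      hne (hl w hw) (by omega) fun h => h1 (h ▸ hw)⟩
  have hsep : ∀ {l l' : List ℕ}, (∀ v ∈ l, v ∉ l') → (∀ v ∈ l, v ≤ 24) → (∀ v ∈ l', v ≤ 24) →
      ∀ {r r'}, (((G.layout t).frame J).tl r ∈ l.map (G.base t J) ∧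
      ((G.layout t).frame J).hd r ∈ l.map (G.base t J)) →
      (((G.layout t).frame J).tl r' ∈ l'.map (G.base t J) ∧
      ((G.layout t).frame J).hd r' ∈ l'.map (G.base t J)) → ((G.layout t).frame J).Sep r r' :=
    fun h hl hl' _ _ hr hr' => Rows.sep_of_disjoint (G.disjoint_base t J h hl hl') hr hr'
  refine ⟨⟨G.base t J 0, G.base t J 24, G.base t J 15, .outer,
    hne (by decide) (by decide) (by decide), hne (by decide) (by decide) (by decide),
    hne (by decide) (by decide) (by decide), hu ▸ hne (by decide) (by decide) (by decide),
    hu ▸ hne (by decide) (by decide) (by decide), hz ▸ hne (by decide) (by decide) (by decide),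
    hz ▸ hne (by decide) (by decide) (by decide), hu ▸ hne (by decide) (by decide) (by decide),
    hz ▸ hne (by decide) (by decide) (by decide), ho.1, ho.2, G.starClosed t J, ?_,
    ⟨.au, .ub, G.tri t J rfl rfl rfl⟩, G.iff_outer t J, G.detour t J,
    tza, tzb, tua, tub, tad, tbd, tzd, tud,
    fun τ τ' r hr r' hr' => hsep ?_ ?_ ?_ (hub τ r hr) (had τ' r' hr'),
    fun τ τ' r hr r' hr' => hsep ?_ ?_ ?_ (hzb τ r hr) (had τ' r' hr'),
    fun τ τ' r hr r' hr' => hsep ?_ ?_ ?_ (hua τ r hr) (hbd τ' r' hr'),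
    fun τ τ' r hr r' hr' => hsep ?_ ?_ ?_ (hza τ r hr) (hbd τ' r' hr'),
    fun τ τ' r hr r' hr' => hsep ?_ ?_ ?_ (hua τ r hr) (hzb τ' r' hr'),
    fun τ τ' r hr r' hr' => hsep ?_ ?_ ?_ (hua τ r hr) (hzd τ' r' hr'),
    fun τ τ' r hr r' hr' => hsep ?_ ?_ ?_ (hub τ r hr) (hza τ' r' hr'),
    fun τ τ' r hr r' hr' => hsep ?_ ?_ ?_ (hub τ r hr) (hzd τ' r' hr'),
    fun τ τ' r hr r' hr' => hsep ?_ ?_ ?_ (hza τ r hr) (hud τ' r' hr'),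
    fun τ τ' r hr r' hr' => hsep ?_ ?_ ?_ (hzb τ r hr) (hud τ' r' hr'),
    fun τ r hr => hav (by decide) (by decide) (by decide) (had τ r hr),
    fun τ r hr => hav (by decide) (by decide) (by decide) (hbd τ r hr),
    fun τ r hr => hsep ?_ ?_ ?_ ho' (hzd τ r hr),
    fun τ r hr => hsep ?_ ?_ ?_ ho' (hud τ r hr)⟩⟩
  · intro r r' h1 h2
    refine ((G.layout t).frame J).primal_simple r r' ?_
    have hne := ((G.layout t).frame J).tl_ne_hd r
    rw [Sym2.eq_iff]
    rcases h1 with h1 | h1 <;> rcases h2 with h2 | h2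
    · exact absurd (h1.symm.trans h2) hne
    · exact .inl ⟨h1.symm, h2.symm⟩
    · exact .inr ⟨h1.symm, h2.symm⟩
    · exact absurd (h1.symm.trans h2) hne
  all_goals decide

end Good

end Table

namespace Drawing

variable {V W : Type} {G : SimpleGraph V} {H : SimpleGraph W}

/-- A drawing of an isomorphic graph. -/
def pull (Γ : Drawing G) (φ : H ≃g G) : Drawing H where
  vpos w := Γ.vpos (φ w)
  vpos_inj := Γ.vpos_inj.comp φ.injective
  arc u v := Γ.arc (φ u) (φ v)
  arc_symm _ _ := Γ.arc_symm _ _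
  arc_cont _ _ h := Γ.arc_cont _ _ (φ.map_adj_iff.2 h)
  arc_injOn _ _ h := Γ.arc_injOn _ _ (φ.map_adj_iff.2 h)
  arc_start _ _ h := Γ.arc_start _ _ (φ.map_adj_iff.2 h)
  arc_end _ _ h := Γ.arc_end _ _ (φ.map_adj_iff.2 h)
  arc_avoids _ _ h t ht := by
    rintro ⟨w, hw⟩
    exact Γ.arc_avoids _ _ (φ.map_adj_iff.2 h) t ht ⟨φ w, hw⟩
  inter_finite _ _ _ _ h h' hne := Γ.inter_finite _ _ _ _ (φ.map_adj_iff.2 h)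
    (φ.map_adj_iff.2 h') fun he => hne (Sym2.map.injective φ.injective he)
  no_triple_point p hp _ _ _ _ _ _ h₁ h₂ h₃ h₁₂ h₁₃ h₂₃ :=
    Γ.no_triple_point p (fun ⟨v, hv⟩ => hp ⟨φ.symm v, by simpa using hv⟩) _ _ _ _ _ _
      (φ.map_adj_iff.2 h₁) (φ.map_adj_iff.2 h₂) (φ.map_adj_iff.2 h₃)
      (fun he => h₁₂ (Sym2.map.injective φ.injective he))
      (fun he => h₁₃ (Sym2.map.injective φ.injective he))
      fun he => h₂₃ (Sym2.map.injective φ.injective he)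

lemma pull_crossing (Γ : Drawing G) (φ : H ≃g G) {e f : Sym2 W} {p : ℝ × ℝ} :
    (Γ.pull φ).Crossing e f p ↔ Γ.Crossing (e.map φ) (f.map φ) p := by
  have himg : ∀ e : Sym2 W, (Γ.pull φ).img e = Γ.img (e.map φ) := fun e => by
    induction e with | _ x y => rfl
  have hedge : ∀ e : Sym2 W, e ∈ H.edgeSet ↔ e.map φ ∈ G.edgeSet := fun e => by
    induction e with | _ x y => exact φ.map_adj_iff.symm
  have hrange : Set.range (Γ.pull φ).vpos = Set.range Γ.vpos := φ.surjective.range_comp Γ.vpos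
  simp only [Crossing, himg, hedge, hrange, ne_eq, (Sym2.map.injective φ.injective).eq_iff]

lemma map_surjective (φ : H ≃g G) (e : Sym2 V) : ∃ e' : Sym2 W, e'.map φ = e := by
  induction e with | _ x y => exact ⟨s(φ.symm x, φ.symm y), by simp⟩

lemma crossings_pull (Γ : Drawing G) (φ : H ≃g G) : (Γ.pull φ).crossings = Γ.crossings := by
  rw [crossings, crossings]
  congr 1
  ext p
  constructor
  · rintro ⟨e, f, h⟩
    exact ⟨_, _, (Γ.pull_crossing φ).1 h⟩
  · rintro ⟨e, f, h⟩
    obtain ⟨e, rfl⟩ := map_surjective φ e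
    obtain ⟨f, rfl⟩ := map_surjective φ f
    exact ⟨e, f, (Γ.pull_crossing φ).2 h⟩

lemma IsKPlanar.pull {Γ : Drawing G} {k : ℕ} (h : Γ.IsKPlanar k) (φ : H ≃g G) :
    (Γ.pull φ).IsKPlanar k := by
  intro e he
  have h1 : (Γ.pull φ).edgeCrossings e = Γ.edgeCrossings (e.map φ) := by
    ext p
    constructor
    · rintro ⟨f, h⟩
      exact ⟨_, (Γ.pull_crossing φ).1 h⟩
    · rintro ⟨f, h⟩
      obtain ⟨f, rfl⟩ := map_surjective φ f
      exact ⟨f, (Γ.pull_crossing φ).2 h⟩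
  rw [h1]
  refine h _ ?_
  induction e with | _ x y => exact φ.map_adj_iff.2 he

end Drawing

lemma Frame.card_vert {B ρ : Type} [Fintype B] [Fintype ρ] (F : Frame B ρ) (k K : ℕ) (hk : 1 ≤ k)
    (hK : k = 1 → K = 1) : Fintype.card (F.system k K hk hK).Vert =
      Fintype.card B + (2 * Fintype.card ρ + 2) * K * (k - 1) := by
  have h : ∑ i : PathIdx ρ K, ((F.system k K hk hK).len i - 1) =
      (2 * Fintype.card ρ + 2) * K * (k - 1) := by
    rw [← (PathIdx.equivSum ρ K).symm.sum_comp, Fintype.sum_sum_type, Fintype.sum_sum_type,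
      Fintype.sum_sum_type]
    have h1 : ∀ x : ρ × Fin K, (F.system k K hk hK).len
      ((PathIdx.equivSum ρ K).symm (.inl (.inl x))) = k := fun _ => rfl
    have h2 : ∀ x : ρ × Fin K, (F.system k K hk hK).len
      ((PathIdx.equivSum ρ K).symm (.inl (.inr x))) = k := fun _ => rfl
    have h3 : ∀ x : Bool × Fin K, (F.system k K hk hK).len
      ((PathIdx.equivSum ρ K).symm (.inr (.inl x))) = k := fun _ => rfl
    have h4 : ∀ x : Bool, (F.system k K hk hK).len
      ((PathIdx.equivSum ρ K).symm (.inr (.inr x))) = 1 := fun _ => rfl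
    simp only [h1, h2, h3, h4, Finset.sum_const, Finset.card_univ, Fintype.card_prod,
      Fintype.card_fin, Fintype.card_bool, smul_eq_mul]
    ring
  simp only [PathSystem.Vert, Fintype.card_sum, Fintype.card_sigma, Fintype.card_fin, h]

lemma Table.rows_length (i : Fin 3) : (table i).rows.length = 64 - i ∧ (table i).ch = 42 - i := by
  revert i; decide

/-- For all integers `k ≥ 1` and `ℓ ≥ 7` there exists a
`k`-planar simple graph `G` on exactly `n = 23ℓ(k-1)k² + 11ℓ + 2` vertices
with `cr(G) ≤ 2k²` and `cr_{k-planar}(G) ≥ 11ℓk⁴` (hence the `k`-planar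
crossing ratio is `Ω(n/k)`). -/
theorem kplanar_crossing_ratio_lower (k ℓ : ℕ) (hk : 1 ≤ k) (hℓ : 7 ≤ ℓ) :
    ∃ G : SimpleGraph (Fin (23 * ℓ * (k - 1) * k ^ 2 + 11 * ℓ + 2)),
      (∃ Γ : Drawing G, Γ.IsKPlanar k) ∧
      crNum G ≤ 2 * k ^ 2 ∧
      11 * ℓ * k ^ 4 ≤ crNumRestricted G (fun Γ => Γ.IsKPlanar k) := by
  obtain ⟨i, hi⟩ : ∃ i : Fin 3, (i : ℕ) = ℓ % 3 := ⟨⟨ℓ % 3, by omega⟩, rfl⟩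
  obtain ⟨t, ht⟩ : ∃ t : ℕ, 69 - (i : ℕ) + 3 * t = 11 * ℓ := ⟨(11 * ℓ + i - 69) / 3, by omega⟩
  obtain ⟨hrows, hch⟩ := Table.rows_length i
  have G : (table i).Good := table_good i
  obtain ⟨J, hJ⟩ : ∃ J : Type, J = Fin ((ℓ - 2) * (k - 1) * k ^ 2) := ⟨_, rfl⟩
  have : Fintype J := hJ ▸ inferInstance
  have hK1 : k = 1 → k ^ 2 = 1 := by rintro rfl; rfl
  have hρ : Fintype.card (Tile (table i).rows.length t) = 11 * ℓ := by
    rw [Tile.card, hrows]; omega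
  have hcard : Fintype.card (((G.layout t).frame J).system k (k ^ 2) hk hK1).Vert =
      23 * ℓ * (k - 1) * k ^ 2 + 11 * ℓ + 2 := by
    have hPt : Fintype.card (G.layout t).Pt = 11 * ℓ + 2 := by
      have hH : (G.layout t).H = 24 + t := rfl
      have hW : (G.layout t).W = (table i).ch + 2 * t + 3 := rfl
      have h1 := Int.card_fintype_Icc_of_le (a := 0) (b := (G.layout t).H) (by omega)
      have h2 := Int.card_fintype_Icc_of_le (a := 0) (b := (G.layout t).W) (by omega)
      rw [Fintype.card_sum]
      omega
    have hJc : Fintype.card J = (ℓ - 2) * (k - 1) * k ^ 2 := by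
      rw [← Nat.card_eq_fintype_card, hJ, Nat.card_fin]
    rw [Frame.card_vert, Fintype.card_sum, hPt, hJc, hρ]
    obtain ⟨m, rfl⟩ := Nat.exists_eq_add_of_le' (show 2 ≤ ℓ by omega)
    rw [Nat.add_sub_cancel]
    ring
  have e := (Fintype.equivFinOfCardEq hcard).symm
  have φ := SimpleGraph.Iso.comap e (((G.layout t).frame J).system k (k ^ 2) hk hK1).graph
  obtain ⟨Γ₁, h₁⟩ := (G.layout t).exists_kPlanar J hk hK1 (sq k)
  obtain ⟨Γ₂, h₂⟩ := (G.layout t).exists_few_crossings J hk hK1 (sq k)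
  obtain ⟨R⟩ := G.exists_rigid t J
  refine ⟨(((G.layout t).frame J).system k (k ^ 2) hk hK1).graph.comap e, ⟨Γ₁.pull φ, h₁.pull φ⟩, ?_, ?_⟩
  · have h : crNum ((((G.layout t).frame J).system k (k ^ 2) hk hK1).graph.comap e) ≤ Γ₂.crossings :=
      Nat.sInf_le ⟨Γ₂.pull φ, Γ₂.crossings_pull φ⟩
    exact h.trans h₂
  · refine le_csInf ⟨_, Γ₁.pull φ, h₁.pull φ, rfl⟩ ?_
    rintro _ ⟨Γ, h, rfl⟩
    have := R.le_crossings hk hK1 (sq k) (h.pull φ.symm)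
    rw [Γ.crossings_pull, hρ] at this
    calc _ = 11 * ℓ * k ^ 2 * k ^ 2 := by ring
      _ ≤ _ := this
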